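/- Let 1 ≤ k ≤ n and let μ : NC_n → ℂ satisfy Σ_{π∈NC_n} μ_π = 1 and the stationarity system, and assume μ is the unique such vector (i.e., every v : NC_n → ℂ with Σ_π v_π = 1 satisfying the stationarity system equals μ). Define, for a positive integer m, R_k(m) = [∏_{j=1}^{(k+1)/2} ∏_{i=j}^{2j−2}(m²−i²)] / [∏_{j=0}^{(k−3)/2}(4m²−(2j+1)²)^{(k−1)/2−j}] when k is odd, and R_k(m) = [∏_{j=1}^{k/2} ∏_{i=j}^{2j−1}(m²−i²)] / [∏_{j=0}^{k/2−1}(4m²−(2j+1)²)^{k/2−j}] when k is even. Then the anti-cluster probability satisfies Σ_{π∈NC_n : π(i) ≠ j for all 1≤i<j≤k} μ_π = (1/ASM(k)) · R_k(n)/R_k(k). -/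

import Mathlib

open scoped BigOperators

open MvPolynomial

attribute [local instance 10] Classical.propDecidable

/-- A noncrossing matching of order `n`, on the points `0, …, 2n-1`
(representing the 1-indexed points `1, …, 2n`): a fixed-point-free involution
with no crossing `a < b < c < d`, `f a = c`, `f b = d`. -/
structure NCM (n : ℕ) where
  f : Fin (2 * n) → Fin (2 * n)
  invol : ∀ k, f (f k) = k
  nofix : ∀ k, f k ≠ k
  noncross : ∀ a b c d : Fin (2 * n), a < b → b < c → c < d → f a = c → f b = d → False

theorem NCM.ext' {n : ℕ} {π σ : NCM n} (h : π.f = σ.f) : π = σ := by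
  cases π; cases σ; simpa using h

noncomputable instance {n : ℕ} : Fintype (NCM n) :=
  Fintype.ofInjective NCM.f fun _ _ h => NCM.ext' h

/-- `q = e^{2πi/3}`. -/
noncomputable def q : ℂ := Complex.exp (2 * Real.pi * Complex.I / 3)

/-- A wheel polynomial of order `n`: homogeneous of total degree `n(n-1)` and
vanishing under every substitution `z_j := q² z_i`, `z_k := q⁴ z_i` for `i < j < k`. -/
def IsWheel (n : ℕ) (p : MvPolynomial (Fin (2 * n)) ℂ) : Prop :=
  p.IsHomogeneous (n * (n - 1)) ∧
  ∀ i j k : Fin (2 * n), i < j → j < k →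
    (aeval fun l : Fin (2 * n) =>
      if l = j then C (q ^ 2) * X i
      else if l = k then C (q ^ 4) * X i
      else (X l : MvPolynomial (Fin (2 * n)) ℂ)) p = 0

/-- The `π`-evaluation `p(π) = p(q^{-π_1}, …, q^{-π_{2n}})`, where the `k`-th coordinate
is `q⁻¹` if `π` matches `k` to the right and `q` if it matches `k` to the left. -/
noncomputable def evalNC {n : ℕ} (p : MvPolynomial (Fin (2 * n)) ℂ) (π : NCM n) : ℂ :=
  eval (fun k => if k < π.f k then q⁻¹ else q) p

/-- Evaluation of a polynomial with all variables set to `1`. -/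
noncomputable def evalOne {n : ℕ} (p : MvPolynomial (Fin (2 * n)) ℂ) : ℂ :=
  eval (fun _ => (1 : ℂ)) p

/-- The alternating sign matrix numbers `ASM(n) = ∏_{j=0}^{n-1} (3j+1)!/(n+j)!`. -/
noncomputable def ASM (n : ℕ) : ℂ :=
  ∏ j ∈ Finset.range n, ((3 * j + 1).factorial : ℂ) / ((n + j).factorial : ℂ)

/-- Cyclic successor on `Fin m`. -/
def fsucc {m : ℕ} (k : Fin m) : Fin m := ⟨((k : ℕ) + 1) % m, Nat.mod_lt _ k.pos⟩

/-- The Temperley–Lieb operator `e_k` (underlying function on points): if `π` matches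
`k` with `k+1` it is `π`; otherwise it matches `k ↔ k+1`, `π(k) ↔ π(k+1)` and agrees
with `π` elsewhere (indices cyclic modulo `2n`). -/
def eRaw {n : ℕ} (k : Fin (2 * n)) (π : NCM n) : Fin (2 * n) → Fin (2 * n) :=
  if π.f k = fsucc k then π.f
  else fun m =>
    if m = k then fsucc k
    else if m = fsucc k then k
    else if m = π.f k then π.f (fsucc k)
    else if m = π.f (fsucc k) then π.f k
    else π.f m

/-- The stationarity linear system `2n·v_π = Σ_{k=1}^{2n} Σ_{π' : e_k(π') = π} v_{π'}`. -/
def Stationary {n : ℕ} (v : NCM n → ℂ) : Prop :=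
  ∀ π : NCM n, ((2 * n : ℕ) : ℂ) * v π =
    ∑ k : Fin (2 * n), ∑ π' : NCM n, if eRaw k π' = π.f then v π' else 0

/-- The rational function `R_k(m)` of Theorem 1.8 (formula (1.11)). -/
noncomputable def Rfun (k m : ℕ) : ℂ :=
  if k % 2 = 1 then
    (∏ j ∈ Finset.Icc 1 ((k + 1) / 2), ∏ i ∈ Finset.Icc j (2 * j - 2),
        ((m : ℂ) ^ 2 - (i : ℂ) ^ 2)) /
    ∏ j ∈ Finset.Icc 0 ((k - 3) / 2),
        (4 * (m : ℂ) ^ 2 - ((2 * j + 1 : ℕ) : ℂ) ^ 2) ^ ((k - 1) / 2 - j)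
  else
    (∏ j ∈ Finset.Icc 1 (k / 2), ∏ i ∈ Finset.Icc j (2 * j - 1),
        ((m : ℂ) ^ 2 - (i : ℂ) ^ 2)) /
    ∏ j ∈ Finset.Icc 0 (k / 2 - 1),
        (4 * (m : ℂ) ^ 2 - ((2 * j + 1 : ℕ) : ℂ) ^ 2) ^ (k / 2 - j)

namespace ACP

open Finset

theorem q_cube : q ^ 3 = 1 := by
  unfold q
  rw [← Complex.exp_nat_mul]
  have : ((3 : ℕ) : ℂ) * (2 * Real.pi * Complex.I / 3) = 2 * Real.pi * Complex.I := by
    push_cast; ring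
  rw [this, Complex.exp_two_pi_mul_I]

theorem q_prim : IsPrimitiveRoot q 3 := by
  have := Complex.isPrimitiveRoot_exp 3 (by norm_num)
  unfold q
  exact_mod_cast this

theorem q_ne_one : q ≠ 1 := by
  have := q_prim.ne_one (by norm_num)
  exact this

theorem q_ne_zero : q ≠ 0 := by
  intro h
  have := q_cube
  rw [h] at this
  norm_num at this

theorem q_quad : q ^ 2 + q + 1 = 0 := by
  have h : (q - 1) * (q ^ 2 + q + 1) = 0 := by
    have := q_cube
    linear_combination this
  rcases mul_eq_zero.mp h with h | h
  · exact absurd (sub_eq_zero.mp h) q_ne_one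
  · exact h

theorem q_inv : q⁻¹ = q ^ 2 := by
  have := q_cube
  field_simp [q_ne_zero]
  linear_combination -this

theorem q_sq_ne_one : q ^ 2 ≠ 1 := by
  intro h
  have h1 := q_cube
  apply q_ne_one
  linear_combination h1 - q * h

theorem q_sq_ne : q ^ 2 ≠ q := by
  intro h
  have h1 := q_cube
  apply q_sq_ne_one
  linear_combination h1 - q * h

/-- polynomial functions with per-variable degree bounds -/
def Mon (N : ℕ) (d : ℕ → ℕ) : Submodule ℂ ((ℕ → ℂ) → ℂ) :=
  Submodule.span ℂ {F | ∃ e : ℕ → ℕ, (∀ i, e i ≤ d i) ∧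
    F = fun z => ∏ i ∈ range N, z i ^ e i}

theorem mon_congr {N : ℕ} {d : ℕ → ℕ} {F : (ℕ → ℂ) → ℂ} (hF : F ∈ Mon N d)
    {z w : ℕ → ℂ} (h : ∀ i < N, z i = w i) : F z = F w := by
  induction hF using Submodule.span_induction with
  | mem F hF =>
    obtain ⟨e, -, rfl⟩ := hF
    exact prod_congr rfl fun i hi => by rw [h i (mem_range.mp hi)]
  | zero => rfl
  | add F G _ _ h1 h2 => simp [h1, h2]
  | smul c F _ h1 => simp [h1]

theorem mon_cont {N : ℕ} {d : ℕ → ℕ} {F : (ℕ → ℂ) → ℂ} (hF : F ∈ Mon N d) :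
    Continuous F := by
  induction hF using Submodule.span_induction with
  | mem F hF =>
    obtain ⟨e, -, rfl⟩ := hF
    fun_prop
  | zero => exact continuous_const
  | add F G _ _ h1 h2 => exact h1.add h2
  | smul c F _ h1 => exact h1.const_smul c

theorem mon_mono {N : ℕ} {d d' : ℕ → ℕ} (h : ∀ i, d i ≤ d' i) : Mon N d ≤ Mon N d' := by
  apply Submodule.span_mono
  rintro F ⟨e, he, rfl⟩
  exact ⟨e, fun i => (he i).trans (h i), rfl⟩

theorem mon_mono' {N : ℕ} {d d' : ℕ → ℕ} (h : ∀ i < N, d i ≤ d' i) : Mon N d ≤ Mon N d' := by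
  apply Submodule.span_le.mpr
  rintro F ⟨e, he, rfl⟩
  apply Submodule.subset_span
  refine ⟨fun i => if i < N then e i else 0, fun i => ?_, ?_⟩
  · dsimp only
    split_ifs with hi
    · exact (he i).trans (h i hi)
    · exact Nat.zero_le _
  · funext z
    exact prod_congr rfl fun i hi => by
      dsimp only; rw [if_pos (mem_range.mp hi)]

theorem mon_const (N : ℕ) (d : ℕ → ℕ) (c : ℂ) : (fun _ => c) ∈ Mon N d := by
  have : (fun _ => c : (ℕ → ℂ) → ℂ) = c • (fun z : ℕ → ℂ => ∏ i ∈ range N, z i ^ (0 : ℕ)) := by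
    funext z; simp
  rw [this]
  exact Submodule.smul_mem _ _ (Submodule.subset_span ⟨fun _ => 0, fun _ => Nat.zero_le _, rfl⟩)

theorem mon_coord {N : ℕ} {d : ℕ → ℕ} {i : ℕ} (hi : i < N) (hd : 1 ≤ d i) :
    (fun z => z i) ∈ Mon N d := by
  apply Submodule.subset_span
  refine ⟨fun k => if k = i then 1 else 0, fun k => ?_, ?_⟩
  · dsimp only
    split_ifs with h
    · rw [h]; exact hd
    · exact Nat.zero_le _
  · funext z
    simp [Finset.prod_ite_eq', hi]

theorem mon_mul {N : ℕ} {d d' d'' : ℕ → ℕ} {F G : (ℕ → ℂ) → ℂ} (hF : F ∈ Mon N d)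
    (hG : G ∈ Mon N d') (h : ∀ i, d i + d' i ≤ d'' i) : (fun z => F z * G z) ∈ Mon N d'' := by
  induction hF, hG using Submodule.span_induction₂ with
  | mem_mem F G hF hG =>
    obtain ⟨e, he, rfl⟩ := hF
    obtain ⟨e', he', rfl⟩ := hG
    apply Submodule.subset_span
    refine ⟨fun i => e i + e' i, fun i => (add_le_add (he i) (he' i)).trans (h i), ?_⟩
    funext z
    rw [← prod_mul_distrib]
    exact prod_congr rfl fun i _ => (pow_add _ _ _).symm
  | zero_left G _ => simp only [Pi.zero_apply, zero_mul]; exact mon_const _ _ _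
  | zero_right F _ => simp only [Pi.zero_apply, mul_zero]; exact mon_const _ _ _
  | add_left F G H _ _ _ h1 h2 =>
    simp only [Pi.add_apply, add_mul]; exact Submodule.add_mem _ h1 h2
  | add_right F G H _ _ _ h1 h2 =>
    simp only [Pi.add_apply, mul_add]; exact Submodule.add_mem _ h1 h2
  | smul_left c F G _ _ h1 =>
    simp only [Pi.smul_apply, smul_mul_assoc]; exact Submodule.smul_mem _ c h1
  | smul_right c F G _ _ h1 =>
    simp only [Pi.smul_apply, mul_smul_comm]; exact Submodule.smul_mem _ c h1

theorem mon_pow {N : ℕ} {d : ℕ → ℕ} {F : (ℕ → ℂ) → ℂ} (hF : F ∈ Mon N d) (k : ℕ) :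
    (fun z => F z ^ k) ∈ Mon N (fun i => k * d i) := by
  induction k with
  | zero => simp only [pow_zero]; exact mon_const _ _ _
  | succ k ih =>
    simp only [pow_succ]
    exact mon_mul ih hF fun i => by rw [Nat.succ_mul]

theorem mon_prod {N : ℕ} {ι : Type*} (s : Finset ι) (d : ι → ℕ → ℕ) (F : ι → (ℕ → ℂ) → ℂ)
    (hF : ∀ i ∈ s, F i ∈ Mon N (d i)) :
    (fun z => ∏ i ∈ s, F i z) ∈ Mon N (fun k => ∑ i ∈ s, d i k) := by
  induction s using Finset.cons_induction with
  | empty => simp only [prod_empty]; exact mon_const _ _ _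
  | cons a s ha ih =>
    simp only [prod_cons, sum_cons]
    exact mon_mul (hF a (mem_cons_self a s)) (ih fun i hi => hF i (mem_cons_of_mem hi))
      fun i => le_rfl

theorem mon_subst {N N' : ℕ} {d d' : ℕ → ℕ} {F : (ℕ → ℂ) → ℂ} (hF : F ∈ Mon N d)
    (s : (ℕ → ℂ) → ℕ → ℂ) (D : ℕ → ℕ → ℕ)
    (hs : ∀ i < N, (fun z => s z i) ∈ Mon N' (D i))
    (hd : ∀ k < N', ∑ i ∈ range N, d i * D i k ≤ d' k) : (fun z => F (s z)) ∈ Mon N' d' := by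
  induction hF using Submodule.span_induction with
  | mem F hF =>
    obtain ⟨e, he, rfl⟩ := hF
    have := mon_prod (N := N') (range N) (fun i k => e i * D i k) (fun i z => s z i ^ e i)
      (fun i hi => mon_pow (hs i (mem_range.mp hi)) (e i))
    exact mon_mono' (fun k hk =>
      (sum_le_sum fun i _ => Nat.mul_le_mul_right _ (he i)).trans (hd k hk)) this
  | zero => exact mon_const _ _ _
  | add F G _ _ h1 h2 => exact Submodule.add_mem _ h1 h2
  | smul c F _ h1 => exact Submodule.smul_mem _ c h1

theorem mon_poly {N : ℕ} {d : ℕ → ℕ} {F : (ℕ → ℂ) → ℂ} (hF : F ∈ Mon N d)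
    (c : ℕ → Polynomial ℂ) (r : ℕ → ℕ) (hc : ∀ i < N, (c i).natDegree ≤ r i) :
    ∃ p : Polynomial ℂ, p.natDegree ≤ ∑ i ∈ range N, d i * r i ∧
      ∀ t, p.eval t = F (fun i => (c i).eval t) := by
  induction hF using Submodule.span_induction with
  | mem F hF =>
    obtain ⟨e, he, rfl⟩ := hF
    refine ⟨∏ i ∈ range N, c i ^ e i, ?_, fun t => ?_⟩
    · refine (Polynomial.natDegree_prod_le _ _).trans (sum_le_sum fun i hi => ?_)
      exact (Polynomial.natDegree_pow_le).trans
        (Nat.mul_le_mul (he i) (hc i (mem_range.mp hi)))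
    · simp [Polynomial.eval_prod]
  | zero => exact ⟨0, by simp, by simp⟩
  | add F G _ _ h1 h2 =>
    obtain ⟨p, hp, hp'⟩ := h1
    obtain ⟨p', hp2, hp2'⟩ := h2
    exact ⟨p + p', (Polynomial.natDegree_add_le _ _).trans (max_le hp hp2), by
      simp [hp', hp2']⟩
  | smul a F _ h1 =>
    obtain ⟨p, hp, hp'⟩ := h1
    exact ⟨a • p, (Polynomial.natDegree_smul_le _ _).trans hp, by simp [hp']⟩

def Gen (N : ℕ) (z : ℕ → ℂ) : Prop :=
  (∀ i < N, z i ≠ 0) ∧ ∀ i < N, ∀ j < N, i ≠ j → z i ^ 3 ≠ z j ^ 3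

theorem gen_finite (N : ℕ) (z : ℕ → ℂ) :
    {t : ℂ | ¬ Gen N (fun i => z i + t * ((i : ℂ) + 1))}.Finite := by
  have h1 : ∀ i : ℕ, {t : ℂ | z i + t * ((i : ℂ) + 1) = 0}.Finite := by
    intro i
    have hi : ((i : ℂ) + 1) ≠ 0 := by exact_mod_cast Nat.succ_ne_zero i
    apply (Set.finite_singleton (-z i / ((i : ℂ) + 1))).subset
    intro t ht
    simp only [Set.mem_ofPred_eq, Set.mem_singleton_iff] at *
    field_simp
    linear_combination ht
  have h2 : ∀ i j : ℕ, i ≠ j → {t : ℂ | (z i + t * ((i : ℂ) + 1)) ^ 3 =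
      (z j + t * ((j : ℂ) + 1)) ^ 3}.Finite := by
    intro i j hij
    let p : Polynomial ℂ := (Polynomial.C (z i) + Polynomial.X * Polynomial.C ((i : ℂ) + 1)) ^ 3
      - (Polynomial.C (z j) + Polynomial.X * Polynomial.C ((j : ℂ) + 1)) ^ 3
    have hp : p ≠ 0 := by
      intro h0
      have hpe : p = Polynomial.C (z i ^ 3 - z j ^ 3)
          + Polynomial.C (3 * z i ^ 2 * ((i : ℂ) + 1) - 3 * z j ^ 2 * ((j : ℂ) + 1)) * Polynomial.X
          + Polynomial.C (3 * z i * ((i : ℂ) + 1) ^ 2 - 3 * z j * ((j : ℂ) + 1) ^ 2)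
            * Polynomial.X ^ 2
          + Polynomial.C (((i : ℂ) + 1) ^ 3 - ((j : ℂ) + 1) ^ 3) * Polynomial.X ^ 3 := by
        simp only [p, map_sub, map_mul, map_pow]
        have : (Polynomial.C (3 : ℂ)) = 3 := rfl
        rw [this]
        ring
      have hc : p.coeff 3 = ((i : ℂ) + 1) ^ 3 - ((j : ℂ) + 1) ^ 3 := by
        rw [hpe]
        simp only [Polynomial.coeff_add, Polynomial.coeff_C_mul, Polynomial.coeff_C,
          Polynomial.coeff_X, Polynomial.coeff_X_pow]
        norm_num
      rw [h0, Polynomial.coeff_zero] at hc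
      have h3 : (((i + 1) ^ 3 : ℕ) : ℂ) = (((j + 1) ^ 3 : ℕ) : ℂ) := by
        push_cast; linear_combination -hc
      have h4 : (i + 1) ^ 3 = (j + 1) ^ 3 := by exact_mod_cast h3
      have h5 := Nat.pow_left_injective (n := 3) (by norm_num) h4
      exact hij (by simpa using h5)
    apply (p.roots.toFinset.finite_toSet).subset
    intro t ht
    simp only [Set.mem_ofPred_eq] at ht
    simp only [Finset.mem_coe, Multiset.mem_toFinset, Polynomial.mem_roots hp, Polynomial.IsRoot]
    simp [p, ht]
  have h3 : {t : ℂ | ¬ Gen N (fun i => z i + t * ((i : ℂ) + 1))} ⊆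
      (⋃ i ∈ (range N : Set ℕ), {t : ℂ | z i + t * ((i : ℂ) + 1) = 0}) ∪
      ⋃ i ∈ (range N : Set ℕ), ⋃ j ∈ (range N : Set ℕ), ⋃ _ : i ≠ j,
        {t : ℂ | (z i + t * ((i : ℂ) + 1)) ^ 3 = (z j + t * ((j : ℂ) + 1)) ^ 3} := by
    intro t ht
    by_contra hcon
    apply ht
    simp only [Set.mem_union, Set.mem_iUnion, not_or, not_exists, Finset.coe_range, Set.mem_Iio,
      Set.mem_ofPred_eq] at hcon
    exact ⟨fun i hi => hcon.1 i hi, fun i hi j hj hij => hcon.2 i hi j hj hij⟩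
  refine Set.Finite.subset (Set.Finite.union ?_ ?_) h3
  · exact Set.Finite.biUnion (Finset.finite_toSet _) fun i _ => h1 i
  · refine Set.Finite.biUnion (Finset.finite_toSet _) fun i _ => ?_
    refine Set.Finite.biUnion (Finset.finite_toSet _) fun j _ => ?_
    exact Set.finite_iUnion fun h => h2 i j h

theorem gen_dense {N : ℕ} {F G : (ℕ → ℂ) → ℂ} (hF : Continuous F) (hG : Continuous G)
    (h : ∀ z, Gen N z → F z = G z) (z : ℕ → ℂ) : F z = G z := by
  have hline : Continuous fun t : ℂ => (fun i => z i + t * ((i : ℂ) + 1) : ℕ → ℂ) := by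
    fun_prop
  have hd : Dense {t : ℂ | Gen N (fun i => z i + t * ((i : ℂ) + 1))} := by
    have := (gen_finite N z).countable.dense_compl ℂ
    convert this using 1
    ext t; simp
  have := Continuous.ext_on hd (hF.comp hline) (hG.comp hline) (fun t ht => h _ ht)
  have h0 := congrFun this 0
  simpa using h0

theorem gen_exists (N : ℕ) : ∃ z, Gen N z := by
  by_contra hcon
  push Not at hcon
  have := gen_dense (N := N) (F := fun _ => 0) (G := fun _ => 1) continuous_const continuous_const
    (fun z hz => absurd hz (hcon z)) (fun _ => 0)
  norm_num at this

/-- a polynomial with too many roots on a finset vanishes -/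
theorem poly_zero {p : Polynomial ℂ} (s : Finset ℂ) (hs : ∀ x ∈ s, p.eval x = 0)
    (hc : p.natDegree < s.card) : p = 0 := by
  by_contra hp
  have h1 : s ⊆ p.roots.toFinset := fun x hx => by
    simp [hp, Polynomial.IsRoot, hs x hx]
  have h2 := (Finset.card_le_card h1).trans (Multiset.toFinset_card_le _)
  have h3 := p.card_roots'
  omega

end ACP

namespace ACP

open Finset

def InjPt (N : ℕ) (z : ℕ → ℂ) : Prop := ∀ a < N, ∀ b < N, a ≠ b → z a ≠ z b

/-- wheel functions -/
def W (n : ℕ) : Submodule ℂ ((ℕ → ℂ) → ℂ) where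
  carrier := {F | F ∈ Mon (2 * n) (fun _ => n - 1) ∧
    ∀ i j l : ℕ, i < j → j < l → l < 2 * n → ∀ z : ℕ → ℂ, InjPt (2 * n) z →
      z j = q ^ 2 * z i → z l = q ^ 2 * z j → F z = 0}
  add_mem' := fun {F G} hF hG => ⟨Submodule.add_mem _ hF.1 hG.1,
    fun i j l h1 h2 h3 z hz h4 h5 => by
      rw [Pi.add_apply, hF.2 i j l h1 h2 h3 z hz h4 h5, hG.2 i j l h1 h2 h3 z hz h4 h5, add_zero]⟩
  zero_mem' := ⟨Submodule.zero_mem _, fun _ _ _ _ _ _ _ _ _ _ => rfl⟩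
  smul_mem' := fun c F hF => ⟨Submodule.smul_mem _ c hF.1,
    fun i j l h1 h2 h3 z hz h4 h5 => by
      rw [Pi.smul_apply, hF.2 i j l h1 h2 h3 z hz h4 h5, smul_zero]⟩

def rotz (N : ℕ) (z : ℕ → ℂ) : ℕ → ℂ := fun i => if i = 0 then z (N - 1) else z (i - 1)

theorem rot_mem {n : ℕ} {F : (ℕ → ℂ) → ℂ} (hF : F ∈ W n) :
    (fun z => F (rotz (2 * n) z)) ∈ W n := by
  constructor
  · refine mon_subst hF.1 (rotz (2 * n))
      (fun i k => if k = (if i = 0 then 2 * n - 1 else i - 1) then 1 else 0) ?_ ?_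
    · intro i hi
      unfold rotz
      by_cases h : i = 0
      · simp only [h, if_true]
        exact mon_coord (by omega) (by simp)
      · simp only [h, if_false]
        exact mon_coord (by omega) (by simp)
    · intro k hk
      calc ∑ i ∈ range (2 * n), (n - 1) *
            (if k = (if i = 0 then 2 * n - 1 else i - 1) then 1 else 0)
          = ∑ i ∈ range (2 * n), (if i = (if k + 1 = 2 * n then 0 else k + 1) then n - 1 else 0) := by
            apply sum_congr rfl
            intro i hi
            have := mem_range.mp hi
            split_ifs <;> omega
        _ ≤ n - 1 := by
            rw [sum_ite_eq']
            split_ifs <;> omega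
  · intro i j l hij hjl hl z hz h1 h2
    have hinj : InjPt (2 * n) (rotz (2 * n) z) := by
      intro a ha b hb hab
      unfold rotz
      split_ifs <;> first | omega | (apply hz <;> omega)
    have h3 := q_cube
    by_cases hl' : l = 2 * n - 1
    · apply hF.2 0 (i + 1) (j + 1) (by omega) (by omega) (by omega) _ hinj
      · simp only [rotz]
        rw [← hl', h2, h1]
        simp only [Nat.add_eq_zero_iff, one_ne_zero, and_false, if_false, if_true,
          Nat.add_sub_cancel]
        linear_combination (-(q ^ 3) - 1) * z i * h3
      · simpa [rotz] using h1
    · apply hF.2 (i + 1) (j + 1) (l + 1) (by omega) (by omega) (by omega) _ hinj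
      · simpa [rotz] using h1
      · simpa [rotz] using h2

theorem mon_zero {N : ℕ} {F : (ℕ → ℂ) → ℂ} (hF : F ∈ Mon N (fun _ => 0)) (z w : ℕ → ℂ) :
    F z = F w := by
  induction hF using Submodule.span_induction with
  | mem F hF =>
    obtain ⟨e, he, rfl⟩ := hF
    have : ∀ i, e i = 0 := fun i => Nat.le_zero.mp (he i)
    simp [this]
  | zero => rfl
  | add F G _ _ h1 h2 => simp [h1, h2]
  | smul c F _ h1 => simp [h1]

theorem mono2_mem {M D x y : ℕ} {d e : ℕ → ℕ} (hx : x ≤ D) (hy : y ≤ D)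
    (he : ∀ i, e i ≤ d i) :
    (fun z : ℕ → ℂ => z 0 ^ x * z 1 ^ y * ∏ i ∈ range M, z (i + 2) ^ e (i + 2)) ∈
      Mon (M + 2) (fun i => if i < 2 then D else d i) := by
  apply Submodule.subset_span
  refine ⟨fun i => if i = 0 then x else if i = 1 then y else e i, ?_, ?_⟩
  · intro i
    dsimp only
    have := he i
    split_ifs <;> omega
  · funext z
    rw [prod_range_succ', prod_range_succ']
    simp
    ring

theorem divdiff {M D : ℕ} {d : ℕ → ℕ} (h0 : d 0 ≤ D + 1) (h1 : d 1 ≤ D + 1)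
    {F : (ℕ → ℂ) → ℂ} (hF : F ∈ Mon (M + 2) d) :
    ∃ G ∈ Mon (M + 2) (fun i => if i < 2 then D else d i),
      ∀ z, (z 0 - z 1) * G z = F z - F (fun i => z (Equiv.swap 0 1 i)) := by
  induction hF using Submodule.span_induction with
  | mem F hF =>
    obtain ⟨e, he, rfl⟩ := hF
    have hs : ∀ i : ℕ, Equiv.swap 0 1 (i + 2) = i + 2 := fun i =>
      Equiv.swap_apply_of_ne_of_ne (by omega) (by omega)
    have e0 := (he 0).trans h0
    have e1 := (he 1).trans h1
    rcases le_total (e 1) (e 0) with h | h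
    · refine ⟨fun z => ∑ i ∈ range (e 0 - e 1), z 0 ^ (e 1 + i) * z 1 ^ (e 1 + (e 0 - e 1 - 1 - i))
        * ∏ i ∈ range M, z (i + 2) ^ e (i + 2), ?_, ?_⟩
      · have := Submodule.sum_mem (Mon (M + 2) (fun i => if i < 2 then D else d i))
          (t := range (e 0 - e 1)) (f := fun i => fun z : ℕ → ℂ =>
            z 0 ^ (e 1 + i) * z 1 ^ (e 1 + (e 0 - e 1 - 1 - i))
            * ∏ i ∈ range M, z (i + 2) ^ e (i + 2))
          (fun i hi => by
            have := mem_range.mp hi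
            exact mono2_mem (by omega) (by omega) he)
        convert this using 1
        funext z
        simp
      · intro z
        have hg := geom_sum₂_mul (z 0) (z 1) (e 0 - e 1)
        obtain ⟨c, hc⟩ := Nat.exists_eq_add_of_le h
        dsimp only
        rw [prod_range_succ', prod_range_succ', prod_range_succ', prod_range_succ']
        simp only [hs, zero_add, Equiv.swap_apply_left, Equiv.swap_apply_right, ← sum_mul]
        rw [hc] at hg ⊢
        simp only [Nat.add_sub_cancel_left] at hg ⊢
        have : ∀ i, z 0 ^ (e 1 + i) * z 1 ^ (e 1 + (c - 1 - i)) =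
          (z 0 * z 1) ^ e 1 * (z 0 ^ i * z 1 ^ (c - 1 - i)) := fun i => by ring
        simp only [this, ← mul_sum]
        linear_combination (z 0 * z 1) ^ e 1 * (∏ i ∈ range M, z (i + 2) ^ e (i + 2)) * hg
    · refine ⟨fun z => - ∑ i ∈ range (e 1 - e 0), z 0 ^ (e 0 + i) * z 1 ^ (e 0 + (e 1 - e 0 - 1 - i))
        * ∏ i ∈ range M, z (i + 2) ^ e (i + 2), ?_, ?_⟩
      · have := Submodule.sum_mem (Mon (M + 2) (fun i => if i < 2 then D else d i))
          (t := range (e 1 - e 0)) (f := fun i => fun z : ℕ → ℂ =>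
            z 0 ^ (e 0 + i) * z 1 ^ (e 0 + (e 1 - e 0 - 1 - i))
            * ∏ i ∈ range M, z (i + 2) ^ e (i + 2))
          (fun i hi => by
            have := mem_range.mp hi
            exact mono2_mem (by omega) (by omega) he)
        convert Submodule.neg_mem _ this using 1
        funext z
        simp
      · intro z
        have hg := geom_sum₂_mul (z 0) (z 1) (e 1 - e 0)
        obtain ⟨c, hc⟩ := Nat.exists_eq_add_of_le h
        dsimp only
        rw [prod_range_succ', prod_range_succ', prod_range_succ', prod_range_succ']
        simp only [hs, zero_add, Equiv.swap_apply_left, Equiv.swap_apply_right, ← sum_mul]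
        rw [hc] at hg ⊢
        simp only [Nat.add_sub_cancel_left] at hg ⊢
        have : ∀ i, z 0 ^ (e 0 + i) * z 1 ^ (e 0 + (c - 1 - i)) =
          (z 0 * z 1) ^ e 0 * (z 0 ^ i * z 1 ^ (c - 1 - i)) := fun i => by ring
        simp only [this, ← mul_sum]
        linear_combination -(z 0 * z 1) ^ e 0 * (∏ i ∈ range M, z (i + 2) ^ e (i + 2)) * hg
  | zero => exact ⟨0, Submodule.zero_mem _, by simp⟩
  | add F G _ _ h1 h2 =>
    obtain ⟨p, hp, hp'⟩ := h1
    obtain ⟨p', hp2, hp2'⟩ := h2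
    refine ⟨p + p', Submodule.add_mem _ hp hp2, fun z => ?_⟩
    simp only [Pi.add_apply]
    linear_combination hp' z + hp2' z
  | smul a F _ h1 =>
    obtain ⟨p, hp, hp'⟩ := h1
    refine ⟨a • p, Submodule.smul_mem _ a hp, fun z => ?_⟩
    simp only [Pi.smul_apply, smul_eq_mul]
    linear_combination a * hp' z

def nx (N j : ℕ) : ℕ := if j + 1 = N then 0 else j + 1

def IsE (N j : ℕ) (F H : (ℕ → ℂ) → ℂ) : Prop :=
  ∀ z : ℕ → ℂ, (z j - z (nx N j)) * (H z - F z) =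
    (q * z j - q ^ 2 * z (nx N j)) * (F z - F (fun i => z (Equiv.swap j (nx N j) i)))

theorem E0_exists {n : ℕ} {F : (ℕ → ℂ) → ℂ} (hF : F ∈ W (n + 1)) :
    ∃ H ∈ W (n + 1), IsE (2 * (n + 1)) 0 F H := by
  have hnx : nx (2 * (n + 1)) 0 = 1 := by unfold nx; rw [if_neg (by omega)]
  rcases n with _ | n
  · refine ⟨F, hF, fun z => ?_⟩
    rw [mon_zero hF.1 (fun i => z (Equiv.swap 0 (nx (2 * (0 + 1)) 0) i)) z]
    ring
  obtain ⟨G, hG, hGz⟩ := divdiff (M := 2 * (n + 1)) (D := n) (d := fun _ => n + 1) le_rfl le_rfl hF.1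
  have hlin : (fun z : ℕ → ℂ => q * z 0 - q ^ 2 * z 1) ∈
      Mon (2 * (n + 1) + 2) (fun i => if i < 2 then 1 else 0) :=
    Submodule.sub_mem _
      (Submodule.smul_mem _ q (mon_coord (i := 0) (by omega) (by simp)))
      (Submodule.smul_mem _ (q ^ 2) (mon_coord (i := 1) (by omega) (by simp)))
  refine ⟨fun z => F z + (q * z 0 - q ^ 2 * z 1) * G z, ⟨?_, ?_⟩, ?_⟩
  · refine Submodule.add_mem _ hF.1 (mon_mul hlin hG fun i => ?_)
    split_ifs <;> omega
  · intro i j l hij hjl hl z hz h1 h2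
    have hF0 := hF.2 i j l hij hjl hl z hz h1 h2
    dsimp only
    rw [hF0, zero_add]
    have hne : z 0 - z 1 ≠ 0 := sub_ne_zero.mpr (hz 0 (by omega) 1 (by omega) (by omega))
    have hg := hGz z
    rw [hF0, zero_sub] at hg
    by_cases hc : i = 0 ∧ j = 1
    · obtain ⟨rfl, rfl⟩ := hc
      rw [h1]
      linear_combination (-q * z 0 * G z) * q_cube
    · have hsw : F (fun i => z (Equiv.swap 0 1 i)) = 0 := by
        have hinj : InjPt (2 * (n + 1 + 1)) (fun i => z (Equiv.swap 0 1 i)) := by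
          intro a ha b hb hab
          have hlt : ∀ a < 2 * (n + 1 + 1), Equiv.swap 0 1 a < 2 * (n + 1 + 1) := by
            intro a ha
            rw [Equiv.swap_apply_def]
            split_ifs <;> omega
          exact hz _ (hlt a ha) _ (hlt b hb) (fun h => hab ((Equiv.swap 0 1).injective h))
        have key : ∀ a : ℕ, z (Equiv.swap 0 1 (Equiv.swap 0 1 a)) = z a := fun a => by simp
        apply hF.2 (Equiv.swap 0 1 i) (Equiv.swap 0 1 j) (Equiv.swap 0 1 l) _ _ _ _ hinj
        · simpa [key] using h1
        · simpa [key] using h2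
        all_goals
          simp only [Equiv.swap_apply_def]
          split_ifs <;> omega
      rw [hsw, neg_zero] at hg
      rcases mul_eq_zero.mp hg with h | h
      · exact absurd h hne
      · rw [h, mul_zero]
  · intro z
    rw [hnx]
    linear_combination (q * z 0 - q ^ 2 * z 1) * hGz z

theorem IsE_rot {N j : ℕ} (hj : j < N) (hN : 2 ≤ N) {d : ℕ → ℕ} {F H : (ℕ → ℂ) → ℂ}
    (hF : F ∈ Mon N d)
    (h : IsE N (nx N j) F H) :
    IsE N j (fun z => F (rotz N z)) (fun z => H (rotz N z)) := by
  intro z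
  have hz := h (rotz N z)
  have e1' : ∀ z : ℕ → ℂ, ∀ k < N, rotz N z (nx N k) = z k := by
    intro z k hk
    unfold rotz nx
    by_cases h : k + 1 = N
    · simp [h]; congr 1; omega
    · simp [h]
  have e1 := e1' z
  have hnx : ∀ k < N, nx N k < N := by intro k hk; unfold nx; split_ifs <;> omega
  rw [e1 j hj, e1 _ (hnx j hj)] at hz
  dsimp only
  rw [hz]
  congr 2
  apply mon_congr hF
  intro i hi
  have hinj : ∀ a < N, ∀ b < N, nx N a = nx N b → a = b := by
    intro a ha b hb hab
    unfold nx at hab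
    split_ifs at hab <;> omega
  obtain ⟨k, hk, rfl⟩ : ∃ k < N, nx N k = i := by
    by_cases h : i = 0
    · exact ⟨N - 1, by omega, by unfold nx; rw [if_pos (by omega), h]⟩
    · exact ⟨i - 1, by omega, by unfold nx; rw [if_neg (by omega)]; omega⟩
  rw [e1' (fun i => z (Equiv.swap j (nx N j) i)) k hk]
  by_cases h1 : k = j
  · rw [h1, Equiv.swap_apply_left, Equiv.swap_apply_left, e1 _ (hnx _ hj)]
  by_cases h2 : k = nx N j
  · rw [h2, Equiv.swap_apply_right, Equiv.swap_apply_right, e1 _ hj]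
  rw [Equiv.swap_apply_of_ne_of_ne h1 h2, Equiv.swap_apply_of_ne_of_ne
    (fun h => h1 (hinj _ hk _ hj h)) (fun h => h2 (hinj _ hk _ (hnx _ hj) h)), e1 _ hk]

theorem rotz_iter (N k : ℕ) (hk : k ≤ N) (z : ℕ → ℂ) (i : ℕ) (hi : i < N) :
    (rotz N)^[k] z i = if i < k then z (N + i - k) else z (i - k) := by
  induction k generalizing i with
  | zero => simp
  | succ k ih =>
    rw [Function.iterate_succ_apply']
    unfold rotz at ih ⊢
    have ih := ih (by omega)
    by_cases h0 : i = 0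
    · rw [if_pos h0, ih (N - 1) (by omega), if_neg (by omega), if_pos (by omega)]
      congr 1; omega
    · rw [if_neg h0, ih (i - 1) (by omega)]
      by_cases h : i < k + 1
      · rw [if_pos (by omega), if_pos h]; congr 1; omega
      · rw [if_neg (by omega), if_neg h]; congr 1; omega

theorem rot_iter_mem {n : ℕ} {F : (ℕ → ℂ) → ℂ} (hF : F ∈ W n) (k : ℕ) :
    (fun z => F ((rotz (2 * n))^[k] z)) ∈ W n := by
  induction k with
  | zero => exact hF
  | succ k ih =>
    have := rot_mem ih
    simpa only [Function.iterate_succ_apply] using this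

theorem E_exists {n j : ℕ} (hj : j < 2 * (n + 1)) {F : (ℕ → ℂ) → ℂ} (hF : F ∈ W (n + 1)) :
    ∃ H ∈ W (n + 1), IsE (2 * (n + 1)) j F H := by
  have key : ∀ k, k < 2 * (n + 1) → ∀ j, ((0 < k ∧ j + k = 2 * (n + 1)) ∨ (j = 0 ∧ k = 0)) →
      ∀ F ∈ W (n + 1), ∃ H ∈ W (n + 1), IsE (2 * (n + 1)) j F H := by
    intro k
    induction k with
    | zero =>
      intro _ j hj F hF
      rcases hj with hj | ⟨rfl, -⟩
      · omega
      · exact E0_exists hF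
    | succ k ih =>
      intro hk j hj F hF
      obtain ⟨H, hH, hHE⟩ := ih (by omega) (nx (2 * (n + 1)) j) (by unfold nx; split_ifs <;> omega)
        _ (rot_iter_mem hF (2 * (n + 1) - 1))
      refine ⟨_, rot_mem hH, ?_⟩
      have := IsE_rot (j := j) (by omega) (by omega) (rot_iter_mem hF (2 * (n + 1) - 1)).1 hHE
      convert this using 1
      funext z
      rw [← Function.iterate_succ_apply]
      apply mon_congr hF.1
      intro i hi
      rw [rotz_iter _ _ (by omega) _ _ hi, if_pos (by omega)]
      congr 1; omega
  rcases Nat.eq_zero_or_pos j with h | h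
  · exact key 0 (by omega) j (Or.inr ⟨h, rfl⟩) F hF
  · exact key (2 * (n + 1) - j) (by omega) j (Or.inl ⟨by omega, by omega⟩) F hF

end ACP

namespace ACP
open Finset

noncomputable def ins (j : ℕ) (t : ℂ) (y : ℕ → ℂ) : ℕ → ℂ := fun i =>
  if i < j then y i else if i = j then t else if i = j + 1 then q ^ 2 * t else y (i - 2)

theorem mon_div_aux {N : ℕ} {d : ℕ → ℕ} {G : (ℕ → ℂ) → ℂ} (hG : G ∈ Mon N d) {m : ℕ} (hm : m < N) :
    ∃ H ∈ Mon N (Function.update d m (d m - 1)), ∀ z, G z = G (Function.update z m 0) + z m * H z := by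
  induction hG using Submodule.span_induction with
  | mem F hF =>
    obtain ⟨e, he, rfl⟩ := hF
    by_cases h0 : e m = 0
    · refine ⟨fun _ => 0, mon_const _ _ 0, fun z => ?_⟩
      simp only [mul_zero, add_zero]
      apply prod_congr rfl
      intro i hi
      by_cases h : i = m
      · rw [h, h0]; simp
      · rw [Function.update_of_ne h]
    · refine ⟨fun z => ∏ i ∈ range N, z i ^ (Function.update e m (e m - 1) i),
        Submodule.subset_span ⟨_, fun i => ?_, rfl⟩, fun z => ?_⟩
      · by_cases h : i = m
        · subst h; simp; have := he i; omega
        · simp [Function.update_of_ne h, he i]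
      · have h1 : ∏ i ∈ range N, (Function.update z m 0 i) ^ e i = 0 := by
          apply prod_eq_zero (mem_range.mpr hm)
          simp [h0]
        beta_reduce
        rw [h1, zero_add, ← mul_prod_erase _ _ (mem_range.mpr hm),
          ← mul_prod_erase (range N) (fun i => z i ^ (Function.update e m (e m - 1) i)) (mem_range.mpr hm)]
        rw [← mul_assoc]
        congr 1
        · simp only [Function.update_self]
          rw [← pow_succ']
          congr 1; omega
        · apply prod_congr rfl
          intro i hi
          rw [Function.update_of_ne (ne_of_mem_erase hi)]
  | zero => exact ⟨0, Submodule.zero_mem _, fun z => by simp⟩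
  | add F G _ _ ihF ihG =>
    obtain ⟨H1, h1, e1⟩ := ihF
    obtain ⟨H2, h2, e2⟩ := ihG
    refine ⟨H1 + H2, Submodule.add_mem _ h1 h2, fun z => ?_⟩
    simp only [Pi.add_apply]
    rw [e1 z, e2 z]; ring
  | smul c F _ ih =>
    obtain ⟨H1, h1, e1⟩ := ih
    refine ⟨c • H1, Submodule.smul_mem _ _ h1, fun z => ?_⟩
    simp only [Pi.smul_apply, smul_eq_mul]
    rw [e1 z]; ring

theorem mon_div {N : ℕ} {d : ℕ} {G : (ℕ → ℂ) → ℂ} (hG : G ∈ Mon N (fun _ => d))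
    (hv : ∀ m < N, ∀ z : ℕ → ℂ, z m = 0 → G z = 0) :
    ∃ H ∈ Mon N (fun _ => d - 1), ∀ z, G z = (∏ i ∈ range N, z i) * H z := by
  have key : ∀ m ≤ N, ∃ H ∈ Mon N (fun i => if i < m then d - 1 else d),
      ∀ z, G z = (∏ i ∈ range m, z i) * H z := by
    intro m
    induction m with
    | zero => intro _; exact ⟨G, by simpa using hG, fun z => by simp⟩
    | succ m ih =>
      intro hm
      obtain ⟨H, hH, e⟩ := ih (by omega)
      obtain ⟨H1, hH1, e1⟩ := mon_div_aux hH (m := m) (by omega)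
      refine ⟨H1, mon_mono (fun i => ?_) hH1, fun z => ?_⟩
      · by_cases h : i = m
        · subst h; simp
        · rw [Function.update_of_ne h]
          split_ifs <;> omega
      · have h0 : H (Function.update z m 0) = 0 := by
          have c1 : Continuous fun z : ℕ → ℂ => H (Function.update z m 0) :=
            (mon_cont hH).comp (continuous_id.update m continuous_const)
          refine gen_dense (N := N) c1 (continuous_const (y := (0 : ℂ))) (fun z hz => ?_) z
          have := e (Function.update z m 0)
          rw [hv m (by omega) _ (by simp)] at this
          rcases mul_eq_zero.mp this.symm with h | h
          · exfalso
            obtain ⟨i, hi, hi'⟩ := prod_eq_zero_iff.mp h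
            have := mem_range.mp hi
            rw [Function.update_of_ne (by omega)] at hi'
            exact hz.1 i (by omega) hi'
          · exact h
        rw [e z, e1 z, h0, prod_range_succ]; ring
  obtain ⟨H, hH, e⟩ := key N le_rfl
  exact ⟨H, mon_mono' (fun i hi => by simp [hi]) hH, e⟩

theorem ins_cont (j : ℕ) (t : ℂ) : Continuous (ins j t) := by
  refine continuous_pi fun i => ?_
  unfold ins
  split_ifs <;> fun_prop

theorem ins_eval_mon {n j : ℕ} {d : ℕ} {F : (ℕ → ℂ) → ℂ} (hj : j + 1 < 2 * n + 2)
    (hF : F ∈ Mon (2 * n + 2) (fun _ => d)) :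
    (fun y => F (ins j 0 y)) ∈ Mon (2 * n) (fun _ => d) := by
  refine mon_subst hF _ (fun i k => if (i < j ∧ i = k) ∨ (j + 1 < i ∧ i = k + 2) then 1 else 0) ?_ ?_
  · intro i hi
    unfold ins
    by_cases h1 : i < j
    · simp only [h1, if_true]
      exact mon_coord (by omega) (by simp)
    · by_cases h2 : i = j
      · simp only [h2, lt_irrefl, if_true, if_false]
        exact mon_const _ _ _
      · by_cases h3 : i = j + 1
        · simp only [h1, h2, h3, if_true, if_false]
          simp
          exact mon_const _ _ 0
        · simp only [h1, h2, h3, if_false]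
          exact mon_coord (by omega) (by rw [if_pos (by omega)])
  · intro k hk
    calc ∑ i ∈ range (2 * n + 2), d * (if (i < j ∧ i = k) ∨ (j + 1 < i ∧ i = k + 2) then 1 else 0)
        = ∑ i ∈ range (2 * n + 2), (if i = (if k < j then k else k + 2) then d else 0) := by
          apply sum_congr rfl
          intro i hi
          have : ((i < j ∧ i = k) ∨ (j + 1 < i ∧ i = k + 2)) ↔ i = (if k < j then k else k + 2) := by
            split_ifs <;> omega
          by_cases h : i = (if k < j then k else k + 2)
          · rw [if_pos (this.mpr h), if_pos h, mul_one]
          · rw [if_neg (fun h' => h (this.mp h')), if_neg h, mul_zero]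
      _ ≤ d := by
          rw [sum_ite_eq']
          split_ifs <;> omega


theorem cof_fin (s : Set ℂ) (hs : s.Finite) : ∃ t, t ∉ s := by
  by_contra h
  push Not at h
  exact Set.infinite_univ (hs.subset fun x _ => h x)

theorem ins_inj {n j : ℕ} (hj : j + 1 < 2 * n + 2) {y : ℕ → ℂ} (hy : InjPt (2 * n) y) {t : ℂ}
    (ht : t ≠ 0) (h1 : ∀ l < 2 * n, y l ≠ t) (h2 : ∀ l < 2 * n, y l ≠ q ^ 2 * t) :
    InjPt (2 * n + 2) (ins j t y) := by
  have h3 : t ≠ q ^ 2 * t := by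
    intro h
    have : (q ^ 2 - 1) * t = 0 := by linear_combination -h
    rcases mul_eq_zero.mp this with h | h
    · exact q_sq_ne_one (sub_eq_zero.mp h)
    · exact ht h
  intro a ha b hb hab
  unfold ins
  split_ifs
  all_goals first
    | omega
    | (apply hy <;> omega)
    | (apply h1; omega)
    | (apply h2; omega)
    | (apply Ne.symm; apply h1; omega)
    | (apply Ne.symm; apply h2; omega)
    | exact h3
    | exact h3.symm

theorem restrict_aux {n j : ℕ} (hj : j + 1 < 2 * n + 2) {F : (ℕ → ℂ) → ℂ} (hF : F ∈ W (n + 1))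
    (t : ℂ) (y : ℕ → ℂ) :
    F (ins j t y) * ∏ l ∈ range (2 * n), y l =
      (∏ l ∈ range (2 * n), (y l - q * t)) * F (ins j 0 y) := by
  have hFm : F ∈ Mon (2 * n + 2) (fun _ => n) := hF.1
  have hc := mon_cont hFm
  refine gen_dense (N := 2 * n) (F := fun y => F (ins j t y) * ∏ l ∈ range (2 * n), y l)
    (G := fun y => (∏ l ∈ range (2 * n), (y l - q * t)) * F (ins j 0 y)) ?_ ?_ ?_ y
  · exact (hc.comp (ins_cont j t)).mul (by fun_prop)
  · exact Continuous.mul (by fun_prop) (hc.comp (ins_cont j 0))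
  clear y
  intro y hy
  obtain ⟨p, hp1, hp2⟩ := mon_poly hFm
    (fun i => if i < j then Polynomial.C (y i) else if i = j then Polynomial.X else
      if i = j + 1 then Polynomial.C (q ^ 2) * Polynomial.X else Polynomial.C (y (i - 2)))
    (fun i => if i = j ∨ i = j + 1 then 1 else 0) (by
      intro i hi
      split_ifs
      all_goals first
        | omega
        | (simp; done)
        | (exact (Polynomial.natDegree_C_mul_le _ _).trans (by simp)))
  have hp3 : ∀ t, p.eval t = F (ins j t y) := by
    intro t
    rw [hp2]
    congr 1
    funext i
    unfold ins
    split_ifs <;> simp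
  have hdeg : p.natDegree ≤ 2 * n := by
    refine hp1.trans ?_
    rw [← mul_sum]
    have : ∑ i ∈ range (2 * n + 2), (if i = j ∨ i = j + 1 then 1 else 0) ≤ 2 := by
      rw [← sum_filter, sum_const, smul_eq_mul, mul_one]
      refine (card_le_card (t := {j, j + 1}) ?_).trans (card_le_two)
      intro i hi
      simpa using (mem_filter.mp hi).2
    nlinarith
  have h0 : p * Polynomial.C (∏ l ∈ range (2 * n), y l) -
      (∏ l ∈ range (2 * n), (Polynomial.C (y l) - Polynomial.C q * Polynomial.X)) *
        Polynomial.C (p.eval 0) = 0 := by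
    apply poly_zero (insert 0 ((range (2 * n)).image fun l => q ^ 2 * y l))
    · intro x hx
      rw [mem_insert] at hx
      simp only [Polynomial.eval_sub, Polynomial.eval_mul, Polynomial.eval_C,
        Polynomial.eval_prod, Polynomial.eval_X]
      rcases hx with rfl | hx
      · simp; ring
      · obtain ⟨l, hl, rfl⟩ := mem_image.mp hx
        have hl' := mem_range.mp hl
        rw [prod_eq_zero (i := l) hl (f := fun l' => y l' - q * (q ^ 2 * y l))
          (by linear_combination -(y l) * q_cube)]
        rw [zero_mul, sub_zero, hp3]
        have hne : y l ≠ 0 := hy.1 l hl'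
        have hinj : InjPt (2 * n + 2) (ins j (q ^ 2 * y l) y) := by
          apply ins_inj hj
          · intro a ha b hb hab h
            exact hy.2 a ha b hb hab (by rw [h])
          · exact mul_ne_zero (pow_ne_zero _ q_ne_zero) hne
          · intro a ha h
            by_cases hal : a = l
            · subst hal
              have : (q ^ 2 - 1) * y a = 0 := by linear_combination -h
              rcases mul_eq_zero.mp this with h | h
              · exact q_sq_ne_one (sub_eq_zero.mp h)
              · exact hne h
            · apply hy.2 a ha l hl' hal
              rw [h]
              linear_combination (q ^ 3 + 1) * y l ^ 3 * q_cube
          · intro a ha h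
            by_cases hal : a = l
            · subst hal
              have : (q - 1) * y a = 0 := by linear_combination -h - q * y a * q_cube
              rcases mul_eq_zero.mp this with h | h
              · exact q_ne_one (sub_eq_zero.mp h)
              · exact hne h
            · apply hy.2 a ha l hl' hal
              rw [h]
              linear_combination (q ^ 9 + q ^ 6 + q ^ 3 + 1) * y l ^ 3 * q_cube
        by_cases hlj : l < j
        · rw [hF.2 l j (j + 1) hlj (by omega) (by omega) _ hinj, zero_mul]
          · unfold ins; simp [hlj]
          · unfold ins; simp
        · rw [hF.2 j (j + 1) (l + 2) (by omega) (by omega) (by omega) _ hinj, zero_mul]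
          · unfold ins; simp
          · unfold ins
            rw [if_neg (by omega), if_neg (by omega), if_neg (by omega), if_neg (by omega),
              if_neg (by omega), if_pos rfl]
            simp only [Nat.add_sub_cancel]
            linear_combination -(q ^ 3 + 1) * y l * q_cube
    · rw [card_insert_of_notMem, card_image_of_injOn, card_range]
      · apply Nat.lt_succ_of_le
        refine (Polynomial.natDegree_sub_le _ _).trans (max_le ?_ ?_)
        · exact (Polynomial.natDegree_mul_C_le _ _).trans hdeg
        · refine (Polynomial.natDegree_mul_C_le _ _).trans ?_
          refine (Polynomial.natDegree_prod_le _ _).trans ?_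
          refine (sum_le_card_nsmul _ _ 1 ?_).trans (by simp)
          intro l _
          refine (Polynomial.natDegree_sub_le _ _).trans (max_le (by simp) ?_)
          exact (Polynomial.natDegree_C_mul_le _ _).trans (by simp)
      · intro a ha b hb hab
        by_contra hne
        have hab' : y a = y b := mul_left_cancel₀ (pow_ne_zero 2 q_ne_zero) hab
        exact hy.2 a (by simpa using ha) b (by simpa using hb) hne (by rw [hab'])
      · intro h
        obtain ⟨l, hl, h⟩ := mem_image.mp h
        exact mul_ne_zero (pow_ne_zero 2 q_ne_zero) (hy.1 l (mem_range.mp hl)) h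
  have := congrArg (Polynomial.eval t) h0
  simp only [Polynomial.eval_sub, Polynomial.eval_mul, Polynomial.eval_C,
        Polynomial.eval_prod, Polynomial.eval_X, Polynomial.eval_zero, hp3] at this
  linear_combination this

theorem restrict {n j : ℕ} (hj : j + 1 < 2 * n + 2) {F : (ℕ → ℂ) → ℂ} (hF : F ∈ W (n + 1)) :
    ∃ H ∈ W n, ∀ t y, F (ins j t y) = (∏ l ∈ range (2 * n), (y l - q * t)) * H y := by
  have hFm : F ∈ Mon (2 * n + 2) (fun _ => n) := hF.1
  have hc := mon_cont hFm
  have hfin : ∀ y : ℕ → ℂ, ∀ c : ℂ, c ≠ 0 → {t : ℂ | ∃ l < 2 * n, y l = c * t}.Finite := by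
    intro y c hc
    refine ((range (2 * n)).image fun l => c⁻¹ * y l).finite_toSet.subset ?_
    rintro t ⟨l, hl, h⟩
    simp only [coe_image, Set.mem_image, mem_coe, mem_range]
    exact ⟨l, hl, by rw [h]; field_simp⟩
  obtain ⟨H, hH, e⟩ := mon_div (ins_eval_mon hj hFm) (by
    intro m hm y hy0
    obtain ⟨t, ht⟩ := cof_fin _ (hfin y q q_ne_zero)
    have := restrict_aux hj hF t y
    rw [prod_eq_zero (mem_range.mpr hm) hy0, mul_zero] at this
    rcases mul_eq_zero.mp this.symm with h | h
    · obtain ⟨l, hl, h⟩ := prod_eq_zero_iff.mp h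
      exact absurd ⟨l, mem_range.mp hl, sub_eq_zero.mp h⟩ ht
    · exact h)
  have main : ∀ t y, F (ins j t y) = (∏ l ∈ range (2 * n), (y l - q * t)) * H y := by
    intro t y
    refine gen_dense (N := 2 * n) (F := fun y => F (ins j t y))
      (G := fun y => (∏ l ∈ range (2 * n), (y l - q * t)) * H y) ?_ ?_ ?_ y
    · exact (hc.comp (ins_cont j t))
    · exact Continuous.mul (by fun_prop) (mon_cont hH)
    · intro y hy
      have h1 := restrict_aux hj hF t y
      have h2 := e y
      rw [h2] at h1
      have : ∏ l ∈ range (2 * n), y l ≠ 0 := prod_ne_zero_iff.mpr fun l hl => hy.1 l (mem_range.mp hl)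
      apply mul_right_cancel₀ this
      linear_combination h1
  refine ⟨H, ⟨hH, ?_⟩, main⟩
  intro a b c hab hbc hcn y hy e1 e2
  obtain ⟨t, ht⟩ := cof_fin _ ((((hfin y 1 one_ne_zero).union
    (hfin y (q ^ 2) (pow_ne_zero 2 q_ne_zero))).union (hfin y q q_ne_zero)).union
    (Set.finite_singleton 0))
  simp only [Set.mem_union, not_or, Set.mem_singleton_iff] at ht
  obtain ⟨⟨⟨t1, t2⟩, t3⟩, t4⟩ := ht
  have hinj := ins_inj hj hy t4 (fun l hl h => t1 ⟨l, hl, by rw [h, one_mul]⟩)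
    (fun l hl h => t2 ⟨l, hl, h⟩)
  have h1 := main t y
  let s : ℕ → ℕ := fun i => if i < j then i else i + 2
  have hs : ∀ i, ins j t y (s i) = y i := by
    intro i
    simp only [s, ins]
    split_ifs <;> first | rfl | omega | simp
  have hs1 : ∀ i k, i < k → s i < s k := by
    intro i k h; simp only [s]; split_ifs <;> omega
  rw [hF.2 (s a) (s b) (s c) (hs1 _ _ hab) (hs1 _ _ hbc) (by simp only [s]; split_ifs <;> omega) _
    hinj (by rw [hs, hs, e1]) (by rw [hs, hs, e2])] at h1
  rcases mul_eq_zero.mp h1.symm with h | h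
  · obtain ⟨l, hl, h⟩ := prod_eq_zero_iff.mp h
    exact absurd ⟨l, mem_range.mp hl, sub_eq_zero.mp h⟩ t3
  · exact h

end ACP

namespace ACP
open Finset

def IsNC (N : ℕ) (g : ℕ → ℕ) : Prop :=
  (∀ i < N, g i < N ∧ g (g i) = i ∧ g i ≠ i) ∧
  ∀ a < N, ∀ b < N, a < b → b < g a → a < g b ∧ g b < g a

noncomputable def pt (g : ℕ → ℕ) : ℕ → ℂ := fun l => if l < g l then 1 else q ^ 2

def sh (j i : ℕ) : ℕ := if i < j then i else i + 2
def un (j i : ℕ) : ℕ := if i < j then i else i - 2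

def insg (j : ℕ) (g : ℕ → ℕ) : ℕ → ℕ := fun i =>
  if i = j then j + 1 else if i = j + 1 then j else sh j (g (un j i))

def remg (j : ℕ) (g : ℕ → ℕ) : ℕ → ℕ := fun i => un j (g (sh j i))

theorem pt_insg {j : ℕ} (g : ℕ → ℕ) : pt (insg j g) = ins j 1 (pt g) := by
  funext i
  simp only [pt, insg, ins, sh, un]
  split_ifs <;> first | rfl | omega | simp

theorem insg_nc {N j : ℕ} (hj : j ≤ N) {g : ℕ → ℕ} (hg : IsNC N g) : IsNC (N + 2) (insg j g) := by
  obtain ⟨h1, h2⟩ := hg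
  have hun : ∀ i < N + 2, i ≠ j → i ≠ j + 1 → un j i < N ∧ sh j (un j i) = i := by
    intro i hi h1 h2; unfold un sh; split_ifs <;> omega
  have hsh : ∀ i < N, sh j i < N + 2 ∧ sh j i ≠ j ∧ sh j i ≠ j + 1 ∧ un j (sh j i) = i := by
    intro i hi; unfold un sh; split_ifs <;> omega
  have hm : ∀ a b, sh j a < sh j b ↔ a < b := by
    intro a b; unfold sh; split_ifs <;> omega
  have v1 : insg j g j = j + 1 := by simp [insg]
  have v2 : insg j g (j + 1) = j := by simp [insg]
  have v3 : ∀ i < N, insg j g (sh j i) = sh j (g i) := by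
    intro i hi
    obtain ⟨a, b, c, d⟩ := hsh i hi
    unfold insg; rw [if_neg b, if_neg c, d]
  have cas : ∀ i < N + 2, i = j ∨ i = j + 1 ∨ ∃ k < N, i = sh j k := by
    intro i hi
    by_cases e1 : i = j
    · exact Or.inl e1
    by_cases e2 : i = j + 1
    · exact Or.inr (Or.inl e2)
    exact Or.inr (Or.inr ⟨un j i, (hun i hi e1 e2).1, (hun i hi e1 e2).2.symm⟩)
  constructor
  · intro i hi
    rcases cas i hi with rfl | rfl | ⟨k, hk, rfl⟩
    · rw [v1, v2]; omega
    · rw [v2, v1]; omega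
    · rw [v3 k hk, v3 _ (h1 k hk).1, (h1 k hk).2.1]
      refine ⟨(hsh _ (h1 k hk).1).1, rfl, ?_⟩
      intro h
      have := congrArg (un j) h
      rw [(hsh _ hk).2.2.2, (hsh _ (h1 k hk).1).2.2.2] at this
      exact (h1 k hk).2.2 this
  · intro a ha b hb hab
    rcases cas a ha with rfl | rfl | ⟨k, hk, rfl⟩
    · rw [v1]; omega
    · rw [v2]; omega
    · rw [v3 k hk]
      rcases cas b hb with rfl | rfl | ⟨l, hl, rfl⟩
      · rw [v1]; intro h; have := hsh _ (h1 k hk).1; omega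
      · rw [v2]; intro h; have := hsh _ hk; omega
      · rw [v3 l hl, hm, hm, hm]
        exact h2 k hk l hl ((hm _ _).mp hab)

theorem remg_nc {N j : ℕ} (hj : j ≤ N) {g : ℕ → ℕ} (hg : IsNC (N + 2) g) (hgj : g j = j + 1) :
    IsNC N (remg j g) ∧ ∀ i < N + 2, insg j (remg j g) i = g i := by
  obtain ⟨h1, h2⟩ := hg
  have hgj' : g (j + 1) = j := by rw [← hgj]; exact (h1 j (by omega)).2.1
  have hun : ∀ i < N + 2, i ≠ j → i ≠ j + 1 → un j i < N ∧ sh j (un j i) = i := by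
    intro i hi h1 h2; unfold un sh; split_ifs <;> omega
  have hsh : ∀ i < N, sh j i < N + 2 ∧ sh j i ≠ j ∧ sh j i ≠ j + 1 ∧ un j (sh j i) = i := by
    intro i hi; unfold un sh; split_ifs <;> omega
  have hm : ∀ a b, sh j a < sh j b ↔ a < b := by
    intro a b; unfold sh; split_ifs <;> omega
  have hg1 : ∀ i < N + 2, i ≠ j → i ≠ j + 1 → g i ≠ j ∧ g i ≠ j + 1 := by
    intro i hi e1 e2
    constructor
    · intro h; rw [← (h1 i hi).2.1, h] at e2; exact e2 hgj
    · intro h; rw [← (h1 i hi).2.1, h] at e1; exact e1 hgj'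
  have hg2 : ∀ k < N, remg j g k < N ∧ sh j (remg j g k) = g (sh j k) := by
    intro k hk
    obtain ⟨a, b, c, d⟩ := hsh k hk
    obtain ⟨e, f⟩ := hg1 _ a b c
    exact hun _ (h1 _ a).1 e f
  refine ⟨⟨?_, ?_⟩, ?_⟩
  · intro k hk
    refine ⟨(hg2 k hk).1, ?_, ?_⟩
    · have := hg2 k hk
      unfold remg at this ⊢
      rw [this.2, (h1 _ (hsh k hk).1).2.1, (hsh k hk).2.2.2]
    · intro h
      have := (hg2 k hk).2
      rw [h] at this
      exact (h1 _ (hsh k hk).1).2.2 this.symm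
  · intro a ha b hb hab hb2
    rw [← hm, (hg2 a ha).2] at hb2
    have := h2 _ (hsh a ha).1 _ (hsh b hb).1 ((hm _ _).mpr hab) hb2
    rw [← (hg2 a ha).2, ← (hg2 b hb).2, hm, hm] at this
    exact this
  · intro i hi
    unfold insg
    split_ifs with e1 e2
    · rw [e1, hgj]
    · rw [e2, hgj']
    · obtain ⟨a, b⟩ := hun i hi e1 e2
      rw [(hg2 _ a).2, b]

theorem small_arc {N : ℕ} (hN : 4 ≤ N) {g : ℕ → ℕ} (hg : IsNC N g) :
    ∃ k, 1 ≤ k ∧ k + 1 < N ∧ g k = k + 1 := by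
  obtain ⟨h1, h2⟩ := hg
  have hex : ∃ L, ∃ a, 1 ≤ a ∧ a < N ∧ g a = a + L ∧ 0 < L := by
    obtain ⟨x, hx1, hx2, hx3⟩ : ∃ x, 1 ≤ x ∧ x < N ∧ g x ≠ 0 := by
      by_cases h : g 1 = 0
      · refine ⟨2, by omega, by omega, fun h' => ?_⟩
        have a := (h1 1 (by omega)).2.1
        have b := (h1 2 (by omega)).2.1
        rw [h] at a; rw [h'] at b; omega
      · exact ⟨1, by omega, by omega, h⟩
    have := h1 x hx2
    rcases lt_or_gt_of_ne this.2.2 with h | h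
    · exact ⟨x - g x, g x, by omega, by omega, by omega, by omega⟩
    · exact ⟨g x - x, x, by omega, by omega, by omega, by omega⟩
  classical
  obtain ⟨a, ha1, ha2, ha3, ha4⟩ := Nat.find_spec hex
  have hmin := fun m => Nat.find_min hex (m := m)
  set L := Nat.find hex
  have hga := h1 a ha2
  by_cases hL : L = 1
  · exact ⟨a, ha1, by omega, by omega⟩
  · exfalso
    have h3 := h2 a ha2 (a + 1) (by omega) (by omega) (by omega)
    have h4 := h1 (a + 1) (by omega)
    exact hmin (g (a + 1) - (a + 1)) (by omega) ⟨a + 1, by omega, by omega, by omega, by omega⟩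

noncomputable def swp (g : ℕ → ℕ) : ℕ → ℂ := fun l =>
  if l = 0 then q ^ 2 else if l = g 0 then 1 else pt g l

theorem pt_congr {N : ℕ} {d : ℕ → ℕ} {F : (ℕ → ℂ) → ℂ} (hF : F ∈ Mon N d) {g g' : ℕ → ℕ}
    (h : ∀ i < N, g i = g' i) : F (pt g) = F (pt g') :=
  mon_congr hF fun i hi => by unfold pt; rw [h i hi]

theorem swap_lemma {n : ℕ} {F : (ℕ → ℂ) → ℂ} (hF : F ∈ W n) {g : ℕ → ℕ} (hg : IsNC (2 * n) g) :
    F (pt g) = F (swp g) := by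
  induction n generalizing F g with
  | zero => exact mon_congr hF.1 (fun i hi => by omega)
  | succ n ih =>
    by_cases hn : n = 0
    · subst hn
      exact mon_zero (N := 2) hF.1 _ _
    obtain ⟨k, hk1, hk2, hk3⟩ := small_arc (by omega) hg
    obtain ⟨r1, r2⟩ := remg_nc (N := 2 * n) (by omega) hg hk3
    set g' := remg k g
    obtain ⟨H, hH, e⟩ := restrict (n := n) (j := k) (by omega) hF
    have hFm : F ∈ Mon (2 * n + 2) (fun _ => n) := hF.1
    have a1 : F (pt g) = F (ins k 1 (pt g')) := by
      rw [← pt_insg]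
      exact pt_congr hFm fun i hi => (r2 i hi).symm
    have hg0 : g 0 = sh k (g' 0) := by
      rw [← r2 0 (by omega)]
      unfold insg
      rw [if_neg (by omega), if_neg (by omega)]
      unfold un; rw [if_pos (by omega)]
    have a2 : F (swp g) = F (ins k 1 (swp g')) := by
      apply mon_congr hFm
      intro i hi
      simp only [swp, pt]
      rw [hg0, ← r2 i hi]
      simp only [ins, insg, sh, un, swp, pt]
      split_ifs <;> first | rfl | omega | simp
    rw [a1, a2, e, e, ih hH r1]
    congr 1
    have hg'0 := r1.1 0 (by omega)
    have h0 : 0 ∈ range (2 * n) := mem_range.mpr (by omega)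
    have h1 : g' 0 ∈ (range (2 * n)).erase 0 := mem_erase.mpr ⟨hg'0.2.2, mem_range.mpr hg'0.1⟩
    rw [← mul_prod_erase _ _ h0, ← mul_prod_erase _ _ h1, ← mul_prod_erase (range (2 * n)) _ h0,
      ← mul_prod_erase _ _ h1, ← mul_assoc, ← mul_assoc]
    congr 1
    · have e1 : pt g' 0 = 1 := by unfold pt; rw [if_pos (by omega)]
      have e2 : pt g' (g' 0) = q ^ 2 := by unfold pt; rw [hg'0.2.1, if_neg (by omega)]
      have e3 : swp g' 0 = q ^ 2 := by simp [swp]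
      have e4 : swp g' (g' 0) = 1 := by unfold swp; rw [if_neg hg'0.2.2, if_pos rfl]
      rw [e1, e2, e3, e4, mul_comm]
    · apply prod_congr rfl
      intro i hi
      simp only [mem_erase] at hi
      unfold swp; rw [if_neg hi.2.1, if_neg hi.1]

def pv (N i : ℕ) : ℕ := if i = 0 then N - 1 else i - 1

def urot (N : ℕ) (g : ℕ → ℕ) : ℕ → ℕ := fun i => pv N (g (nx N i))

def rotg (N : ℕ) (g : ℕ → ℕ) : ℕ → ℕ := fun i => nx N (g (pv N i))

theorem pv_nx {N i : ℕ} (h : i < N) : pv N (nx N i) = i := by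
  unfold nx; grind [pv]
theorem nx_pv {N i : ℕ} (h : i < N) : nx N (pv N i) = i := by
  unfold pv; grind [nx]
theorem pv_lt {N i : ℕ} (h : i < N) : pv N i < N := by
  unfold pv; split_ifs <;> omega
theorem nx_lt {N i : ℕ} (h : i < N) : nx N i < N := by
  unfold nx; split_ifs <;> omega

theorem urot_nc {N : ℕ} {g : ℕ → ℕ} (hg : IsNC N g) : IsNC N (urot N g) := by
  obtain ⟨h1, h2⟩ := hg
  constructor
  · intro i hi
    have h := h1 _ (nx_lt hi)
    refine ⟨pv_lt h.1, ?_, ?_⟩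
    · unfold urot; rw [nx_pv h.1, h.2.1, pv_nx hi]
    · intro e
      have := congrArg (nx N) e
      unfold urot at this
      rw [nx_pv h.1] at this
      exact h.2.2 this
  · intro a ha b hb hab hb2
    have ha1 := h1 _ (nx_lt ha)
    have hb1 := h1 _ (nx_lt hb)
    have e1 := h2 _ (nx_lt ha) _ (nx_lt hb)
    have e2 := h2 _ (nx_lt hb) _ (nx_lt ha)
    have e3 := h2 _ hb1.1 _ (nx_lt ha)
    have e4 := h2 _ ha1.1 _ (nx_lt hb)
    have e6 := h2 _ ha1.1 _ hb1.1
    have e7 := h2 _ hb1.1 _ ha1.1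
    have e8 := h2 _ (nx_lt ha) _ hb1.1
    have e9 := h2 _ (nx_lt hb) _ ha1.1
    have e5 : g (nx N a) ≠ g (nx N b) := fun h => by
      have := congrArg g h; rw [ha1.2.1, hb1.2.1] at this
      have := congrArg (pv N) this; rw [pv_nx ha, pv_nx hb] at this; omega
    rw [hb1.2.1] at e3 e7 e8
    rw [ha1.2.1] at e4 e6 e9
    rw [hb1.2.1] at e6
    rw [ha1.2.1] at e7
    unfold urot at hb2 ⊢
    have na : nx N a = if a + 1 = N then 0 else a + 1 := rfl
    have nb : nx N b = if b + 1 = N then 0 else b + 1 := rfl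
    generalize g (nx N a) = ga at *
    generalize g (nx N b) = gb at *
    generalize nx N a = na' at *
    generalize nx N b = nb' at *
    have pa : pv N ga = if ga = 0 then N - 1 else ga - 1 := rfl
    have pb : pv N gb = if gb = 0 then N - 1 else gb - 1 := rfl
    generalize pv N ga = pa' at *
    generalize pv N gb = pb' at *
    split_ifs at na nb pa pb <;> first | omega | grind

theorem rotg_nc {N : ℕ} {g : ℕ → ℕ} (hg : IsNC N g) : IsNC N (rotg N g) := by
  obtain ⟨h1, h2⟩ := hg
  constructor
  · intro i hi
    have h := h1 _ (pv_lt hi)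
    refine ⟨nx_lt h.1, ?_, ?_⟩
    · unfold rotg; rw [pv_nx h.1, h.2.1, nx_pv hi]
    · intro e
      have := congrArg (pv N) e
      unfold rotg at this
      rw [pv_nx h.1] at this
      exact h.2.2 this
  · intro a ha b hb hab hb2
    have ha1 := h1 _ (pv_lt ha)
    have hb1 := h1 _ (pv_lt hb)
    have e1 := h2 _ (pv_lt ha) _ (pv_lt hb)
    have e2 := h2 _ (pv_lt hb) _ (pv_lt ha)
    have e3 := h2 _ hb1.1 _ (pv_lt ha)
    have e4 := h2 _ ha1.1 _ (pv_lt hb)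
    have e6 := h2 _ ha1.1 _ hb1.1
    have e7 := h2 _ hb1.1 _ ha1.1
    have e8 := h2 _ (pv_lt ha) _ hb1.1
    have e9 := h2 _ (pv_lt hb) _ ha1.1
    have e5 : g (pv N a) ≠ g (pv N b) := fun h => by
      have := congrArg g h; rw [ha1.2.1, hb1.2.1] at this
      have := congrArg (nx N) this; rw [nx_pv ha, nx_pv hb] at this; omega
    rw [hb1.2.1] at e3 e7 e8
    rw [ha1.2.1] at e4 e6 e9
    rw [hb1.2.1] at e6
    rw [ha1.2.1] at e7
    unfold rotg at hb2 ⊢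
    have na : pv N a = if a = 0 then N - 1 else a - 1 := rfl
    have nb : pv N b = if b = 0 then N - 1 else b - 1 := rfl
    generalize g (pv N a) = ga at *
    generalize g (pv N b) = gb at *
    generalize pv N a = na' at *
    generalize pv N b = nb' at *
    have pa : nx N ga = if ga + 1 = N then 0 else ga + 1 := rfl
    have pb : nx N gb = if gb + 1 = N then 0 else gb + 1 := rfl
    generalize nx N ga = pa' at *
    generalize nx N gb = pb' at *
    split_ifs at na nb pa pb <;> first | omega | grind

theorem rot_cov {n : ℕ} {F : (ℕ → ℂ) → ℂ} (hF : F ∈ W n) {g : ℕ → ℕ} (hg : IsNC (2 * n) g) :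
    F (rotz (2 * n) (pt (urot (2 * n) g))) = F (pt g) := by
  rw [swap_lemma hF hg]
  apply mon_congr hF.1
  intro i hi
  have h0 := hg.1 0 (by omega)
  have hi' := hg.1 i hi
  have hu : urot (2 * n) g (pv (2 * n) i) = pv (2 * n) (g i) := by
    unfold urot; rw [nx_pv hi]
  have e5 : g 0 = i ↔ g i = 0 := by
    constructor
    · rintro rfl; exact h0.2.1
    · intro h; rw [← h]; exact hi'.2.1
  have : rotz (2 * n) (pt (urot (2 * n) g)) i = pt (urot (2 * n) g) (pv (2 * n) i) := by
    unfold rotz pv; split_ifs <;> rfl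
  rw [this]
  unfold swp pt
  rw [hu]
  by_cases hi0 : i = 0
  · subst hi0
    rw [if_pos rfl, if_neg]; unfold pv; split_ifs <;> omega
  · rw [if_neg hi0]
    by_cases h : i = g 0
    · rw [if_pos h, if_pos]; rw [e5.mp h.symm]; unfold pv; split_ifs <;> omega
    · rw [if_neg h]
      have : g i ≠ 0 := fun h' => h (e5.mpr h').symm
      congr 1
      unfold pv; rw [if_neg hi0, if_neg this]
      exact propext ⟨fun h => by omega, fun h => by omega⟩

end ACP

namespace ACP
open Finset

theorem nc_congr {N : ℕ} {g h : ℕ → ℕ} (hg : IsNC N g) (e : ∀ i < N, g i = h i) : IsNC N h := by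
  constructor
  · intro i hi
    have := hg.1 i hi
    rw [← e i hi, ← e _ this.1]
    exact this
  · intro a ha b hb
    rw [← e a ha, ← e b hb]
    exact hg.2 a ha b hb

def eG (N j : ℕ) (g : ℕ → ℕ) : ℕ → ℕ := fun i =>
  if g j = nx N j then g i else if i = j then nx N j else if i = nx N j then j
  else if i = g j then g (nx N j) else if i = g (nx N j) then g j else g i

theorem pv_inj {N a b : ℕ} (ha : a < N) (hb : b < N) : pv N a = pv N b ↔ a = b :=
  ⟨fun h => by rw [← nx_pv ha, h, nx_pv hb], fun h => by rw [h]⟩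

theorem eG_rot {N j : ℕ} (hj : j < N) {g : ℕ → ℕ} (hg : IsNC N g) (i : ℕ) (hi : i < N) :
    eG N (pv N j) (urot N g) i = urot N (eG N j g) i := by
  obtain ⟨k, hk, rfl⟩ : ∃ k < N, i = pv N k := ⟨nx N i, nx_lt hi, (pv_nx hi).symm⟩
  have hgj := (hg.1 j hj).1
  have hnj := nx_lt hj
  have hgn := (hg.1 _ hnj).1
  simp only [eG, urot, nx_pv hk, nx_pv hj]
  have e1 : j = pv N (nx N j) := (pv_nx hj).symm
  have c1 : (pv N (g j) = j) ↔ g j = nx N j := by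
    conv_lhs => rw [e1]
    rw [pv_inj _ hnj]
    · rw [← e1]
    · rw [← e1]; exact hgj
  have c2 : (pv N k = j) ↔ k = nx N j := by
    conv_lhs => rw [e1]
    rw [pv_inj hk hnj]
  simp only [c1, c2, pv_inj hk hgj, pv_inj hk hgn, pv_inj hk hj]
  split_ifs <;> first | rfl | exact e1

theorem e_eval {n : ℕ} {j : ℕ} (hj : j < 2 * (n + 1)) {g : ℕ → ℕ} (hg : IsNC (2 * (n + 1)) g) :
    IsNC (2 * (n + 1)) (eG (2 * (n + 1)) j g) ∧ ∀ F ∈ W (n + 1), ∀ H ∈ W (n + 1),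
      IsE (2 * (n + 1)) j F H → H (pt g) = F (pt (eG (2 * (n + 1)) j g)) := by
  set N := 2 * (n + 1) with hN
  have step : ∀ j < N, ∀ g, IsNC N g →
      (IsNC N (eG N (pv N j) (urot N g)) ∧ ∀ F ∈ W (n + 1), ∀ H ∈ W (n + 1),
      IsE N (pv N j) F H → H (pt (urot N g)) = F (pt (eG N (pv N j) (urot N g)))) →
      (IsNC N (eG N j g) ∧ ∀ F ∈ W (n + 1), ∀ H ∈ W (n + 1),
      IsE N j F H → H (pt g) = F (pt (eG N j g))) := by
    intro j hj g hg ⟨h1, h2⟩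
    have h1' : IsNC N (urot N (eG N j g)) := nc_congr h1 (eG_rot hj hg)
    have hlt : ∀ i < N, eG N j g i < N := by
      intro i hi
      have := (hg.1 j hj).1
      have := (hg.1 _ (nx_lt hj)).1
      have := (hg.1 _ hi).1
      have := nx_lt hj
      unfold eG; split_ifs <;> assumption
    have h3 : IsNC N (eG N j g) := by
      refine nc_congr (rotg_nc h1') ?_
      intro i hi
      unfold rotg urot
      rw [nx_pv hi, nx_pv (hlt i hi)]
    refine ⟨h3, ?_⟩
    intro F hF H hH hE
    have h4 : IsE N (pv N j) (fun z => F (rotz N z)) (fun z => H (rotz N z)) := by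
      apply IsE_rot (pv_lt hj) (by omega) hF.1
      rwa [nx_pv hj]
    have h5 := h2 _ (rot_mem hF) _ (rot_mem hH) h4
    have h6 := rot_cov hH hg
    have h7 := rot_cov hF h3
    rw [← h6, ← h7]
    rw [← hN]
    have h8 : (fun z => F (rotz N z)) (pt (eG N (pv N j) (urot N g))) =
      (fun z => F (rotz N z)) (pt (urot N (eG N j g))) := pt_congr (rot_mem hF).1 (eG_rot hj hg)
    exact h5.trans h8
  by_cases hc : g j = nx N j
  ·
    induction j generalizing g with
    | zero =>
      have e0 : eG N 0 g = g := by funext i; unfold eG; rw [if_pos hc]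
      rw [e0]
      refine ⟨hg, fun F hF H hH hE => ?_⟩
      have hnx : nx N 0 = 1 := by unfold nx; rw [if_neg (by omega)]
      rw [hnx] at hc
      have h := hE (pt g)
      rw [hnx] at h
      have p0 : pt g 0 = 1 := by unfold pt; rw [if_pos (by omega)]
      have p1 : pt g 1 = q ^ 2 := by
        unfold pt; rw [if_neg]; have := (hg.1 0 (by omega)).2.1; rw [hc] at this; omega
      rw [p0, p1] at h
      have h1 : (1 - q ^ 2) * (H (pt g) - F (pt g)) = 0 := by
        rw [h]; linear_combination (-q * (F (pt g) - F (fun i => pt g (Equiv.swap 0 1 i)))) * q_cube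
      rcases mul_eq_zero.mp h1 with h | h
      · exact absurd (sub_eq_zero.mp h).symm q_sq_ne_one
      · exact sub_eq_zero.mp h
    | succ j ih =>
      apply step _ hj _ hg
      have hp : pv N (j + 1) = j := rfl
      rw [hp]
      apply ih (by omega) (urot_nc hg)
      unfold urot
      have e1 : nx N j = j + 1 := by unfold nx; rw [if_neg (by omega)]
      rw [e1, hc, pv_nx hj]
  · obtain ⟨m, hm⟩ : ∃ m, g j = m := ⟨_, rfl⟩
    induction m generalizing g j with
    | zero =>
      have g0 : g 0 = j := by rw [← hm]; exact (hg.1 j hj).2.1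
      have hj0 := (hg.1 j hj).2.2
      have hj1 : j + 1 < N := by
        by_contra h
        apply hc
        rw [hm]; unfold nx; rw [if_pos (by omega)]
      have hnx : nx N j = j + 1 := by unfold nx; rw [if_neg (by omega)]
      obtain ⟨b, hb⟩ : ∃ b, g (j + 1) = b := ⟨_, rfl⟩
      have hb1 := hg.1 _ hj1
      rw [hb] at hb1
      have hb2 : j + 1 < b := by
        rcases lt_or_ge (j + 1) b with h | h
        · exact h
        exfalso
        have h3 := hg.2 0 (by omega) b hb1.1
        rw [g0, hb1.2.1] at h3
        by_cases hb0 : b = 0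
        · rw [hb0] at hb1; omega
        by_cases hbj : b = j
        · rw [hbj] at hb1; omega
        omega
      have hv : ∀ i, eG N j g i = if i = j then j + 1 else if i = j + 1 then j else
          if i = 0 then b else if i = b then 0 else g i := by
        intro i
        unfold eG
        rw [if_neg hc, hnx, hm, hb]
      have ho : ∀ i < N, i ≠ 0 → i ≠ j → i ≠ j + 1 → i ≠ b →
          g i ≠ 0 ∧ g i ≠ j ∧ g i ≠ j + 1 ∧ g i ≠ b := by
        intro i hi a1 a2 a3 a4
        have := (hg.1 i hi).2.1
        refine ⟨?_, ?_, ?_, ?_⟩ <;> intro h <;> rw [h] at this <;> omega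
      refine ⟨⟨?_, ?_⟩, ?_⟩
      · intro i hi
        have h1 := hg.1 i hi
        have h2 := ho i hi
        have vj : eG N j g j = j + 1 := by rw [hv, if_pos rfl]
        have vj1 : eG N j g (j + 1) = j := by rw [hv, if_neg (by omega), if_pos rfl]
        have v0 : eG N j g 0 = b := by rw [hv, if_neg (by omega), if_neg (by omega), if_pos rfl]
        have vb : eG N j g b = 0 := by
          rw [hv, if_neg (by omega), if_neg (by omega), if_neg (by omega), if_pos rfl]
        by_cases e1 : i = j
        · rw [e1, vj, vj1]; omega
        by_cases e2 : i = j + 1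
        · rw [e2, vj1, vj]; omega
        by_cases e3 : i = 0
        · rw [e3, v0, vb]; omega
        by_cases e4 : i = b
        · rw [e4, vb, v0]; omega
        have h2 := h2 e3 e1 e2 e4
        have vo : ∀ i, i ≠ 0 → i ≠ j → i ≠ j + 1 → i ≠ b → eG N j g i = g i := by
          intro i a1 a2 a3 a4
          rw [hv, if_neg a2, if_neg a3, if_neg a1, if_neg a4]
        rw [vo i e3 e1 e2 e4, vo _ h2.1 h2.2.1 h2.2.2.1 h2.2.2.2]
        exact h1
      · intro a ha c hc' hac
        have h1 := hg.1 a ha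
        have h2 := hg.1 c hc'
        have h3 := ho a ha
        have h4 := ho c hc'
        have h5 := hg.2 a ha c hc' hac
        have h6 := hg.2 0 (by omega) a ha
        have h7 := hg.2 0 (by omega) c hc'
        have h8 := hg.2 (j + 1) (by omega) a ha
        have h9 := hg.2 (j + 1) (by omega) c hc'
        have h10 := hg.2 a ha (j + 1) (by omega)
        have h11 := hg.2 a ha b (by omega)
        rw [hb] at h8 h9 h10
        rw [hb1.2.1] at h11
        rw [g0] at h6 h7
        have h12 := hg.2 a ha j (by omega)
        rw [hm] at h12
        rw [hv, hv]
        split_ifs <;> omega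
      · intro F hF H hH hE
        have h := hE (pt g)
        rw [hnx] at h
        have p0 : pt g j = q ^ 2 := by unfold pt; rw [if_neg (by omega)]
        have p1 : pt g (j + 1) = 1 := by unfold pt; rw [if_pos (by omega)]
        rw [p0, p1] at h
        have h2 : F (fun i => pt g (Equiv.swap j (j + 1) i)) = F (pt (eG N j g)) := by
          apply mon_congr hF.1
          intro i hi
          by_cases e1 : i = j
          · subst e1
            rw [Equiv.swap_apply_left, p1]
            unfold pt; rw [hv, if_pos rfl, if_pos (by omega)]
          by_cases e2 : i = j + 1
          · subst e2
            rw [Equiv.swap_apply_right, p0]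
            have := hv (j + 1)
            rw [if_neg e1, if_pos rfl] at this
            unfold pt; rw [this, if_neg (by omega)]
          rw [Equiv.swap_apply_of_ne_of_ne e1 e2]
          unfold pt
          rw [hv, if_neg e1, if_neg e2]
          by_cases e3 : i = 0
          · subst e3; rw [if_pos rfl, if_pos (by omega), if_pos (by omega)]
          · rw [if_neg e3]
            by_cases e4 : i = b
            · subst e4; rw [if_pos rfl, if_neg (by omega), if_neg (by omega)]
            · rw [if_neg e4]
        rw [h2] at h
        have h1 : (1 - q ^ 2) * (H (pt g) - F (pt (eG N j g))) = 0 := by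
          linear_combination -h - (F (pt g) - F (pt (eG N j g))) * q_cube
        rcases mul_eq_zero.mp h1 with h | h
        · exact absurd (sub_eq_zero.mp h).symm q_sq_ne_one
        · exact sub_eq_zero.mp h
    | succ m ih =>
      apply step _ hj _ hg
      apply ih (pv_lt hj) (urot_nc hg)
      · unfold urot
        rw [nx_pv hj]
        intro h
        apply hc
        rw [← nx_pv (hg.1 j hj).1, h]
      · unfold urot; rw [nx_pv hj, hm]; rfl

end ACP

namespace ACP
open Finset

noncomputable def set2 (i d : ℕ) (t : ℂ) (y : ℕ → ℂ) : ℕ → ℂ := fun l =>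
  if l = i then t else if l = i + d then q ^ 2 * t else y l

theorem set2_cont (j d : ℕ) (t : ℂ) : Continuous (set2 j d t) := by
  refine continuous_pi fun i => ?_
  unfold set2
  split_ifs <;> fun_prop

theorem set2_dist {N : ℕ} {n : ℕ} (hN : N = 2 * n + 2) {F : (ℕ → ℂ) → ℂ} (hF : F ∈ W (n + 1))
    {i d : ℕ} (hd : 2 ≤ d) (hid : i + d < N)
    (ih : ∀ d' < d, 1 ≤ d' → ∀ i', i' + d' < N → ∀ z : ℕ → ℂ, z (i' + d') = q ^ 2 * z i' → F z = 0)
    (t : ℂ) (y : ℕ → ℂ) : F (set2 i d t y) = 0 := by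
  subst hN
  have hFm : F ∈ Mon (2 * n + 2) (fun _ => n) := hF.1
  have hc := mon_cont hFm
  refine gen_dense (N := 2 * n + 2) (hc.comp (set2_cont i d t)) (continuous_const (y := (0 : ℂ))) ?_ y
  clear y
  intro y hy
  show F (set2 i d t y) = 0
  obtain ⟨p, hp1, hp2⟩ := mon_poly hFm
    (fun l => if l = i then Polynomial.X else if l = i + d then Polynomial.C (q ^ 2) * Polynomial.X
      else Polynomial.C (y l))
    (fun l => if l = i ∨ l = i + d then 1 else 0) (by
      intro l hi
      split_ifs
      all_goals first
        | omega
        | (simp; done)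
        | (exact (Polynomial.natDegree_C_mul_le _ _).trans (by simp)))
  have hp3 : ∀ t, p.eval t = F (set2 i d t y) := by
    intro t
    rw [hp2]
    congr 1
    funext i
    unfold set2
    split_ifs <;> simp
  have hdeg : p.natDegree ≤ 2 * n := by
    refine hp1.trans ?_
    rw [← mul_sum]
    have : ∑ l ∈ range (2 * n + 2), (if l = i ∨ l = i + d then 1 else 0) ≤ 2 := by
      rw [← sum_filter, sum_const, smul_eq_mul, mul_one]
      refine (card_le_card (t := {i, i + d}) ?_).trans (card_le_two)
      intro i hi
      simpa using (mem_filter.mp hi).2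
    nlinarith
  have h0 : p = 0 := by
    let S : Finset (ℕ × ℕ) :=
      ((range (2 * n + 2)).filter fun l => l ≠ i ∧ l ≠ i + d).image (fun l => if i < l ∧ l < i + d then (l, 1) else (l, 2))
        ∪ ((range (2 * n + 2)).filter fun l => i < l ∧ l < i + d).image (fun l => (l, 0))
    have hS : ∀ x ∈ S, x.1 < 2 * n + 2 ∧ x.1 ≠ i ∧ x.1 ≠ i + d ∧
        ((i < x.1 ∧ x.1 < i + d ∧ (x.2 = 0 ∨ x.2 = 1)) ∨ ((x.1 < i ∨ i + d < x.1) ∧ x.2 = 2)) := by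
      intro x hx
      simp only [S, mem_union, mem_image, mem_filter, mem_range] at hx
      rcases hx with ⟨l, hl, rfl⟩ | ⟨l, hl, rfl⟩
      · split_ifs with h
        · simp; omega
        · simp; omega
      · simp; omega
    apply poly_zero (S.image fun x => q ^ x.2 * y x.1)
    · intro x hx
      obtain ⟨⟨l, e⟩, hle, rfl⟩ := mem_image.mp hx
      have := hS _ hle
      simp only at this ⊢
      rw [hp3]
      obtain ⟨hl, hli, hlid, h | h⟩ := this
      · rcases h with ⟨h1, h2, rfl | rfl⟩
        · have := ih (i + d - l) (by omega) (by omega) l (by omega) (set2 i d (q ^ 0 * y l) y)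
          rw [show l + (i + d - l) = i + d by omega] at this
          apply this
          unfold set2
          rw [if_neg (by omega), if_pos rfl, if_neg hli, if_neg hlid]; simp
        · have := ih (l - i) (by omega) (by omega) i (by omega) (set2 i d (q ^ 1 * y l) y)
          rw [show i + (l - i) = l by omega] at this
          apply this
          unfold set2
          rw [if_pos rfl, if_neg hli, if_neg hlid]
          linear_combination -(y l) * q_cube
      · obtain ⟨h, rfl⟩ := h
        have hyl := hy.1 l hl
        have hz1 : ∀ a < 2 * n + 2, a ≠ l → y a ≠ q ^ 2 * y l := by
          intro a ha hal h
          apply hy.2 a ha l hl hal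
          rw [h]; linear_combination (q ^ 3 + 1) * y l ^ 3 * q_cube
        have hz2 : ∀ a < 2 * n + 2, a ≠ l → y a ≠ q ^ 2 * (q ^ 2 * y l) := by
          intro a ha hal h
          apply hy.2 a ha l hl hal
          rw [h]; linear_combination (q ^ 9 + q ^ 6 + q ^ 3 + 1) * y l ^ 3 * q_cube
        have hz3 : y l ≠ q ^ 2 * y l := by
          intro h
          have : (q ^ 2 - 1) * y l = 0 := by linear_combination -h
          rcases mul_eq_zero.mp this with h | h
          · exact q_sq_ne_one (sub_eq_zero.mp h)
          · exact hyl h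
        have hz4 : y l ≠ q ^ 2 * (q ^ 2 * y l) := by
          intro h
          have : (q - 1) * y l = 0 := by linear_combination -h - q * y l * q_cube
          rcases mul_eq_zero.mp this with h | h
          · exact q_ne_one (sub_eq_zero.mp h)
          · exact hyl h
        have hz5 : q ^ 2 * y l ≠ q ^ 2 * (q ^ 2 * y l) := by
          intro h
          exact hz3 (mul_left_cancel₀ (pow_ne_zero 2 q_ne_zero) h)
        have hz1' : ∀ a < 2 * n + 2, y a ≠ q ^ 2 * y l := by
          intro a ha
          by_cases hal : a = l
          · rw [hal]; exact hz3
          · exact hz1 a ha hal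
        have hz2' : ∀ a < 2 * n + 2, y a ≠ q ^ 2 * (q ^ 2 * y l) := by
          intro a ha
          by_cases hal : a = l
          · rw [hal]; exact hz4
          · exact hz2 a ha hal
        have hinj : InjPt (2 * n + 2) (set2 i d (q ^ 2 * y l) y) := by
          intro a ha b hb hab
          unfold set2
          split_ifs
          all_goals first
            | omega
            | exact hz5
            | exact hz5.symm
            | exact hz1' _ ‹_›
            | exact hz2' _ ‹_›
            | exact (hz1' _ ‹_›).symm
            | exact (hz2' _ ‹_›).symm
            | (intro h; exact hy.2 a ha b hb hab (by rw [h]))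
        have v1 : set2 i d (q ^ 2 * y l) y i = q ^ 2 * y l := by simp [set2]
        have v2 : set2 i d (q ^ 2 * y l) y (i + d) = q ^ 2 * (q ^ 2 * y l) := by
          unfold set2; rw [if_neg (by omega), if_pos rfl]
        have v3 : set2 i d (q ^ 2 * y l) y l = y l := by
          unfold set2; rw [if_neg hli, if_neg hlid]
        rcases h with h | h
        · exact hF.2 l i (i + d) h (by omega) (by omega) _ hinj (by rw [v1, v3]) (by rw [v2, v1])
        · refine hF.2 i (i + d) l (by omega) h (by omega) _ hinj (by rw [v2, v1]) ?_
          rw [v3, v2]; linear_combination -(q ^ 3 + 1) * y l * q_cube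
    · rw [card_image_of_injOn]
      · rw [card_union_of_disjoint, card_image_of_injOn, card_image_of_injOn]
        · have c1 : ((range (2 * n + 2)).filter fun l => l ≠ i ∧ l ≠ i + d) =
              ((range (2 * n + 2)).erase i).erase (i + d) := by
            ext l; simp only [mem_filter, mem_erase, mem_range]; omega
          have c2 : ((range (2 * n + 2)).filter fun l => i < l ∧ l < i + d) = Ioo i (i + d) := by
            ext l; simp only [mem_filter, mem_range, mem_Ioo]; omega
          rw [c1, c2, Nat.card_Ioo, card_erase_of_mem, card_erase_of_mem, card_range]
          · omega
          · simp; omega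
          · simp; omega
        · intro a _ b _ h; exact (Prod.mk.inj h).1
        · intro a _ b _ h
          dsimp only at h
          split_ifs at h <;> exact (Prod.mk.inj h).1
        · rw [disjoint_left]
          intro x hx hx'
          obtain ⟨a, ha, rfl⟩ := mem_image.mp hx
          obtain ⟨b, hb, h⟩ := mem_image.mp hx'
          split_ifs at h <;> simp at h
      · rintro ⟨a, e⟩ ha ⟨b, f⟩ hb h
        have ha' := hS _ ha
        have hb' := hS _ hb
        simp only at h ha' hb'
        have hab : a = b := by
          by_contra hab
          apply hy.2 a ha'.1 b hb'.1 hab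
          have hq : ∀ e : ℕ, (q ^ e) ^ 3 = 1 := fun e => by
            rw [← pow_mul, mul_comm, pow_mul, q_cube, one_pow]
          have := congrArg (· ^ 3) h
          simp only [mul_pow, hq, one_mul] at this
          exact this
        subst hab
        have hef : q ^ e = q ^ f := mul_right_cancel₀ (hy.1 a ha'.1) h
        have : e = f := by
          apply q_prim.pow_inj _ _ hef <;> omega
        rw [this]
  rw [← hp3, h0, Polynomial.eval_zero]

theorem inj_W {n : ℕ} {F : (ℕ → ℂ) → ℂ} (hF : F ∈ W n)
    (h : ∀ g, IsNC (2 * n) g → F (pt g) = 0) : F = 0 := by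
  induction n generalizing F with
  | zero =>
    funext z
    rw [mon_congr hF.1 (z := z) (w := pt id) (fun i hi => by omega)]
    exact h _ ⟨fun i hi => by omega, fun i hi => by omega⟩
  | succ n ih =>
    have hFm : F ∈ Mon (2 * n + 2) (fun _ => n) := hF.1
    have h1 : ∀ j, j + 1 < 2 * n + 2 → ∀ z : ℕ → ℂ, z (j + 1) = q ^ 2 * z j → F z = 0 := by
      intro j hj z hz
      obtain ⟨H, hH, e⟩ := restrict hj hF
      have hH0 : H = 0 := by
        apply ih hH
        intro g hg
        have h2 := h _ (insg_nc (N := 2 * n) (j := j) (by omega) hg)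
        rw [pt_insg, e] at h2
        rcases mul_eq_zero.mp h2 with h | h
        · exfalso
          obtain ⟨l, _, hl⟩ := prod_eq_zero_iff.mp h
          unfold pt at hl
          split_ifs at hl
          · exact q_ne_one (by linear_combination -hl)
          · exact q_sq_ne (by linear_combination hl)
        · exact h
      have hz' : z = ins j (z j) (fun i => if i < j then z i else z (i + 2)) := by
        funext i
        unfold ins
        split_ifs with a b c
        · simp [a]
        · rw [b]
        · rw [c, hz]
        · beta_reduce
          rw [if_neg (by omega)]; congr 1; omega
      rw [hz', e, hH0]; simp
    have h2 : ∀ d, 1 ≤ d → ∀ i, i + d < 2 * n + 2 → ∀ z : ℕ → ℂ, z (i + d) = q ^ 2 * z i → F z = 0 := by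
      intro d
      induction d using Nat.strong_induction_on with
      | _ d ihd =>
        intro hd i hid z hz
        by_cases hd1 : d = 1
        · subst hd1; exact h1 i hid z hz
        · have := set2_dist rfl hF (i := i) (d := d) (by omega) hid
            (fun d' a b i' c => ihd d' a b i' c) (z i) z
          rw [← this]
          congr 1
          funext l
          unfold set2
          split_ifs with a b
          · rw [a]
          · rw [b, hz]
          · rfl
    funext z
    refine gen_dense (N := 2 * n + 2) (mon_cont hFm) (continuous_const (y := (0 : ℂ))) ?_ z
    clear z
    intro y hy
    obtain ⟨p, hp1, hp2⟩ := mon_poly hFm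
      (fun l => if l = 0 then Polynomial.X else Polynomial.C (y l))
      (fun l => if l = 0 then 1 else 0) (by
        intro l hi
        split_ifs <;> simp)
    have hp0 : p = 0 := by
      apply poly_zero ((Ico 1 (2 * n + 2)).image fun l => q * y l)
      · intro x hx
        obtain ⟨l, hl, rfl⟩ := mem_image.mp hx
        rw [mem_Ico] at hl
        rw [hp2]
        apply h2 l hl.1 0 (by omega)
        rw [zero_add, if_neg (by omega), if_pos rfl]
        simp
        linear_combination -(y l) * q_cube
      · rw [card_image_of_injOn, Nat.card_Ico]
        · refine lt_of_le_of_lt hp1 ?_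
          rw [← mul_sum, sum_ite_eq', if_pos (by simp)]
          omega
        · intro a ha b hb hab
          by_contra hne
          have ha := mem_Ico.mp ha
          have hb := mem_Ico.mp hb
          have hab' : y a = y b := mul_left_cancel₀ q_ne_zero hab
          exact hy.2 a ha.2 b hb.2 hne (by rw [hab'])
    have := hp2 (y 0)
    rw [hp0, Polynomial.eval_zero] at this
    rw [this]
    congr 1
    funext l
    split_ifs with a
    · rw [a]; simp
    · simp

end ACP

namespace ACP
open Finset

def toG {n : ℕ} (π : NCM n) : ℕ → ℕ := fun i => if h : i < 2 * n then (π.f ⟨i, h⟩ : ℕ) else i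

theorem toG_val {n : ℕ} (π : NCM n) (k : Fin (2 * n)) : toG π k = π.f k := by
  unfold toG; rw [dif_pos k.2]

theorem toG_nc {n : ℕ} (π : NCM n) : IsNC (2 * n) (toG π) := by
  have hv : ∀ i (h : i < 2 * n), toG π i = π.f ⟨i, h⟩ := fun i h => toG_val π ⟨i, h⟩
  have h1 : ∀ i < 2 * n, toG π i < 2 * n ∧ toG π (toG π i) = i ∧ toG π i ≠ i := by
    intro i hi
    rw [hv i hi]
    refine ⟨(π.f ⟨i, hi⟩).2, ?_, ?_⟩
    · rw [toG_val, π.invol]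
    · intro h; exact π.nofix ⟨i, hi⟩ (Fin.ext h)
  refine ⟨h1, ?_⟩
  intro a ha b hb hab hb2
  have hga := h1 a ha
  have hgb := h1 b hb
  have nc : ∀ a b c d, ∀ (ha : a < 2 * n) (hb : b < 2 * n), c < 2 * n → d < 2 * n → a < b → b < c → c < d →
      toG π a = c → toG π b = d → False := by
    intro a b c d ha hb hc hd h1 h2 h3 h4 h5
    rw [hv a ha] at h4
    rw [hv b hb] at h5
    exact π.noncross ⟨a, ha⟩ ⟨b, hb⟩ ⟨c, hc⟩ ⟨d, hd⟩ h1 h2 h3 (Fin.ext h4) (Fin.ext h5)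
  constructor
  · by_contra h
    have h2 : toG π b ≠ a := by
      intro h'; rw [h'] at hgb; omega
    exact nc (toG π b) a b (toG π a) hgb.1 ha hb hga.1 (by omega) hab hb2 hgb.2.1 rfl
  · by_contra h
    have h2 : toG π b ≠ toG π a := by
      intro h'
      have := congrArg (toG π) h'
      rw [hgb.2.1, hga.2.1] at this; omega
    exact nc a b (toG π a) (toG π b) ha hb hga.1 hgb.1 hab hb2 (by omega) rfl rfl

theorem ofG {n : ℕ} {g : ℕ → ℕ} (hg : IsNC (2 * n) g) :
    ∃ π : NCM n, ∀ k : Fin (2 * n), (π.f k : ℕ) = g k := by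
  refine ⟨⟨fun k => ⟨g k, (hg.1 k k.2).1⟩, ?_, ?_, ?_⟩, fun k => rfl⟩
  · intro k; exact Fin.ext (hg.1 k k.2).2.1
  · intro k h; exact (hg.1 k k.2).2.2 (congrArg Fin.val h)
  · intro a b c d hab hbc hcd h1 h2
    have h1 : g a = c := congrArg Fin.val h1
    have h2 : g b = d := congrArg Fin.val h2
    have := hg.2 a a.2 b b.2 hab (by rw [h1]; exact hbc)
    rw [h1, h2] at this
    exact absurd hcd (by have := this.2; exact not_lt.mpr this.le)

theorem fsucc_nx {n : ℕ} (k : Fin (2 * n)) : (fsucc k : ℕ) = nx (2 * n) k := by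
  unfold fsucc nx
  simp only
  split_ifs with h
  · rw [h, Nat.mod_self]
  · exact Nat.mod_eq_of_lt (by have := k.2; omega)

theorem eRaw_eG {n : ℕ} (k : Fin (2 * n)) (π : NCM n) (m : Fin (2 * n)) :
    (eRaw k π m : ℕ) = eG (2 * n) k (toG π) m := by
  unfold eRaw eG
  simp only [← fsucc_nx, toG_val, Fin.val_inj]
  by_cases h : π.f k = fsucc k
  · simp only [if_pos h]
  · simp only [if_neg h]
    split_ifs <;> rfl

theorem eN_exists {n : ℕ} (k : Fin (2 * n)) (π : NCM n) : ∃ σ : NCM n, σ.f = eRaw k π := by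
  obtain ⟨m, rfl⟩ : ∃ m, n = m + 1 := ⟨n - 1, by have := k.2; omega⟩
  obtain ⟨σ, hσ⟩ := ofG (e_eval k.2 (toG_nc π)).1
  refine ⟨σ, funext fun l => Fin.ext ?_⟩
  rw [hσ, eRaw_eG]

theorem eN_eval {n : ℕ} (k : Fin (2 * n)) (π σ : NCM n) (h : σ.f = eRaw k π)
    {F H : (ℕ → ℂ) → ℂ} (hF : F ∈ W n) (hH : H ∈ W n) (hE : IsE (2 * n) k F H) :
    H (pt (toG π)) = F (pt (toG σ)) := by
  obtain ⟨m, rfl⟩ : ∃ m, n = m + 1 := ⟨n - 1, by have := k.2; omega⟩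
  rw [(e_eval k.2 (toG_nc π)).2 F hF H hH hE]
  apply pt_congr hF.1
  intro i hi
  rw [show toG σ i = (σ.f ⟨i, hi⟩ : ℕ) from toG_val σ ⟨i, hi⟩, h, eRaw_eG]

theorem ev_inj {n : ℕ} {F : (ℕ → ℂ) → ℂ} (hF : F ∈ W n)
    (h : ∀ π : NCM n, F (pt (toG π)) = 0) : F = 0 := by
  apply inj_W hF
  intro g hg
  obtain ⟨π, hπ⟩ := ofG hg
  rw [← h π]
  apply pt_congr hF.1
  intro i hi
  rw [← hπ ⟨i, hi⟩, ← toG_val]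

/-- the value at `1` is killed by the sum of the Temperley-Lieb operators -/
theorem sum_E_one {N : ℕ} (hN : 2 ≤ N) {d : ℕ → ℕ} {F : (ℕ → ℂ) → ℂ} (hF : F ∈ Mon N d)
    {H : ℕ → (ℕ → ℂ) → ℂ} (hH : ∀ j < N, H j ∈ Mon N d) (hE : ∀ j < N, IsE N j F (H j)) :
    ∑ j ∈ range N, (H j (fun _ => 1) - F (fun _ => 1)) = 0 := by
  have hp : ∀ j, ∀ G ∈ Mon N d, ∃ p : Polynomial ℂ, ∀ t, p.eval t = G (fun i => if i = j then 1 + t else 1) := by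
    intro j G hG
    obtain ⟨p, -, hp⟩ := mon_poly hG
      (fun l => if l = j then 1 + Polynomial.X else 1) (fun _ => 1) (by
        intro i _
        split_ifs
        · refine (Polynomial.natDegree_add_le _ _).trans (by simp)
        · simp)
    refine ⟨p, fun t => ?_⟩
    rw [hp]
    congr 1
    funext l
    split_ifs <;> simp
  choose p hp using fun j => hp j F hF
  have hone : ∀ j, (fun i : ℕ => if i = j then 1 + (0 : ℂ) else 1) = fun _ => 1 := by
    intro j; funext i; simp
  have hp0 : ∀ j, (p j).eval 0 = F (fun _ => 1) := by
    intro j; rw [hp, hone]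
  have key : ∀ j < N, H j (fun _ => 1) - F (fun _ => 1) =
      (q - q ^ 2) * ((p j).derivative.eval 0 - (p (nx N j)).derivative.eval 0) := by
    intro j hj
    obtain ⟨h, hh⟩ : ∃ h : Polynomial ℂ, ∀ t, h.eval t = (H j - F) (fun i => if i = j then 1 + t else 1) := by
      obtain ⟨p, -, hp⟩ := mon_poly (Submodule.sub_mem _ (hH j hj) hF)
        (fun l => if l = j then 1 + Polynomial.X else 1) (fun _ => 1) (by
          intro i _
          split_ifs
          · refine (Polynomial.natDegree_add_le _ _).trans (by simp)
          · simp)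
      refine ⟨p, fun t => ?_⟩
      rw [hp]
      refine congrArg (H j - F) ?_
      funext l
      split_ifs <;> simp
    have hne : nx N j ≠ j := by unfold nx; split_ifs <;> omega
    have hid : Polynomial.X * h =
        (Polynomial.C (q - q ^ 2) + Polynomial.C q * Polynomial.X) * (p j - p (nx N j)) := by
      apply Polynomial.funext
      intro t
      simp only [Polynomial.eval_mul, Polynomial.eval_X, Polynomial.eval_add, Polynomial.eval_C,
        Polynomial.eval_sub, hh, hp]
      have := hE j hj (fun i => if i = j then 1 + t else 1)
      rw [if_pos rfl, if_neg hne] at this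
      have e : (fun i : ℕ => (fun i => if i = j then 1 + t else 1) ((Equiv.swap j (nx N j)) i)) =
          fun i => if i = nx N j then 1 + t else 1 := by
        funext i
        have : (Equiv.swap j (nx N j) i = j) ↔ i = nx N j := by
          constructor
          · intro h
            have := congrArg (Equiv.swap j (nx N j)) h
            rwa [Equiv.swap_apply_self, Equiv.swap_apply_left] at this
          · rintro rfl; exact Equiv.swap_apply_right _ _
        simp only [this]
      rw [e] at this
      rw [Pi.sub_apply]
      linear_combination this
    have h2 := congrArg (fun r => (Polynomial.derivative r).eval 0) hid
    simp only [Polynomial.derivative_mul, Polynomial.derivative_X, Polynomial.derivative_add,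
      Polynomial.derivative_C, Polynomial.eval_mul, Polynomial.eval_X, Polynomial.eval_add,
      Polynomial.eval_C, Polynomial.derivative_sub, Polynomial.eval_sub, Polynomial.eval_one,
      Polynomial.eval_zero, hp0, hh, hone] at h2
    rw [Pi.sub_apply] at h2
    linear_combination h2
  rw [sum_congr rfl fun j hj => key j (mem_range.mp hj), ← mul_sum, sum_sub_distrib]
  have : ∑ x ∈ range N, (p (nx N x)).derivative.eval 0 = ∑ x ∈ range N, (p x).derivative.eval 0 := by
    refine sum_nbij' (nx N) (pv N) ?_ ?_ ?_ ?_ ?_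
    · intro a ha; exact mem_range.mpr (nx_lt (mem_range.mp ha))
    · intro a ha; exact mem_range.mpr (pv_lt (mem_range.mp ha))
    · intro a ha; exact pv_nx (mem_range.mp ha)
    · intro a ha; exact nx_pv (mem_range.mp ha)
    · intro a ha; rfl
  rw [this, sub_self, mul_zero]

end ACP

namespace ACP
open Finset

theorem lin_core {ι : Type*} [Fintype ι] [DecidableEq ι] (A : Matrix ι ι ℂ) (μ : ι → ℂ)
    (h0 : Matrix.vecMul μ A = 0) (hker : ∀ v, Matrix.vecMul v A = 0 → ∃ c : ℂ, v = c • μ)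
    (M : Submodule ℂ (ι → ℂ)) (hM : ∀ v ∈ M, Matrix.mulVec A v ∈ M)
    (g : ι → ℂ) (hg : g ∈ M) (hg0 : ∑ i, μ i * g i ≠ 0)
    (f : ι → ℂ) (hf : f ∈ M) (hf0 : ∑ i, μ i * f i = 0) :
    ∃ h ∈ M, Matrix.mulVec A h = f := by
  have hk1 : Module.finrank ℂ (LinearMap.ker A.mulVecLin) ≤ 1 := by
    have e1 := LinearMap.finrank_range_add_finrank_ker A.mulVecLin
    have e2 := LinearMap.finrank_range_add_finrank_ker A.transpose.mulVecLin
    have e3 := Matrix.rank_transpose A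
    unfold Matrix.rank at e3
    have : Module.finrank ℂ (LinearMap.ker A.transpose.mulVecLin) ≤ 1 := by
      have : LinearMap.ker A.transpose.mulVecLin ≤ Submodule.span ℂ {μ} := by
        intro v hv
        rw [LinearMap.mem_ker, Matrix.mulVecLin_apply, Matrix.mulVec_transpose] at hv
        obtain ⟨c, rfl⟩ := hker v hv
        exact Submodule.smul_mem _ _ (Submodule.mem_span_singleton_self μ)
      exact (Submodule.finrank_mono this).trans ((finrank_span_le_card _).trans (by simp))
    omega
  let T : M →ₗ[ℂ] M := A.mulVecLin.restrict hM
  let m : (ι → ℂ) →ₗ[ℂ] ℂ := ∑ i, μ i • LinearMap.proj i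
  have hm : ∀ v, m v = ∑ i, μ i * v i := by
    intro v; simp [m]
  let mM : M →ₗ[ℂ] ℂ := m.domRestrict M
  have hle : LinearMap.range T ≤ LinearMap.ker mM := by
    rintro _ ⟨v, rfl⟩
    rw [LinearMap.mem_ker]
    change m (Matrix.mulVec A v) = 0
    rw [hm]
    change μ ⬝ᵥ (Matrix.mulVec A v) = 0
    rw [Matrix.dotProduct_mulVec, h0, zero_dotProduct]
  have hkT : Module.finrank ℂ (LinearMap.ker T) ≤ 1 := by
    refine le_trans ?_ hk1
    have : ∀ x : LinearMap.ker T, ((x : M) : ι → ℂ) ∈ LinearMap.ker A.mulVecLin := by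
      intro x
      have := x.2
      rw [LinearMap.mem_ker] at this
      exact congrArg Subtype.val this
    let φ : LinearMap.ker T →ₗ[ℂ] LinearMap.ker A.mulVecLin :=
      LinearMap.codRestrict _ (M.subtype ∘ₗ (LinearMap.ker T).subtype) this
    refine LinearMap.finrank_le_finrank_of_injective (f := φ) ?_
    intro x y hxy
    have h : ((x : M) : ι → ℂ) = ((y : M) : ι → ℂ) := congrArg (fun r : LinearMap.ker A.mulVecLin => (r : ι → ℂ)) hxy
    exact Subtype.ext (Subtype.ext h)
  have e1 := LinearMap.finrank_range_add_finrank_ker T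
  have e2 := LinearMap.finrank_range_add_finrank_ker mM
  have hr : 1 ≤ Module.finrank ℂ (LinearMap.range mM) := by
    have : LinearMap.range mM ≠ ⊥ := by
      intro h
      have : mM ⟨g, hg⟩ ∈ LinearMap.range mM := ⟨_, rfl⟩
      rw [h, Submodule.mem_bot] at this
      exact hg0 (by rw [← hm]; exact this)
    exact Submodule.one_le_finrank_iff.mpr this
  have heq := Submodule.eq_of_le_of_finrank_le hle (by omega)
  have : (⟨f, hf⟩ : M) ∈ LinearMap.ker mM := by
    rw [LinearMap.mem_ker]
    change m f = 0
    rw [hm, hf0]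
  rw [← heq] at this
  obtain ⟨h, hh⟩ := this
  exact ⟨h, h.2, congrArg Subtype.val hh⟩

noncomputable def tlMat (n : ℕ) : Matrix (NCM n) (NCM n) ℂ := fun π σ =>
  (∑ k : Fin (2 * n), if eRaw k π = σ.f then (1 : ℂ) else 0) - if π = σ then ((2 * n : ℕ) : ℂ) else 0

theorem tl_vecMul {n : ℕ} (w : NCM n → ℂ) (σ : NCM n) : Matrix.vecMul w (tlMat n) σ =
    (∑ k : Fin (2 * n), ∑ π' : NCM n, if eRaw k π' = σ.f then w π' else 0) - ((2 * n : ℕ) : ℂ) * w σ := by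
  unfold Matrix.vecMul dotProduct tlMat
  simp only [mul_sub, sum_sub_distrib, mul_sum, mul_ite, mul_one, mul_zero, sum_ite_eq', mem_univ, if_true]
  rw [sum_comm, mul_comm (w σ)]

theorem tl_mulVec {n : ℕ} (v : NCM n → ℂ) (π : NCM n) (e : Fin (2 * n) → NCM n)
    (he : ∀ k, (e k).f = eRaw k π) : Matrix.mulVec (tlMat n) v π =
    ∑ k : Fin (2 * n), (v (e k) - v π) := by
  unfold Matrix.mulVec dotProduct tlMat
  simp only [sub_mul, sum_sub_distrib, sum_mul, ite_mul, one_mul, zero_mul, sum_ite_eq, mem_univ, if_true]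
  rw [sum_comm]
  congr 1
  · refine sum_congr rfl fun k _ => ?_
    rw [sum_eq_single (e k)]
    · rw [if_pos (he k).symm]
    · intro b _ hb
      rw [if_neg]
      intro h
      exact hb (NCM.ext' (by rw [he, h]))
    · simp
  · simp

theorem main_lin {n : ℕ} (hn : 1 ≤ n) (μ : NCM n → ℂ)
    (hsum : ∑ π : NCM n, μ π = 1) (hstat : Stationary μ)
    (huniq : ∀ v : NCM n → ℂ, (∑ π : NCM n, v π = 1) → Stationary v → v = μ)
    {G : (ℕ → ℂ) → ℂ} (hG : G ∈ W n) {C : ℂ} (hC : C ≠ 0) (hGC : ∀ π : NCM n, G (pt (toG π)) = C)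
    {F : (ℕ → ℂ) → ℂ} (hF : F ∈ W n) :
    F (fun _ => 1) * C = G (fun _ => 1) * ∑ π : NCM n, μ π * F (pt (toG π)) := by
  have hst : ∀ v : NCM n → ℂ, Stationary v ↔ Matrix.vecMul v (tlMat n) = 0 := by
    intro v
    constructor
    · intro h; funext σ; rw [tl_vecMul, ← h σ, sub_self]; rfl
    · intro h σ
      have := congrFun h σ
      rw [tl_vecMul] at this
      exact (sub_eq_zero.mp this).symm
  let ev : ((ℕ → ℂ) → ℂ) →ₗ[ℂ] (NCM n → ℂ) :=
    { toFun := fun F π => F (pt (toG π)), map_add' := fun _ _ => rfl, map_smul' := fun _ _ => rfl }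
  have hev : ∀ F π, ev F π = F (pt (toG π)) := fun _ _ => rfl
  choose e he using fun (k : Fin (2 * n)) (π : NCM n) => eN_exists k π
  have hE : ∀ G' ∈ W n, ∃ H : ℕ → (ℕ → ℂ) → ℂ, (∀ j < 2 * n, H j ∈ W n ∧ IsE (2 * n) j G' (H j)) := by
    intro G' hG'
    obtain ⟨m, rfl⟩ : ∃ m, n = m + 1 := ⟨n - 1, by omega⟩
    have : ∀ j, ∃ H, j < 2 * (m + 1) → H ∈ W (m + 1) ∧ IsE (2 * (m + 1)) j G' H := by
      intro j
      by_cases hj : j < 2 * (m + 1)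
      · obtain ⟨H, h1, h2⟩ := E_exists hj hG'
        exact ⟨H, fun _ => ⟨h1, h2⟩⟩
      · exact ⟨0, fun h => absurd h hj⟩
    choose H hH using this
    exact ⟨H, hH⟩
  have hT : ∀ G' ∈ W n, ∀ H : ℕ → (ℕ → ℂ) → ℂ, (∀ j < 2 * n, H j ∈ W n ∧ IsE (2 * n) j G' (H j)) →
      Matrix.mulVec (tlMat n) (ev G') = ev (∑ j ∈ range (2 * n), (H j - G')) := by
    intro G' hG' H hH
    funext π
    rw [tl_mulVec _ π (fun k => e k π) (fun k => he k π), map_sum, Finset.sum_apply,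
      ← Fin.sum_univ_eq_sum_range (fun j => ev (H j - G') π)]
    refine sum_congr rfl fun k _ => ?_
    rw [hev, hev, hev, Pi.sub_apply, eN_eval k π _ (he k π) hG' (hH k k.2).1 (hH k k.2).2]
  have hGm : ∑ π : NCM n, μ π * ev G π = C := by
    simp only [hev, hGC, ← sum_mul, hsum, one_mul]
  set c := (∑ π : NCM n, μ π * F (pt (toG π))) / C with hc
  have hF' : F - c • G ∈ W n := Submodule.sub_mem _ hF (Submodule.smul_mem _ _ hG)
  obtain ⟨h, hhM, hh⟩ := lin_core (tlMat n) μ ((hst μ).mp hstat) (by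
      intro v hv
      have hv := (hst v).mpr hv
      by_cases hs : ∑ π, v π = 0
      · refine ⟨0, ?_⟩
        have := huniq (μ + v) (by simp [sum_add_distrib, hsum, hs]) ((hst _).mpr (by
          rw [Matrix.add_vecMul, (hst _).mp hstat, (hst _).mp hv, add_zero]))
        rw [zero_smul]
        simpa using this
      · refine ⟨∑ π, v π, ?_⟩
        rw [← huniq ((∑ π, v π)⁻¹ • v) (by
          simp only [Pi.smul_apply, smul_eq_mul, ← mul_sum]; exact inv_mul_cancel₀ hs) ((hst _).mpr (by
          rw [Matrix.smul_vecMul, (hst _).mp hv, smul_zero])), smul_smul, mul_inv_cancel₀ hs, one_smul])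
    (Submodule.map ev (W n)) (by
      rintro _ ⟨G', hG', rfl⟩
      obtain ⟨H, hH⟩ := hE G' hG'
      rw [hT G' hG' H hH]
      exact ⟨_, Submodule.sum_mem _ fun j hj => Submodule.sub_mem _ (hH j (mem_range.mp hj)).1 hG', rfl⟩)
    (ev G) ⟨G, hG, rfl⟩ (by rw [hGm]; exact hC) (ev (F - c • G)) ⟨_, hF', rfl⟩ (by
      rw [map_sub, map_smul]
      simp only [Pi.sub_apply, Pi.smul_apply, smul_eq_mul, mul_sub, sum_sub_distrib]
      simp only [mul_left_comm _ c, ← mul_sum, hGm]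
      rw [hc, div_mul_cancel₀ _ hC]
      exact sub_self _)
  obtain ⟨G', hG', rfl⟩ := hhM
  obtain ⟨H, hH⟩ := hE G' hG'
  rw [hT G' hG' H hH] at hh
  have hz : (∑ j ∈ range (2 * n), (H j - G')) - (F - c • G) = 0 := by
    apply ev_inj (Submodule.sub_mem _ (Submodule.sum_mem _ fun j hj =>
      Submodule.sub_mem _ (hH j (mem_range.mp hj)).1 hG') hF')
    intro π
    have := congrFun hh π
    rw [hev, hev] at this
    rw [Pi.sub_apply, this, sub_self]
  have h1 := congrFun hz (fun _ => 1)
  rw [Pi.sub_apply, Finset.sum_apply] at h1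
  simp only [Pi.sub_apply, Pi.smul_apply, smul_eq_mul, Pi.zero_apply] at h1
  have h2 := sum_E_one (by omega) hG'.1 (fun j hj => (hH j hj).1.1) (fun j hj => (hH j hj).2)
  rw [h2] at h1
  have h3 : c * C = ∑ π : NCM n, μ π * F (pt (toG π)) := div_mul_cancel₀ _ hC
  rw [← h3]
  linear_combination -C * h1

end ACP

namespace ACP
open Finset

theorem gen_ne {N : ℕ} {z : ℕ → ℂ} (h : Gen N z) {i j : ℕ} (hi : i < N) (hj : j < N) (hij : i ≠ j) :
    z i - z j ≠ 0 := by
  intro h0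
  apply h.2 i hi j hj hij
  rw [sub_eq_zero.mp h0]

theorem gen_ne' {N : ℕ} {z : ℕ → ℂ} (h : Gen N z) {i j : ℕ} (hi : i < N) (hj : j < N) (hij : i ≠ j) :
    q * z i - q ^ 2 * z j ≠ 0 := by
  intro h0
  apply h.2 i hi j hj hij
  have h1 : z i = q * z j := by
    have := q_ne_zero
    apply mul_left_cancel₀ this
    linear_combination h0
  rw [h1, mul_pow, q_cube, one_mul]

theorem gen_swap {N : ℕ} {z : ℕ → ℂ} (h : Gen N z) {j : ℕ} (hj : j + 1 < N) :
    Gen N (fun i => z (Equiv.swap j (j + 1) i)) := by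
  have hs : ∀ i < N, Equiv.swap j (j + 1) i < N := by
    intro i hi
    rw [Equiv.swap_apply_def]; split_ifs <;> omega
  exact ⟨fun i hi => h.1 _ (hs i hi), fun i hi k hk hik => h.2 _ (hs i hi) _ (hs k hk)
    (fun h => hik ((Equiv.swap j (j + 1)).injective h))⟩

noncomputable def pre (N : ℕ) (z : ℕ → ℂ) : ℂ :=
  ∏ i ∈ range N, ∏ k ∈ range N, if i < k then q * z i - q ^ 2 * z k else 1

noncomputable def wt (N a : ℕ) (z : ℕ → ℂ) (s : ℕ) : ℂ :=
  if s < a then ∏ i ∈ (range N).erase s, (if i < a then z s - z i else q * z s - q ^ 2 * z i)⁻¹ else 0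

noncomputable def KK {n : ℕ} (w : Fin n → ℂ) : ℂ :=
  ∏ l, ∏ m, if l < m then (w m - w l) * (q * w l - q ^ 2 * w m) else 1

noncomputable def TT {n : ℕ} (N : ℕ) (c : Fin n → ℕ → ℂ) (z : ℕ → ℂ) : ℂ :=
  ∑ s ∈ Fintype.piFinset (fun _ : Fin n => range N), (∏ l, c l (s l)) * KK (fun l => z (s l))

noncomputable def Phi (n : ℕ) (a : Fin n → ℕ) (z : ℕ → ℂ) : ℂ :=
  pre (2 * n) z * TT (2 * n) (fun l => wt (2 * n) (a l) z) z

theorem KK_zero {n : ℕ} (w : Fin n → ℂ) {l m : Fin n} (hlm : l ≠ m) (h : w l = w m) : KK w = 0 := by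
  have : ∀ l m : Fin n, l < m → w l = w m → KK w = 0 := by
    intro l m hlm h
    unfold KK
    refine prod_eq_zero (mem_univ l) (prod_eq_zero (mem_univ m) ?_)
    rw [if_pos hlm, h]; ring
  rcases lt_or_gt_of_ne hlm with h1 | h1
  · exact this l m h1 h
  · exact this m l h1 h.symm

theorem sw_lt {N j i : ℕ} (hj : j + 1 < N) (hi : i < N) : Equiv.swap j (j + 1) i < N := by
  rw [Equiv.swap_apply_def]; split_ifs <;> omega

theorem prod_sw {N j : ℕ} (hj : j + 1 < N) (g : ℕ → ℂ) :
    ∏ i ∈ range N, g (Equiv.swap j (j + 1) i) = ∏ i ∈ range N, g i := by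
  refine prod_nbij' (Equiv.swap j (j + 1)) (Equiv.swap j (j + 1)) ?_ ?_ ?_ ?_ ?_
  · intro i hi; exact mem_range.mpr (sw_lt hj (mem_range.mp hi))
  · intro i hi; exact mem_range.mpr (sw_lt hj (mem_range.mp hi))
  · intro i _; exact Equiv.swap_apply_self _ _ _
  · intro i _; exact Equiv.swap_apply_self _ _ _
  · intro i _; rfl

theorem pre_swap {N j : ℕ} (hj : j + 1 < N) (z : ℕ → ℂ) :
    pre N (fun i => z (Equiv.swap j (j + 1) i)) * (q * z j - q ^ 2 * z (j + 1)) =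
      pre N z * (q * z (j + 1) - q ^ 2 * z j) := by
  set σ := Equiv.swap j (j + 1) with hσ
  have h1 : pre N z = ∏ i ∈ range N, ∏ k ∈ range N,
      if σ i < σ k then q * z (σ i) - q ^ 2 * z (σ k) else 1 := by
    unfold pre
    rw [← prod_sw hj]
    refine prod_congr rfl fun i _ => ?_
    rw [← prod_sw hj]
  have h2 : ∀ i k, (i = j ∧ k = j + 1) ∨ (i = j + 1 ∧ k = j) ∨ ((σ i < σ k ↔ i < k)) := by
    intro i k
    rw [hσ, Equiv.swap_apply_def, Equiv.swap_apply_def]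
    split_ifs <;> omega
  have h3 : ∀ f : ℕ → ℕ → ℂ, ∏ i ∈ range N, ∏ k ∈ range N, f i k =
      f j (j + 1) * f (j + 1) j * ∏ p ∈ ((range N ×ˢ range N).erase (j, j + 1)).erase (j + 1, j), f p.1 p.2 := by
    intro f
    rw [← prod_product' (range N) (range N) f]
    rw [← mul_prod_erase (range N ×ˢ range N) _ (a := (j, j + 1)) (by simp; omega)]
    rw [← mul_prod_erase ((range N ×ˢ range N).erase (j, j + 1)) _ (a := (j + 1, j)) (by simp; omega), mul_assoc]
  rw [h1]
  unfold pre
  rw [h3, h3]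
  have e1 : σ j = j + 1 := Equiv.swap_apply_left _ _
  have e2 : σ (j + 1) = j := Equiv.swap_apply_right _ _
  rw [e1, e2, if_pos (by omega), if_neg (by omega), if_neg (by omega), if_pos (by omega)]
  have : ∏ p ∈ ((range N ×ˢ range N).erase (j, j + 1)).erase (j + 1, j),
      (if p.1 < p.2 then q * z (σ p.1) - q ^ 2 * z (σ p.2) else 1) =
    ∏ p ∈ ((range N ×ˢ range N).erase (j, j + 1)).erase (j + 1, j),
      (if σ p.1 < σ p.2 then q * z (σ p.1) - q ^ 2 * z (σ p.2) else 1) := by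
    refine prod_congr rfl fun p hp => ?_
    simp only [mem_erase, ne_eq, Prod.ext_iff] at hp
    have := h2 p.1 p.2
    have h4 : σ p.1 < σ p.2 ↔ p.1 < p.2 := by tauto
    simp only [h4]
  rw [this]
  simp only [e1, e2]
  ring

theorem wt_swap {N j a : ℕ} (hj : j + 1 < N) (ha : a ≠ j + 1) (z : ℕ → ℂ) (s : ℕ) :
    wt N a (fun i => z (Equiv.swap j (j + 1) i)) (Equiv.swap j (j + 1) s) = wt N a z s := by
  set σ := Equiv.swap j (j + 1) with hσ
  have hs : ∀ i, σ i < a ↔ i < a := by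
    intro i; rw [hσ, Equiv.swap_apply_def]; split_ifs <;> omega
  have hss : ∀ i, σ (σ i) = i := fun i => Equiv.swap_apply_self _ _ _
  unfold wt
  simp only [hs, hss]
  congr 1
  refine prod_nbij' σ σ ?_ ?_ ?_ ?_ ?_
  · intro i hi
    simp only [mem_erase, mem_range] at hi ⊢
    exact ⟨fun h => hi.1 (by rw [← h, hss]), sw_lt hj hi.2⟩
  · intro i hi
    simp only [mem_erase, mem_range] at hi ⊢
    exact ⟨fun h => hi.1 (σ.injective h), sw_lt hj hi.2⟩
  · intro i _; exact hss i
  · intro i _; exact hss i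
  · intro i _
    simp only [hs]

theorem raise_aux {A B P R D X Y c : ℂ} (h1 : A ≠ 0) (h2 : B ≠ 0) (h3 : P ≠ 0) (h4 : R ≠ 0)
    (h : D * (A * B + P * R) = X * (B * P) - Y * (A * R)) :
    D * (P⁻¹ * (R⁻¹ * c) + A⁻¹ * (B⁻¹ * c)) =
    X * (A⁻¹ * (R⁻¹ * c)) - Y * (B⁻¹ * (P⁻¹ * c)) := by
  field_simp
  linear_combination c * h

theorem raise_id {x y w c : ℂ} (h1 : w - x ≠ 0) (h2 : w - y ≠ 0) (h3 : q * w - q ^ 2 * x ≠ 0)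
    (h4 : q * w - q ^ 2 * y ≠ 0) :
    (x - y) * ((q * w - q ^ 2 * x)⁻¹ * ((q * w - q ^ 2 * y)⁻¹ * c) + (w - x)⁻¹ * ((w - y)⁻¹ * c)) =
    (q * x - q ^ 2 * y) * ((w - x)⁻¹ * ((q * w - q ^ 2 * y)⁻¹ * c)) -
    (q * y - q ^ 2 * x) * ((w - y)⁻¹ * ((q * w - q ^ 2 * x)⁻¹ * c)) := by
  have := q_quad
  have : (x - y) * ((w - x) * (w - y) + (q * w - q ^ 2 * x) * (q * w - q ^ 2 * y)) =
      (q * x - q ^ 2 * y) * ((w - y) * (q * w - q ^ 2 * x)) -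
      (q * y - q ^ 2 * x) * ((w - x) * (q * w - q ^ 2 * y)) := by
    have e3 := q_cube
    have e : q ^ 2 = - q - 1 := by linear_combination this
    simp only [e]
    ring_nf
    simp only [e]
    ring
  exact raise_aux h1 h2 h3 h4 this

theorem wt_raise {N j : ℕ} (hj : j + 1 < N) {z : ℕ → ℂ} (hz : Gen N z) {s : ℕ} (hs : s < N) :
    (z j - z (j + 1)) * (wt N j z s + wt N (j + 2) z s) =
      (q * z j - q ^ 2 * z (j + 1)) * wt N (j + 1) z s -
      (q * z (j + 1) - q ^ 2 * z j) *
        wt N (j + 1) (fun i => z (Equiv.swap j (j + 1) i)) (Equiv.swap j (j + 1) s) := by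
  set σ := Equiv.swap j (j + 1) with hσ
  have hss : ∀ i, σ (σ i) = i := fun i => Equiv.swap_apply_self _ _ _
  have e1 : σ j = j + 1 := Equiv.swap_apply_left _ _
  have e2 : σ (j + 1) = j := Equiv.swap_apply_right _ _
  have e3 : ∀ i, i ≠ j → i ≠ j + 1 → σ i = i := fun i => Equiv.swap_apply_of_ne_of_ne
  have two : ∀ g : ℕ → ℂ, s ≠ j → s ≠ j + 1 → ∏ i ∈ (range N).erase s, g i =
      g j * (g (j + 1) * ∏ i ∈ (((range N).erase s).erase j).erase (j + 1), g i) := by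
    intro g h1 h2
    rw [← mul_prod_erase ((range N).erase s) _ (a := j) (by simp; omega),
      ← mul_prod_erase (((range N).erase s).erase j) _ (a := j + 1) (by simp; omega)]
  have hc : ∀ (w : ℂ) (a b : ℕ), (j ≤ a ∧ a ≤ j + 2) → (j ≤ b ∧ b ≤ j + 2) →
      ∀ R : Finset ℕ, (∀ i ∈ R, i ≠ j ∧ i ≠ j + 1) →
      ∏ i ∈ R, (if i < a then w - z i else q * w - q ^ 2 * z i)⁻¹ =
      ∏ i ∈ R, (if i < b then w - z i else q * w - q ^ 2 * z i)⁻¹ := by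
    intro w a b ha hb R hR
    refine prod_congr rfl fun i hi => ?_
    have := hR i hi
    have : i < a ↔ i < b := by omega
    simp only [this]
  rcases lt_trichotomy s j with h | h | h
  · have hsj : σ s = s := e3 s (by omega) (by omega)
    rw [hsj]
    unfold wt
    rw [if_pos h, if_pos (by omega), if_pos (by omega), if_pos (by omega)]
    rw [two _ (by omega) (by omega), two _ (by omega) (by omega), two _ (by omega) (by omega), two _ (by omega) (by omega)]
    have hR : ∀ i ∈ (((range N).erase s).erase j).erase (j + 1), i ≠ j ∧ i ≠ j + 1 := by
      intro i hi; simp at hi; omega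
    rw [hc _ j (j + 2) (by omega) (by omega) _ hR, hc _ (j + 1) (j + 2) (by omega) (by omega) _ hR]
    have : ∏ i ∈ (((range N).erase s).erase j).erase (j + 1),
        (if i < j + 1 then z (σ s) - z (σ i) else q * z (σ s) - q ^ 2 * z (σ i))⁻¹ =
        ∏ i ∈ (((range N).erase s).erase j).erase (j + 1),
        (if i < j + 1 then z s - z i else q * z s - q ^ 2 * z i)⁻¹ := by
      refine prod_congr rfl fun i hi => ?_
      rw [hsj, e3 i (hR i hi).1 (hR i hi).2]
    beta_reduce
    rw [this, hc _ (j + 1) (j + 2) (by omega) (by omega) _ hR, e1, e2, hsj]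
    simp only [lt_irrefl, if_false, show ¬ (j + 1 < j) by omega, show j < j + 2 by omega, if_true,
      show j + 1 < j + 2 by omega, show j < j + 1 by omega]
    exact raise_id (gen_ne hz hs (by omega) (by omega)) (gen_ne hz hs (by omega) (by omega))
      (gen_ne' hz hs (by omega) (by omega)) (gen_ne' hz hs (by omega) (by omega))
  · subst h
    rw [e1]
    unfold wt
    rw [if_neg (by omega), if_pos (by omega), if_pos (by omega), if_neg (by omega)]
    have one : ∀ g : ℕ → ℂ, ∏ i ∈ (range N).erase s, g i =
      g (s + 1) * ∏ i ∈ ((range N).erase s).erase (s + 1), g i := by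
      intro g
      rw [← mul_prod_erase ((range N).erase s) _ (a := s + 1) (by simp; omega)]
    have hR : ∀ i ∈ ((range N).erase s).erase (s + 1), i ≠ s ∧ i ≠ s + 1 := by
      intro i hi; simp at hi; omega
    rw [one, one, hc _ (s + 1) (s + 2) (by omega) (by omega) _ hR, if_pos (by omega), if_neg (by omega)]
    have h1 := gen_ne hz hs hj (by omega)
    have h2 := gen_ne' hz hs hj (by omega)
    rw [zero_add, mul_inv_cancel_left₀ h1, mul_inv_cancel_left₀ h2]
    ring
  · by_cases h' : s = j + 1
    · subst h'
      rw [e2]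
      unfold wt
      rw [if_neg (by omega), if_pos (by omega), if_neg (by omega), if_pos (by omega)]
      have one : ∏ i ∈ (range N).erase (j + 1), (if i < j + 2 then z (j + 1) - z i else q * z (j + 1) - q ^ 2 * z i)⁻¹ =
        (z (j + 1) - z j)⁻¹ * ∏ i ∈ ((range N).erase (j + 1)).erase j,
          (if i < j + 2 then z (j + 1) - z i else q * z (j + 1) - q ^ 2 * z i)⁻¹ := by
        rw [← mul_prod_erase ((range N).erase (j + 1)) _ (a := j) (by simp; omega), if_pos (by omega)]
      have one' : ∏ i ∈ (range N).erase j, (if i < j + 1 then z (σ j) - z (σ i) else q * z (σ j) - q ^ 2 * z (σ i))⁻¹ =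
        (q * z (j + 1) - q ^ 2 * z j)⁻¹ * ∏ i ∈ ((range N).erase (j + 1)).erase j,
          (if i < j + 2 then z (j + 1) - z i else q * z (j + 1) - q ^ 2 * z i)⁻¹ := by
        rw [← mul_prod_erase ((range N).erase j) _ (a := j + 1) (by simp; omega), if_neg (by omega), e1, e2,
          erase_right_comm]
        congr 1
        refine prod_congr rfl fun i hi => ?_
        simp at hi
        rw [e3 i (by omega) (by omega)]
        have : i < j + 1 ↔ i < j + 2 := by omega
        simp only [this]
      rw [one, one']
      have h1 := gen_ne hz hs (show j < N by omega) (by omega)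
      have h2 := gen_ne' hz hs (show j < N by omega) (by omega)
      generalize ∏ i ∈ ((range N).erase (j + 1)).erase j,
          (if i < j + 2 then z (j + 1) - z i else q * z (j + 1) - q ^ 2 * z i)⁻¹ = c
      rw [zero_add, mul_inv_cancel_left₀ h2]
      linear_combination -(mul_inv_cancel_left₀ h1 c)
    · rw [e3 s (by omega) h']
      unfold wt
      rw [if_neg (by omega), if_neg (by omega), if_neg (by omega), if_neg (by omega)]
      ring

theorem Phi_raise {n j : ℕ} (hj : j + 1 < 2 * n) {z : ℕ → ℂ} (hz : Gen (2 * n) z) (a : Fin n → ℕ)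
    (l0 : Fin n) (h0 : a l0 = j + 1) (hne : ∀ l, l ≠ l0 → a l ≠ j + 1) :
    (z j - z (j + 1)) * (Phi n (Function.update a l0 j) z + Phi n (Function.update a l0 (j + 2)) z) =
    (q * z j - q ^ 2 * z (j + 1)) * (Phi n a z - Phi n a (fun i => z (Equiv.swap j (j + 1) i))) := by
  set σ := Equiv.swap j (j + 1) with hσ
  have hss : ∀ i, σ (σ i) = i := fun i => Equiv.swap_apply_self _ _ _
  have hT : ∀ c : ℕ, ∀ y, TT (2 * n) (fun l => wt (2 * n) (Function.update a l0 c l) y) y =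
      ∑ s ∈ Fintype.piFinset (fun _ : Fin n => range (2 * n)), wt (2 * n) c y (s l0) *
        ((∏ l ∈ univ.erase l0, wt (2 * n) (a l) y (s l)) * KK (fun l => y (s l))) := by
    intro c y
    unfold TT
    refine sum_congr rfl fun s _ => ?_
    rw [← mul_prod_erase univ _ (mem_univ l0)]
    beta_reduce
    rw [Function.update_self, mul_assoc]
    congr 2
    refine prod_congr rfl fun l hl => ?_
    rw [Function.update_of_ne (ne_of_mem_erase hl)]
  have ha : a = Function.update a l0 (j + 1) := by rw [← h0, Function.update_eq_self]
  have hsw : TT (2 * n) (fun l => wt (2 * n) (a l) (fun i => z (σ i))) (fun i => z (σ i)) =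
      ∑ s ∈ Fintype.piFinset (fun _ : Fin n => range (2 * n)), wt (2 * n) (j + 1) (fun i => z (σ i)) (σ (s l0)) *
        ((∏ l ∈ univ.erase l0, wt (2 * n) (a l) z (s l)) * KK (fun l => z (s l))) := by
    conv_lhs => rw [ha]
    rw [hT]
    refine sum_nbij' (fun s l => σ (s l)) (fun s l => σ (s l)) ?_ ?_ ?_ ?_ ?_
    · intro s hs
      rw [Fintype.mem_piFinset] at hs ⊢
      exact fun l => mem_range.mpr (sw_lt hj (mem_range.mp (hs l)))
    · intro s hs
      rw [Fintype.mem_piFinset] at hs ⊢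
      exact fun l => mem_range.mpr (sw_lt hj (mem_range.mp (hs l)))
    · intro s _; funext l; exact hss _
    · intro s _; funext l; exact hss _
    · intro s _
      simp only [hss]
      congr 2
      refine prod_congr rfl fun l hl => ?_
      rw [← wt_swap hj (hne l (ne_of_mem_erase hl)) z, hss]
  have key : (z j - z (j + 1)) * (TT (2 * n) (fun l => wt (2 * n) (Function.update a l0 j l) z) z +
      TT (2 * n) (fun l => wt (2 * n) (Function.update a l0 (j + 2) l) z) z) =
      (q * z j - q ^ 2 * z (j + 1)) * TT (2 * n) (fun l => wt (2 * n) (a l) z) z -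
      (q * z (j + 1) - q ^ 2 * z j) *
        TT (2 * n) (fun l => wt (2 * n) (a l) (fun i => z (σ i))) (fun i => z (σ i)) := by
    rw [hsw, hT, hT]
    conv_rhs => rw [ha, hT]
    rw [← sum_add_distrib, mul_sum, mul_sum, mul_sum, ← sum_sub_distrib]
    refine sum_congr rfl fun s hs => ?_
    rw [Fintype.mem_piFinset] at hs
    have := wt_raise hj hz (mem_range.mp (hs l0))
    rw [← hσ] at this
    have e : ∏ l ∈ univ.erase l0, wt (2 * n) (Function.update a l0 (j + 1) l) z (s l) =
        ∏ l ∈ univ.erase l0, wt (2 * n) (a l) z (s l) := by rw [← ha]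
    rw [e]
    linear_combination ((∏ l ∈ univ.erase l0, wt (2 * n) (a l) z (s l)) * KK (fun l => z (s l))) * this
  have hp := pre_swap hj z
  rw [← hσ] at hp
  unfold Phi
  linear_combination pre (2 * n) z * key +
    TT (2 * n) (fun l => wt (2 * n) (a l) (fun i => z (σ i))) (fun i => z (σ i)) * hp

theorem Phi_pigeon {n : ℕ} (a : Fin n → ℕ) (l : Fin n) (h : ∀ i ≤ l, a i ≤ l) (z : ℕ → ℂ) :
    Phi n a z = 0 := by
  unfold Phi TT
  rw [sum_eq_zero, mul_zero]
  intro s _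
  by_cases hs : ∀ i ≤ l, s i < a i
  · obtain ⟨x, hx, y, hy, hxy, he⟩ := exists_ne_map_eq_of_card_lt_of_maps_to (s := Finset.Iic l)
      (t := range l) (f := s) (by simp) (fun i hi => by
        have := hs i (mem_Iic.mp hi)
        have := h i (mem_Iic.mp hi)
        simp; omega)
    rw [KK_zero _ hxy (by rw [he]), mul_zero]
  · push Not at hs
    obtain ⟨i, hi, hi'⟩ := hs
    rw [prod_eq_zero (mem_univ i), zero_mul]
    unfold wt
    beta_reduce
    rw [if_neg (by omega)]

end ACP

namespace ACP
open Finset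

noncomputable def Rb (n : ℕ) (z : ℕ → ℂ) : ℂ :=
  ∏ i ∈ range (2 * n), ∏ k ∈ range (2 * n),
    if i < k ∧ (k < n ∨ n ≤ i) then q * z i - q ^ 2 * z k else 1

theorem Rb_mem (n : ℕ) : Rb n ∈ W n := by
  constructor
  · have h1 : ∀ i ∈ range (2 * n), ∀ k ∈ range (2 * n),
        (fun z : ℕ → ℂ => if i < k ∧ (k < n ∨ n ≤ i) then q * z i - q ^ 2 * z k else 1) ∈
        Mon (2 * n) (fun c => if i < k ∧ (k < n ∨ n ≤ i) then (if c = i then 1 else 0) + (if c = k then 1 else 0) else 0) := by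
      intro i hi k hk
      split_ifs with h
      · have e1 : (fun z : ℕ → ℂ => z i) ∈ Mon (2 * n)
            (fun c => (if c = i then 1 else 0) + (if c = k then 1 else 0)) :=
          mon_coord (mem_range.mp hi) (by simp)
        have e2 : (fun z : ℕ → ℂ => z k) ∈ Mon (2 * n)
            (fun c => (if c = i then 1 else 0) + (if c = k then 1 else 0)) :=
          mon_coord (mem_range.mp hk) (by simp)
        exact Submodule.sub_mem _ (Submodule.smul_mem _ q e1) (Submodule.smul_mem _ (q ^ 2) e2)
      · exact mon_const _ _ _
    have h2 := mon_prod (range (2 * n)) _ _ (fun i hi => mon_prod (range (2 * n)) _ _ (h1 i hi))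
    refine mon_mono' ?_ h2
    intro c hc
    have e : ∀ i k, (if i < k ∧ (k < n ∨ n ≤ i) then (if c = i then 1 else 0) + (if c = k then 1 else 0) else 0) =
       (if c = i then (if i < k ∧ (k < n ∨ n ≤ i) then 1 else 0) else 0) +
       (if c = k then (if i < k ∧ (k < n ∨ n ≤ i) then 1 else 0) else 0) := by
      intro i k; split_ifs <;> rfl
    simp only [e, sum_add_distrib, sum_ite_eq, mem_range, hc, if_true]
    rw [sum_comm]
    simp only [sum_ite_eq, mem_range, hc, if_true]
    rw [← sum_add_distrib]
    have : ∀ S : Finset ℕ, S.card ≤ n → c ∈ S → (∀ k, k < 2 * n → k ∉ S →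
        ¬ (c < k ∧ (k < n ∨ n ≤ c)) ∧ ¬ (k < c ∧ (c < n ∨ n ≤ k))) →
        ∑ x ∈ range (2 * n), ((if c < x ∧ (x < n ∨ n ≤ c) then 1 else 0) +
          if x < c ∧ (c < n ∨ n ≤ x) then 1 else 0) ≤ n - 1 := by
      intro S hS hcS hk
      calc ∑ x ∈ range (2 * n), ((if c < x ∧ (x < n ∨ n ≤ c) then 1 else 0) +
          if x < c ∧ (c < n ∨ n ≤ x) then 1 else 0)
          ≤ ∑ x ∈ range (2 * n), (if x ∈ S.erase c then 1 else 0) := by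
            refine sum_le_sum fun x hx => ?_
            by_cases hxS : x ∈ S
            · by_cases hxc : x = c
              · simp [hxc]
              · rw [if_pos (mem_erase.mpr ⟨hxc, hxS⟩)]
                split_ifs <;> omega
            · have := hk x (mem_range.mp hx) hxS
              rw [if_neg this.1, if_neg this.2]; omega
        _ ≤ (S.erase c).card := by
            rw [← sum_filter, card_eq_sum_ones]
            exact sum_le_sum_of_subset (by intro x hx; exact (mem_filter.mp hx).2)
        _ ≤ n - 1 := by rw [card_erase_of_mem hcS]; omega
    by_cases hcn : c < n
    · exact this (range n) (by simp) (by simpa using hcn) (by intro k hk hkS; simp at hkS; omega)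
    · exact this (Ico n (2 * n)) (by simp; omega) (by simp; omega) (by intro k hk hkS; simp at hkS; omega)
  · intro i j l hij hjl hl z _ h1 h2
    have e3 := q_cube
    have key : ∀ a b, a < b → b < 2 * n → (b < n ∨ n ≤ a) → z b = q ^ 2 * z a → Rb n z = 0 := by
      intro a b hab hb h hz
      unfold Rb
      refine prod_eq_zero (i := a) (by simp; omega) (prod_eq_zero (i := b) (by simp; omega) ?_)
      rw [if_pos ⟨hab, h⟩, hz]
      linear_combination (- q * z a) * e3
    by_cases h : j < n
    · exact key i j hij (by omega) (Or.inl h) h1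
    · exact key j l hjl hl (Or.inr (by omega)) h2

theorem prod_half (n : ℕ) (f : ℕ → ℂ) :
    ∏ l : Fin n, f l = ∏ l ∈ range (2 * n), if l < n then f l else 1 := by
  rw [Fin.prod_univ_eq_prod_range f, ← prod_filter]
  refine prod_congr ?_ fun _ _ => rfl
  ext x; simp; omega

theorem Phi_rainbow (n : ℕ) {z : ℕ → ℂ} (hz : Gen (2 * n) z) :
    Phi n (fun l => (l : ℕ) + 1) z = Rb n z := by
  unfold Phi TT
  beta_reduce
  rw [sum_eq_single (fun l : Fin n => (l : ℕ))]
  · set D : ℕ → ℂ := fun l => ∏ i ∈ range (2 * n), (if i = l then 1 else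
      if i < l + 1 then z l - z i else q * z l - q ^ 2 * z i) with hD
    have hw : ∀ l : Fin n, wt (2 * n) ((l : ℕ) + 1) z l = (D l)⁻¹ := by
      intro l
      unfold wt
      rw [if_pos (by omega), hD]
      beta_reduce
      rw [← mul_prod_erase (range (2 * n)) _ (a := (l : ℕ)) (by simp; omega), if_pos rfl, one_mul,
        ← prod_inv_distrib]
      refine prod_congr rfl fun i hi => ?_
      rw [if_neg (ne_of_mem_erase hi)]
    have hD0 : ∀ l < n, D l ≠ 0 := by
      intro l hl
      rw [hD]
      refine prod_ne_zero_iff.mpr fun i hi => ?_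
      have := mem_range.mp hi
      split_ifs with h1 h2
      · exact one_ne_zero
      · exact gen_ne hz (by omega) this (by omega)
      · exact gen_ne' hz (by omega) this (by omega)
    simp only [hw]
    rw [prod_inv_distrib]
    have hDn : ∏ l : Fin n, D l ≠ 0 := prod_ne_zero_iff.mpr fun l _ => hD0 l l.2
    have key : pre (2 * n) z * KK (fun l : Fin n => z l) = Rb n z * ∏ l : Fin n, D l := by
      have hK : KK (fun l : Fin n => z l) = (∏ i ∈ range (2 * n), ∏ k ∈ range (2 * n),
          if i < k ∧ k < n then z k - z i else 1) * ∏ i ∈ range (2 * n), ∏ k ∈ range (2 * n),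
          if i < k ∧ k < n then q * z i - q ^ 2 * z k else 1 := by
        unfold KK
        simp only [Fin.lt_def]
        rw [← prod_mul_distrib]
        simp only [← prod_mul_distrib]
        rw [prod_half n (fun l => ∏ m : Fin n, if l < m then (z m - z l) * (q * z l - q ^ 2 * z m) else 1)]
        refine prod_congr rfl fun i _ => ?_
        rw [prod_half n (fun m => if i < m then (z m - z i) * (q * z i - q ^ 2 * z m) else 1)]
        by_cases hi : i < n
        · rw [if_pos hi]
          refine prod_congr rfl fun k _ => ?_
          by_cases h1 : i < k <;> by_cases h2 : k < n <;> simp [h1, h2]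
        · rw [if_neg hi]
          symm
          refine prod_eq_one fun k _ => ?_
          rw [if_neg (by omega), if_neg (by omega), one_mul]
      have hDD : ∏ l : Fin n, D l = (∏ i ∈ range (2 * n), ∏ k ∈ range (2 * n),
          if i < k ∧ k < n then z k - z i else 1) * ∏ i ∈ range (2 * n), ∏ k ∈ range (2 * n),
          if i < k ∧ i < n then q * z i - q ^ 2 * z k else 1 := by
        rw [prod_comm (s := range (2 * n)), ← prod_mul_distrib, prod_half]
        refine prod_congr rfl fun l _ => ?_
        rw [← prod_mul_distrib, hD]
        by_cases h : l < n
        · rw [if_pos h]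
          refine prod_congr rfl fun i _ => ?_
          rcases lt_trichotomy i l with h1 | h1 | h1
          · rw [if_neg (by omega), if_pos (by omega), if_pos ⟨h1, h⟩, if_neg (by omega), mul_one]
          · rw [if_pos h1, if_neg (by omega), if_neg (by omega), one_mul]
          · rw [if_neg (by omega), if_neg (by omega), if_neg (by omega), if_pos ⟨h1, h⟩, one_mul]
        · rw [if_neg h]
          symm
          refine prod_eq_one fun k _ => ?_
          rw [if_neg (by omega), if_neg (by omega), one_mul]
      rw [hK, hDD]
      have : pre (2 * n) z * (∏ i ∈ range (2 * n), ∏ k ∈ range (2 * n),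
          if i < k ∧ k < n then q * z i - q ^ 2 * z k else 1) = Rb n z *
          ∏ i ∈ range (2 * n), ∏ k ∈ range (2 * n),
          if i < k ∧ i < n then q * z i - q ^ 2 * z k else 1 := by
        unfold pre Rb
        rw [← prod_mul_distrib, ← prod_mul_distrib]
        refine prod_congr rfl fun i _ => ?_
        rw [← prod_mul_distrib, ← prod_mul_distrib]
        refine prod_congr rfl fun k _ => ?_
        by_cases h1 : i < k <;> by_cases h2 : k < n <;> by_cases h3 : i < n <;>
          simp [h1, h2, h3] <;> omega
      linear_combination (∏ i ∈ range (2 * n), ∏ k ∈ range (2 * n),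
          if i < k ∧ k < n then z k - z i else 1) * this
    rw [mul_left_comm, key, mul_comm (Rb n z), inv_mul_cancel_left₀ hDn]
  · intro s _ hs
    by_contra hne
    have h1 := left_ne_zero_of_mul hne
    have h2 := right_ne_zero_of_mul hne
    have h3 : ∀ l, s l < (l : ℕ) + 1 := by
      intro l
      have := prod_ne_zero_iff.mp h1 l (mem_univ l)
      by_contra h
      apply this
      unfold wt
      rw [if_neg h]
    apply hs
    have : ∀ m, ∀ l : Fin n, (l : ℕ) = m → s l = l := by
      intro m
      induction m using Nat.strong_induction_on with
      | _ m ih =>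
        intro l hl
        by_contra h
        have h4 := h3 l
        have h5 := ih (s l) (by omega) ⟨s l, by omega⟩ rfl
        apply h2
        exact KK_zero _ (l := ⟨s l, by omega⟩) (m := l) (by intro h'; exact h (congrArg Fin.val h')) (by
          rw [h5])
    funext l
    exact this l l rfl
  · intro h
    exfalso; apply h
    rw [Fintype.mem_piFinset]
    intro l; simp; omega

def InW (n : ℕ) (a : Fin n → ℕ) : Prop := ∃ F ∈ W n, ∀ z, Gen (2 * n) z → F z = Phi n a z

theorem inW_raise {n j : ℕ} (hj : j + 1 < 2 * n) (a : Fin n → ℕ) (l0 : Fin n) (h0 : a l0 = j + 1)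
    (hne : ∀ l, l ≠ l0 → a l ≠ j + 1) (h1 : InW n a) (h2 : InW n (Function.update a l0 j)) :
    InW n (Function.update a l0 (j + 2)) := by
  obtain ⟨F, hF, hF'⟩ := h1
  obtain ⟨G, hG, hG'⟩ := h2
  obtain ⟨m, rfl⟩ : ∃ m, n = m + 1 := ⟨n - 1, by omega⟩
  obtain ⟨H, hH, hE⟩ := E_exists (show j < 2 * (m + 1) by omega) hF
  refine ⟨H - F - G, Submodule.sub_mem _ (Submodule.sub_mem _ hH hF) hG, ?_⟩
  intro z hz
  have hnx : nx (2 * (m + 1)) j = j + 1 := by unfold nx; rw [if_neg (by omega)]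
  have e1 := hE z
  rw [hnx, hF' z hz, hF' _ (gen_swap hz hj)] at e1
  have e2 := Phi_raise hj hz a l0 h0 hne
  rw [← e2] at e1
  have e3 := mul_left_cancel₀ (gen_ne hz (by omega) hj (by omega)) e1
  rw [Pi.sub_apply, Pi.sub_apply, hG' z hz, hF' z hz, e3]
  ring

theorem inW_all {n : ℕ} (b : Fin n → ℕ) (hb : StrictMono b) (hb1 : ∀ l : Fin n, (l : ℕ) + 1 ≤ b l)
    (hb2 : ∀ l, b l + 1 ≤ 2 * n) : InW n b := by
  have main : ∀ d l, l + d = n → InW n (fun i => if (i : ℕ) < l then (i : ℕ) + 1 else b i) := by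
    intro d
    induction d with
    | zero =>
      intro l hl
      refine ⟨Rb n, Rb_mem n, fun z hz => ?_⟩
      rw [← Phi_rainbow n hz]
      congr 1
      funext i
      rw [if_pos (by omega)]
    | succ d ih =>
      intro l hl
      set l0 : Fin n := ⟨l, by omega⟩ with hl0
      set c : ℕ → Fin n → ℕ := fun j i => if (i : ℕ) < l then (i : ℕ) + 1 else if (i : ℕ) = l then j else b i with hc
      have hcu : ∀ j j', Function.update (c j) l0 j' = c j' := by
        intro j j'
        funext i
        rw [Function.update_apply]
        simp only [hc, hl0, Fin.ext_iff]
        split_ifs <;> first | rfl | omega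
      have hz : InW n (c l) := by
        refine ⟨0, Submodule.zero_mem _, fun z _ => ?_⟩
        rw [Phi_pigeon (c l) l0, Pi.zero_apply]
        intro i hi
        have : (i : ℕ) ≤ l := hi
        simp only [hc, hl0]
        split_ifs <;> omega
      have h1 : InW n (c (l + 1)) := by
        have := ih (l + 1) (by omega)
        have h' : c (l + 1) = fun i : Fin n => if (i : ℕ) < l + 1 then (i : ℕ) + 1 else b i := by
          funext i
          simp only [hc]
          split_ifs <;> omega
        rw [h']
        exact this
      have hstep : ∀ e, l + 1 + e ≤ b l0 → InW n (c (l + e)) ∧ InW n (c (l + 1 + e)) := by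
        intro e
        induction e with
        | zero => intro _; exact ⟨hz, h1⟩
        | succ e ihe =>
          intro he
          have ih2 := ihe (by omega)
          refine ⟨by convert ih2.2 using 2; omega, ?_⟩
          have := inW_raise (n := n) (j := l + e) (by have := hb2 l0; omega) (c (l + 1 + e)) l0 (by
            simp only [hc, hl0]; simp; omega) (by
            intro i hi h
            have hi' : (i : ℕ) ≠ l := fun h => hi (Fin.ext h)
            simp only [hc, hi', if_false] at h
            split_ifs at h with h'
            · omega
            · have : b l0 < b i := hb (show l0 < i by rw [Fin.lt_def]; simp [hl0]; omega)
              omega) ih2.2 (by rw [hcu]; exact ih2.1)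
          rw [hcu] at this
          convert this using 2
          omega
      have := (hstep (b l0 - (l + 1)) (by have := hb1 l0; simp only [hl0] at this ⊢; omega)).2
      convert this using 2 with i
      have h5 := hb1 l0
      simp only [hc]
      split_ifs with h3 h4
      · rfl
      · have : i = l0 := Fin.ext h4
        rw [this]; simp only [hl0] at h5 ⊢; omega
      · rfl
  have := main n 0 (by omega)
  simpa using this

end ACP

namespace ACP
open Finset Filter Topology

theorem gen_nebot (N : ℕ) (z : ℕ → ℂ) : (𝓝[{z | Gen N z}] z).NeBot := by
  rw [← mem_closure_iff_nhdsWithin_neBot]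
  have hline : Continuous fun t : ℂ => (fun i => z i + t * ((i : ℂ) + 1) : ℕ → ℂ) := by
    fun_prop
  have hd : Dense {t : ℂ | Gen N (fun i => z i + t * ((i : ℂ) + 1))} := by
    have := (gen_finite N z).countable.dense_compl ℂ
    convert this using 1
    ext t; simp
  have h0 := hd 0
  have := hline.closure_preimage_subset {z | Gen N z} h0
  simpa using this

theorem gen_contAt {N : ℕ} {F G : (ℕ → ℂ) → ℂ} {z0 : ℕ → ℂ} (hF : ContinuousAt F z0)
    (hG : ContinuousAt G z0) (h : ∀ z, Gen N z → F z = G z) : F z0 = G z0 := by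
  have := gen_nebot N z0
  have h1 : Tendsto F (𝓝[{z | Gen N z}] z0) (𝓝 (F z0)) := hF.tendsto.mono_left nhdsWithin_le_nhds
  have h2 : Tendsto G (𝓝[{z | Gen N z}] z0) (𝓝 (G z0)) := hG.tendsto.mono_left nhdsWithin_le_nhds
  refine tendsto_nhds_unique h1 (h2.congr' ?_)
  filter_upwards [self_mem_nhdsWithin] with z hz
  exact (h z hz).symm

def GenI (M : ℕ) (y : ℕ → ℂ) (t : ℂ) : Prop := Gen M y ∧ t ≠ 0 ∧ ∀ i < M, y i ^ 3 ≠ t ^ 3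

theorem ins_sh (j : ℕ) (t : ℂ) (y : ℕ → ℂ) (i : ℕ) : ins j t y (sh j i) = y i := by
  unfold ins sh; split_ifs <;> first | rfl | omega
theorem ins_j (j : ℕ) (t : ℂ) (y : ℕ → ℂ) : ins j t y j = t := by simp [ins]
theorem ins_j1 (j : ℕ) (t : ℂ) (y : ℕ → ℂ) : ins j t y (j + 1) = q ^ 2 * t := by simp [ins]

theorem sh_cases {M j i : ℕ} (hj : j ≤ M) (hi : i < M + 2) : i = j ∨ i = j + 1 ∨ ∃ k < M, i = sh j k := by
  by_cases h : i < j
  · exact Or.inr (Or.inr ⟨i, by omega, by simp [sh, h]⟩)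
  · by_cases h1 : i = j
    · exact Or.inl h1
    · by_cases h2 : i = j + 1
      · exact Or.inr (Or.inl h2)
      · exact Or.inr (Or.inr ⟨i - 2, by omega, by unfold sh; rw [if_neg (by omega)]; omega⟩)

theorem ins_cube {M j : ℕ} (hj : j ≤ M) {y : ℕ → ℂ} {t : ℂ} (h : GenI M y t) {a b : ℕ} (ha : a < M + 2)
    (hb : b < M + 2) (hab : a ≠ b) (hx : ins j t y a ^ 3 = ins j t y b ^ 3) :
    (a = j ∧ b = j + 1) ∨ (a = j + 1 ∧ b = j) := by
  have e : (q ^ 2 * t) ^ 3 = t ^ 3 := by linear_combination (q ^ 3 + 1) * t ^ 3 * q_cube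
  rcases sh_cases hj ha with rfl | rfl | ⟨k, hk, rfl⟩ <;> rcases sh_cases hj hb with h' | h' | ⟨k', hk', h'⟩ <;>
    (try subst h') <;> simp only [ins_sh, ins_j, ins_j1, e] at hx
  · omega
  · omega
  · exact absurd hx.symm (h.2.2 _ hk')
  · omega
  · omega
  · exact absurd hx.symm (h.2.2 _ hk')
  · exact absurd hx (h.2.2 _ hk)
  · exact absurd hx (h.2.2 _ hk)
  · exact absurd hx (h.1.2 _ hk _ hk' (by rintro rfl; exact hab rfl))

theorem ins_sub {M j : ℕ} (hj : j ≤ M) {y : ℕ → ℂ} {t : ℂ} (h : GenI M y t) {a b : ℕ} (ha : a < M + 2)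
    (hb : b < M + 2) (hab : a ≠ b) : ins j t y a - ins j t y b ≠ 0 := by
  intro h0
  have h1 := sub_eq_zero.mp h0
  have h2 : t ≠ q ^ 2 * t := by
    intro h'
    have : (q ^ 2 - 1) * t = 0 := by linear_combination -h'
    rcases mul_eq_zero.mp this with h'' | h''
    · exact q_sq_ne_one (sub_eq_zero.mp h'')
    · exact h.2.1 h''
  rcases ins_cube hj h ha hb hab (by rw [h1]) with ⟨rfl, rfl⟩ | ⟨rfl, rfl⟩
  · rw [ins_j, ins_j1] at h1; exact h2 h1
  · rw [ins_j, ins_j1] at h1; exact h2 h1.symm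

theorem ins_sub' {M j : ℕ} (hj : j ≤ M) {y : ℕ → ℂ} {t : ℂ} (h : GenI M y t) {a b : ℕ} (ha : a < M + 2)
    (hb : b < M + 2) (hab : a < b) (hne : ¬ (a = j ∧ b = j + 1)) :
    q * ins j t y a - q ^ 2 * ins j t y b ≠ 0 := by
  intro h0
  have h1 : ins j t y a = q * ins j t y b := by
    apply mul_left_cancel₀ q_ne_zero
    linear_combination h0
  rcases ins_cube hj h ha hb hab.ne (by rw [h1, mul_pow, q_cube, one_mul]) with h' | h'
  · exact hne h'
  · omega

theorem wt_contAt {M j : ℕ} (hj : j ≤ M) {y : ℕ → ℂ} {t : ℂ} (h : GenI M y t) {a s : ℕ} (hs : s < M + 2)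
    (has : a ≠ j + 1 ∨ s ≠ j) : ContinuousAt (fun z => wt (M + 2) a z s) (ins j t y) := by
  unfold wt
  by_cases hsa : s < a
  · simp only [if_pos hsa]
    refine tendsto_finsetProd _ fun i hi => ?_
    have hi1 := ne_of_mem_erase hi
    have hi2 := mem_range.mp (mem_of_mem_erase hi)
    by_cases hia : i < a
    · simp only [if_pos hia]
      exact ContinuousAt.inv₀ (by fun_prop) (ins_sub hj h hs hi2 (Ne.symm hi1))
    · simp only [if_neg hia]
      exact ContinuousAt.inv₀ (by fun_prop) (ins_sub' hj h hs hi2 (by omega) (by omega))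
  · simp only [if_neg hsa]
    exact continuousAt_const

theorem KK_cont {n : ℕ} (s : Fin n → ℕ) : Continuous fun z : ℕ → ℂ => KK (fun l => z (s l)) := by
  unfold KK
  refine continuous_finsetProd _ fun i _ => continuous_finsetProd _ fun k _ => ?_
  split_ifs <;> fun_prop

theorem pre_cont (N : ℕ) : Continuous (pre N) := by
  unfold pre
  refine continuous_finsetProd _ fun i _ => continuous_finsetProd _ fun k _ => ?_
  split_ifs <;> fun_prop

theorem Phi_restrict_zero {m j : ℕ} (hj : j ≤ 2 * m) (a : Fin (m + 1) → ℕ) (ha : ∀ l, a l ≠ j + 1)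
    {F : (ℕ → ℂ) → ℂ} (hF : Continuous F) (hFP : ∀ z, Gen (2 * (m + 1)) z → F z = Phi (m + 1) a z)
    {y : ℕ → ℂ} {t : ℂ} (h : GenI (2 * m) y t) : F (ins j t y) = 0 := by
  have e := gen_contAt (z0 := ins j t y) hF.continuousAt (G := Phi (m + 1) a) (by
    unfold Phi TT
    refine (pre_cont _).continuousAt.mul ?_
    refine tendsto_finsetSum _ fun s hs => ?_
    refine ContinuousAt.mul ?_ (KK_cont s).continuousAt
    refine tendsto_finsetProd _ fun l _ => ?_
    have := mem_range.mp (Fintype.mem_piFinset.mp hs l)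
    exact wt_contAt hj h (by omega) (Or.inl (ha l))) hFP
  rw [e]
  unfold Phi
  have : pre (2 * (m + 1)) (ins j t y) = 0 := by
    unfold pre
    refine prod_eq_zero (i := j) (by simp; omega) (prod_eq_zero (i := j + 1) (by simp; omega) ?_)
    rw [if_pos (by omega), ins_j, ins_j1]
    linear_combination (- q * t) * q_cube
  rw [this, zero_mul]

theorem prod_sh {M j : ℕ} (hj : j ≤ M) (g : ℕ → ℂ) :
    ∏ i ∈ range (M + 2), g i = g j * g (j + 1) * ∏ i ∈ range M, g (sh j i) := by
  rw [← mul_prod_erase (range (M + 2)) g (a := j) (by simp; omega),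
    ← mul_prod_erase ((range (M + 2)).erase j) g (a := j + 1) (by simp; omega), mul_assoc]
  congr 2
  symm
  refine prod_nbij (sh j) ?_ ?_ ?_ (fun _ _ => rfl)
  · intro i hi
    have := mem_range.mp hi
    simp only [mem_erase, mem_range, sh]
    split_ifs <;> omega
  · intro a _ b _ hab
    simp only [sh] at hab
    split_ifs at hab <;> omega
  · intro i hi
    simp only [coe_erase, coe_range, Set.mem_sdiff, Set.mem_Iio, Set.mem_singleton_iff] at hi
    rcases sh_cases hj hi.1.1 with h | h | ⟨k, hk, rfl⟩
    · exact absurd h hi.1.2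
    · exact absurd h hi.2
    · exact ⟨k, by simpa using hk, rfl⟩

end ACP

namespace ACP
open Finset Filter Topology

noncomputable def preP (N j : ℕ) (z : ℕ → ℂ) : ℂ :=
  ∏ i ∈ range N, ∏ k ∈ range N, if i < k ∧ ¬ (i = j ∧ k = j + 1) then q * z i - q ^ 2 * z k else 1

noncomputable def wtP (N j : ℕ) (z : ℕ → ℂ) : ℂ :=
  ∏ i ∈ range N, if i = j ∨ i = j + 1 then 1 else (if i < j + 1 then z j - z i else q * z j - q ^ 2 * z i)⁻¹

theorem pre_eq {N j : ℕ} (hj : j + 1 < N) (z : ℕ → ℂ) :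
    pre N z = (q * z j - q ^ 2 * z (j + 1)) * preP N j z := by
  have : (q * z j - q ^ 2 * z (j + 1)) = ∏ i ∈ range N, ∏ k ∈ range N,
      if i = j ∧ k = j + 1 then q * z i - q ^ 2 * z k else 1 := by
    rw [prod_eq_single j, prod_eq_single (j + 1)]
    · simp
    · intro k _ hk; rw [if_neg (by omega)]
    · intro h; exact absurd (mem_range.mpr hj) h
    · intro i _ hi; exact prod_eq_one fun k _ => by rw [if_neg (by omega)]
    · intro h; exact absurd (mem_range.mpr (by omega)) h
  rw [this]
  unfold pre preP
  rw [← prod_mul_distrib]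
  refine prod_congr rfl fun i _ => ?_
  rw [← prod_mul_distrib]
  refine prod_congr rfl fun k _ => ?_
  by_cases h1 : i = j ∧ k = j + 1
  · rw [if_pos (by omega), if_pos h1, if_neg (by omega), mul_one]
  · by_cases h2 : i < k
    · rw [if_pos h2, if_neg h1, if_pos ⟨h2, h1⟩, one_mul]
    · rw [if_neg h2, if_neg h1, if_neg (by omega), one_mul]

theorem wt_range {N a s : ℕ} (z : ℕ → ℂ) (hs : s < N) (hsa : s < a) : wt N a z s =
    ∏ i ∈ range N, if i = s then 1 else (if i < a then z s - z i else q * z s - q ^ 2 * z i)⁻¹ := by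
  unfold wt
  rw [if_pos hsa, ← mul_prod_erase (range N) _ (a := s) (by simpa using hs), if_pos rfl, one_mul]
  refine prod_congr rfl fun i hi => ?_
  rw [if_neg (ne_of_mem_erase hi)]

theorem wt_j {N j : ℕ} (hj : j + 1 < N) (z : ℕ → ℂ) :
    wt N (j + 1) z j = (q * z j - q ^ 2 * z (j + 1))⁻¹ * wtP N j z := by
  rw [wt_range z (by omega) (by omega)]
  unfold wtP
  rw [← mul_prod_erase (range N) _ (a := j + 1) (by simpa using hj),
    ← mul_prod_erase (range N) (fun i => if i = j ∨ i = j + 1 then 1 else (if i < j + 1 then z j - z i else q * z j - q ^ 2 * z i)⁻¹) (a := j + 1) (by simpa using hj)]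
  simp only [Nat.succ_ne_self, if_false, lt_irrefl, or_true, if_true, one_mul]
  congr 1
  refine prod_congr rfl fun i hi => ?_
  have := ne_of_mem_erase hi
  by_cases h : i = j
  · rw [if_pos h, if_pos (Or.inl h)]
  · have h' : ¬ (i = j ∨ i = j + 1) := by omega
    rw [if_neg h, if_neg h']

noncomputable def uu (N j : ℕ) (z : ℕ → ℂ) (s : ℕ) : ℂ :=
  if s = j then wtP N j z else (q * z j - q ^ 2 * z (j + 1)) * wt N (j + 1) z s

noncomputable def PhiP (m j : ℕ) (a : Fin (m + 1) → ℕ) (l0 : Fin (m + 1)) (z : ℕ → ℂ) : ℂ :=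
  ∑ s ∈ Fintype.piFinset (fun _ : Fin (m + 1) => range (2 * m + 2)),
    preP (2 * m + 2) j z * uu (2 * m + 2) j z (s l0) *
      (∏ l : Fin m, wt (2 * m + 2) (a (l0.succAbove l)) z (s (l0.succAbove l))) * KK (fun l => z (s l))

theorem Phi_PhiP {m j : ℕ} (hj : j ≤ 2 * m) (a : Fin (m + 1) → ℕ) (l0 : Fin (m + 1)) (h0 : a l0 = j + 1)
    {z : ℕ → ℂ} (hz : Gen (2 * (m + 1)) z) : Phi (m + 1) a z = PhiP m j a l0 z := by
  unfold Phi TT PhiP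
  rw [mul_sum]
  refine sum_congr rfl fun s _ => ?_
  have hP : q * z j - q ^ 2 * z (j + 1) ≠ 0 := gen_ne' hz (by omega) (by omega) (by omega)
  rw [Fin.prod_univ_succAbove _ l0]
  beta_reduce
  rw [h0, pre_eq (j := j) (by omega)]
  have : (q * z j - q ^ 2 * z (j + 1)) * wt (2 * (m + 1)) (j + 1) z (s l0) = uu (2 * m + 2) j z (s l0) := by
    unfold uu
    by_cases h : s l0 = j
    · rw [if_pos h, h, wt_j (by omega), mul_inv_cancel_left₀ hP]; rfl
    · rw [if_neg h]; rfl
  rw [← this]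
  change _ * preP (2 * m + 2) j z * _ = _
  change (q * z j - q ^ 2 * z (j + 1)) * preP (2 * m + 2) j z * (wt (2 * m + 2) _ _ _ * _ * _) = _ * (_ * wt (2 * m + 2) _ _ _) * _ * _
  ring

theorem preP_cont (N j : ℕ) : Continuous (preP N j) := by
  unfold preP
  refine continuous_finsetProd _ fun i _ => continuous_finsetProd _ fun k _ => ?_
  split_ifs <;> fun_prop

theorem wtP_contAt {M j : ℕ} (hj : j ≤ M) {y : ℕ → ℂ} {t : ℂ} (h : GenI M y t) :
    ContinuousAt (wtP (M + 2) j) (ins j t y) := by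
  unfold wtP
  refine tendsto_finsetProd _ fun i hi => ?_
  have := mem_range.mp hi
  by_cases h1 : i = j ∨ i = j + 1
  · simp only [if_pos h1]; exact continuousAt_const
  · simp only [if_neg h1]
    by_cases hia : i < j + 1
    · simp only [if_pos hia]
      exact ContinuousAt.inv₀ (by fun_prop) (ins_sub hj h (by omega) this (by omega))
    · simp only [if_neg hia]
      exact ContinuousAt.inv₀ (by fun_prop) (ins_sub' hj h (by omega) this (by omega) (by omega))

theorem PhiP_contAt {m j : ℕ} (hj : j ≤ 2 * m) (a : Fin (m + 1) → ℕ) (l0 : Fin (m + 1))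
    (hne : ∀ l, l ≠ l0 → a l ≠ j + 1) {y : ℕ → ℂ} {t : ℂ} (h : GenI (2 * m) y t) :
    ContinuousAt (PhiP m j a l0) (ins j t y) := by
  unfold PhiP
  refine tendsto_finsetSum _ fun s hs => ?_
  have hs' := fun l => mem_range.mp (Fintype.mem_piFinset.mp hs l)
  refine ContinuousAt.mul (ContinuousAt.mul ((preP_cont _ _).continuousAt.mul ?_) ?_) (KK_cont s).continuousAt
  · unfold uu
    by_cases h1 : s l0 = j
    · simp only [if_pos h1]; exact wtP_contAt hj h
    · simp only [if_neg h1]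
      exact ContinuousAt.mul (by fun_prop) (wt_contAt hj h (hs' _) (Or.inr h1))
  · refine tendsto_finsetProd _ fun l _ => ?_
    exact wt_contAt hj h (hs' _) (Or.inl (hne _ (Fin.succAbove_ne l0 l)))

theorem preP_ins {M j : ℕ} (hj : j ≤ M) {y : ℕ → ℂ} {t : ℂ} (h : GenI M y t) :
    preP (M + 2) j (ins j t y) * wtP (M + 2) j (ins j t y) =
      (∏ i ∈ range M, (- q ^ 2) * (y i - q * t)) * pre M y := by
  have e1 : preP (M + 2) j (ins j t y) = ((∏ i ∈ range M, if i < j then 1 else q * t - q ^ 2 * y i) *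
     (∏ i ∈ range M, if i < j then 1 else t - q ^ 2 * y i)) *
     (∏ i ∈ range M, ((if i < j then (q * y i - q ^ 2 * t) * (q * y i - q * t) else 1) *
      ∏ k ∈ range M, if i < k then q * y i - q ^ 2 * y k else 1)) := by
    unfold preP
    rw [prod_sh hj, prod_sh hj, prod_sh hj]
    have hc := q_cube
    have s1 : ∀ i, j < sh j i ↔ ¬ i < j := by intro i; unfold sh; split_ifs <;> omega
    have s2 : ∀ i, j + 1 < sh j i ↔ ¬ i < j := by intro i; unfold sh; split_ifs <;> omega
    have s3 : ∀ i, sh j i ≠ j + 1 := by intro i; unfold sh; split_ifs <;> omega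
    have s4 : ∀ i, sh j i ≠ j := by intro i; unfold sh; split_ifs <;> omega
    congr 1
    · congr 1
      · simp only [lt_irrefl, false_and, if_false, true_and, not_true_eq_false, and_false, one_mul, ins_sh, ins_j, s1, s3, not_false_eq_true, and_true]
        refine prod_congr rfl fun i _ => ?_
        split_ifs <;> rfl
      · have : ¬ (j + 1 < j) := by omega
        simp only [this, lt_irrefl, false_and, if_false, and_false, one_mul, ins_sh, ins_j1, s2, not_false_eq_true, and_true, Nat.succ_ne_self]
        refine prod_congr rfl fun i _ => ?_
        split_ifs
        · rfl
        · linear_combination t * hc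
    · refine prod_congr rfl fun i _ => ?_
      rw [prod_sh hj]
      congr 1
      · simp only [s4, ins_sh, ins_j, ins_j1, false_and, not_false_eq_true, and_true]
        by_cases hi : i < j
        · have : sh j i = i := by unfold sh; rw [if_pos hi]
          rw [this, if_pos hi, if_pos (by omega), if_pos (by omega)]
          linear_combination (- q * t * (q * y i - q ^ 2 * t)) * hc
        · have : sh j i = i + 2 := by unfold sh; rw [if_neg hi]
          rw [this, if_neg hi, if_neg (by omega), if_neg (by omega), one_mul]
      · refine prod_congr rfl fun k _ => ?_
        simp only [s4, ins_sh, false_and, not_false_eq_true, and_true]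
        have : sh j i < sh j k ↔ i < k := by unfold sh; split_ifs <;> omega
        simp only [this]
  have e2 : wtP (M + 2) j (ins j t y) = ∏ i ∈ range M, (if i < j then t - y i else q * t - q ^ 2 * y i)⁻¹ := by
    unfold wtP
    rw [prod_sh hj]
    simp only [true_or, or_true, if_true, one_mul, ins_sh, ins_j]
    refine prod_congr rfl fun i _ => ?_
    have s3 : sh j i ≠ j + 1 := by unfold sh; split_ifs <;> omega
    have s4 : sh j i ≠ j := by unfold sh; split_ifs <;> omega
    have s5 : sh j i < j + 1 ↔ i < j := by unfold sh; split_ifs <;> omega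
    rw [if_neg (by omega)]
    simp only [s5]
  rw [e1, e2]
  unfold pre
  rw [← prod_mul_distrib, ← prod_mul_distrib, ← prod_mul_distrib, ← prod_mul_distrib]
  refine prod_congr rfl fun i hi => ?_
  have hi := mem_range.mp hi
  have hc := q_cube
  generalize (∏ k ∈ range M, if i < k then q * y i - q ^ 2 * y k else 1) = X
  by_cases hij : i < j
  · simp only [if_pos hij]
    have h1 : t - y i ≠ 0 := by
      intro h'; apply h.2.2 i hi; rw [sub_eq_zero.mp h']
    field_simp
    linear_combination (0 : ℂ) * hc
  · simp only [if_neg hij]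
    have h1 : q * t - q ^ 2 * y i ≠ 0 := by
      intro h'
      apply h.2.2 i hi
      have : t = q * y i := by
        apply mul_left_cancel₀ q_ne_zero; linear_combination h'
      rw [this, mul_pow, hc, one_mul]
    rw [one_mul]
    have : (q * t - q ^ 2 * y i) * (t - q ^ 2 * y i) * X * (q * t - q ^ 2 * y i)⁻¹ = (t - q ^ 2 * y i) * X := by
      rw [mul_assoc (q * t - q ^ 2 * y i), mul_comm (q * t - q ^ 2 * y i), mul_assoc, mul_inv_cancel₀ h1, mul_one]
    rw [this]
    linear_combination (-t * X) * hc

theorem wt_ins_lo {M j : ℕ} (hj : j ≤ M) {y : ℕ → ℂ} {t : ℂ} (h : GenI M y t) {a s : ℕ} (hs : s < M)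
    (ha : a ≤ j) : wt (M + 2) a (ins j t y) (sh j s) * ((t - y s) * (q * y s - q ^ 2 * t)) =
      (- q ^ 2) * wt M a y s := by
  by_cases hsa : s < a
  · have hss : sh j s = s := by unfold sh; rw [if_pos (by omega)]
    rw [wt_range _ (by rw [hss]; omega) (by rw [hss]; exact hsa), wt_range _ hs hsa, prod_sh hj]
    have e : (∏ i ∈ range M, if sh j i = sh j s then 1 else
        (if sh j i < a then ins j t y (sh j s) - ins j t y (sh j i) else
          q * ins j t y (sh j s) - q ^ 2 * ins j t y (sh j i))⁻¹) =
        ∏ i ∈ range M, if i = s then 1 else (if i < a then y s - y i else q * y s - q ^ 2 * y i)⁻¹ := by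
      refine prod_congr rfl fun i _ => ?_
      have s1 : sh j i = sh j s ↔ i = s := by unfold sh; split_ifs <;> omega
      have s2 : sh j i < a ↔ i < a := by unfold sh; split_ifs <;> omega
      simp only [s1, s2, ins_sh]
    rw [e, ins_sh, ins_j, ins_j1]
    generalize (∏ i ∈ range M, if i = s then 1 else (if i < a then y s - y i else q * y s - q ^ 2 * y i)⁻¹) = X
    rw [if_neg (by rw [hss]; omega), if_neg (by omega), if_neg (by rw [hss]; omega), if_neg (by omega)]
    have hc := q_cube
    have h1 : y s - t ≠ 0 := by
      intro h'; apply h.2.2 s hs; rw [sub_eq_zero.mp h']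
    have h2 : q * y s - q ^ 2 * t ≠ 0 := by
      intro h'
      apply h.2.2 s hs
      have : y s = q * t := by
        apply mul_left_cancel₀ q_ne_zero; linear_combination h'
      rw [this, mul_pow, hc, one_mul]
    have h3 : q * y s - q ^ 2 * (q ^ 2 * t) = q * (y s - t) := by linear_combination (-q * t) * hc
    rw [h3]
    have h4 := q_ne_zero
    generalize q * y s - q ^ 2 * t = A at *
    rw [show t - y s = - (y s - t) by ring]
    generalize y s - t = B at *
    rw [mul_inv, q_inv]
    field_simp
  · have : ¬ sh j s < a := by unfold sh; split_ifs <;> omega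
    unfold wt
    rw [if_neg this, if_neg hsa]; ring

theorem wt_ins_hi {M j : ℕ} (hj : j ≤ M) {y : ℕ → ℂ} {t : ℂ} (h : GenI M y t) {a s : ℕ} (hs : s < M)
    (ha : j + 2 ≤ a) : wt (M + 2) a (ins j t y) (sh j s) * ((y s - t) * (q * t - q ^ 2 * y s)) =
      (- q ^ 2) * wt M (a - 2) y s := by
  by_cases hsa : s < a - 2
  · have hss : sh j s < a := by unfold sh; split_ifs <;> omega
    have hss2 : sh j s ≠ j ∧ sh j s ≠ j + 1 ∧ sh j s < M + 2 := by unfold sh; split_ifs <;> omega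
    rw [wt_range _ hss2.2.2 hss, wt_range _ hs hsa, prod_sh hj]
    have e : (∏ i ∈ range M, if sh j i = sh j s then 1 else
        (if sh j i < a then ins j t y (sh j s) - ins j t y (sh j i) else
          q * ins j t y (sh j s) - q ^ 2 * ins j t y (sh j i))⁻¹) =
        ∏ i ∈ range M, if i = s then 1 else (if i < a - 2 then y s - y i else q * y s - q ^ 2 * y i)⁻¹ := by
      refine prod_congr rfl fun i _ => ?_
      have s1 : sh j i = sh j s ↔ i = s := by unfold sh; split_ifs <;> omega
      have s2 : sh j i < a ↔ i < a - 2 := by unfold sh; split_ifs <;> omega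
      simp only [s1, s2, ins_sh]
    rw [e, ins_sh, ins_j, ins_j1]
    generalize (∏ i ∈ range M, if i = s then 1 else (if i < a - 2 then y s - y i else q * y s - q ^ 2 * y i)⁻¹) = X
    rw [if_neg (by omega), if_pos (by omega), if_neg (by omega), if_pos (by omega)]
    have hc := q_cube
    have h1 : y s - t ≠ 0 := by
      intro h'; apply h.2.2 s hs; rw [sub_eq_zero.mp h']
    have h2 : y s - q ^ 2 * t ≠ 0 := by
      intro h'
      apply h.2.2 s hs
      rw [sub_eq_zero.mp h', mul_pow]; linear_combination (q ^ 3 + 1) * t ^ 3 * hc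
    have h3 : q * t - q ^ 2 * y s = - q ^ 2 * (y s - q ^ 2 * t) := by linear_combination (-q * t) * hc
    rw [h3]
    generalize y s - q ^ 2 * t = A at *
    generalize y s - t = B at *
    field_simp
  · have : ¬ sh j s < a := by unfold sh; split_ifs <;> omega
    unfold wt
    rw [if_neg this, if_neg hsa]; ring

end ACP

namespace ACP
open Finset Filter Topology

theorem KK_succAbove {m : ℕ} (w : Fin (m + 1) → ℂ) (l0 : Fin (m + 1)) :
    KK w = (∏ l : Fin m, if l0.succAbove l < l0 then
      (w l0 - w (l0.succAbove l)) * (q * w (l0.succAbove l) - q ^ 2 * w l0) else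
      (w (l0.succAbove l) - w l0) * (q * w l0 - q ^ 2 * w (l0.succAbove l))) *
      KK (fun l => w (l0.succAbove l)) := by
  unfold KK
  rw [Fin.prod_univ_succAbove _ l0, Fin.prod_univ_succAbove _ l0]
  simp only [lt_irrefl, if_false, one_mul]
  have : ∀ l : Fin m, (∏ k : Fin (m + 1), if l0.succAbove l < k then
      (w k - w (l0.succAbove l)) * (q * w (l0.succAbove l) - q ^ 2 * w k) else 1) =
      (if l0.succAbove l < l0 then (w l0 - w (l0.succAbove l)) * (q * w (l0.succAbove l) - q ^ 2 * w l0) else 1) *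
      ∏ k : Fin m, if l < k then (w (l0.succAbove k) - w (l0.succAbove l)) *
        (q * w (l0.succAbove l) - q ^ 2 * w (l0.succAbove k)) else 1 := by
    intro l
    rw [Fin.prod_univ_succAbove _ l0]
    simp only [Fin.succAbove_lt_succAbove_iff]
  simp only [this]
  rw [prod_mul_distrib, ← mul_assoc, ← prod_mul_distrib]
  congr 1
  refine prod_congr rfl fun l _ => ?_
  have hne := Fin.succAbove_ne l0 l
  rcases lt_or_gt_of_ne hne with h | h
  · rw [if_neg (by exact not_lt_of_gt h), if_pos h, if_pos h, one_mul]
  · rw [if_pos h, if_neg (not_lt_of_gt h), if_neg (not_lt_of_gt h), mul_one]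

theorem Phi_restrict {m j : ℕ} (hj : j ≤ 2 * m) (a : Fin (m + 1) → ℕ) (l0 : Fin (m + 1)) (h0 : a l0 = j + 1)
    (hlo : ∀ l, l < l0 → a l ≤ j) (hhi : ∀ l, l0 < l → j + 2 ≤ a l)
    {F : (ℕ → ℂ) → ℂ} (hF : Continuous F) (hFP : ∀ z, Gen (2 * (m + 1)) z → F z = Phi (m + 1) a z)
    {y : ℕ → ℂ} {t : ℂ} (h : GenI (2 * m) y t) :
    F (ins j t y) = (-1) ^ m * (∏ i ∈ range (2 * m), (y i - q * t)) *
      Phi m (fun l => if a (l0.succAbove l) ≤ j then a (l0.succAbove l) else a (l0.succAbove l) - 2) y := by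
  have e : F (ins j t y) = PhiP m j a l0 (ins j t y) := by
    refine gen_contAt (N := 2 * (m + 1)) hF.continuousAt (PhiP_contAt hj a l0 ?_ h) ?_
    · intro l hl
      rcases lt_or_gt_of_ne hl with h' | h'
      · have := hlo l h'; omega
      · have := hhi l h'; omega
    · intro z hz; rw [hFP z hz, Phi_PhiP hj a l0 h0 hz]
  rw [e]
  unfold PhiP Phi TT
  rw [mul_sum, mul_sum]
  symm
  refine sum_of_injOn (fun s => l0.insertNth j (fun l => sh j (s l))) ?_ ?_ ?_ ?_
  · intro s _ s' _ hss
    funext l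
    have := congrFun hss (l0.succAbove l)
    simp only [Fin.insertNth_apply_succAbove] at this
    unfold sh at this
    split_ifs at this <;> omega
  · intro s hs
    simp only [mem_coe, Fintype.mem_piFinset, mem_range] at hs ⊢
    intro l
    rcases Fin.eq_self_or_eq_succAbove l0 l with rfl | ⟨k, rfl⟩
    · rw [Fin.insertNth_apply_same]; omega
    · rw [Fin.insertNth_apply_succAbove]
      have := hs k
      unfold sh; split_ifs <;> omega
  · intro s hs hns
    have hs' := fun l => mem_range.mp (Fintype.mem_piFinset.mp hs l)
    by_contra hne
    have hK := right_ne_zero_of_mul hne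
    have hne2 := left_ne_zero_of_mul hne
    have hw := prod_ne_zero_iff.mp (right_ne_zero_of_mul hne2)
    have hu := right_ne_zero_of_mul (left_ne_zero_of_mul hne2)
    have hl0 : s l0 = j := by
      by_contra h'
      apply hu
      unfold uu
      rw [if_neg h', ins_j, ins_j1]
      rw [show q * t - q ^ 2 * (q ^ 2 * t) = 0 by linear_combination (-q * t) * q_cube, zero_mul]
    apply hns
    have hex : ∀ l : Fin m, ∃ k < 2 * m, s (l0.succAbove l) = sh j k := by
      intro l
      rcases sh_cases hj (hs' (l0.succAbove l)) with h1 | h1 | h1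
      · exfalso; apply hK
        refine KK_zero _ (Fin.succAbove_ne l0 l) ?_
        rw [h1, hl0]
      · exfalso
        rcases lt_or_gt_of_ne (Fin.succAbove_ne l0 l) with h2 | h2
        · apply hw l (mem_univ l)
          unfold wt
          rw [if_neg]
          have := hlo _ h2; omega
        · apply hK
          unfold KK
          refine prod_eq_zero (mem_univ l0) (prod_eq_zero (mem_univ (l0.succAbove l)) ?_)
          rw [if_pos h2]
          beta_reduce
          rw [h1, hl0, ins_j, ins_j1]
          linear_combination (-q * t * (q ^ 2 * t - t)) * q_cube
      · exact h1
    choose k hk hk' using hex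
    refine ⟨k, ?_, ?_⟩
    · simpa using hk
    · funext l
      beta_reduce
      rcases Fin.eq_self_or_eq_succAbove l0 l with rfl | ⟨i, rfl⟩
      · rw [Fin.insertNth_apply_same, hl0]
      · rw [Fin.insertNth_apply_succAbove, hk']
  · intro s hs
    have hs' := fun l => mem_range.mp (Fintype.mem_piFinset.mp hs l)
    rw [KK_succAbove _ l0]
    simp only [Fin.insertNth_apply_same, Fin.insertNth_apply_succAbove, ins_sh, ins_j]
    have hu : uu (2 * m + 2) j (ins j t y) j = wtP (2 * m + 2) j (ins j t y) := by
      unfold uu; rw [if_pos rfl]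
    rw [hu, preP_ins hj h]
    have e2 : ∀ l : Fin m, wt (2 * m + 2) (a (l0.succAbove l)) (ins j t y) (sh j (s l)) *
        (if l0.succAbove l < l0 then (t - y (s l)) * (q * y (s l) - q ^ 2 * t) else
          (y (s l) - t) * (q * t - q ^ 2 * y (s l))) = (- q ^ 2) *
        wt (2 * m) (if a (l0.succAbove l) ≤ j then a (l0.succAbove l) else a (l0.succAbove l) - 2) y (s l) := by
      intro l
      rcases lt_or_gt_of_ne (Fin.succAbove_ne l0 l) with h2 | h2
      · rw [if_pos h2, if_pos (hlo _ h2), wt_ins_lo hj h (hs' l) (hlo _ h2)]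
      · have := hhi _ h2
        rw [if_neg (not_lt_of_gt h2), if_neg (by omega), wt_ins_hi hj h (hs' l) this]
    have e4 := prod_congr (s₁ := univ) rfl fun (l : Fin m) _ => e2 l
    rw [prod_mul_distrib, prod_mul_distrib, prod_const, card_univ, Fintype.card_fin] at e4
    rw [prod_mul_distrib, prod_const, card_range]
    have e3 : (- q ^ 2) ^ (2 * m) * (- q ^ 2) ^ m = (-1) ^ m := by
      rw [← pow_add, show 2 * m + m = 3 * m by ring, pow_mul]
      congr 1
      linear_combination (- q ^ 3 - 1) * q_cube
    rw [← e3]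
    linear_combination (-(- q ^ 2) ^ (2 * m) * (∏ i ∈ range (2 * m), (y i - q * t)) * pre (2 * m) y * KK (fun l => y (s l))) * e4

end ACP

namespace ACP
open Finset Filter Topology

noncomputable def AS (n k c : ℕ) : Finset (Fin n → ℕ) :=
  (Fintype.piFinset (fun _ : Fin n => range (2 * n))).filter (fun a =>
    (∀ l : Fin n, (l : ℕ) < k → a l = (l : ℕ) + 1) ∧ (∀ l : Fin n, k ≤ (l : ℕ) → c ≤ a l) ∧
    ∀ l m : Fin n, k ≤ (l : ℕ) → l < m → a l / 2 < a m / 2)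

theorem mem_AS {n k c : ℕ} {a : Fin n → ℕ} : a ∈ AS n k c ↔ (∀ l, a l < 2 * n) ∧
    (∀ l : Fin n, (l : ℕ) < k → a l = (l : ℕ) + 1) ∧ (∀ l : Fin n, k ≤ (l : ℕ) → c ≤ a l) ∧
    ∀ l m : Fin n, k ≤ (l : ℕ) → l < m → a l / 2 < a m / 2 := by
  unfold AS
  rw [mem_filter, Fintype.mem_piFinset]
  simp only [mem_range]

noncomputable def PS (n k c : ℕ) (z : ℕ → ℂ) : ℂ := ∑ a ∈ AS n k c, Phi n a z

theorem AS_zero {n k c : ℕ} (hc : c ≤ k + 1) {a : Fin n → ℕ} (ha : a ∈ AS n k 0) (ha' : a ∉ AS n k c)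
    (z : ℕ → ℂ) : Phi n a z = 0 := by
  rw [mem_AS] at ha ha'
  obtain ⟨h1, h2, h3, h4⟩ := ha
  have : ∃ l : Fin n, k ≤ (l : ℕ) ∧ a l < c := by
    by_contra hcon
    push Not at hcon
    exact ha' ⟨h1, h2, hcon, h4⟩
  obtain ⟨l, hl, hlc⟩ := this
  have hk : a ⟨k, by omega⟩ ≤ k := by
    rcases Nat.eq_or_lt_of_le hl with h | h
    · have : (⟨k, by omega⟩ : Fin n) = l := Fin.ext h
      rw [this]; omega
    · have := h4 ⟨k, by omega⟩ l le_rfl h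
      omega
  apply Phi_pigeon a ⟨k, by omega⟩
  intro i hi
  have hi' : (i : ℕ) ≤ k := hi
  rcases Nat.eq_or_lt_of_le hi' with h | h
  · have : i = (⟨k, by omega⟩ : Fin n) := Fin.ext h
    rw [this]; exact hk
  · rw [h2 i h]; simpa using h

theorem PS_c {n k c : ℕ} (hc : c ≤ k + 1) (z : ℕ → ℂ) : PS n k c z = PS n k 0 z := by
  unfold PS
  refine sum_subset ?_ ?_
  · intro a ha
    rw [mem_AS] at ha ⊢
    exact ⟨ha.1, ha.2.1, fun _ _ => Nat.zero_le _, ha.2.2.2⟩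
  · intro a ha ha'
    exact AS_zero hc ha ha' z

theorem AS_inW {n k : ℕ} {a : Fin n → ℕ} (ha : a ∈ AS n k 0) : InW n a := by
  by_cases ha' : a ∈ AS n k (k + 1)
  · rw [mem_AS] at ha'
    obtain ⟨h1, h2, h3, h4⟩ := ha'
    have hmono : StrictMono a := by
      intro l m hlm
      have hlm' : (l : ℕ) < m := hlm
      by_cases hl : (l : ℕ) < k
      · rw [h2 l hl]
        by_cases hm : (m : ℕ) < k
        · rw [h2 m hm]; omega
        · have := h3 m (by omega); omega
      · have := h4 l m (by omega) hlm
        omega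
    have hlow : ∀ p, ∀ l : Fin n, (l : ℕ) = p → p + 1 ≤ a l := by
      intro p
      induction p with
      | zero =>
        intro l hl
        by_cases hk : (l : ℕ) < k
        · rw [h2 l hk]; omega
        · have := h3 l (by omega); omega
      | succ p ih =>
        intro l hl
        have h5 := ih ⟨p, by omega⟩ rfl
        have : a ⟨p, by omega⟩ < a l := hmono (by rw [Fin.lt_def]; simp; omega)
        omega
    exact inW_all a hmono (fun l => hlow l l rfl) (fun l => by have := h1 l; omega)
  · exact ⟨0, Submodule.zero_mem _, fun z _ => by rw [AS_zero le_rfl ha ha']; rfl⟩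

theorem F_exists (n k : ℕ) : ∃ F ∈ W n, ∀ z, Gen (2 * n) z → F z = PS n k 0 z := by
  have : ∀ a : Fin n → ℕ, ∃ F ∈ W n, a ∈ AS n k 0 → ∀ z, Gen (2 * n) z → F z = Phi n a z := by
    intro a
    by_cases h : a ∈ AS n k 0
    · obtain ⟨F, hF, h'⟩ := AS_inW h
      exact ⟨F, hF, fun _ => h'⟩
    · exact ⟨0, Submodule.zero_mem _, fun h' => absurd h' h⟩
  choose f hf hf' using this
  refine ⟨∑ a ∈ AS n k 0, f a, Submodule.sum_mem _ fun a _ => hf a, fun z hz => ?_⟩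
  rw [Finset.sum_apply]
  exact sum_congr rfl fun a ha => hf' a ha z hz

/-- removal of entry `l0` -/
def rem {m : ℕ} (j : ℕ) (a : Fin (m + 1) → ℕ) (l0 : Fin (m + 1)) : Fin m → ℕ := fun l =>
  if a (l0.succAbove l) ≤ j then a (l0.succAbove l) else a (l0.succAbove l) - 2

theorem PS_restrict {m j k c : ℕ} (hj : j ≤ 2 * m) (hc : c ≤ k + 1) {F : (ℕ → ℂ) → ℂ} (hF : F ∈ W (m + 1))
    (hFP : ∀ z, Gen (2 * (m + 1)) z → F z = PS (m + 1) k 0 z)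
    (hA : ∀ a ∈ AS (m + 1) k c, ∀ l0, a l0 = j + 1 →
      (∀ l, l < l0 → a l ≤ j) ∧ (∀ l, l0 < l → j + 2 ≤ a l))
    {y : ℕ → ℂ} {t : ℂ} (h : GenI (2 * m) y t) :
    F (ins j t y) = (-1) ^ m * (∏ i ∈ range (2 * m), (y i - q * t)) *
      ∑ a ∈ AS (m + 1) k c, ∑ l0, if a l0 = j + 1 then Phi m (rem j a l0) y else 0 := by
  have : ∀ a : Fin (m + 1) → ℕ, ∃ F ∈ W (m + 1), a ∈ AS (m + 1) k 0 → ∀ z, Gen (2 * (m + 1)) z →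
      F z = Phi (m + 1) a z := by
    intro a
    by_cases h : a ∈ AS (m + 1) k 0
    · obtain ⟨F, hF, h'⟩ := AS_inW h
      exact ⟨F, hF, fun _ => h'⟩
    · exact ⟨0, Submodule.zero_mem _, fun h' => absurd h' h⟩
  choose f hf hf' using this
  have hsub : ∀ a ∈ AS (m + 1) k c, a ∈ AS (m + 1) k 0 := by
    intro a ha
    rw [mem_AS] at ha ⊢
    exact ⟨ha.1, ha.2.1, fun _ _ => Nat.zero_le _, ha.2.2.2⟩
  have e : F (ins j t y) = ∑ a ∈ AS (m + 1) k c, f a (ins j t y) := by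
    refine gen_contAt (N := 2 * (m + 1)) (G := fun z => ∑ a ∈ AS (m + 1) k c, f a z) (mon_cont hF.1).continuousAt
      (continuous_finsetSum _ fun a _ => mon_cont (hf a).1).continuousAt ?_
    intro z hz
    rw [hFP z hz, ← PS_c hc]
    exact sum_congr rfl fun a ha => (hf' a (hsub a ha) z hz).symm
  rw [e, mul_sum]
  refine sum_congr rfl fun a ha => ?_
  by_cases hex : ∃ l0, a l0 = j + 1
  · obtain ⟨l0, h0⟩ := hex
    obtain ⟨hlo, hhi⟩ := hA a ha l0 h0
    rw [Phi_restrict hj a l0 h0 hlo hhi (mon_cont (hf a).1) (hf' a (hsub a ha)) h, sum_eq_single l0, if_pos h0]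
    · rfl
    · intro l _ hl
      rw [if_neg]
      rcases lt_or_gt_of_ne hl with h' | h'
      · have := hlo l h'; omega
      · have := hhi l h'; omega
    · intro h; exact absurd (mem_univ _) h
  · push Not at hex
    rw [Phi_restrict_zero hj a hex (mon_cont (hf a).1) (hf' a (hsub a ha)) h, sum_eq_zero, mul_zero]
    intro l _
    rw [if_neg (hex l)]

/-- extension from generic points -/
theorem restrict_ext {m j : ℕ} (hj : j ≤ 2 * m) {F H : (ℕ → ℂ) → ℂ} (hF : F ∈ W (m + 1)) (hH : H ∈ W m)
    (h : ∀ y t, GenI (2 * m) y t → F (ins j t y) = (-1) ^ m * (∏ i ∈ range (2 * m), (y i - q * t)) * H y)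
    (y : ℕ → ℂ) (t : ℂ) : F (ins j t y) = (-1) ^ m * (∏ i ∈ range (2 * m), (y i - q * t)) * H y := by
  have hFc := mon_cont hF.1
  have hHc := mon_cont hH.1
  have hic : Continuous fun w : ℕ → ℂ => ins j (w (2 * m)) w := by
    refine continuous_pi fun i => ?_
    unfold ins
    split_ifs <;> fun_prop
  have key := gen_dense (N := 2 * m + 1) (F := fun w => F (ins j (w (2 * m)) w))
    (G := fun w => (-1) ^ m * (∏ i ∈ range (2 * m), (w i - q * w (2 * m))) * H w)
    (hFc.comp hic) (by fun_prop) (by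
      intro w hw
      refine h w (w (2 * m)) ⟨⟨fun i hi => hw.1 i (by omega), fun i hi k hk hik => hw.2 i (by omega) k (by omega) hik⟩,
        hw.1 _ (by omega), fun i hi => hw.2 i (by omega) _ (by omega) (by omega)⟩)
    (Function.update y (2 * m) t)
  have hup : ∀ i < 2 * m, Function.update y (2 * m) t i = y i := by
    intro i hi; rw [Function.update_of_ne (by omega)]
  simp only [Function.update_self] at key
  rw [mon_congr hH.1 hup, prod_congr rfl (fun i hi => by rw [hup i (mem_range.mp hi)])] at key
  rw [← key]
  refine mon_congr hF.1 fun i hi => ?_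
  unfold ins
  split_ifs with h1 h2 h3
  · rw [hup i (by omega)]
  · rfl
  · rfl
  · rw [hup _ (by omega)]

theorem case1 {m j k : ℕ} (hj : j + 1 < k) (hk : k ≤ m + 1) {F : (ℕ → ℂ) → ℂ} (hF : F ∈ W (m + 1))
    (hFP : ∀ z, Gen (2 * (m + 1)) z → F z = PS (m + 1) k 0 z) (y : ℕ → ℂ) (t : ℂ) : F (ins j t y) = 0 := by
  have := restrict_ext (j := j) (by omega) hF (Submodule.zero_mem (W m)) (fun y t h => by
    rw [PS_restrict (by omega) (le_refl (k + 1)) hF hFP ?_ h, sum_eq_zero]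
    · rfl
    · intro a ha
      rw [mem_AS] at ha
      refine sum_eq_zero fun l0 _ => ?_
      by_cases h0 : a l0 = j + 1
      · rw [if_pos h0]
        have hl0 : (l0 : ℕ) = j := by
          by_cases hl : (l0 : ℕ) < k
          · have := ha.2.1 l0 hl; omega
          · have := ha.2.2.1 l0 (by omega); omega
        refine Phi_pigeon _ ⟨j, by omega⟩ ?_ y
        intro i hi
        have hi' : (i : ℕ) ≤ j := hi
        unfold rem
        by_cases hij : (i : ℕ) < j
        · have : l0.succAbove i = i.castSucc := by
            rw [Fin.succAbove_of_castSucc_lt]; rw [Fin.lt_def]; simp; omega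
          have e := ha.2.1 i.castSucc (by simp; omega)
          simp only [Fin.val_castSucc] at e
          rw [this, e, if_pos (by omega)]; simp; omega
        · have : l0.succAbove i = i.succ := by
            rw [Fin.succAbove_of_le_castSucc]; rw [Fin.le_def]; simp; omega
          have e := ha.2.1 i.succ (by simp; omega)
          simp only [Fin.val_succ] at e
          rw [this, e, if_neg (by omega)]; simp; omega
      · rw [if_neg h0]
    · intro a ha l0 h0
      rw [mem_AS] at ha
      have hl0 : (l0 : ℕ) = j := by
        by_cases hl : (l0 : ℕ) < k
        · have := ha.2.1 l0 hl; omega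
        · have := ha.2.2.1 l0 (by omega); omega
      constructor
      · intro l hl
        have hl' : (l : ℕ) < l0 := hl
        rw [ha.2.1 l (by omega)]; omega
      · intro l hl
        have hl' : (l0 : ℕ) < l := hl
        by_cases hlk : (l : ℕ) < k
        · rw [ha.2.1 l (by omega)]; omega
        · have := ha.2.2.1 l (by omega); omega) y t
  rw [this, Pi.zero_apply, mul_zero]

end ACP

namespace ACP
open Finset Filter Topology

theorem rem_lo {m j : ℕ} (a : Fin (m + 1) → ℕ) (l0 : Fin (m + 1)) (hlo : ∀ l, l < l0 → a l ≤ j)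
    (l : Fin m) (h : (l : ℕ) < l0) : rem j a l0 l = a l.castSucc := by
  have h1 : l0.succAbove l = l.castSucc := by
    rw [Fin.succAbove_of_castSucc_lt]; rw [Fin.lt_def]; simpa using h
  unfold rem
  rw [h1, if_pos (hlo _ (by rw [Fin.lt_def]; simpa using h))]

theorem rem_hi {m j : ℕ} (a : Fin (m + 1) → ℕ) (l0 : Fin (m + 1)) (hhi : ∀ l, l0 < l → j + 2 ≤ a l)
    (l : Fin m) (h : (l0 : ℕ) ≤ l) : rem j a l0 l = a l.succ - 2 := by
  have h1 : l0.succAbove l = l.succ := by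
    rw [Fin.succAbove_of_le_castSucc]; rw [Fin.le_def]; simpa using h
  have := hhi l.succ (by rw [Fin.lt_def]; simp; omega)
  unfold rem
  rw [h1, if_neg (by omega)]

def insA {m : ℕ} (j : ℕ) (l0 : Fin (m + 1)) (b : Fin m → ℕ) : Fin (m + 1) → ℕ := fun l =>
  if h : (l : ℕ) < l0 then b ⟨l, by omega⟩ else if h' : (l : ℕ) = l0 then j + 1 else b ⟨l - 1, by omega⟩ + 2

theorem insA_lo {m j : ℕ} {l0 : Fin (m + 1)} {b : Fin m → ℕ} (l : Fin (m + 1)) (h : (l : ℕ) < l0) :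
    insA j l0 b l = b ⟨l, by omega⟩ := by unfold insA; rw [dif_pos h]
theorem insA_eq {m j : ℕ} {l0 : Fin (m + 1)} {b : Fin m → ℕ} : insA j l0 b l0 = j + 1 := by
  unfold insA; rw [dif_neg (by omega), dif_pos rfl]
theorem insA_hi {m j : ℕ} {l0 : Fin (m + 1)} {b : Fin m → ℕ} (l : Fin (m + 1)) (h : (l0 : ℕ) < l) :
    insA j l0 b l = b ⟨l - 1, by omega⟩ + 2 := by unfold insA; rw [dif_neg (by omega), dif_neg (by omega)]

theorem rem_insA {m j : ℕ} (l0 : Fin (m + 1)) (b : Fin m → ℕ) (hlo : ∀ l : Fin m, (l : ℕ) < l0 → b l ≤ j)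
    (hhi : ∀ l : Fin m, (l0 : ℕ) ≤ l → j ≤ b l) : rem j (insA j l0 b) l0 = b := by
  funext l
  by_cases h : (l : ℕ) < l0
  · rw [rem_lo _ _ _ _ h]
    · rw [insA_lo _ (by simpa using h)]; rfl
    · intro l hl
      rw [insA_lo l hl]; exact hlo _ hl
  · rw [rem_hi _ _ _ _ (by omega)]
    · rw [insA_hi _ (by simp; omega)]; simp
    · intro l hl
      have hl' : (l0 : ℕ) < l := hl
      rw [insA_hi l hl]
      have := hhi ⟨l - 1, by omega⟩ (by simp; omega)
      omega

theorem ext_rem {m j : ℕ} (l0 : Fin (m + 1)) (a b : Fin (m + 1) → ℕ) (ha0 : a l0 = j + 1) (hb0 : b l0 = j + 1)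
    (halo : ∀ l, l < l0 → a l ≤ j) (hahi : ∀ l, l0 < l → j + 2 ≤ a l)
    (hblo : ∀ l, l < l0 → b l ≤ j) (hbhi : ∀ l, l0 < l → j + 2 ≤ b l)
    (h : rem j a l0 = rem j b l0) : a = b := by
  funext l
  rcases lt_trichotomy l l0 with hl | hl | hl
  · have hl' : (l : ℕ) < l0 := hl
    have e := congrFun h ⟨l, by omega⟩
    rwa [rem_lo a l0 halo _ hl, rem_lo b l0 hblo _ hl] at e
  · rw [hl, ha0, hb0]
  · have hl' : (l0 : ℕ) < l := hl
    have e := congrFun h ⟨l - 1, by omega⟩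
    rw [rem_hi a l0 hahi _ (by simp; omega), rem_hi b l0 hbhi _ (by simp; omega)] at e
    have e1 : (⟨l - 1, by omega⟩ : Fin m).succ = l := by ext; simp; omega
    rw [e1] at e
    have := hahi l hl
    have := hbhi l hl
    omega

theorem sum_pair {m j : ℕ} (A : Finset (Fin (m + 1) → ℕ)) (f : (Fin (m + 1) → ℕ) → Fin (m + 1) → ℂ) :
    ∑ a ∈ A, ∑ l0, (if a l0 = j + 1 then f a l0 else 0) =
      ∑ p ∈ (A ×ˢ univ).filter (fun p => p.1 p.2 = j + 1), f p.1 p.2 := by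
  rw [sum_filter, sum_product]

theorem case2 {m j : ℕ} (hk : j ≤ m) {F : (ℕ → ℂ) → ℂ} (hF : F ∈ W (m + 1))
    (hFP : ∀ z, Gen (2 * (m + 1)) z → F z = PS (m + 1) (j + 1) 0 z)
    {H : (ℕ → ℂ) → ℂ} (hH : H ∈ W m) (hHP : ∀ z, Gen (2 * m) z → H z = PS m j 0 z)
    (y : ℕ → ℂ) (t : ℂ) :
    F (ins j t y) = (-1) ^ m * (∏ i ∈ range (2 * m), (y i - q * t)) * H y := by
  have hA : ∀ a ∈ AS (m + 1) (j + 1) (j + 2), ∀ l0, a l0 = j + 1 → (l0 : ℕ) = j ∧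
      (∀ l, l < l0 → a l ≤ j) ∧ (∀ l, l0 < l → j + 2 ≤ a l) := by
    intro a ha l0 h0
    rw [mem_AS] at ha
    have hl0 : (l0 : ℕ) = j := by
      by_cases hl : (l0 : ℕ) < j + 1
      · have := ha.2.1 l0 hl; omega
      · have := ha.2.2.1 l0 (by omega); omega
    refine ⟨hl0, ?_, ?_⟩
    · intro l hl
      have hl' : (l : ℕ) < l0 := hl
      rw [ha.2.1 l (by omega)]; omega
    · intro l hl
      have hl' : (l0 : ℕ) < l := hl
      exact ha.2.2.1 l (by omega)
  refine restrict_ext (by omega) hF hH (fun y t h => ?_) y t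
  rw [PS_restrict (by omega) (le_refl (j + 1 + 1)) hF hFP (fun a ha l0 h0 => (hA a ha l0 h0).2) h]
  congr 1
  rw [hHP y h.1, ← PS_c (c := j) (by omega), sum_pair _ (fun a l0 => Phi m (rem j a l0) y)]
  unfold PS
  refine sum_bij (fun p _ => rem j p.1 p.2) ?_ ?_ ?_ (fun _ _ => rfl)
  · rintro ⟨a, l0⟩ hp
    simp only [mem_filter, mem_product, mem_univ, and_true] at hp
    obtain ⟨hl0, hlo, hhi⟩ := hA a hp.1 l0 hp.2
    have ha := mem_AS.mp hp.1
    rw [mem_AS]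
    refine ⟨?_, ?_, ?_, ?_⟩
    · intro l
      by_cases hl : (l : ℕ) < l0
      · rw [rem_lo a l0 hlo l hl, ha.2.1 _ (by simp; omega)]; simp; omega
      · rw [rem_hi a l0 hhi l (by omega)]; have := ha.1 l.succ
        have := hhi l.succ (by rw [Fin.lt_def]; simp; omega)
        omega
    · intro l hl
      rw [rem_lo a l0 hlo l (by omega), ha.2.1 _ (by simp; omega)]; simp
    · intro l hl
      rw [rem_hi a l0 hhi l (by omega)]
      have := hhi l.succ (by rw [Fin.lt_def]; simp; omega)
      omega
    · intro l l' hl hll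
      have hll' : (l : ℕ) < l' := hll
      rw [rem_hi a l0 hhi l (by omega), rem_hi a l0 hhi l' (by omega)]
      have := hhi l.succ (by rw [Fin.lt_def]; simp; omega)
      have := ha.2.2.2 l.succ l'.succ (by simp; omega) (by simpa using hll)
      omega
  · rintro ⟨a, l0⟩ hp ⟨b, l1⟩ hp' hab
    simp only [mem_filter, mem_product, mem_univ, and_true] at hp hp'
    obtain ⟨hl0, hlo, hhi⟩ := hA a hp.1 l0 hp.2
    obtain ⟨hl1, hlo1, hhi1⟩ := hA b hp'.1 l1 hp'.2
    have : l0 = l1 := Fin.ext (by omega)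
    subst this
    rw [ext_rem l0 a b hp.2 hp'.2 hlo hhi hlo1 hhi1 hab]
  · intro b hb
    rw [mem_AS] at hb
    refine ⟨(insA j ⟨j, by omega⟩ b, ⟨j, by omega⟩), ?_, ?_⟩
    · simp only [mem_filter, mem_product, mem_univ, and_true]
      refine ⟨?_, insA_eq⟩
      rw [mem_AS]
      refine ⟨?_, ?_, ?_, ?_⟩
      · intro l
        rcases lt_trichotomy (l : ℕ) j with hl | hl | hl
        · rw [insA_lo l hl]; have := hb.1 ⟨l, by omega⟩; omega
        · have : l = ⟨j, by omega⟩ := Fin.ext hl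
          rw [this, insA_eq]; omega
        · rw [insA_hi l hl]; have := hb.1 ⟨l - 1, by omega⟩; omega
      · intro l hl
        rcases Nat.eq_or_lt_of_le (Nat.lt_succ_iff.mp hl) with hl | hl
        · have : l = ⟨j, by omega⟩ := Fin.ext hl
          rw [this, insA_eq]
        · rw [insA_lo l hl, hb.2.1 _ (by simpa using hl)]
      · intro l hl
        rw [insA_hi l (by simp; omega)]
        have := hb.2.2.1 ⟨l - 1, by omega⟩ (by simp; omega)
        omega
      · intro l l' hl hll
        have hll' : (l : ℕ) < l' := hll
        rw [insA_hi l (by simp; omega), insA_hi l' (by simp; omega)]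
        have := hb.2.2.2 ⟨l - 1, by omega⟩ ⟨l' - 1, by omega⟩ (by simp; omega) (by rw [Fin.lt_def]; simp; omega)
        omega
    · refine rem_insA _ _ ?_ ?_
      · intro l hl
        have hl : (l : ℕ) < j := hl
        rw [hb.2.1 l hl]; omega
      · intro l hl
        exact hb.2.2.1 l hl

theorem case3 {m j k : ℕ} (hj : j ≤ 2 * m) (hk : k ≤ m) (hkj : k ≤ j) {F : (ℕ → ℂ) → ℂ} (hF : F ∈ W (m + 1))
    (hFP : ∀ z, Gen (2 * (m + 1)) z → F z = PS (m + 1) k 0 z)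
    {H : (ℕ → ℂ) → ℂ} (hH : H ∈ W m) (hHP : ∀ z, Gen (2 * m) z → H z = PS m k 0 z)
    (y : ℕ → ℂ) (t : ℂ) :
    F (ins j t y) = (-1) ^ m * (∏ i ∈ range (2 * m), (y i - q * t)) * H y := by
  have hA : ∀ a ∈ AS (m + 1) k 0, ∀ l0, a l0 = j + 1 → k ≤ (l0 : ℕ) ∧
      (∀ l, l < l0 → a l ≤ j) ∧ (∀ l, l0 < l → j + 2 ≤ a l) := by
    intro a ha l0 h0
    rw [mem_AS] at ha
    have hl0 : k ≤ (l0 : ℕ) := by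
      by_contra hl
      have := ha.2.1 l0 (by omega)
      omega
    refine ⟨hl0, ?_, ?_⟩
    · intro l hl
      have hl' : (l : ℕ) < l0 := hl
      by_cases hlk : (l : ℕ) < k
      · rw [ha.2.1 l hlk]; omega
      · have := ha.2.2.2 l l0 (by omega) hl; omega
    · intro l hl
      have := ha.2.2.2 l0 l hl0 hl; omega
  refine restrict_ext (by omega) hF hH (fun y t h => ?_) y t
  rw [PS_restrict (by omega) (Nat.zero_le (k + 1)) hF hFP (fun a ha l0 h0 => (hA a ha l0 h0).2) h]
  congr 1
  rw [hHP y h.1, sum_pair _ (fun a l0 => Phi m (rem j a l0) y)]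
  unfold PS
  refine sum_bij (fun p _ => rem j p.1 p.2) ?_ ?_ ?_ (fun _ _ => rfl)
  · rintro ⟨a, l0⟩ hp
    simp only [mem_filter, mem_product, mem_univ, and_true] at hp
    obtain ⟨hl0, hlo, hhi⟩ := hA a hp.1 l0 hp.2
    have ha := mem_AS.mp hp.1
    have hm : ∀ l : Fin m, k ≤ (l : ℕ) → (l : ℕ) < l0 → a l.castSucc / 2 < (j + 1) / 2 := by
      intro l h1 h2
      have := ha.2.2.2 l.castSucc l0 (by simpa using h1) (by rw [Fin.lt_def]; simpa using h2)
      rwa [hp.2] at this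
    have hM : ∀ l : Fin m, (l0 : ℕ) ≤ l → (j + 1) / 2 < a l.succ / 2 := by
      intro l h1
      have := ha.2.2.2 l0 l.succ (by omega) (by rw [Fin.lt_def]; simp; omega)
      rwa [hp.2] at this
    rw [mem_AS]
    refine ⟨?_, ?_, fun _ _ => Nat.zero_le _, ?_⟩
    · intro l
      by_cases hl : (l : ℕ) < l0
      · rw [rem_lo a l0 hlo l hl]
        by_cases hlk : (l : ℕ) < k
        · rw [ha.2.1 _ (by simpa using hlk)]; simp; omega
        · have := hm l (by omega) hl
          omega
      · rw [rem_hi a l0 hhi l (by omega)]; have := ha.1 l.succ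
        have := hM l (by omega)
        omega
    · intro l hl
      rw [rem_lo a l0 hlo l (by omega), ha.2.1 _ (by simp; omega)]; simp
    · intro l l' hl hll
      have hll' : (l : ℕ) < l' := hll
      by_cases h1 : (l : ℕ) < l0
      · rw [rem_lo a l0 hlo l h1]
        by_cases h2 : (l' : ℕ) < l0
        · rw [rem_lo a l0 hlo l' h2]
          exact ha.2.2.2 _ _ (by simpa using hl) (by simpa using hll)
        · rw [rem_hi a l0 hhi l' (by omega)]
          have := hM l' (by omega)
          have := hm l (by omega) h1
          omega
      · rw [rem_hi a l0 hhi l (by omega), rem_hi a l0 hhi l' (by omega)]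
        have := hM l (by omega)
        have := ha.2.2.2 l.succ l'.succ (by simp; omega) (by simpa using hll)
        omega
  · have half : ∀ a b : Fin (m + 1) → ℕ, ∀ l0 l1 : Fin (m + 1), a ∈ AS (m + 1) k 0 → b ∈ AS (m + 1) k 0 →
        a l0 = j + 1 → b l1 = j + 1 → rem j a l0 = rem j b l1 → ¬ l0 < l1 := by
      intro a b l0 l1 ha hb h0 h1 hab hlt
      have hlt' : (l0 : ℕ) < l1 := hlt
      obtain ⟨hl0, hlo, hhi⟩ := hA a ha l0 h0
      obtain ⟨hl1, hlo1, hhi1⟩ := hA b hb l1 h1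
      have e := congrFun hab ⟨l0, by omega⟩
      rw [rem_hi a l0 hhi _ le_rfl, rem_lo b l1 hlo1 _ hlt'] at e
      have e1 := (mem_AS.mp ha).2.2.2 l0 (⟨l0, by omega⟩ : Fin m).succ hl0 (by rw [Fin.lt_def]; simp)
      have e2 := (mem_AS.mp hb).2.2.2 (⟨l0, by omega⟩ : Fin m).castSucc l1 hl0 hlt'
      rw [h0] at e1
      rw [h1] at e2
      omega
    rintro ⟨a, l0⟩ hp ⟨b, l1⟩ hp' hab
    simp only [mem_filter, mem_product, mem_univ, and_true] at hp hp'
    obtain ⟨hl0, hlo, hhi⟩ := hA a hp.1 l0 hp.2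
    obtain ⟨hl1, hlo1, hhi1⟩ := hA b hp'.1 l1 hp'.2
    have : l0 = l1 := le_antisymm (not_lt.mp (half b a l1 l0 hp'.1 hp.1 hp'.2 hp.2 hab.symm))
      (not_lt.mp (half a b l0 l1 hp.1 hp'.1 hp.2 hp'.2 hab))
    subst this
    rw [ext_rem l0 a b hp.2 hp'.2 hlo hhi hlo1 hhi1 hab]
  · intro b hb
    rw [mem_AS] at hb
    have hex : ∃ p, k ≤ p ∧ ∀ l : Fin m, p ≤ (l : ℕ) → (j + 1) / 2 ≤ b l / 2 :=
      ⟨m, hk, fun l hl => by omega⟩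
    obtain ⟨p, ⟨hp1, hp2⟩, hp3⟩ := Nat.findX hex
    have hpm : p ≤ m := by
      by_contra hpm
      exact hp3 m (by omega) ⟨hk, fun l hl => by omega⟩
    have hp4 : ∀ l : Fin m, k ≤ (l : ℕ) → (l : ℕ) < p → b l / 2 < (j + 1) / 2 := by
      intro l h1 h2
      by_contra hcon
      refine hp3 l h2 ⟨h1, fun l' hl' => ?_⟩
      rcases Nat.eq_or_lt_of_le hl' with h | h
      · rw [← Fin.ext h]; omega
      · have := hb.2.2.2 l l' h1 h; omega
    refine ⟨(insA j ⟨p, by omega⟩ b, ⟨p, by omega⟩), ?_, ?_⟩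
    · simp only [mem_filter, mem_product, mem_univ, and_true]
      refine ⟨?_, insA_eq⟩
      rw [mem_AS]
      refine ⟨?_, ?_, fun _ _ => Nat.zero_le _, ?_⟩
      · intro l
        rcases lt_trichotomy (l : ℕ) p with hl | hl | hl
        · rw [insA_lo l hl]; have := hb.1 ⟨l, by omega⟩; omega
        · have : l = ⟨p, by omega⟩ := Fin.ext hl
          rw [this, insA_eq]; omega
        · rw [insA_hi l hl]; have := hb.1 ⟨l - 1, by omega⟩; omega
      · intro l hl
        rw [insA_lo l (show (l : ℕ) < p by omega), hb.2.1 _ (by simpa using hl)]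
      · intro l l' hl hll
        have hll' : (l : ℕ) < l' := hll
        rcases lt_trichotomy (l : ℕ) p with h1 | h1 | h1
        · rw [insA_lo l h1]
          have e1 := hp4 ⟨l, by omega⟩ hl h1
          rcases lt_trichotomy (l' : ℕ) p with h2 | h2 | h2
          · rw [insA_lo l' h2]; exact hb.2.2.2 _ _ hl hll'
          · have : l' = ⟨p, by omega⟩ := Fin.ext h2
            rw [this, insA_eq]; omega
          · rw [insA_hi l' h2]
            have := hp2 ⟨l' - 1, by omega⟩ (by simp; omega)
            omega
        · have : l = ⟨p, by omega⟩ := Fin.ext h1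
          have e2 := hp2 ⟨l' - 1, by omega⟩ (by simp; omega)
          have e3 : ∀ pf, insA j (⟨p, pf⟩ : Fin (m + 1)) b l = j + 1 := by
            intro pf
            have : l = ⟨p, pf⟩ := Fin.ext h1
            rw [this]; exact insA_eq
          rw [insA_hi l' (show p < (l' : ℕ) by omega), e3]
          omega
        · rw [insA_hi l h1, insA_hi l' (show p < (l' : ℕ) by omega)]
          have := hb.2.2.2 ⟨l - 1, by omega⟩ ⟨l' - 1, by omega⟩ (by simp; omega) (by rw [Fin.lt_def]; simp; omega)
          omega
    · refine rem_insA _ _ ?_ ?_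
      · intro l hl
        have hl : (l : ℕ) < p := hl
        by_cases hlk : (l : ℕ) < k
        · rw [hb.2.1 l hlk]; omega
        · have := hp4 l (by omega) hl; omega
      · intro l hl
        have := hp2 l hl
        omega

theorem case4 {m j : ℕ} (hj : j ≤ 2 * m) (hkj : m + 1 ≤ j) {F : (ℕ → ℂ) → ℂ} (hF : F ∈ W (m + 1))
    (hFP : ∀ z, Gen (2 * (m + 1)) z → F z = PS (m + 1) (m + 1) 0 z)
    (y : ℕ → ℂ) (t : ℂ) : F (ins j t y) = 0 := by
  have hA : ∀ a ∈ AS (m + 1) (m + 1) 0, ∀ l0, a l0 ≠ j + 1 := by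
    intro a ha l0
    rw [(mem_AS.mp ha).2.1 l0 l0.2]; omega
  have := restrict_ext (j := j) (by omega) hF (Submodule.zero_mem (W m)) (fun y t h => by
    rw [PS_restrict (by omega) (Nat.zero_le _) hF hFP (fun a ha l0 h0 => absurd h0 (hA a ha l0)) h, sum_eq_zero]
    · rfl
    · intro a ha
      exact sum_eq_zero fun l0 _ => by rw [if_neg (hA a ha l0)]) y t
  rw [this, Pi.zero_apply, mul_zero]

end ACP

namespace ACP
open Finset Filter Topology

theorem sh_val_lt {j i : ℕ} (h : i < j) : sh j i = i := by unfold sh; rw [if_pos h]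
theorem un_val_lt {j i : ℕ} (h : i < j) : un j i = i := by unfold un; rw [if_pos h]

noncomputable def κ : ℂ := (1 - q) * (q ^ 2 - q)

theorem κ_ne : κ ≠ 0 := by
  unfold κ
  refine mul_ne_zero (sub_ne_zero.mpr q_ne_one.symm) ?_
  have : q ^ 2 - q = q * (q - 1) := by ring
  rw [this]
  exact mul_ne_zero q_ne_zero (sub_ne_zero.mpr q_ne_one)

theorem arc_exists {m : ℕ} {g : ℕ → ℕ} (hg : IsNC (2 * (m + 1)) g) : ∃ j, j ≤ 2 * m ∧ g j = j + 1 := by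
  rcases Nat.eq_zero_or_pos m with h | h
  · subst h
    refine ⟨0, by omega, ?_⟩
    have := hg.1 0 (by omega)
    omega
  · obtain ⟨k, _, h2, h3⟩ := small_arc (by omega) hg
    exact ⟨k, by omega, h3⟩

theorem prod_pt {n : ℕ} {g : ℕ → ℕ} (hg : IsNC (2 * n) g) : ∏ i ∈ range (2 * n), (pt g i - q * 1) = κ ^ n := by
  induction n generalizing g with
  | zero => simp
  | succ m ih =>
    obtain ⟨j, hj, hgj⟩ := arc_exists hg
    obtain ⟨hn, he⟩ := remg_nc hj hg hgj
    have e1 : ∏ i ∈ range (2 * m + 2), (pt g i - q * 1) = ∏ i ∈ range (2 * m + 2), (pt (insg j (remg j g)) i - q * 1) :=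
      prod_congr rfl fun i hi => by unfold pt; rw [he i (mem_range.mp hi)]
    rw [show 2 * (m + 1) = 2 * m + 2 by ring, e1, pt_insg, prod_sh hj, pow_succ, ← ih hn, mul_comm]
    congr 1
    · exact prod_congr rfl fun i hi => by rw [ins_sh]
    · rw [ins_j, ins_j1]; unfold κ; ring

noncomputable def Cn : ℕ → ℂ
  | 0 => 1
  | m + 1 => (-1) ^ m * κ ^ m * Cn m

theorem Cn_ne (n : ℕ) : Cn n ≠ 0 := by
  induction n with
  | zero => exact one_ne_zero
  | succ m ih =>
    exact mul_ne_zero (mul_ne_zero (pow_ne_zero _ (by norm_num)) (pow_ne_zero _ κ_ne)) ih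

theorem PS_zero (z : ℕ → ℂ) : PS 0 0 0 z = 1 := by
  unfold PS
  have : AS 0 0 0 = {fun _ => 0} := by
    ext a
    rw [mem_AS, mem_singleton]
    constructor
    · intro _; funext l; exact l.elim0
    · intro _; exact ⟨fun l => l.elim0, fun l => l.elim0, fun l => l.elim0, fun l => l.elim0⟩
  rw [this, sum_singleton]
  unfold Phi TT KK pre
  simp

theorem F_val {n k : ℕ} (hk : k ≤ n) {F : (ℕ → ℂ) → ℂ} (hF : F ∈ W n)
    (hFP : ∀ z, Gen (2 * n) z → F z = PS n k 0 z) {g : ℕ → ℕ} (hg : IsNC (2 * n) g) :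
    F (pt g) = Cn n * (if ∀ i < k, i < g i then 1 else 0) := by
  induction n generalizing k F g with
  | zero =>
    obtain rfl : k = 0 := by omega
    rw [if_pos (by omega)]
    obtain ⟨z, hz⟩ := gen_exists 0
    have := hFP z hz
    rw [PS_zero] at this
    rw [show F (pt g) = F z from mon_congr hF.1 (fun i hi => by omega), this]
    simp [Cn]
  | succ m ih =>
    obtain ⟨j, hj, hgj⟩ := arc_exists hg
    obtain ⟨hn, he⟩ := remg_nc hj hg hgj
    have hgj' : g (j + 1) = j := by rw [← hgj]; exact (hg.1 j (by omega)).2.1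
    have e1 : F (pt g) = F (ins j 1 (pt (remg j g))) := by
      rw [← pt_insg]
      exact (pt_congr hF.1 (fun i hi => he i (by omega))).symm
    rw [e1]
    have hlow : ∀ i < j, (i < remg j g i ↔ i < g i) := by
      intro i hi
      unfold remg
      rw [sh_val_lt hi]
      have h1 : g i ≠ j := by
        intro h
        have := (hg.1 i (by omega)).2.1
        rw [h] at this; omega
      have h2 : g i ≠ j + 1 := by
        intro h
        have := (hg.1 i (by omega)).2.1
        rw [h] at this; omega
      unfold un; split_ifs <;> omega
    rcases lt_trichotomy (j + 1) k with h | h | h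
    · rw [case1 h hk hF hFP, if_neg, mul_zero]
      intro h'
      have := h' (j + 1) h
      omega
    · subst h
      obtain ⟨H, hH, hHP⟩ := F_exists m j
      rw [case2 (by omega) hF hFP hH hHP, prod_pt hn, ih (by omega) hH hHP hn]
      have : (∀ i < j, i < remg j g i) ↔ (∀ i < j + 1, i < g i) := by
        constructor
        · intro h' i hi
          rcases Nat.lt_succ_iff_lt_or_eq.mp hi with h | h
          · exact (hlow i h).mp (h' i h)
          · rw [h]; omega
        · intro h' i hi
          exact (hlow i hi).mpr (h' i (by omega))
      simp only [this, Cn]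
      ring
    · by_cases hkm : k ≤ m
      · obtain ⟨H, hH, hHP⟩ := F_exists m k
        rw [case3 hj hkm (by omega) hF hFP hH hHP, prod_pt hn, ih hkm hH hHP hn]
        have : (∀ i < k, i < remg j g i) ↔ (∀ i < k, i < g i) := by
          constructor
          · intro h' i hi
            exact (hlow i (by omega)).mp (h' i hi)
          · intro h' i hi
            exact (hlow i (by omega)).mpr (h' i (by omega))
        simp only [this, Cn]
        ring
      · obtain rfl : k = m + 1 := by omega
        rw [case4 hj (by omega) hF hFP, if_neg, mul_zero]
        intro h'
        have hinj : Set.InjOn g (range (m + 1) : Finset ℕ) := by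
          intro a ha b hb hab
          rw [mem_coe, mem_range] at ha hb
          have h1 := (hg.1 a (by omega)).2.1
          have h2 := (hg.1 b (by omega)).2.1
          rw [hab] at h1; omega
        have hge : ∀ i < m + 1, m + 1 ≤ g i := by
          intro i hi
          by_contra hc
          have h1 := h' (g i) (by omega)
          rw [(hg.1 i (by omega)).2.1] at h1
          have := h' i hi
          omega
        have hmap : Set.MapsTo g (range (m + 1) : Finset ℕ) ((Ico (m + 1) (2 * m + 2)).erase j : Finset ℕ) := by
          intro i hi
          rw [mem_coe, mem_range] at hi
          rw [mem_coe, mem_erase, mem_Ico]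
          refine ⟨?_, hge i hi, by have := (hg.1 i (by omega)).1; omega⟩
          intro hc
          have := (hg.1 i (by omega)).2.1
          rw [hc] at this; omega
        have := card_le_card_of_injOn g hmap hinj
        rw [card_range, card_erase_of_mem (by rw [mem_Ico]; omega), Nat.card_Ico] at this
        omega

/-- The anti-cluster probability as a ratio of homogeneous values. -/
theorem prob_ratio {n k : ℕ} (hk1 : 1 ≤ k) (hkn : k ≤ n) (μ : NCM n → ℂ)
    (hsum : ∑ π : NCM n, μ π = 1) (hstat : Stationary μ)
    (huniq : ∀ v : NCM n → ℂ, (∑ π : NCM n, v π = 1) → Stationary v → v = μ)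
    {G F : (ℕ → ℂ) → ℂ} (hG : G ∈ W n) (hGP : ∀ z, Gen (2 * n) z → G z = PS n 1 0 z)
    (hF : F ∈ W n) (hFP : ∀ z, Gen (2 * n) z → F z = PS n k 0 z) :
    F (fun _ => 1) = G (fun _ => 1) * ∑ π : NCM n,
      if ∀ i j : Fin (2 * n), i < j → (j : ℕ) < k → π.f i ≠ j then μ π else 0 := by
  have h0 : ∀ π : NCM n, G (pt (toG π)) = Cn n := by
    intro π
    rw [F_val (by omega) hG hGP (toG_nc π), if_pos, mul_one]
    intro i hi
    obtain rfl : i = 0 := by omega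
    have := (toG_nc π).1 0 (by omega)
    omega
  have := main_lin (by omega) μ hsum hstat huniq hG (Cn_ne n) h0 hF
  have h2 : ∑ π : NCM n, μ π * F (pt (toG π)) = Cn n * ∑ π : NCM n,
      if ∀ i j : Fin (2 * n), i < j → (j : ℕ) < k → π.f i ≠ j then μ π else 0 := by
    rw [mul_sum]
    refine sum_congr rfl fun π _ => ?_
    rw [F_val hkn hF hFP (toG_nc π)]
    have hiff : (∀ i j : Fin (2 * n), i < j → (j : ℕ) < k → π.f i ≠ j) ↔ ∀ i < k, i < toG π i := by
      have hnc := toG_nc π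
      constructor
      · intro h i hi
        by_contra hc
        have h1 := hnc.1 i (by omega)
        have h2 := h ⟨toG π i, h1.1⟩ ⟨i, by omega⟩ (by rw [Fin.lt_def]; simp only; omega) hi
        apply h2
        apply Fin.ext
        rw [← toG_val]
        exact h1.2.1
      · intro h i j hij hj he
        have h1 := h j hj
        rw [← he, toG_val, π.invol] at h1
        rw [he] at h1
        rw [Fin.lt_def] at hij
        omega
    simp only [hiff]
    split_ifs <;> ring
  rw [h2] at this
  have h3 := Cn_ne n
  apply mul_right_cancel₀ h3
  rw [this]; ring

end ACP

namespace ACP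
open Finset Filter Topology

/-- partial-fraction functional -/
noncomputable def AA (p r : ℕ) (x y : ℕ → ℂ) (f : ℂ → ℂ) : ℂ :=
  ∑ s ∈ range p, f (x s) * (∏ i ∈ (range p).erase s, (x s - x i)⁻¹) * ∏ i ∈ range r, (q * x s - q ^ 2 * y i)⁻¹

theorem AA_rec {p r : ℕ} {x y : ℕ → ℂ} {l f : ℂ → ℂ} {X Y : ℂ}
    (hl : ∀ w, l w = X * (w - x p) + Y * (q * w - q ^ 2 * y r))
    (hx : ∀ s < p, x s - x p ≠ 0) (hy : ∀ s < p + 1, q * x s - q ^ 2 * y r ≠ 0) :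
    AA (p + 1) (r + 1) x y (fun w => l w * f w) = X * AA p (r + 1) x y f + Y * AA (p + 1) r x y f := by
  have h1 : AA p (r + 1) x y f = ∑ s ∈ range (p + 1), (x s - x p) * (f (x s) *
      (∏ i ∈ (range (p + 1)).erase s, (x s - x i)⁻¹) * ∏ i ∈ range (r + 1), (q * x s - q ^ 2 * y i)⁻¹) := by
    rw [sum_range_succ, sub_self, zero_mul, add_zero]
    refine sum_congr rfl fun s hs => ?_
    have hs := mem_range.mp hs
    have e : (range (p + 1)).erase s = insert p ((range p).erase s) := by
      ext i; simp only [mem_erase, mem_range, mem_insert]; omega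
    rw [e, prod_insert (by simp)]
    have := hx s hs
    rw [show ∀ a b c d : ℂ, (x s - x p) * (a * ((x s - x p)⁻¹ * c) * d) = ((x s - x p) * (x s - x p)⁻¹) * (a * c * d) by
      intros; ring, mul_inv_cancel₀ this, one_mul]
    exact 0
  have h2 : AA (p + 1) r x y f = ∑ s ∈ range (p + 1), (q * x s - q ^ 2 * y r) * (f (x s) *
      (∏ i ∈ (range (p + 1)).erase s, (x s - x i)⁻¹) * ∏ i ∈ range (r + 1), (q * x s - q ^ 2 * y i)⁻¹) := by
    refine sum_congr rfl fun s hs => ?_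
    have hs := mem_range.mp hs
    rw [prod_range_succ]
    have := hy s hs
    generalize q * x s - q ^ 2 * y r = c at *
    field_simp
  rw [h1, h2, mul_sum, mul_sum, ← sum_add_distrib]
  refine sum_congr rfl fun s hs => ?_
  beta_reduce
  rw [hl]
  ring

theorem AA_zero_right {p : ℕ} {x y : ℕ → ℂ} (hx : ∀ i < p, ∀ j < p, i ≠ j → x i - x j ≠ 0)
    (P : Polynomial ℂ) (hP : P.natDegree + 2 ≤ p) : AA p 0 x y (fun w => P.eval w) = 0 := by
  have hinj : Set.InjOn x (range p : Finset ℕ) := by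
    intro a ha b hb hab
    rw [mem_coe, mem_range] at ha hb
    by_contra hc
    exact hx a ha b hb hc (sub_eq_zero.mpr hab)
  have hd : P.degree < (#(range p) : ℕ) := by
    rw [card_range]
    refine lt_of_le_of_lt Polynomial.degree_le_natDegree ?_
    exact_mod_cast (by omega)
  have := Lagrange.coeff_eq_sum hinj hd
  rw [card_range, Polynomial.coeff_eq_zero_of_natDegree_lt (by omega)] at this
  rw [AA]
  rw [this]
  refine sum_congr rfl fun s hs => ?_
  rw [range_zero, prod_empty, mul_one, prod_inv_distrib, div_eq_mul_inv]

end ACP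

namespace ACP
open Finset Filter Topology

theorem qq_ne : q - q ^ 2 ≠ 0 := by
  have : q - q ^ 2 = - (q * (q - 1)) := by ring
  rw [this]
  exact neg_ne_zero.mpr (mul_ne_zero q_ne_zero (sub_ne_zero.mpr q_ne_one))

theorem AA_lim {ι : Type*} {L : Filter ι} {x y : ι → ℕ → ℂ} (hx : ∀ i, Tendsto (fun t => x t i) L (𝓝 1))
    (hy : ∀ i, Tendsto (fun t => y t i) L (𝓝 1)) (M : ℕ) :
    ∀ p r e d : ℕ, p + r = M → e + d + 2 = p + r →
    (∀ᶠ t in L, ∀ i < p, ∀ j < p, i ≠ j → x t i - x t j ≠ 0) →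
    Tendsto (fun t => AA p r (x t) (y t) (fun w => (w - 1) ^ e * (q * w - q ^ 2) ^ d)) L
      (𝓝 (if e + 1 = p then (q - q ^ 2)⁻¹ else 0)) := by
  have hqq := qq_ne
  have hxy : ∀ i j, Tendsto (fun t => q * x t i - q ^ 2 * y t j) L (𝓝 (q - q ^ 2)) := by
    intro i j
    have := ((hx i).const_mul q).sub ((hy j).const_mul (q ^ 2))
    simpa using this
  induction M with
  | zero => intro p r e d h1 h2; omega
  | succ M ih =>
    intro p r e d h1 h2 hd
    rcases p with _ | p
    · rw [if_neg (by omega)]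
      simp only [AA, range_zero, sum_empty]
      exact tendsto_const_nhds
    rcases r with _ | r
    · rw [if_neg (by omega)]
      refine tendsto_const_nhds.congr' ?_
      filter_upwards [hd] with t ht
      have := AA_zero_right (y := y t) ht
        ((Polynomial.X - Polynomial.C 1) ^ e * (Polynomial.C q * Polynomial.X - Polynomial.C (q ^ 2)) ^ d) (by
          have a1 : ((Polynomial.X - Polynomial.C 1 : Polynomial ℂ) ^ e).natDegree ≤ e := by
            refine Polynomial.natDegree_pow_le.trans ?_
            rw [Polynomial.natDegree_X_sub_C, mul_one]
          have a2 : ((Polynomial.C q * Polynomial.X - Polynomial.C (q ^ 2) : Polynomial ℂ) ^ d).natDegree ≤ d := by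
            refine Polynomial.natDegree_pow_le.trans ?_
            have : (Polynomial.C q * Polynomial.X - Polynomial.C (q ^ 2) : Polynomial ℂ).natDegree ≤ 1 := by
              refine (Polynomial.natDegree_sub_le _ _).trans ?_
              rw [Polynomial.natDegree_C]
              exact max_le ((Polynomial.natDegree_C_mul_le _ _).trans Polynomial.natDegree_X_le) (by omega)
            nlinarith
          have := Polynomial.natDegree_mul_le_of_le a1 a2
          omega)
      rw [← this]
      congr 1
      funext w
      simp
    have hev : ∀ᶠ t in L, (∀ s < p, x t s - x t p ≠ 0) ∧ (∀ s < p + 1, q * x t s - q ^ 2 * y t r ≠ 0) := by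
      have h3 : ∀ᶠ t in L, ∀ s ∈ range (p + 1), q * x t s - q ^ 2 * y t r ≠ 0 := by
        rw [Filter.eventually_all_finset]
        intro s _
        exact (hxy s r).eventually_ne hqq
      filter_upwards [hd, h3] with t h1 h2
      exact ⟨fun s hs => h1 s (by omega) p (by omega) (by omega), fun s hs => h2 s (mem_range.mpr hs)⟩
    have hd' : ∀ᶠ t in L, ∀ i < p, ∀ j < p, i ≠ j → x t i - x t j ≠ 0 := by
      filter_upwards [hd] with t ht i hi j hj
      exact ht i (by omega) j (by omega)
    rcases e with _ | e
    · rcases d with _ | d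
      · obtain rfl : p = 0 := by omega
        obtain rfl : r = 0 := by omega
        simp only [AA, zero_add, range_one, sum_singleton, if_true]
        have := (hxy 0 0).inv₀ hqq
        simpa using this
      ·
        set Y : ι → ℂ := fun t => (q * x t p - q ^ 2) * (q * x t p - q ^ 2 * y t r)⁻¹ with hY
        have tY : Tendsto Y L (𝓝 1) := by
          have := (((hx p).const_mul q).sub_const (q ^ 2)).mul ((hxy p r).inv₀ hqq)
          rw [mul_one, mul_inv_cancel₀ hqq] at this
          exact this
        have tX : Tendsto (fun t => q - q * Y t) L (𝓝 0) := by
          have := (tY.const_mul q).const_sub q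
          simpa using this
        have t1 := ih p (r + 1) 0 d (by omega) (by omega) hd'
        have t2 := ih (p + 1) r 0 d (by omega) (by omega) hd
        have := (tX.mul t1).add (tY.mul t2)
        rw [zero_mul, zero_add, one_mul] at this
        refine this.congr' ?_
        filter_upwards [hev] with t ht
        rw [← AA_rec (l := fun w => q * w - q ^ 2) ?_ ht.1 ht.2]
        · congr 1; funext w; ring
        · intro w
          have h0 := ht.2 p (by omega)
          have hYe : Y t * (q * x t p - q ^ 2 * y t r) = q * x t p - q ^ 2 := by
            rw [hY]; beta_reduce; rw [mul_assoc, inv_mul_cancel₀ h0, mul_one]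
          linear_combination -hYe
    · set Y : ι → ℂ := fun t => (x t p - 1) * (q * x t p - q ^ 2 * y t r)⁻¹ with hY
      have tY : Tendsto Y L (𝓝 0) := by
        have := (((hx p).sub_const 1)).mul ((hxy p r).inv₀ hqq)
        rw [sub_self, zero_mul] at this
        exact this
      have tX : Tendsto (fun t => 1 - q * Y t) L (𝓝 1) := by
        have := (tY.const_mul q).const_sub 1
        simpa using this
      have t1 := ih p (r + 1) e d (by omega) (by omega) hd'
      have t2 := ih (p + 1) r e d (by omega) (by omega) hd
      have := (tX.mul t1).add (tY.mul t2)
      rw [zero_mul, add_zero, one_mul] at this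
      have e0 : (e + 1 + 1 = p + 1) ↔ (e + 1 = p) := by omega
      simp only [e0]
      refine this.congr' ?_
      filter_upwards [hev] with t ht
      rw [← AA_rec (l := fun w => w - 1) ?_ ht.1 ht.2]
      · congr 1; funext w; ring
      · intro w
        have h0 := ht.2 p (by omega)
        have hYe : Y t * (q * x t p - q ^ 2 * y t r) = x t p - 1 := by
          rw [hY]; beta_reduce; rw [mul_assoc, inv_mul_cancel₀ h0, mul_one]
        linear_combination -hYe

/-- The functional attached to `wt`. -/
theorem wt_AA {N a : ℕ} (ha : a ≤ N) (z : ℕ → ℂ) (f : ℂ → ℂ) :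
    ∑ s ∈ range N, wt N a z s * f (z s) = AA a (N - a) z (fun i => z (a + i)) f := by
  have h1 : range a ⊆ range N := range_mono ha
  rw [← sum_subset h1 (fun s _ hs => by
    unfold wt; rw [if_neg (by simpa using hs), zero_mul])]
  unfold AA
  refine sum_congr rfl fun s hs => ?_
  have hs := mem_range.mp hs
  unfold wt
  rw [if_pos hs, mul_comm, mul_assoc]
  congr 1
  have e : (range N).erase s = ((range a).erase s) ∪ (Ico a N) := by
    ext i; simp only [mem_erase, mem_range, mem_union, mem_Ico]; omega
  rw [e, prod_union]
  · congr 1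
    · refine prod_congr rfl fun i hi => ?_
      rw [if_pos (mem_range.mp (mem_erase.mp hi).2)]
    · rw [prod_Ico_eq_prod_range]
      refine prod_congr rfl fun i hi => ?_
      rw [if_neg (by omega)]
  · rw [disjoint_left]
    intro i hi hi'
    simp only [mem_erase, mem_range, mem_Ico] at hi hi'
    omega

theorem wt_lim {N a e d : ℕ} (ha : a ≤ N) (h : e + d + 2 = N) :
    Tendsto (fun z => ∑ s ∈ range N, wt N a z s * ((z s - 1) ^ e * (q * z s - q ^ 2) ^ d))
      (𝓝[{z | Gen N z}] (fun _ => 1)) (𝓝 (if e + 1 = a then (q - q ^ 2)⁻¹ else 0)) := by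
  have hx : ∀ i, Tendsto (fun z : ℕ → ℂ => z i) (𝓝[{z | Gen N z}] (fun _ => 1)) (𝓝 1) := by
    intro i
    have : Tendsto (fun z : ℕ → ℂ => z i) (𝓝 (fun _ => 1)) (𝓝 1) := (continuous_apply i).tendsto' _ _ rfl
    exact this.mono_left nhdsWithin_le_nhds
  have := AA_lim (x := fun z => z) (y := fun z i => z (a + i)) hx (fun i => hx (a + i)) N a (N - a) e d (by omega) (by omega) (by
    filter_upwards [self_mem_nhdsWithin] with z hz i hi j hj hij
    exact gen_ne hz (by omega) (by omega) hij)
  refine this.congr fun z => ?_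
  rw [← wt_AA ha]

end ACP

namespace ACP
open Finset Filter Topology

noncomputable def QQ (n : ℕ) : MvPolynomial (Fin n) ℂ :=
  ∏ l, ∏ m, if l < m then (X m - X l) * (1 + X m + X l * X m) else 1

theorem prod_pairs {n : ℕ} (b : Fin n → ℂ) :
    (∏ l, ∏ m, if l < m then b l * b m else 1) = ∏ l, b l ^ (n - 1) := by
  have h1 : ∀ l m : Fin n, (if l < m then b l * b m else 1) = (if l < m then b l else 1) * (if l < m then b m else 1) := by
    intro l m; split_ifs <;> simp
  simp only [h1, prod_mul_distrib]
  rw [prod_comm (f := fun l m => if l < m then b m else 1), ← prod_mul_distrib]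
  refine prod_congr rfl fun l _ => ?_
  rw [← prod_mul_distrib]
  have h2 : ∀ m : Fin n, (if l < m then b l else 1) * (if m < l then b l else 1) = if m ∈ univ.erase l then b l else 1 := by
    intro m
    rcases lt_trichotomy l m with h | h | h
    · rw [if_pos h, if_neg (not_lt.mpr h.le), if_pos (by simp [h.ne']), mul_one]
    · subst h; simp
    · rw [if_neg (not_lt.mpr h.le), if_pos h, if_pos (by simp [h.ne]), one_mul]
  simp only [h2]
  rw [prod_ite_mem, univ_inter, prod_const, card_erase_of_mem (mem_univ _), card_univ, Fintype.card_fin]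

theorem degreeOf_factor {n : ℕ} (l i j : Fin n) :
    ((X j - X i) * (1 + X j + X i * X j) : MvPolynomial (Fin n) ℂ).degreeOf l ≤
      (if i = l then 2 else 0) + (if j = l then 2 else 0) := by
  have hX : ∀ i : Fin n, (X i : MvPolynomial (Fin n) ℂ).degreeOf l = if i = l then 1 else 0 := by
    intro i; rw [degreeOf_X]; simp only [eq_comm]
  have h1 : (X j - X i : MvPolynomial (Fin n) ℂ).degreeOf l ≤ (if i = l then 1 else 0) + (if j = l then 1 else 0) := by
    refine (degreeOf_sub_le _ _ _).trans ?_
    rw [hX, hX]; exact max_le (by omega) (by omega)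
  have h3 : (X i * X j : MvPolynomial (Fin n) ℂ).degreeOf l ≤ (if i = l then 1 else 0) + (if j = l then 1 else 0) := by
    refine (degreeOf_mul_le _ _ _).trans ?_
    rw [hX, hX]
  have h2 : (1 + X j + X i * X j : MvPolynomial (Fin n) ℂ).degreeOf l ≤ (if i = l then 1 else 0) + (if j = l then 1 else 0) := by
    refine (degreeOf_add_le _ _ _).trans (max_le ((degreeOf_add_le _ _ _).trans (max_le ?_ ?_)) h3)
    · rw [degreeOf_one]; omega
    · rw [hX]; omega
  refine (degreeOf_mul_le _ _ _).trans ((add_le_add h1 h2).trans ?_)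
  split_ifs <;> omega

theorem QQ_degree {n : ℕ} (l : Fin n) : (QQ n).degreeOf l ≤ 2 * n - 2 := by
  unfold QQ
  refine (degreeOf_prod_le _ _ _).trans ?_
  have h1 : ∀ i : Fin n, (∏ m, if i < m then (X m - X i) * (1 + X m + X i * X m) else 1 : MvPolynomial (Fin n) ℂ).degreeOf l
      ≤ ∑ m, ((if i = l ∧ i < m then 2 else 0) + (if m = l ∧ i < m then 2 else 0)) := by
    intro i
    refine (degreeOf_prod_le _ _ _).trans (sum_le_sum fun m _ => ?_)
    by_cases h : i < m
    · rw [if_pos h]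
      simp only [h, and_true]
      exact degreeOf_factor l i m
    · rw [if_neg h, degreeOf_one]; omega
  refine (sum_le_sum fun i _ => h1 i).trans ?_
  simp only [sum_add_distrib]
  rw [sum_comm (f := fun i m => if m = l ∧ i < m then 2 else 0), ← sum_add_distrib]
  have h2 : ∀ i : Fin n, (∑ m, (if i = l ∧ i < m then 2 else 0) + ∑ m, if i = l ∧ m < i then 2 else 0) =
      if i = l then ∑ m : Fin n, (if m ∈ univ.erase l then 2 else 0) else 0 := by
    intro i
    split_ifs with h
    · rw [← sum_add_distrib]
      refine sum_congr rfl fun m _ => ?_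
      subst h
      rcases lt_trichotomy i m with h | h | h
      · rw [if_pos ⟨rfl, h⟩, if_neg (by simp [h.le]), if_pos (by simp [h.ne'])]
      · subst h; simp
      · rw [if_neg (by simp [h.le]), if_pos ⟨rfl, h⟩, if_pos (by simp [h.ne])]
    · simp [h]
  simp only [h2]
  rw [sum_ite_eq' univ l, if_pos (mem_univ _), sum_ite_mem, univ_inter, sum_const, card_erase_of_mem (mem_univ _), card_univ, Fintype.card_fin]
  simp; omega

noncomputable def kc (n : ℕ) : ℂ := ∏ l : Fin n, ∏ m : Fin n, if l < m then (q - q ^ 2) ^ 2 else 1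

theorem kc_ne (n : ℕ) : kc n ≠ 0 := by
  unfold kc
  refine prod_ne_zero_iff.mpr fun l _ => prod_ne_zero_iff.mpr fun m _ => ?_
  split_ifs
  · exact pow_ne_zero _ qq_ne
  · exact one_ne_zero

theorem KK_expand {n : ℕ} (w : Fin n → ℂ) (hw : ∀ l, q * w l - q ^ 2 ≠ 0) :
    kc n * KK w = ∑ e ∈ (QQ n).support, coeff e (QQ n) *
      ∏ l, ((w l - 1) ^ (e l) * (q * w l - q ^ 2) ^ (2 * n - 2 - e l)) := by
  have h1 : kc n * KK w = (∏ l, (q * w l - q ^ 2) ^ (2 * n - 2)) * eval (fun l => (w l - 1) * (q * w l - q ^ 2)⁻¹) (QQ n) := by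
    have h2 := prod_pairs (fun l => (q * w l - q ^ 2) ^ 2)
    have h3 : ∏ l, ((q * w l - q ^ 2) ^ 2) ^ (n - 1) = ∏ l, (q * w l - q ^ 2) ^ (2 * n - 2) := by
      refine prod_congr rfl fun l _ => ?_
      rw [← pow_mul]; congr 1; omega
    rw [← h3, ← h2]
    unfold kc KK QQ
    rw [eval_prod, ← prod_mul_distrib, ← prod_mul_distrib]
    refine prod_congr rfl fun l _ => ?_
    rw [eval_prod, ← prod_mul_distrib, ← prod_mul_distrib]
    refine prod_congr rfl fun m _ => ?_
    split_ifs
    · simp only [map_mul, map_sub, map_add, map_one, eval_X]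
      have a1 : q * w m - q ^ 2 = (q * w m - q ^ 2) := rfl
      have hl := hw l
      have hm := hw m
      have e1 : (q - q ^ 2) * (w m - w l) = (w m - 1) * (q * w l - q ^ 2) - (w l - 1) * (q * w m - q ^ 2) := by ring
      have e2 : (q - q ^ 2) * (q * w l - q ^ 2 * w m) = (q * w l - q ^ 2) * (q * w m - q ^ 2) + (w m - 1) * (q * w l - q ^ 2)
          + (w l - 1) * (w m - 1) := by
        linear_combination (-w l * w m + w l + (w m - 1) * (q ^ 2 - q + 1)) * q_quad
      rw [show ∀ a b c : ℂ, a ^ 2 * (b * c) = (a * b) * (a * c) by intros; ring, e1, e2]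
      generalize q * w l - q ^ 2 = B at *
      generalize q * w m - q ^ 2 = C at *
      field_simp
    · simp
  rw [h1, eval_eq', mul_sum]
  refine sum_congr rfl fun e he => ?_
  rw [mul_left_comm, ← prod_mul_distrib]
  congr 1
  refine prod_congr rfl fun l _ => ?_
  have he' : e l ≤ 2 * n - 2 := (degreeOf_le_iff.mp (QQ_degree l)) e he
  have hl := hw l
  rw [mul_pow, inv_pow]
  have : (q * w l - q ^ 2) ^ (2 * n - 2) = (q * w l - q ^ 2) ^ (e l) * (q * w l - q ^ 2) ^ (2 * n - 2 - e l) := by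
    rw [← pow_add]; congr 1; omega
  rw [this]
  have := pow_ne_zero (e l) hl
  generalize (q * w l - q ^ 2) ^ (e l) = c at *
  field_simp

end ACP

namespace ACP
open Finset Filter Topology

noncomputable def fs {n : ℕ} (a : Fin n → ℕ) : Fin n →₀ ℕ := Finsupp.equivFunOnFinite.symm a
@[simp] theorem fs_apply {n : ℕ} (a : Fin n → ℕ) (l : Fin n) : fs a l = a l := rfl

theorem prod_X_eq {n : ℕ} : (∏ l : Fin n, X l : MvPolynomial (Fin n) ℂ) = monomial (fs fun _ => 1) 1 := by
  rw [monomial_eq, Finsupp.prod_fintype _ _ (by simp)]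
  simp

theorem coeff_XQ {n : ℕ} (a : Fin n → ℕ) (P : MvPolynomial (Fin n) ℂ) :
    coeff (fs a) ((∏ l, X l) * P) = ∑ e ∈ P.support, coeff e P * if ∀ l, e l + 1 = a l then 1 else 0 := by
  rw [prod_X_eq, coeff_monomial_mul']
  split_ifs with h
  · rw [sum_eq_single (fs a - fs fun _ => 1)]
    · rw [if_pos, one_mul, mul_one]
      intro l
      have := h l
      simp at this ⊢
      omega
    · intro e _ he
      rw [if_neg, mul_zero]
      intro h'
      apply he
      ext l
      have := h' l
      simp; omega
    · intro he
      rw [notMem_support_iff.mp he, zero_mul]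
  · rw [sum_eq_zero]
    intro e _
    rw [if_neg, mul_zero]
    intro h'
    apply h
    intro l
    have := h' l
    simp; omega

noncomputable def Kc (n : ℕ) : ℂ := pre (2 * n) (fun _ => 1) * ((kc n)⁻¹ * (q - q ^ 2)⁻¹ ^ n)

theorem Kc_ne (n : ℕ) : Kc n ≠ 0 := by
  unfold Kc
  refine mul_ne_zero ?_ (mul_ne_zero (inv_ne_zero (kc_ne n)) (pow_ne_zero _ (inv_ne_zero qq_ne)))
  unfold pre
  refine prod_ne_zero_iff.mpr fun i _ => prod_ne_zero_iff.mpr fun k _ => ?_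
  split_ifs
  · simpa using qq_ne
  · exact one_ne_zero

theorem Phi_lim {n : ℕ} (hn : 1 ≤ n) (a : Fin n → ℕ) (ha : ∀ l, a l < 2 * n) :
    Tendsto (Phi n a) (𝓝[{z | Gen (2 * n) z}] (fun _ => 1))
      (𝓝 (Kc n * coeff (fs a) ((∏ l, X l) * QQ n))) := by
  have hx : ∀ i, Tendsto (fun z : ℕ → ℂ => z i) (𝓝[{z | Gen (2 * n) z}] (fun _ => 1)) (𝓝 1) := by
    intro i
    have : Tendsto (fun z : ℕ → ℂ => z i) (𝓝 (fun _ => 1)) (𝓝 1) := (continuous_apply i).tendsto' _ _ rfl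
    exact this.mono_left nhdsWithin_le_nhds
  have hpre : Tendsto (pre (2 * n)) (𝓝[{z | Gen (2 * n) z}] (fun _ => 1)) (𝓝 (pre (2 * n) (fun _ => 1))) :=
    ((pre_cont (2 * n)).tendsto _).mono_left nhdsWithin_le_nhds
  have hev : ∀ᶠ z in 𝓝[{z | Gen (2 * n) z}] (fun _ : ℕ => (1 : ℂ)), ∀ s ∈ range (2 * n), q * z s - q ^ 2 ≠ 0 := by
    rw [Filter.eventually_all_finset]
    intro s _
    have := ((hx s).const_mul q).sub_const (q ^ 2)
    rw [mul_one] at this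
    exact this.eventually_ne qq_ne
  have hsum : Tendsto (fun z => ∑ e ∈ (QQ n).support, coeff e (QQ n) * ∏ l, ∑ s ∈ range (2 * n),
      wt (2 * n) (a l) z s * ((z s - 1) ^ (e l) * (q * z s - q ^ 2) ^ (2 * n - 2 - e l)))
      (𝓝[{z | Gen (2 * n) z}] (fun _ => 1)) (𝓝 (∑ e ∈ (QQ n).support, coeff e (QQ n) * ∏ l, if e l + 1 = a l then (q - q ^ 2)⁻¹ else 0)) := by
    refine tendsto_finset_sum _ fun e he => ?_
    refine Tendsto.const_mul _ ?_
    refine tendsto_finset_prod _ fun l _ => ?_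
    have he' : e l ≤ 2 * n - 2 := (degreeOf_le_iff.mp (QQ_degree l)) e he
    exact wt_lim (ha l).le (by omega)
  have hval : (∑ e ∈ (QQ n).support, coeff e (QQ n) * ∏ l, if e l + 1 = a l then (q - q ^ 2)⁻¹ else 0) =
      (q - q ^ 2)⁻¹ ^ n * coeff (fs a) ((∏ l, X l) * QQ n) := by
    rw [coeff_XQ, mul_sum]
    refine sum_congr rfl fun e _ => ?_
    split_ifs with h
    · rw [prod_congr rfl fun l _ => if_pos (h l), prod_const, card_univ, Fintype.card_fin]
      ring
    · push Not at h
      obtain ⟨l, hl⟩ := h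
      rw [prod_eq_zero (mem_univ l) (if_neg hl)]; ring
  rw [hval] at hsum
  have := hpre.mul (hsum.const_mul (kc n)⁻¹)
  rw [show pre (2 * n) (fun _ => 1) * ((kc n)⁻¹ * ((q - q ^ 2)⁻¹ ^ n * coeff (fs a) ((∏ l, X l) * QQ n))) =
    Kc n * coeff (fs a) ((∏ l, X l) * QQ n) by unfold Kc; ring] at this
  refine this.congr' ?_
  filter_upwards [hev] with z hz
  unfold Phi TT
  congr 1
  rw [inv_mul_eq_iff_eq_mul₀ (kc_ne n), mul_sum]
  have h1 : ∀ s ∈ Fintype.piFinset (fun _ : Fin n => range (2 * n)),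
      kc n * ((∏ l, wt (2 * n) (a l) z (s l)) * KK (fun l => z (s l))) =
      ∑ e ∈ (QQ n).support, coeff e (QQ n) * ∏ l, (wt (2 * n) (a l) z (s l) * ((z (s l) - 1) ^ (e l) * (q * z (s l) - q ^ 2) ^ (2 * n - 2 - e l))) := by
    intro s hs
    rw [mul_left_comm, KK_expand _ (fun l => hz _ ((Fintype.mem_piFinset.mp hs) l)), mul_sum]
    refine sum_congr rfl fun e _ => ?_
    rw [mul_left_comm, ← prod_mul_distrib]
  rw [sum_congr rfl h1, sum_comm]
  refine sum_congr rfl fun e _ => ?_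
  rw [← mul_sum, prod_univ_sum]

/-- Homogeneous value. -/
theorem F_one {n k : ℕ} (hn : 1 ≤ n) {F : (ℕ → ℂ) → ℂ} (hF : F ∈ W n)
    (hFP : ∀ z, Gen (2 * n) z → F z = PS n k 0 z) :
    F (fun _ => 1) = Kc n * ∑ a ∈ AS n k 0, coeff (fs a) ((∏ l, X l) * QQ n) := by
  have := gen_nebot (2 * n) (fun _ => 1)
  have h1 : Tendsto F (𝓝[{z | Gen (2 * n) z}] (fun _ => 1)) (𝓝 (F fun _ => 1)) :=
    ((mon_cont hF.1).tendsto _).mono_left nhdsWithin_le_nhds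
  have h2 : Tendsto (PS n k 0) (𝓝[{z | Gen (2 * n) z}] (fun _ => 1))
      (𝓝 (∑ a ∈ AS n k 0, Kc n * coeff (fs a) ((∏ l, X l) * QQ n))) :=
    tendsto_finset_sum _ fun a ha => Phi_lim hn a (mem_AS.mp ha).1
  rw [mul_sum]
  refine tendsto_nhds_unique h1 (h2.congr' ?_)
  filter_upwards [self_mem_nhdsWithin] with z hz
  rw [hFP z hz]

end ACP

namespace ACP
open Finset Filter Topology

noncomputable def pr {n : ℕ} (E : (Fin n →₀ ℕ) → ℂ) : MvPolynomial (Fin n) ℂ →ₗ[ℂ] ℂ :=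
  (basisMonomials (Fin n) ℂ).constr ℂ E

theorem pr_mon {n : ℕ} (E : (Fin n →₀ ℕ) → ℂ) (a : Fin n →₀ ℕ) (c : ℂ) : pr E (monomial a c) = c * E a := by
  have h : monomial a c = c • (basisMonomials (Fin n) ℂ) a := by
    rw [coe_basisMonomials, smul_monomial, smul_eq_mul, mul_one]
  rw [h, map_smul, pr, Module.Basis.constr_basis, smul_eq_mul]

theorem pr_sum {n : ℕ} (E : (Fin n →₀ ℕ) → ℂ) (P : MvPolynomial (Fin n) ℂ) :
    pr E P = ∑ e ∈ P.support, coeff e P * E e := by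
  conv_lhs => rw [P.as_sum]
  rw [map_sum]
  exact sum_congr rfl fun e _ => pr_mon _ _ _

theorem pr_ext {n : ℕ} {V : Type*} [AddCommMonoid V] [Module ℂ V] {f g : MvPolynomial (Fin n) ℂ →ₗ[ℂ] V}
    (h : ∀ a, f (monomial a 1) = g (monomial a 1)) : f = g := by
  apply (basisMonomials (Fin n) ℂ).ext
  intro a
  rw [coe_basisMonomials]
  exact h a

theorem pr_slice {n c : ℕ} {E : (Fin (n + 1) →₀ ℕ) → ℂ} {E' : (Fin n →₀ ℕ) → ℂ}
    (h : ∀ e, E e = if e 0 = c then E' e.tail else 0) (P : MvPolynomial (Fin (n + 1)) ℂ) :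
    pr E P = pr E' (Polynomial.coeff (finSuccEquiv ℂ n P) c) := by
  induction P using MvPolynomial.induction_on' with
  | monomial a r =>
    have : Polynomial.coeff (finSuccEquiv ℂ n (monomial a r)) c = if a 0 = c then monomial a.tail r else 0 := by
      ext m
      rw [finSuccEquiv_coeff_coeff, coeff_monomial]
      by_cases h0 : a 0 = c
      · rw [if_pos h0, coeff_monomial]
        have : a = m.cons c ↔ a.tail = m := by
          constructor
          · intro h; rw [h, Finsupp.tail_cons]
          · intro h; rw [← h, ← h0, Finsupp.cons_tail]
        simp only [this]
      · rw [if_neg h0, coeff_zero, if_neg]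
        intro h
        apply h0
        rw [h, Finsupp.cons_zero]
    rw [this, pr_mon, h]
    split_ifs
    · rw [pr_mon]
    · simp
  | add p q hp hq => rw [map_add, map_add, Polynomial.coeff_add, map_add, hp, hq]

theorem fse_rename {n : ℕ} (Q : MvPolynomial (Fin n) ℂ) :
    finSuccEquiv ℂ n (rename Fin.succ Q) = Polynomial.C Q := by
  induction Q using MvPolynomial.induction_on with
  | C a =>
    rw [rename_C]
    have := congrArg (fun f => f a) (finSuccEquiv_comp_C_eq_C (R := ℂ) n)
    simp only [RingHom.coe_comp, Function.comp_apply] at this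
    have h2 : (finSuccEquiv ℂ n).symm (Polynomial.C (C a)) = C a := this
    exact ((AlgEquiv.symm_apply_eq _).mp h2).symm
  | add p q hp hq => rw [map_add, map_add, hp, hq, map_add]
  | mul_X p i hp => rw [map_mul, map_mul, hp, rename_X, finSuccEquiv_X_succ, map_mul]

def Gd (n k c : ℕ) (e : Fin n →₀ ℕ) : Prop :=
  (∀ l : Fin n, (l : ℕ) < k → e l = (l : ℕ) + 1 + c) ∧ ∀ l m : Fin n, k ≤ (l : ℕ) → l < m → e l / 2 < e m / 2

theorem Gd_succ {n k c : ℕ} (e : Fin (n + 1) →₀ ℕ) : Gd (n + 1) (k + 1) c e ↔ e 0 = c + 1 ∧ Gd n k (c + 1) e.tail := by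
  unfold Gd
  constructor
  · rintro ⟨h1, h2⟩
    refine ⟨?_, ?_, ?_⟩
    · have := h1 0 (by simp); simp at this; omega
    · intro l hl
      have := h1 l.succ (by simp; omega)
      rw [Finsupp.tail_apply, this]; simp; omega
    · intro l m hl hlm
      have := h2 l.succ m.succ (by simp; omega) (by simpa using hlm)
      simpa [Finsupp.tail_apply] using this
  · rintro ⟨h0, h1, h2⟩
    constructor
    · intro l hl
      induction l using Fin.cases with
      | zero => simp; omega
      | succ l =>
        have := h1 l (by simp at hl; omega)
        rw [Finsupp.tail_apply] at this
        rw [this]; simp; omega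
    · intro l m hl hlm
      induction l using Fin.cases with
      | zero => simp at hl
      | succ l =>
        induction m using Fin.cases with
        | zero => simp at hlm
        | succ m =>
          have := h2 l m (by simp at hl; omega) (by simpa using hlm)
          simpa [Finsupp.tail_apply] using this

noncomputable def PP (n c : ℕ) : MvPolynomial (Fin n) ℂ := (∏ l, X l ^ (c + 1) * (1 + X l) ^ c) * QQ n

theorem QQ_succ (n : ℕ) : QQ (n + 1) = (∏ j : Fin n, (X j.succ - X 0) * (1 + X j.succ + X 0 * X j.succ)) *
    rename Fin.succ (QQ n) := by
  unfold QQ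
  rw [Fin.prod_univ_succ]
  congr 1
  · rw [Fin.prod_univ_succ]; simp
  · rw [map_prod]
    refine prod_congr rfl fun l _ => ?_
    rw [Fin.prod_univ_succ, map_prod, if_neg (by simp), one_mul]
    refine prod_congr rfl fun m _ => ?_
    simp only [Fin.succ_lt_succ_iff]
    split_ifs <;> simp

theorem PP_slice (n c : ℕ) : Polynomial.coeff (finSuccEquiv ℂ n (PP (n + 1) c)) (c + 1) = PP n (c + 1) := by
  have h1 : finSuccEquiv ℂ n (PP (n + 1) c) = Polynomial.X ^ (c + 1) * ((1 + Polynomial.X) ^ c *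
      (∏ j : Fin n, Polynomial.C (X j) ^ (c + 1) * (1 + Polynomial.C (X j)) ^ c) *
      ((∏ j : Fin n, (Polynomial.C (X j) - Polynomial.X) * (1 + Polynomial.C (X j) + Polynomial.X * Polynomial.C (X j))) *
        Polynomial.C (QQ n))) := by
    unfold PP
    rw [QQ_succ, Fin.prod_univ_succ]
    simp only [map_mul, map_prod, map_pow, map_add, map_sub, map_one, finSuccEquiv_X_zero, finSuccEquiv_X_succ]
    rw [fse_rename]; ring
  rw [h1, Polynomial.coeff_X_pow_mul', if_pos le_rfl, Nat.sub_self, Polynomial.coeff_zero_eq_eval_zero]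
  simp only [Polynomial.eval_mul, Polynomial.eval_prod, Polynomial.eval_pow, Polynomial.eval_add, Polynomial.eval_sub,
    Polynomial.eval_one, Polynomial.eval_X, Polynomial.eval_C, PP]
  simp only [add_zero, one_pow, one_mul, sub_zero, zero_mul]
  rw [← mul_assoc, ← prod_mul_distrib]
  refine congrArg (fun t => t * QQ n) (prod_congr rfl fun j _ => ?_)
  ring

noncomputable def ind {n : ℕ} (p : (Fin n →₀ ℕ) → Prop) : (Fin n →₀ ℕ) → ℂ := fun e => if p e then 1 else 0

theorem pfx_extract (m k c : ℕ) : pr (ind (Gd (m + k) k c)) (PP (m + k) c) = pr (ind (Gd m 0 (c + k))) (PP m (c + k)) := by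
  induction k generalizing c with
  | zero => rfl
  | succ k ih =>
    have := pr_slice (n := m + k) (c := c + 1) (E := ind (Gd (m + k + 1) (k + 1) c)) (E' := ind (Gd (m + k) k (c + 1)))
      (fun e => by
        unfold ind
        simp only [Gd_succ]
        split_ifs <;> tauto) (PP (m + k + 1) c)
    rw [PP_slice, ih] at this
    rw [show c + (k + 1) = c + 1 + k by ring]
    exact this

theorem AS_sum {n k : ℕ} : ∑ a ∈ AS n k 0, coeff (fs a) ((∏ l, X l) * QQ n) = pr (ind (Gd n k 0)) (PP n 0) := by
  have hPP : PP n 0 = (∏ l, X l) * QQ n := by unfold PP; simp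
  rw [← hPP, pr_sum]
  have hdeg : ∀ e ∈ (PP n 0).support, ∀ l, e l < 2 * n := by
    intro e he l
    have h1 : (PP n 0).degreeOf l ≤ 1 + (2 * n - 2) := by
      rw [hPP, prod_X_eq]
      refine (degreeOf_mul_le _ _ _).trans (add_le_add ?_ (QQ_degree l))
      rw [degreeOf_monomial_eq _ _ one_ne_zero]; rfl
    have := (degreeOf_le_iff.mp h1) e he
    have := l.2
    omega
  have h2 : ∑ a ∈ AS n k 0, coeff (fs a) (PP n 0) = ∑ e ∈ (AS n k 0).image fs, coeff e (PP n 0) := by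
    rw [sum_image]
    intro a _ b _ hab
    exact Finsupp.equivFunOnFinite.symm.injective hab
  have h3 : ∑ e ∈ (PP n 0).support, coeff e (PP n 0) * ind (Gd n k 0) e =
      ∑ e ∈ (PP n 0).support.filter (Gd n k 0), coeff e (PP n 0) := by
    rw [sum_filter]
    refine sum_congr rfl fun e _ => ?_
    unfold ind; split_ifs <;> simp
  rw [h2, h3]
  symm
  apply sum_subset
  · intro e he
    rw [mem_filter] at he
    rw [mem_image]
    refine ⟨e, ?_, by ext; simp⟩
    rw [mem_AS]
    exact ⟨hdeg e he.1, fun l hl => by have := he.2.1 l hl; omega, fun _ _ => Nat.zero_le _, he.2.2⟩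
  · intro e he hne
    rw [mem_image] at he
    obtain ⟨a, ha, rfl⟩ := he
    rw [mem_AS] at ha
    by_contra hc
    apply hne
    rw [mem_filter]
    exact ⟨mem_support_iff.mpr hc, fun l hl => by rw [fs_apply, ha.2.1 l hl], ha.2.2.2⟩

/-- `F_k(1)` in terms of `m = n - k` variables. -/
theorem F_one' {m k : ℕ} (hn : 1 ≤ m + k) {F : (ℕ → ℂ) → ℂ} (hF : F ∈ W (m + k))
    (hFP : ∀ z, Gen (2 * (m + k)) z → F z = PS (m + k) k 0 z) :
    F (fun _ => 1) = Kc (m + k) * pr (ind (Gd m 0 k)) (PP m k) := by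
  rw [F_one hn hF hFP, AS_sum, pfx_extract, zero_add]

end ACP

namespace ACP
open Finset Filter Topology

section field
variable {K : Type*} [Field K]

theorem lag_opt {m : ℕ} (s v : Fin m → K) (hs : Function.Injective s) (h1 : ∀ i, 1 + s i ≠ 0) :
    1 = (∑ i, (∏ j, (1 - s i * v j)) * ((1 + s i)⁻¹ * ∏ j, if j = i then 1 else s j * (s j - s i)⁻¹)) +
      ∏ j, ((1 + v j) * (s j * (1 + s j)⁻¹)) := by
  classical
  set nd : Option (Fin m) → K := fun o => o.elim (-1) s with hnd
  have hinj : Set.InjOn nd (univ : Finset (Option (Fin m))) := by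
    intro a _ b _ hab
    rcases a with _ | a <;> rcases b with _ | b
    · rfl
    · exact absurd (by simp only [hnd, Option.elim] at hab; rw [← hab]; ring) (h1 b)
    · exact absurd (by simp only [hnd, Option.elim] at hab; rw [hab]; ring) (h1 a)
    · simp only [hnd, Option.elim] at hab; rw [hs hab]
  set P : Polynomial K := ∏ j, (1 - Polynomial.C (v j) * Polynomial.X) with hP
  have hdeg : P.degree < (#(univ : Finset (Option (Fin m))) : ℕ) := by
    have : P.natDegree ≤ m := by
      rw [hP]
      refine (Polynomial.natDegree_prod_le _ _).trans ?_
      have : ∀ j ∈ (univ : Finset (Fin m)), (1 - Polynomial.C (v j) * Polynomial.X : Polynomial K).natDegree ≤ 1 := by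
        intro j _
        refine (Polynomial.natDegree_sub_le _ _).trans ?_
        rw [Polynomial.natDegree_one]
        exact max_le (by omega) ((Polynomial.natDegree_C_mul_le _ _).trans Polynomial.natDegree_X_le)
      refine (sum_le_sum this).trans ?_
      simp
    refine lt_of_le_of_lt Polynomial.degree_le_natDegree ?_
    rw [card_univ, Fintype.card_option, Fintype.card_fin]
    exact_mod_cast (by omega)
  have h2 := Lagrange.eq_interpolate hinj hdeg
  have h3 : P.eval 0 = 1 := by rw [hP, Polynomial.eval_prod]; simp
  have hPe : ∀ t, P.eval t = ∏ j, (1 - t * v j) := by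
    intro t; rw [hP, Polynomial.eval_prod]
    refine prod_congr rfl fun j _ => ?_
    rw [Polynomial.eval_sub, Polynomial.eval_mul, Polynomial.eval_C, Polynomial.eval_X, Polynomial.eval_one, mul_comm]
  have hb : ∀ o, (Lagrange.basis univ nd o).eval 0 = ∏ o', if o' = o then 1 else (nd o - nd o')⁻¹ * (0 - nd o') := by
    intro o
    rw [Lagrange.basis, Polynomial.eval_prod]
    have : ∀ o' ∈ univ.erase o, (if o' = o then 1 else (nd o - nd o')⁻¹ * (0 - nd o')) = (nd o - nd o')⁻¹ * (0 - nd o') := by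
      intro o' ho; rw [if_neg (mem_erase.mp ho).1]
    rw [← mul_prod_erase univ _ (mem_univ o), prod_congr rfl this, if_pos rfl, one_mul]
    refine prod_congr rfl fun o' _ => ?_
    simp [Lagrange.basisDivisor]
  have h4 := congrArg (Polynomial.eval 0) h2
  rw [h3, Lagrange.interpolate_apply, Polynomial.eval_finset_sum, Fintype.sum_option] at h4
  have hn0 : nd none = -1 := rfl
  have hns : ∀ i, nd (some i) = s i := fun i => rfl
  simp only [Polynomial.eval_mul, Polynomial.eval_C, hb, hPe, Fintype.prod_option, hn0, hns] at h4
  refine h4.trans ?_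
  rw [add_comm]
  congr 1
  · refine sum_congr rfl fun i _ => ?_
    congr 1
    simp only [reduceCtorEq, if_false, Option.some.injEq]
    congr 1
    · simp [add_comm]
    · refine prod_congr rfl fun j _ => ?_
      split_ifs
      · rfl
      · rw [← neg_sub (s j) (s i), inv_neg]; ring
  · simp only [reduceCtorEq, if_false, if_true, one_mul]
    rw [← prod_mul_distrib]
    refine prod_congr rfl fun j _ => ?_
    rw [show -1 - s j = -(1 + s j) by ring, inv_neg]; ring

theorem lag_succ {m : ℕ} (s v : Fin (m + 1) → K) (hs : Function.Injective s) (h1 : ∀ i, 1 + s i ≠ 0) :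
    1 = (∑ i, (∏ j, (1 - s i * v j)) * ((1 + s i)⁻¹ * ∏ j : Fin m, s (i.succAbove j) * (s (i.succAbove j) - s i)⁻¹)) +
      ∏ j, ((1 + v j) * (s j * (1 + s j)⁻¹)) := by
  refine (lag_opt s v hs h1).trans ?_
  congr 1
  refine sum_congr rfl fun i _ => ?_
  congr 2
  rw [Fin.prod_univ_succAbove _ i, if_pos rfl, one_mul]
  refine prod_congr rfl fun j _ => ?_
  rw [if_neg (Fin.succAbove_ne i j)]

/-- splitting permutations of `Fin (m+1)` by the image of `0` -/
def pext {m : ℕ} (i : Fin (m + 1)) (τ : Equiv.Perm (Fin m)) : Equiv.Perm (Fin (m + 1)) :=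
  i.cycleRange.symm * Equiv.Perm.decomposeFin.symm (0, τ)

theorem pext_zero {m : ℕ} (i : Fin (m + 1)) (τ : Equiv.Perm (Fin m)) : pext i τ 0 = i := by
  unfold pext
  rw [Equiv.Perm.mul_apply, Equiv.Perm.decomposeFin_symm_apply_zero]
  exact Fin.cycleRange_symm_zero i

theorem pext_succ {m : ℕ} (i : Fin (m + 1)) (τ : Equiv.Perm (Fin m)) (j : Fin m) :
    pext i τ j.succ = i.succAbove (τ j) := by
  unfold pext
  rw [Equiv.Perm.mul_apply, Equiv.Perm.decomposeFin_symm_apply_succ, Equiv.swap_self, Equiv.refl_apply]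
  exact Fin.cycleRange_symm_succ i _

theorem pext_sign {m : ℕ} (i : Fin (m + 1)) (τ : Equiv.Perm (Fin m)) :
    Equiv.Perm.sign (pext i τ) = (-1) ^ (i : ℕ) * Equiv.Perm.sign τ := by
  unfold pext
  rw [Equiv.Perm.sign_mul, Equiv.Perm.decomposeFin.symm_sign, if_pos rfl, one_mul, Equiv.Perm.sign_symm, Fin.sign_cycleRange]

theorem pext_bij (m : ℕ) : Function.Bijective (fun p : Fin (m + 1) × Equiv.Perm (Fin m) => pext p.1 p.2) := by
  rw [Fintype.bijective_iff_injective_and_card]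
  constructor
  · rintro ⟨i, τ⟩ ⟨i', τ'⟩ h
    simp only at h
    have h0 : i = i' := by rw [← pext_zero i τ, h, pext_zero]
    subst h0
    have : τ = τ' := by
      ext j
      have h1 : pext i τ j.succ = pext i τ' j.succ := by rw [h]
      rw [pext_succ, pext_succ] at h1
      rw [Fin.succAbove_right_injective h1]
    rw [this]
  · simp [Fintype.card_perm, Nat.factorial_succ]

theorem alt_rec {α : Type*} {m : ℕ} (f : (Fin (m + 1) → α) → K) (h : α → (Fin m → α) → K) (g : (Fin m → α) → K)
    (hf : ∀ x, f x = h (x 0) (fun j => x j.succ) * g (fun j => x j.succ))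
    (hsym : ∀ c x (τ : Equiv.Perm (Fin m)), h c (fun j => x (τ j)) = h c x) (y : Fin (m + 1) → α) :
    ∑ σ : Equiv.Perm (Fin (m + 1)), ((Equiv.Perm.sign σ : ℤ) : K) * f (fun j => y (σ j)) =
    ∑ i : Fin (m + 1), (-1) ^ (i : ℕ) * h (y i) (fun j => y (i.succAbove j)) *
      ∑ τ : Equiv.Perm (Fin m), ((Equiv.Perm.sign τ : ℤ) : K) * g (fun j => y (i.succAbove (τ j))) := by
  rw [← (pext_bij m).sum_comp, Fintype.sum_prod_type]
  refine sum_congr rfl fun i _ => ?_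
  rw [mul_sum]
  refine sum_congr rfl fun τ _ => ?_
  simp only [hf, pext_zero, pext_succ, pext_sign]
  rw [hsym (y i) (fun j => y (i.succAbove j)) τ]
  push_cast
  ring

theorem pairs_split {M : Type*} [CommMonoid M] {m : ℕ} (F : Fin (m + 1) → Fin (m + 1) → M) (i : Fin (m + 1)) :
    (∏ a, ∏ b, if a < b then F a b else 1) =
    (∏ j : Fin m, if (j : ℕ) < i then F (i.succAbove j) i else F i (i.succAbove j)) *
      ∏ a : Fin m, ∏ b : Fin m, if a < b then F (i.succAbove a) (i.succAbove b) else 1 := by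
  rw [Fin.prod_univ_succAbove _ i, Fin.prod_univ_succAbove _ i, if_neg (lt_irrefl _), one_mul]
  have h2 : ∀ a : Fin m, (∏ b, if i.succAbove a < b then F (i.succAbove a) b else 1) =
      (if i.succAbove a < i then F (i.succAbove a) i else 1) * ∏ b : Fin m, if a < b then F (i.succAbove a) (i.succAbove b) else 1 := by
    intro a
    rw [Fin.prod_univ_succAbove _ i]
    simp only [Fin.succAbove_lt_succAbove_iff]
  simp only [h2, prod_mul_distrib]
  rw [← mul_assoc, ← prod_mul_distrib]
  congr 1
  refine prod_congr rfl fun j _ => ?_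
  have h3 : i.succAbove j < i ↔ (j : ℕ) < i := by
    rw [Fin.succAbove_lt_iff_castSucc_lt, Fin.lt_def, Fin.val_castSucc]
  have h4 : i < i.succAbove j ↔ ¬ (j : ℕ) < i := by
    rw [Fin.lt_succAbove_iff_le_castSucc, Fin.le_def, Fin.val_castSucc, not_lt]
  simp only [h3, h4]
  split_ifs <;> simp

theorem sign_count {m : ℕ} (i : ℕ) (hi : i ≤ m) : (∏ j : Fin m, if (j : ℕ) < i then (-1 : K) else 1) = (-1) ^ i := by
  rw [Fin.prod_univ_eq_prod_range (fun j => if j < i then (-1 : K) else 1) m, prod_ite, prod_const_one, mul_one, prod_const]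
  congr 1
  have : (range m).filter (· < i) = range i := by ext; simp; omega
  rw [this, card_range]

end field

end ACP

namespace ACP
open Finset Filter Topology

section field
variable {K : Type*} [Field K]

structure Gd2 {m : ℕ} (y : Fin m → K) : Prop where
  inj : Function.Injective y
  m1 : ∀ i, 1 - y i ≠ 0
  p1 : ∀ i, 1 + y i ≠ 0
  c1 : ∀ i, 1 + y i + y i ^ 2 ≠ 0
  mm : ∀ i j, i ≠ j → 1 - y i * y j ≠ 0
  pp : ∀ i j, i ≠ j → y i + y j + y i * y j ≠ 0
  s1 : ∀ S : Finset (Fin m), S.Nonempty → 1 - ∏ i ∈ S, y i ≠ 0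
  s2 : ∀ S : Finset (Fin m), S.Nonempty → 1 - ∏ i ∈ S, y i ^ 2 ≠ 0

theorem Gd2.sA {m : ℕ} {y : Fin (m + 1) → K} (h : Gd2 y) (i : Fin (m + 1)) : Gd2 (fun j => y (i.succAbove j)) where
  inj := h.inj.comp Fin.succAbove_right_injective
  m1 j := h.m1 _
  p1 j := h.p1 _
  c1 j := h.c1 _
  mm a b hab := h.mm _ _ fun e => hab (Fin.succAbove_right_injective e)
  pp a b hab := h.pp _ _ fun e => hab (Fin.succAbove_right_injective e)
  s1 S hS := by
    have := h.s1 (S.map (Fin.succAboveEmb i)) (hS.map)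
    rw [prod_map] at this
    exact this
  s2 S hS := by
    have := h.s2 (S.map (Fin.succAboveEmb i)) (hS.map)
    rw [prod_map] at this
    exact this

def fd1 : (m : ℕ) → (Fin m → K) → K
  | 0, _ => 1
  | m + 1, x => (∏ j : Fin m, x j.succ) * (1 - x 0 * ∏ j : Fin m, x j.succ)⁻¹ * fd1 m fun j => x j.succ

def fd2 : (m : ℕ) → (Fin m → K) → K
  | 0, _ => 1
  | m + 1, x => (1 + x 0) * (∏ j : Fin m, (x j.succ ^ 2 * (1 + x 0 + x 0 * x j.succ))) *
      (1 - x 0 ^ 2 * ∏ j : Fin m, x j.succ ^ 2)⁻¹ * fd2 m fun j => x j.succ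

def ZZ (m : ℕ) (y : Fin m → K) : K :=
  (∏ a, ∏ b, if a < b then (y b - y a) * (1 - y a * y b)⁻¹ else 1) * ∏ a, (1 - y a)⁻¹

def PY (m : ℕ) (y : Fin m → K) : K := ∏ a, ∏ b, if a < b then y a + y b + y a * y b else 1

theorem ZZ_rec {m : ℕ} (y : Fin (m + 1) → K) (i : Fin (m + 1)) :
    ZZ (m + 1) y = (-1) ^ (i : ℕ) * (∏ j : Fin m, (y (i.succAbove j) - y i) * (1 - y i * y (i.succAbove j))⁻¹) *
      (1 - y i)⁻¹ * ZZ m fun j => y (i.succAbove j) := by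
  unfold ZZ
  rw [pairs_split (fun a b => (y b - y a) * (1 - y a * y b)⁻¹) i, Fin.prod_univ_succAbove (fun a => (1 - y a)⁻¹) i]
  have : (∏ j : Fin m, if (j : ℕ) < i then (y i - y (i.succAbove j)) * (1 - y (i.succAbove j) * y i)⁻¹
      else (y (i.succAbove j) - y i) * (1 - y i * y (i.succAbove j))⁻¹) =
      (-1) ^ (i : ℕ) * (∏ j : Fin m, (y (i.succAbove j) - y i) * (1 - y i * y (i.succAbove j))⁻¹) := by
    rw [← sign_count (m := m) (i : ℕ) (by omega), ← prod_mul_distrib]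
    refine prod_congr rfl fun j _ => ?_
    split_ifs
    · rw [mul_comm (y i)]; ring
    · ring
  rw [this]
  ring

theorem PY_rec {m : ℕ} (y : Fin (m + 1) → K) (i : Fin (m + 1)) :
    PY (m + 1) y = (∏ j : Fin m, (y i + y (i.succAbove j) + y i * y (i.succAbove j))) * PY m fun j => y (i.succAbove j) := by
  unfold PY
  rw [pairs_split (fun a b => y a + y b + y a * y b) i]
  refine congrArg (fun t => t * _) ?_
  refine prod_congr rfl fun j _ => ?_
  split_ifs
  · ring
  · rfl

theorem alt_fd1 : ∀ (m : ℕ) (y : Fin m → K), Gd2 y →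
    ∑ σ : Equiv.Perm (Fin m), ((Equiv.Perm.sign σ : ℤ) : K) * fd1 m (fun j => y (σ j)) = ZZ m y := by
  intro m
  induction m with
  | zero => intro y _; simp [fd1, ZZ]
  | succ m ih =>
    intro y hy
    rw [alt_rec (fd1 (m + 1)) (fun c x => (∏ j : Fin m, x j) * (1 - c * ∏ j : Fin m, x j)⁻¹) (fd1 m) (fun x => rfl)
      (fun c x τ => by rw [Equiv.prod_comp τ x]) y]
    simp only [ih _ (hy.sA _)]
    have hall : ∀ i : Fin (m + 1), y i * ∏ j : Fin m, y (i.succAbove j) = ∏ j, y j := fun i => (Fin.prod_univ_succAbove y i).symm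
    simp only [hall]
    have hne : 1 - ∏ j, y j ≠ 0 := hy.s1 univ ⟨0, mem_univ _⟩
    have hl := lag_succ y y hy.inj hy.p1
    have e1 : ∏ j, ((1 + y j) * (y j * (1 + y j)⁻¹)) = ∏ j, y j := by
      refine prod_congr rfl fun j _ => ?_
      field_simp [hy.p1 j]
    rw [e1] at hl
    have hl2 := sub_eq_of_eq_add hl
    have hterm : ∀ i : Fin (m + 1), (-1) ^ (i : ℕ) * ((∏ j : Fin m, y (i.succAbove j)) * (1 - ∏ j, y j)⁻¹) * ZZ m (fun j => y (i.succAbove j)) =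
        (1 - ∏ j, y j)⁻¹ * ZZ (m + 1) y * ((∏ j, (1 - y i * y j)) * ((1 + y i)⁻¹ * ∏ j : Fin m, y (i.succAbove j) * (y (i.succAbove j) - y i)⁻¹)) := by
      intro i
      rw [ZZ_rec y i, Fin.prod_univ_succAbove (fun j => (1 - y i * y j)) i]
      have e2 : (∏ j : Fin m, (y (i.succAbove j) - y i) * (1 - y i * y (i.succAbove j))⁻¹) * ((∏ j : Fin m, (1 - y i * y (i.succAbove j))) *
          (∏ j : Fin m, y (i.succAbove j) * (y (i.succAbove j) - y i)⁻¹)) = ∏ j : Fin m, y (i.succAbove j) := by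
        rw [← prod_mul_distrib, ← prod_mul_distrib]
        refine prod_congr rfl fun j _ => ?_
        have a1 := hy.mm i (i.succAbove j) (Fin.succAbove_ne i j).symm
        have a2 : y (i.succAbove j) - y i ≠ 0 := sub_ne_zero.mpr fun e => Fin.succAbove_ne i j (hy.inj e)
        generalize y (i.succAbove j) = b at *
        generalize y i = a at *
        rw [mul_comm a b] at *
        field_simp
      rw [← e2]
      have a3 := hy.m1 i
      have a4 := hy.p1 i
      have e3 : (1 - y i)⁻¹ * ((1 - y i * y i) * (1 + y i)⁻¹) = 1 := by
        rw [show 1 - y i * y i = (1 - y i) * (1 + y i) by ring]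
        field_simp
      generalize (1 - y i)⁻¹ = A at *
      generalize (1 + y i)⁻¹ = B at *
      linear_combination (-(1 - ∏ j, y j)⁻¹ * (-1) ^ (i : ℕ) * ZZ m (fun j => y (i.succAbove j)) * ((∏ j : Fin m, (y (i.succAbove j) - y i) * (1 - y i * y (i.succAbove j))⁻¹) * ((∏ j : Fin m, (1 - y i * y (i.succAbove j))) *
          (∏ j : Fin m, y (i.succAbove j) * (y (i.succAbove j) - y i)⁻¹)))) * e3
    rw [sum_congr rfl fun i _ => hterm i, ← mul_sum, ← hl2]
    field_simp

theorem alt_fd2 : ∀ (m : ℕ) (y : Fin m → K), Gd2 y →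
    ∑ σ : Equiv.Perm (Fin m), ((Equiv.Perm.sign σ : ℤ) : K) * fd2 m (fun j => y (σ j)) = PY m y * ZZ m y := by
  intro m
  induction m with
  | zero => intro y _; simp [fd2, ZZ, PY]
  | succ m ih =>
    intro y hy
    rw [alt_rec (fd2 (m + 1)) (fun c x => (1 + c) * (∏ j : Fin m, (x j ^ 2 * (1 + c + c * x j))) *
      (1 - c ^ 2 * ∏ j : Fin m, x j ^ 2)⁻¹) (fd2 m) (fun x => rfl)
      (fun c x τ => by rw [Equiv.prod_comp τ (fun j => x j ^ 2 * (1 + c + c * x j)), Equiv.prod_comp τ (fun j => x j ^ 2)]) y]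
    simp only [ih _ (hy.sA _)]
    have hall : ∀ i : Fin (m + 1), y i ^ 2 * ∏ j : Fin m, y (i.succAbove j) ^ 2 = ∏ j, y j ^ 2 := fun i => (Fin.prod_univ_succAbove (fun j => y j ^ 2) i).symm
    simp only [hall]
    have hne : 1 - ∏ j, y j ^ 2 ≠ 0 := hy.s2 univ ⟨0, mem_univ _⟩
    have hs1 : ∀ j, 1 + y j ^ 2 * (1 + y j)⁻¹ = (1 + y j + y j ^ 2) * (1 + y j)⁻¹ := by
      intro j; have := hy.p1 j; field_simp
    have hsd : ∀ i j, y j ^ 2 * (1 + y j)⁻¹ - y i ^ 2 * (1 + y i)⁻¹ = (y j - y i) * (y i + y j + y i * y j) * ((1 + y i)⁻¹ * (1 + y j)⁻¹) := by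
      intro i j; have := hy.p1 j; have := hy.p1 i; field_simp; ring
    have hl := lag_succ (fun i => y i ^ 2 * (1 + y i)⁻¹) (fun i => y i * (1 + y i)) (by
      intro a b hab
      by_contra hne
      have h1 := hsd b a
      simp only at hab
      rw [hab, sub_self] at h1
      have := hy.pp b a (Ne.symm hne)
      have h2 : y a - y b ≠ 0 := sub_ne_zero.mpr fun e => hne (hy.inj e)
      have := hy.p1 a; have := hy.p1 b
      exact absurd h1.symm (by positivity)) (by
      intro i; beta_reduce; rw [hs1]; exact mul_ne_zero (hy.c1 i) (inv_ne_zero (hy.p1 i)))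
    simp only [hs1, hsd] at hl
    have e1 : ∏ j, ((1 + y j * (1 + y j)) * (y j ^ 2 * (1 + y j)⁻¹ * ((1 + y j + y j ^ 2) * (1 + y j)⁻¹)⁻¹)) = ∏ j, y j ^ 2 := by
      refine prod_congr rfl fun j _ => ?_
      have := hy.p1 j
      have := hy.c1 j
      rw [show 1 + y j * (1 + y j) = 1 + y j + y j ^ 2 by ring]
      field_simp
    rw [e1] at hl
    have hl2 := sub_eq_of_eq_add hl
    have hterm : ∀ i : Fin (m + 1), (-1) ^ (i : ℕ) * ((1 + y i) * (∏ j : Fin m, (y (i.succAbove j) ^ 2 * (1 + y i + y i * y (i.succAbove j)))) * (1 - ∏ j, y j ^ 2)⁻¹) * (PY m (fun j => y (i.succAbove j)) * ZZ m (fun j => y (i.succAbove j))) =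
        (1 - ∏ j, y j ^ 2)⁻¹ * (PY (m + 1) y * ZZ (m + 1) y) * ((∏ j, (1 - y i ^ 2 * (1 + y i)⁻¹ * (y j * (1 + y j)))) * (((1 + y i + y i ^ 2) * (1 + y i)⁻¹)⁻¹ * ∏ j : Fin m, y (i.succAbove j) ^ 2 * (1 + y (i.succAbove j))⁻¹ * ((y (i.succAbove j) - y i) * (y i + y (i.succAbove j) + y i * y (i.succAbove j)) * ((1 + y i)⁻¹ * (1 + y (i.succAbove j))⁻¹))⁻¹)) := by
      intro i
      rw [ZZ_rec y i, PY_rec y i, Fin.prod_univ_succAbove (fun j => (1 - y i ^ 2 * (1 + y i)⁻¹ * (y j * (1 + y j)))) i]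
      have e2 : (∏ j : Fin m, (y (i.succAbove j) - y i) * (1 - y i * y (i.succAbove j))⁻¹) * ((∏ j : Fin m, (y i + y (i.succAbove j) + y i * y (i.succAbove j))) * ((∏ j : Fin m, (1 - y i ^ 2 * (1 + y i)⁻¹ * (y (i.succAbove j) * (1 + y (i.succAbove j))))) *
          (∏ j : Fin m, y (i.succAbove j) ^ 2 * (1 + y (i.succAbove j))⁻¹ * ((y (i.succAbove j) - y i) * (y i + y (i.succAbove j) + y i * y (i.succAbove j)) * ((1 + y i)⁻¹ * (1 + y (i.succAbove j))⁻¹))⁻¹))) = ∏ j : Fin m, (y (i.succAbove j) ^ 2 * (1 + y i + y i * y (i.succAbove j))) := by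
        rw [← prod_mul_distrib, ← prod_mul_distrib, ← prod_mul_distrib]
        refine prod_congr rfl fun j _ => ?_
        have a1 := hy.mm i (i.succAbove j) (Fin.succAbove_ne i j).symm
        have a2 : y (i.succAbove j) - y i ≠ 0 := sub_ne_zero.mpr fun e => Fin.succAbove_ne i j (hy.inj e)
        have a3 := hy.pp i (i.succAbove j) (Fin.succAbove_ne i j).symm
        have a4 := hy.p1 i
        have a5 := hy.p1 (i.succAbove j)
        have a6 : 1 - y i ^ 2 * (1 + y i)⁻¹ * (y (i.succAbove j) * (1 + y (i.succAbove j))) = (1 + y i + y i * y (i.succAbove j)) * (1 - y i * y (i.succAbove j)) * (1 + y i)⁻¹ := by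
          field_simp; ring
        rw [a6]
        generalize y (i.succAbove j) = b at *
        generalize y i = a at *
        clear a6
        rw [mul_comm a b] at *
        field_simp
      rw [← e2]
      have a3 := hy.m1 i
      have a4 := hy.p1 i
      have a5 := hy.c1 i
      have e3 : (1 - y i)⁻¹ * ((1 - y i ^ 2 * (1 + y i)⁻¹ * (y i * (1 + y i))) * ((1 + y i + y i ^ 2) * (1 + y i)⁻¹)⁻¹) = 1 + y i := by
        rw [show (1 - y i ^ 2 * (1 + y i)⁻¹ * (y i * (1 + y i))) = (1 - y i) * (1 + y i + y i ^ 2) by field_simp; ring]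
        field_simp
      generalize (∏ j : Fin m, (y (i.succAbove j) - y i) * (1 - y i * y (i.succAbove j))⁻¹) = Q1 at *
      generalize (∏ j : Fin m, (y i + y (i.succAbove j) + y i * y (i.succAbove j))) = Q2 at *
      generalize (∏ j : Fin m, (1 - y i ^ 2 * (1 + y i)⁻¹ * (y (i.succAbove j) * (1 + y (i.succAbove j))))) = Q3 at *
      generalize (∏ j : Fin m, y (i.succAbove j) ^ 2 * (1 + y (i.succAbove j))⁻¹ * ((y (i.succAbove j) - y i) * (y i + y (i.succAbove j) + y i * y (i.succAbove j)) * ((1 + y i)⁻¹ * (1 + y (i.succAbove j))⁻¹))⁻¹) = Q4 at *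
      generalize ((1 + y i + y i ^ 2) * (1 + y i)⁻¹)⁻¹ = B1 at *
      generalize (1 - y i ^ 2 * (1 + y i)⁻¹ * (y i * (1 + y i))) = B2 at *
      generalize (1 - y i)⁻¹ = B3 at *
      generalize (1 - ∏ j, y j ^ 2)⁻¹ = B4 at *
      generalize 1 + y i = B5 at *
      rw [← e3]
      ring
    rw [sum_congr rfl fun i _ => hterm i, ← mul_sum, ← hl2]
    field_simp

end field

end ACP

namespace ACP
open Finset Filter Topology

abbrev PSr (m : ℕ) := MvPowerSeries (Fin m) ℂ

noncomputable def EE (d m : ℕ) : PSr m := fun e => if ∀ l m' : Fin m, l < m' → e l / d < e m' / d then 1 else 0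

theorem coeff_EE (d m : ℕ) (e : Fin m →₀ ℕ) : MvPowerSeries.coeff e (EE d m) = if ∀ l m' : Fin m, l < m' → e l / d < e m' / d then 1 else 0 := rfl

theorem coeff_rs {m : ℕ} (F : PSr m) (b : Fin (m + 1) →₀ ℕ) :
    MvPowerSeries.coeff b (MvPowerSeries.rename (Fin.succ : Fin m → Fin (m + 1)) F) =
      if b 0 = 0 then MvPowerSeries.coeff b.tail F else 0 := by
  split_ifs with h
  · have hb : b = Finsupp.embDomain (Fin.succEmb m) b.tail := by
      ext i
      refine Fin.cases ?_ (fun j => ?_) i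
      · rw [h, Finsupp.embDomain_notin_range]
        rintro ⟨j, hj⟩
        exact Fin.succ_ne_zero j hj
      · have := Finsupp.embDomain_apply_self (Fin.succEmb m) b.tail j
        refine Eq.trans ?_ this.symm
        rfl
    conv_lhs => rw [hb]
    exact MvPowerSeries.coeff_embDomain_rename (Fin.succEmb m) F b.tail
  · refine MvPowerSeries.coeff_rename_eq_zero _ _ ?_
    rintro ⟨c, hc⟩
    apply h
    rw [← hc]
    refine Finsupp.mapDomain_notin_range _ _ ?_
    rintro ⟨j, hj⟩
    exact Fin.succ_ne_zero j hj

theorem prod_X_ps {m : ℕ} (e : Fin m → ℕ) : (∏ i, (MvPowerSeries.X i : PSr m) ^ e i) = MvPowerSeries.monomial (fs e) 1 := by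
  have h : ∀ S : Finset (Fin m), (∏ i ∈ S, (MvPowerSeries.X i : PSr m) ^ e i) = MvPowerSeries.monomial (∑ i ∈ S, Finsupp.single i (e i)) 1 := by
    intro S
    induction S using Finset.induction_on with
    | empty => simp
    | insert i S hi ih => rw [prod_insert hi, sum_insert hi, ih, MvPowerSeries.X_pow_eq, MvPowerSeries.monomial_mul_monomial, one_mul]
  rw [h]
  congr 2
  ext j
  rw [Finsupp.finset_sum_apply, fs_apply]
  simp [Finsupp.single_apply]

theorem EE_rec (d m : ℕ) (hd : 1 ≤ d) :
    EE d (m + 1) * (1 - ∏ i, MvPowerSeries.X i ^ d) =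
    (∑ r ∈ range d, MvPowerSeries.X 0 ^ r) * (∏ j : Fin m, MvPowerSeries.X j.succ ^ d) *
      MvPowerSeries.rename (Fin.succ : Fin m → Fin (m + 1)) (EE d m) := by
  ext b
  have h1 : (∑ r ∈ range d, (MvPowerSeries.X 0 : PSr (m + 1)) ^ r) * (∏ j : Fin m, MvPowerSeries.X j.succ ^ d) =
      ∑ r ∈ range d, MvPowerSeries.monomial (fs (Fin.cons r fun _ => d)) 1 := by
    rw [sum_mul]
    refine sum_congr rfl fun r _ => ?_
    rw [← prod_X_ps, Fin.prod_univ_succ]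
    simp
  rw [h1, sum_mul, map_sum, mul_sub, mul_one, map_sub, prod_X_ps (fun _ => d), MvPowerSeries.coeff_mul_monomial]
  simp only [MvPowerSeries.coeff_monomial_mul, one_mul, mul_one, coeff_rs, coeff_EE]
  have h2 : ∀ r, fs (Fin.cons r fun _ => d : Fin (m + 1) → ℕ) ≤ b ↔ r ≤ b 0 ∧ ∀ j : Fin m, d ≤ b j.succ := by
    intro r
    rw [Finsupp.le_def]
    constructor
    · intro h
      exact ⟨by simpa [fs_apply] using h 0, fun j => by simpa [fs_apply] using h j.succ⟩
    · rintro ⟨h0, hs⟩ i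
      refine Fin.cases ?_ (fun j => ?_) i
      · simpa [fs_apply] using h0
      · simpa [fs_apply] using hs j
  have h3 : fs (fun _ : Fin (m + 1) => d) ≤ b ↔ d ≤ b 0 ∧ ∀ j : Fin m, d ≤ b j.succ := by
    rw [← h2]
    have : (fun _ : Fin (m + 1) => d) = Fin.cons d fun _ => d := by
      funext i; refine Fin.cases ?_ (fun j => ?_) i <;> simp
    rw [this]
  have hdiv : ∀ x, d ≤ x → x / d = (x - d) / d + 1 := fun x hx => Nat.div_eq_sub_div hd hx
  simp only [h2, h3, Finsupp.tsub_apply, fs_apply, Finsupp.tail_apply, Fin.cons_zero, Fin.cons_succ]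
  by_cases hs : ∀ j : Fin m, d ≤ b j.succ
  · by_cases h0 : d ≤ b 0
    · have e1 : (∀ l m' : Fin (m + 1), l < m' → (b l - d) / d < (b m' - d) / d) ↔ ∀ l m' : Fin (m + 1), l < m' → b l / d < b m' / d := by
        have hall : ∀ i, d ≤ b i := fun i => Fin.cases h0 hs i
        refine forall₂_congr fun l m' => ?_
        rw [hdiv _ (hall l), hdiv _ (hall m')]
        simp
      have hh : d ≤ b 0 ∧ ∀ j : Fin m, d ≤ b j.succ := ⟨h0, hs⟩
      rw [if_pos hh]
      simp only [e1]
      rw [sub_self, eq_comm]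
      refine sum_eq_zero fun r hr => ?_
      have := mem_range.mp hr
      split_ifs
      · omega
      · omega
      · rfl
      · rfl
    · have hh : ¬ (d ≤ b 0 ∧ ∀ j : Fin m, d ≤ b j.succ) := fun h => h0 h.1
      rw [if_neg hh, sub_zero]
      rw [sum_eq_single (b 0)]
      · have hh2 : b 0 ≤ b 0 ∧ ∀ j : Fin m, d ≤ b j.succ := ⟨le_rfl, hs⟩
        have hh3 : b 0 - b 0 = 0 := by omega
        rw [if_pos hh2, if_pos hh3]
        refine if_congr ?_ rfl rfl
        have hb0 : b 0 / d = 0 := Nat.div_eq_of_lt (by omega)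
        constructor
        · intro h l m' hlm
          have := h l.succ m'.succ (by simpa using hlm)
          rw [hdiv _ (hs l), hdiv _ (hs m')] at this
          omega
        · intro h l m' hlm
          revert hlm
          refine Fin.cases ?_ (fun m'' => ?_) m'
          · intro hh; exact absurd hh (Fin.not_lt_zero l)
          · refine Fin.cases ?_ (fun l' => ?_) l
            · intro _
              rw [hb0, hdiv _ (hs m'')]; exact Nat.succ_pos _
            · intro hh
              have := h l' m'' (by simpa using hh)
              rw [hdiv _ (hs l'), hdiv _ (hs m'')]
              omega
      · intro r _ hr
        split_ifs
        · omega
        · omega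
        · rfl
        · rfl
      · intro h
        exact absurd (mem_range.mpr (by omega)) h
  · have hh : ¬ (d ≤ b 0 ∧ ∀ j : Fin m, d ≤ b j.succ) := fun h => hs h.2
    rw [if_neg hh, sub_zero, if_neg]
    · rw [eq_comm]
      refine sum_eq_zero fun r _ => ?_
      rw [if_neg (fun h => hs h.2)]
    · intro h
      apply hs
      intro j
      have := h 0 j.succ (Fin.succ_pos j)
      by_contra hlt
      rw [Nat.div_eq_of_lt (a := b j.succ) (by omega)] at this
      exact absurd this (Nat.not_lt_zero _)

section
variable {K : Type*} [Field K]

theorem unit_prod {m d : ℕ} (hd : 1 ≤ d) (S : Finset (Fin m)) (hS : S.Nonempty) : IsUnit (1 - ∏ i ∈ S, (MvPowerSeries.X i : PSr m) ^ d) := by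
  rw [MvPowerSeries.isUnit_iff_constantCoeff, map_sub, map_one, map_prod]
  obtain ⟨i, hi⟩ := hS
  rw [prod_eq_zero hi]
  · simp
  · rw [map_pow, MvPowerSeries.constantCoeff_X, zero_pow (by omega)]

theorem psi_E1 : ∀ (m : ℕ) (ψ : PSr m →+* K), ψ (EE 1 m) = fd1 m fun i => ψ (MvPowerSeries.X i) := by
  intro m
  induction m with
  | zero =>
    intro ψ
    have : EE 1 0 = 1 := by
      ext e
      rw [coeff_EE, if_pos (fun l => l.elim0), Subsingleton.elim e 0]
      simp
    rw [this, map_one]; rfl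
  | succ m ih =>
    intro ψ
    have h := congrArg ψ (EE_rec 1 m le_rfl)
    have hu := ((unit_prod (m := m + 1) (d := 1) le_rfl univ ⟨0, mem_univ _⟩).map ψ).ne_zero
    have h2 := ih (ψ.comp (MvPowerSeries.rename (Fin.succ : Fin m → Fin (m + 1))).toRingHom)
    simp only [RingHom.comp_apply, AlgHom.toRingHom_eq_coe, RingHom.coe_coe, MvPowerSeries.rename_X] at h2
    rw [map_mul, map_mul, h2] at h
    rw [eq_div_of_mul_eq hu h]
    simp only [pow_one, map_sub, map_one, map_prod, Fin.prod_univ_succ, map_mul, fd1, div_eq_mul_inv, range_one, sum_singleton, pow_zero, one_mul]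
    ring

noncomputable def G2 (m : ℕ) : PSr m := ∏ a, ∏ b, if a < b then 1 + MvPowerSeries.X a + MvPowerSeries.X a * MvPowerSeries.X b else 1

theorem G2_rec (m : ℕ) : G2 (m + 1) = (∏ j : Fin m, (1 + MvPowerSeries.X 0 + MvPowerSeries.X 0 * MvPowerSeries.X j.succ)) *
    MvPowerSeries.rename (Fin.succ : Fin m → Fin (m + 1)) (G2 m) := by
  unfold G2
  rw [pairs_split (fun a b => 1 + (MvPowerSeries.X a : PSr (m + 1)) + MvPowerSeries.X a * MvPowerSeries.X b) 0]
  refine congrArg₂ (· * ·) ?_ ?_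
  · refine prod_congr rfl fun j _ => ?_
    rw [if_neg (by simp), Fin.succAbove_zero]
  · simp only [map_prod, Fin.succAbove_zero]
    refine prod_congr rfl fun a _ => prod_congr rfl fun b _ => ?_
    split_ifs
    · simp
    · simp

theorem psi_E2 : ∀ (m : ℕ) (ψ : PSr m →+* K), ψ (G2 m * EE 2 m) = fd2 m fun i => ψ (MvPowerSeries.X i) := by
  intro m
  induction m with
  | zero =>
    intro ψ
    have : EE 2 0 = 1 := by
      ext e
      rw [coeff_EE, if_pos (fun l => l.elim0), Subsingleton.elim e 0]
      simp
    rw [this, mul_one]; simp [G2, fd2]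
  | succ m ih =>
    intro ψ
    have h := congrArg ψ (EE_rec 2 m (by norm_num))
    have hu := ((unit_prod (m := m + 1) (d := 2) (by norm_num) univ ⟨0, mem_univ _⟩).map ψ).ne_zero
    have h2 := ih (ψ.comp (MvPowerSeries.rename (Fin.succ : Fin m → Fin (m + 1))).toRingHom)
    simp only [RingHom.comp_apply, AlgHom.toRingHom_eq_coe, RingHom.coe_coe, MvPowerSeries.rename_X, map_mul] at h2
    rw [map_mul, map_mul] at h
    rw [map_mul, eq_div_of_mul_eq hu h, G2_rec]
    simp only [fd2]
    rw [← h2]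
    simp only [map_sub, map_one, map_prod, Fin.prod_univ_succ, map_mul, map_pow, div_eq_mul_inv, sum_range_succ, sum_range_zero, zero_add, pow_zero, pow_one, map_add, prod_mul_distrib]
    ring

end

end ACP

namespace ACP
open Finset Filter Topology

theorem pp_Ioi {M : Type*} [CommMonoid M] {m : ℕ} (F : Fin m → Fin m → M) :
    (∏ a, ∏ b, if a < b then F a b else 1) = ∏ i, ∏ j ∈ Ioi i, F i j := by
  refine prod_congr rfl fun a _ => ?_
  rw [← prod_filter]
  congr 1
  ext b; simp

theorem pp_anti {R : Type*} [CommRing R] {m : ℕ} (F : Fin m → Fin m → R) (hF : ∀ i j, F i j = -F j i) (σ : Equiv.Perm (Fin m)) :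
    (∏ a, ∏ b, if a < b then F (σ a) (σ b) else 1) = ((Equiv.Perm.sign σ : ℤ) : R) * ∏ a, ∏ b, if a < b then F a b else 1 := by
  rw [pp_Ioi F, pp_Ioi (fun a b => F (σ a) (σ b)), Equiv.Perm.prod_Ioi_comp_eq_sign_mul_prod σ hF]

theorem pp_symm {R : Type*} [CommRing R] [IsDomain R] {m : ℕ} (x : Fin m → R) (hx : Function.Injective x)
    (G : Fin m → Fin m → R) (hG : ∀ i j, G i j = G j i) (σ : Equiv.Perm (Fin m)) :
    (∏ a, ∏ b, if a < b then G (σ a) (σ b) else 1) = ∏ a, ∏ b, if a < b then G a b else 1 := by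
  have h1 := pp_anti (fun a b => x b - x a) (fun i j => by ring) σ
  have h2 := pp_anti (fun a b => (x b - x a) * G a b) (fun i j => by rw [hG i j]; ring) σ
  have hs : ∀ (f g : Fin m → Fin m → R), (∏ a, ∏ b, if a < b then f a b * g a b else 1) =
      (∏ a, ∏ b, if a < b then f a b else 1) * ∏ a, ∏ b, if a < b then g a b else 1 := by
    intro f g
    simp only [← prod_mul_distrib]
    refine prod_congr rfl fun a _ => prod_congr rfl fun b _ => ?_
    split_ifs <;> simp
  rw [hs (fun a b => x (σ b) - x (σ a)) (fun a b => G (σ a) (σ b)), hs (fun a b => x b - x a) G, h1] at h2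
  have hne : ((Equiv.Perm.sign σ : ℤ) : R) * (∏ a, ∏ b, if a < b then x b - x a else 1) ≠ 0 := by
    rw [← h1]
    refine prod_ne_zero_iff.mpr fun a _ => prod_ne_zero_iff.mpr fun b _ => ?_
    split_ifs with h
    · exact sub_ne_zero.mpr fun e => h.ne' (σ.injective (hx e))
    · exact one_ne_zero
  refine mul_left_cancel₀ hne ?_
  rw [h2]; ring

noncomputable def GY (m : ℕ) : PSr m := ∏ a, ∏ b, if a < b then MvPowerSeries.X a + MvPowerSeries.X b + MvPowerSeries.X a * MvPowerSeries.X b else 1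

instance psrDomain (m : ℕ) : IsDomain (PSr m) := NoZeroDivisors.to_isDomain _

theorem Xinj (m : ℕ) : Function.Injective (fun i => (MvPowerSeries.X i : PSr m)) := fun _ _ h => MvPowerSeries.X_inj.mp h

theorem GY_symm {m : ℕ} (σ : Equiv.Perm (Fin m)) : MvPowerSeries.rename σ (GY m) = GY m := by
  have h := pp_symm (fun i => (MvPowerSeries.X i : PSr m)) (Xinj m) (fun a b => MvPowerSeries.X a + MvPowerSeries.X b + MvPowerSeries.X a * MvPowerSeries.X b) (fun i j => by ring) σ
  unfold GY
  refine Eq.trans ?_ h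
  simp only [map_prod]
  refine prod_congr rfl fun a _ => prod_congr rfl fun b _ => ?_
  split_ifs <;> simp

theorem gd2_X (m : ℕ) : Gd2 (fun i => algebraMap (PSr m) (FractionRing (PSr m)) (MvPowerSeries.X i)) := by
  have hinj := IsFractionRing.injective (PSr m) (FractionRing (PSr m))
  have hne : ∀ F : PSr m, F ≠ 0 → algebraMap (PSr m) (FractionRing (PSr m)) F ≠ 0 := fun F hF h =>
    hF (hinj (by rw [h, map_zero]))
  have hc : ∀ F : PSr m, MvPowerSeries.constantCoeff F ≠ 0 → F ≠ 0 := fun F hF h => hF (by rw [h, map_zero])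
  constructor
  · exact hinj.comp (Xinj m)
  · intro i
    have := hne (1 - MvPowerSeries.X i) (hc _ (by simp))
    simpa using this
  · intro i
    have := hne (1 + MvPowerSeries.X i) (hc _ (by simp))
    simpa using this
  · intro i
    have := hne (1 + MvPowerSeries.X i + MvPowerSeries.X i ^ 2) (hc _ (by simp))
    simpa using this
  · intro i j _
    have := hne (1 - MvPowerSeries.X i * MvPowerSeries.X j) (hc _ (by simp))
    simpa using this
  · intro i j hij
    have := hne (MvPowerSeries.X i + MvPowerSeries.X j + MvPowerSeries.X i * MvPowerSeries.X j) (by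
      intro h
      have h2 := congrArg (MvPowerSeries.coeff (Finsupp.single i 1)) h
      rw [map_add, map_add, MvPowerSeries.coeff_index_single_X, MvPowerSeries.coeff_index_single_X, if_pos rfl, if_neg hij,
        MvPowerSeries.X_def, MvPowerSeries.X_def, MvPowerSeries.monomial_mul_monomial, MvPowerSeries.coeff_monomial, if_neg] at h2
      · simp at h2
      · intro h3
        have := DFunLike.congr_fun h3 j
        simp [Finsupp.single_apply, hij] at this)
    simpa using this
  · intro S hS
    have := hne _ (unit_prod (m := m) (d := 1) le_rfl S hS).ne_zero
    simpa using this
  · intro S hS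
    have := hne _ (unit_prod (m := m) (d := 2) (by norm_num) S hS).ne_zero
    simpa using this

theorem alt_ps (m : ℕ) : ∑ σ : Equiv.Perm (Fin m), ((Equiv.Perm.sign σ : ℤ) : PSr m) * MvPowerSeries.rename σ (G2 m * EE 2 m) =
    ∑ σ : Equiv.Perm (Fin m), ((Equiv.Perm.sign σ : ℤ) : PSr m) * MvPowerSeries.rename σ (GY m * EE 1 m) := by
  apply IsFractionRing.injective (PSr m) (FractionRing (PSr m))
  simp only [map_mul _ (GY m), GY_symm]
  rw [map_sum, map_sum]
  have h1 : ∀ σ : Equiv.Perm (Fin m), algebraMap (PSr m) (FractionRing (PSr m)) (MvPowerSeries.rename σ (EE 1 m)) =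
      fd1 m fun i => algebraMap (PSr m) (FractionRing (PSr m)) (MvPowerSeries.X (σ i)) := by
    intro σ
    have := psi_E1 m ((algebraMap (PSr m) (FractionRing (PSr m))).comp (MvPowerSeries.rename σ).toRingHom)
    simpa using this
  have h2 : ∀ σ : Equiv.Perm (Fin m), algebraMap (PSr m) (FractionRing (PSr m)) (MvPowerSeries.rename σ (G2 m * EE 2 m)) =
      fd2 m fun i => algebraMap (PSr m) (FractionRing (PSr m)) (MvPowerSeries.X (σ i)) := by
    intro σ
    have := psi_E2 m ((algebraMap (PSr m) (FractionRing (PSr m))).comp (MvPowerSeries.rename σ).toRingHom)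
    simpa using this
  have e1 := alt_fd1 m _ (gd2_X m)
  have e2 := alt_fd2 m _ (gd2_X m)
  have e3 : algebraMap (PSr m) (FractionRing (PSr m)) (GY m) = PY m fun i => algebraMap (PSr m) (FractionRing (PSr m)) (MvPowerSeries.X i) := by
    unfold GY PY
    simp only [map_prod]
    refine prod_congr rfl fun a _ => prod_congr rfl fun b _ => ?_
    split_ifs <;> simp
  simp only [map_mul _ ((_ : ℤ) : PSr m), map_mul _ (GY m), map_intCast, h1, h2, e3]
  rw [e2, ← e1, mul_sum]
  refine sum_congr rfl fun σ _ => ?_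
  ring

end ACP

namespace ACP
open Finset Filter Topology

noncomputable def prs {m : ℕ} (F : PSr m) (D : Fin m →₀ ℕ) : MvPolynomial (Fin m) ℂ →ₗ[ℂ] ℂ :=
  pr fun a => MvPowerSeries.coeff (a + D) F

theorem prs_mon {m : ℕ} (F : PSr m) (D a : Fin m →₀ ℕ) (r : ℂ) : prs F D (monomial a r) = r * MvPowerSeries.coeff (a + D) F := pr_mon _ _ _

theorem prs_add {m : ℕ} (F F' : PSr m) (D : Fin m →₀ ℕ) (P : MvPolynomial (Fin m) ℂ) : prs (F + F') D P = prs F D P + prs F' D P := by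
  unfold prs
  rw [pr_sum, pr_sum, pr_sum, ← sum_add_distrib]
  refine sum_congr rfl fun e _ => ?_
  rw [map_add]; ring

def Rev {m : ℕ} (D : Fin m →₀ ℕ) (G : MvPolynomial (Fin m) ℂ) (g : PSr m) : Prop :=
  ∀ D'' P F, prs F D'' (G * P) = prs (g * F) (D'' + D) P

theorem Rev_mon {m : ℕ} (c d D : Fin m →₀ ℕ) (h : c + d = D) : Rev D (monomial c 1) (MvPowerSeries.monomial d 1) := by
  intro D'' P F
  induction P using MvPolynomial.induction_on' with
  | monomial a r =>
    rw [monomial_mul, one_mul, prs_mon, prs_mon, ← h]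
    rw [show a + (D'' + (c + d)) = d + (c + a + D'') by abel, MvPowerSeries.coeff_add_monomial_mul, one_mul]
  | add p q hp hq => rw [mul_add, map_add, map_add, hp, hq]

theorem Rev_add {m : ℕ} {D : Fin m →₀ ℕ} {G G' : MvPolynomial (Fin m) ℂ} {g g' : PSr m} (h : Rev D G g) (h' : Rev D G' g') :
    Rev D (G + G') (g + g') := by
  intro D'' P F
  rw [add_mul, map_add, h, h', add_mul, prs_add]

theorem Rev_mul {m : ℕ} {D D' : Fin m →₀ ℕ} {G G' : MvPolynomial (Fin m) ℂ} {g g' : PSr m} (h : Rev D G g) (h' : Rev D' G' g') :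
    Rev (D + D') (G * G') (g * g') := by
  intro D'' P F
  rw [mul_assoc, h, h', add_assoc, ← mul_assoc, mul_comm g' g]

theorem Rev_one {m : ℕ} : Rev (0 : Fin m →₀ ℕ) 1 1 := by
  intro D'' P F
  rw [one_mul, one_mul, add_zero]

theorem Rev_prod {m : ℕ} {ι : Type*} (S : Finset ι) (D : ι → Fin m →₀ ℕ) (G : ι → MvPolynomial (Fin m) ℂ) (g : ι → PSr m)
    (h : ∀ i ∈ S, Rev (D i) (G i) (g i)) : Rev (∑ i ∈ S, D i) (∏ i ∈ S, G i) (∏ i ∈ S, g i) := by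
  induction S using Finset.induction_on with
  | empty => simpa using Rev_one
  | insert i S hi ih =>
    rw [sum_insert hi, prod_insert hi, prod_insert hi]
    exact Rev_mul (h i (mem_insert_self _ _)) (ih fun j hj => h j (mem_insert_of_mem hj))

noncomputable def DD (m : ℕ) : Fin m →₀ ℕ := ∑ a : Fin m, ∑ b : Fin m, if a < b then Finsupp.single a 1 + Finsupp.single b 1 else 0

noncomputable def G2p (m : ℕ) : MvPolynomial (Fin m) ℂ := ∏ a, ∏ b, if a < b then 1 + X b + X a * X b else 1
noncomputable def G1p (m : ℕ) : MvPolynomial (Fin m) ℂ := ∏ a, ∏ b, if a < b then 1 + X a + X b else 1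

theorem Rev_G2 (m : ℕ) : Rev (DD m) (G2p m) (G2 m) := by
  refine Rev_prod _ _ _ _ fun a _ => Rev_prod _ _ _ _ fun b _ => ?_
  split_ifs
  · have h1 := Rev_mon (m := m) 0 (Finsupp.single a 1 + Finsupp.single b 1) _ (zero_add _)
    have h2 := Rev_mon (m := m) (Finsupp.single b 1) (Finsupp.single a 1) (Finsupp.single a 1 + Finsupp.single b 1) (add_comm _ _)
    have h3 := Rev_mon (m := m) (Finsupp.single a 1 + Finsupp.single b 1) 0 _ (add_zero _)
    have := Rev_add (Rev_add h1 h2) h3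
    have e1 : (1 + X b + X a * X b : MvPolynomial (Fin m) ℂ) = monomial 0 1 + monomial (Finsupp.single b 1) 1 + monomial (Finsupp.single a 1 + Finsupp.single b 1) 1 := by
      simp [X, monomial_mul]
    have e2 : (1 + MvPowerSeries.X a + MvPowerSeries.X a * MvPowerSeries.X b : PSr m) = MvPowerSeries.monomial (Finsupp.single a 1 + Finsupp.single b 1) 1 + MvPowerSeries.monomial (Finsupp.single a 1) 1 + MvPowerSeries.monomial 0 1 := by
      rw [MvPowerSeries.X_def, MvPowerSeries.X_def, MvPowerSeries.monomial_mul_monomial, one_mul, MvPowerSeries.monomial_zero_one]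
      ring
    rw [e1, e2]; exact this
  · exact Rev_one

theorem Rev_G1 (m : ℕ) : Rev (DD m) (G1p m) (GY m) := by
  refine Rev_prod _ _ _ _ fun a _ => Rev_prod _ _ _ _ fun b _ => ?_
  split_ifs
  · have h1 := Rev_mon (m := m) 0 (Finsupp.single a 1 + Finsupp.single b 1) _ (zero_add _)
    have h2 := Rev_mon (m := m) (Finsupp.single b 1) (Finsupp.single a 1) (Finsupp.single a 1 + Finsupp.single b 1) (add_comm _ _)
    have h3 := Rev_mon (m := m) (Finsupp.single a 1) (Finsupp.single b 1) (Finsupp.single a 1 + Finsupp.single b 1) rfl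
    have := Rev_add (Rev_add h1 h3) h2
    have e1 : (1 + X a + X b : MvPolynomial (Fin m) ℂ) = monomial 0 1 + monomial (Finsupp.single a 1) 1 + monomial (Finsupp.single b 1) 1 := by
      simp [X]
    have e2 : (MvPowerSeries.X a + MvPowerSeries.X b + MvPowerSeries.X a * MvPowerSeries.X b : PSr m) = MvPowerSeries.monomial (Finsupp.single a 1 + Finsupp.single b 1) 1 + MvPowerSeries.monomial (Finsupp.single b 1) 1 + MvPowerSeries.monomial (Finsupp.single a 1) 1 := by
      rw [MvPowerSeries.X_def, MvPowerSeries.X_def, MvPowerSeries.monomial_mul_monomial, one_mul]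
      ring
    rw [e1, e2]; exact this
  · exact Rev_one

theorem DD_apply (m : ℕ) (i : Fin m) : DD m i = m - 1 := by
  unfold DD
  rw [Finsupp.finset_sum_apply]
  have h1 : ∀ a : Fin m, (∑ b : Fin m, if a < b then (Finsupp.single a 1 + Finsupp.single b 1 : Fin m →₀ ℕ) else 0) i =
      (∑ b : Fin m, if a < b ∧ a = i then 1 else 0) + ∑ b : Fin m, if a < b ∧ b = i then 1 else 0 := by
    intro a
    rw [Finsupp.finset_sum_apply, ← sum_add_distrib]
    refine sum_congr rfl fun b _ => ?_
    by_cases h : a < b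
    · simp [h, Finsupp.single_apply]
    · simp [h]
  rw [sum_congr rfl fun a _ => h1 a, sum_add_distrib]
  have h2 : (∑ a : Fin m, ∑ b : Fin m, if a < b ∧ a = i then 1 else 0) = m - 1 - i := by
    rw [sum_eq_single i]
    · simp only [and_true]
      rw [← card_filter, ← Fin.card_Ioi i]
      congr 1; ext b; simp
    · intro a _ ha; simp [ha]
    · simp
  have h3 : (∑ a : Fin m, ∑ b : Fin m, if a < b ∧ b = i then 1 else 0) = (i : ℕ) := by
    rw [sum_comm, sum_eq_single i]
    · simp only [and_true]
      rw [← card_filter]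
      conv_rhs => rw [← Fin.card_Iio i]
      congr 1; ext b; simp
    · intro a _ ha; simp [ha]
    · simp
  rw [h2, h3]; omega

theorem mapD {m : ℕ} (σ : Equiv.Perm (Fin m)) (a : Fin m →₀ ℕ) : Finsupp.mapDomain σ (a + DD m) = Finsupp.mapDomain σ a + DD m := by
  rw [Finsupp.mapDomain_add]
  congr 1
  ext i
  rw [← Finsupp.equivMapDomain_eq_mapDomain, Finsupp.equivMapDomain_apply, DD_apply, DD_apply]

theorem prs_ren {m : ℕ} (σ : Equiv.Perm (Fin m)) (F : PSr m) (P : MvPolynomial (Fin m) ℂ) :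
    prs (MvPowerSeries.rename σ F) (DD m) (rename σ P) = prs F (DD m) P := by
  induction P using MvPolynomial.induction_on' with
  | monomial a r =>
    rw [rename_monomial, prs_mon, prs_mon, ← mapD]
    have := MvPowerSeries.coeff_embDomain_rename (R := ℂ) σ.toEmbedding F (a + DD m)
    rw [Finsupp.embDomain_eq_mapDomain] at this
    exact congrArg _ this
  | add p q hp hq => rw [map_add, map_add, map_add, hp, hq]

theorem sgn_sq {m : ℕ} (σ : Equiv.Perm (Fin m)) : (((Equiv.Perm.sign σ : ℤ) : ℂ)) * ((Equiv.Perm.sign σ : ℤ) : ℂ) = 1 := by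
  rcases Int.units_eq_one_or (Equiv.Perm.sign σ) with h | h <;> simp [h]

theorem prs_zmul {m : ℕ} (z : ℤ) (F : PSr m) (D : Fin m →₀ ℕ) (P : MvPolynomial (Fin m) ℂ) : prs ((z : PSr m) * F) D P = z * prs F D P := by
  unfold prs
  rw [pr_sum, pr_sum, mul_sum]
  refine sum_congr rfl fun e _ => ?_
  rw [← zsmul_eq_mul, map_zsmul, zsmul_eq_mul]; ring

theorem prs_sum {m : ℕ} {ι : Type*} (S : Finset ι) (F : ι → PSr m) (D : Fin m →₀ ℕ) (P : MvPolynomial (Fin m) ℂ) :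
    prs (∑ i ∈ S, F i) D P = ∑ i ∈ S, prs (F i) D P := by
  unfold prs
  simp only [pr_sum]
  rw [sum_comm]
  refine sum_congr rfl fun e _ => ?_
  rw [map_sum, mul_sum]

theorem prs_alt {m : ℕ} (A : MvPolynomial (Fin m) ℂ) (hA : ∀ σ : Equiv.Perm (Fin m), rename σ A = ((Equiv.Perm.sign σ : ℤ) : ℂ) • A) (F : PSr m) :
    prs (∑ σ : Equiv.Perm (Fin m), ((Equiv.Perm.sign σ : ℤ) : PSr m) * MvPowerSeries.rename σ F) (DD m) A = (m.factorial : ℂ) * prs F (DD m) A := by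
  rw [prs_sum]
  have : ∀ σ : Equiv.Perm (Fin m), prs (((Equiv.Perm.sign σ : ℤ) : PSr m) * MvPowerSeries.rename σ F) (DD m) A = prs F (DD m) A := by
    intro σ
    rw [prs_zmul, ← prs_ren σ F A, hA σ, map_smul, smul_eq_mul]
  rw [sum_congr rfl fun σ _ => this σ, sum_const, card_univ, Fintype.card_perm, Fintype.card_fin, nsmul_eq_mul]

theorem star {m : ℕ} (A : MvPolynomial (Fin m) ℂ) (hA : ∀ σ : Equiv.Perm (Fin m), rename σ A = ((Equiv.Perm.sign σ : ℤ) : ℂ) • A) :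
    prs (EE 2 m) 0 (G2p m * A) = prs (EE 1 m) 0 (G1p m * A) := by
  rw [Rev_G2 m, Rev_G1 m, zero_add]
  have hf : (m.factorial : ℂ) ≠ 0 := by exact_mod_cast Nat.factorial_ne_zero m
  refine mul_left_cancel₀ hf ?_
  rw [← prs_alt A hA, ← prs_alt A hA, alt_ps]

/-- the product `∏ X^(k+1)(1+X)^k · ∏_{a<b} (X b - X a)(1 + X a + X b)` -/
noncomputable def PV (m k : ℕ) : MvPolynomial (Fin m) ℂ := (∏ l, X l ^ (k + 1) * (1 + X l) ^ k) * ∏ a, ∏ b, if a < b then (X b - X a) * (1 + X a + X b) else 1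

theorem pp_mul {R : Type*} [CommRing R] {m : ℕ} (f g : Fin m → Fin m → R) : (∏ a, ∏ b, if a < b then f a b * g a b else 1) =
      (∏ a, ∏ b, if a < b then f a b else 1) * ∏ a, ∏ b, if a < b then g a b else 1 := by
  simp only [← prod_mul_distrib]
  refine prod_congr rfl fun a _ => prod_congr rfl fun b _ => ?_
  split_ifs <;> simp

theorem PP_PV (m k : ℕ) : pr (ind (Gd m 0 k)) (PP m k) = prs (EE 1 m) 0 (PV m k) := by
  have h1 : pr (ind (Gd m 0 k)) = prs (EE 2 m) 0 := by
    unfold prs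
    congr 1
    funext e
    rw [add_zero, coeff_EE]
    have hiff : Gd m 0 k e ↔ ∀ l m' : Fin m, l < m' → e l / 2 < e m' / 2 := ?_
    · unfold ind
      by_cases h : Gd m 0 k e
      · rw [if_pos h, if_pos (hiff.mp h)]
      · rw [if_neg h, if_neg (fun h' => h (hiff.mpr h'))]
    unfold Gd
    constructor
    · rintro ⟨_, h⟩ l m' hl; exact h l m' (Nat.zero_le _) hl
    · intro h; exact ⟨fun l hl => absurd hl (Nat.not_lt_zero _), fun l m' _ hl => h l m' hl⟩
  have h2 : PP m k = G2p m * ((∏ l, X l ^ (k + 1) * (1 + X l) ^ k) * ∏ a, ∏ b, if a < b then (X b - X a) else 1) := by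
    unfold PP QQ G2p
    rw [pp_mul]; ring
  have h3 : PV m k = G1p m * ((∏ l, X l ^ (k + 1) * (1 + X l) ^ k) * ∏ a, ∏ b, if a < b then (X b - X a) else 1) := by
    unfold PV G1p
    rw [pp_mul]; ring
  rw [h1, h2, h3]
  apply star
  intro σ
  have h4 := pp_anti (fun a b => (X b - X a : MvPolynomial (Fin m) ℂ)) (fun i j => by ring) σ
  rw [map_mul, map_prod, map_prod]
  have h5 : (∏ a, rename σ (∏ b, if a < b then (X b - X a : MvPolynomial (Fin m) ℂ) else 1)) = ∏ a, ∏ b, if a < b then (X (σ b) - X (σ a) : MvPolynomial (Fin m) ℂ) else 1 := by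
    refine prod_congr rfl fun a _ => ?_
    rw [map_prod]
    refine prod_congr rfl fun b _ => ?_
    split_ifs <;> simp
  rw [h5, h4, smul_eq_C_mul]
  have h6 : (∏ l, rename σ (X l ^ (k + 1) * (1 + X l) ^ k : MvPolynomial (Fin m) ℂ)) = ∏ l, (X l ^ (k + 1) * (1 + X l) ^ k) := by
    refine Eq.trans ?_ (Equiv.prod_comp σ (fun l => (X l ^ (k + 1) * (1 + X l) ^ k : MvPolynomial (Fin m) ℂ)))
    refine prod_congr rfl fun b _ => ?_
    simp
  rw [h6]
  simp only [map_intCast]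
  ring

end ACP

namespace ACP
open Finset Filter Topology

section pf
variable {α : Type*} [LinearOrder α]

noncomputable def sg (a b : α) : ℂ := if a < b then 1 else if b < a then -1 else 0

theorem sg_anti (a b : α) : sg a b = -sg b a := by
  unfold sg
  rcases lt_trichotomy a b with h | h | h
  · simp [h, h.le, not_lt_of_gt h]
  · simp [h]
  · simp [h, h.le, not_lt_of_gt h]

noncomputable def ep {m : ℕ} (a : Fin m → α) : ℂ := ∏ i, ∏ j, if i < j then sg (a i) (a j) else 1

theorem ep_perm {m : ℕ} (a : Fin m → α) (σ : Equiv.Perm (Fin m)) : ep (fun i => a (σ i)) = ((Equiv.Perm.sign σ : ℤ) : ℂ) * ep a :=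
  pp_anti (fun i j => sg (a i) (a j)) (fun _ _ => sg_anti _ _) σ

theorem alt_ext {m : ℕ} (f g : (Fin m → α) → ℂ)
    (hf : ∀ b (σ : Equiv.Perm (Fin m)), f (fun i => b (σ i)) = ((Equiv.Perm.sign σ : ℤ) : ℂ) * f b)
    (hg : ∀ b (σ : Equiv.Perm (Fin m)), g (fun i => b (σ i)) = ((Equiv.Perm.sign σ : ℤ) : ℂ) * g b)
    (h : ∀ b, StrictMono b → f b = g b) (b : Fin m → α) : f b = g b := by
  have hz : ∀ f : (Fin m → α) → ℂ, (∀ b (σ : Equiv.Perm (Fin m)), f (fun i => b (σ i)) = ((Equiv.Perm.sign σ : ℤ) : ℂ) * f b) →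
      ¬ Function.Injective b → f b = 0 := by
    intro f hf hb
    obtain ⟨p, r, h1, h2⟩ : ∃ p r, b p = b r ∧ p ≠ r := by
      by_contra hc; push Not at hc; exact hb fun x y hxy => hc x y hxy
    have h3 := hf b (Equiv.swap p r)
    have h4 : (fun i => b (Equiv.swap p r i)) = b := by
      funext i
      by_cases hp : i = p
      · rw [hp, Equiv.swap_apply_left, h1]
      by_cases hr : i = r
      · rw [hr, Equiv.swap_apply_right, h1]
      rw [Equiv.swap_apply_of_ne_of_ne hp hr]
    rw [h4, Equiv.Perm.sign_swap h2] at h3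
    push_cast at h3
    linear_combination h3 / 2
  by_cases hb : Function.Injective b
  · have hs : StrictMono (fun i => b (Tuple.sort b i)) :=
      (Tuple.monotone_sort b).strictMono_of_injective (hb.comp (Tuple.sort b).injective)
    have h1 := h _ hs
    rw [hf, hg] at h1
    refine mul_left_cancel₀ ?_ h1
    intro h0
    have := sgn_sq (Tuple.sort b)
    rw [h0] at this; simp at this
  · rw [hz f hf hb, hz g hg hb]

theorem ep_mono {m : ℕ} (b : Fin m → α) (hb : StrictMono b) : ep b = 1 := by
  unfold ep
  refine prod_eq_one fun i _ => prod_eq_one fun j _ => ?_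
  split_ifs with h
  · exact if_pos (hb h)
  · rfl

theorem sg_sum (t : α) : ∀ (m : ℕ) (b : Fin m → α), StrictMono b →
    (∑ j : Fin m, (-1 : ℂ) ^ (j : ℕ) * sg t (b j)) = (∏ j, sg t (b j)) - (if Even m then 1 else 0) := by
  intro m
  induction m with
  | zero => intro b _; simp
  | succ m ih =>
    intro b hb
    have h1 := ih (fun j => b j.succ) (fun i j h => hb (Fin.succ_lt_succ_iff.2 h))
    have h2 : (sg t (b 0) + 1) * (1 - ∏ j : Fin m, sg t (b j.succ)) = 0 := by
      by_cases h : b 0 < t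
      · have : sg t (b 0) = -1 := by unfold sg; rw [if_neg (not_lt_of_gt h), if_pos h]
        rw [this]; ring
      · have : ∏ j : Fin m, sg t (b j.succ) = 1 :=
          prod_eq_one fun j _ => if_pos (lt_of_le_of_lt (not_lt.1 h) (hb (Fin.succ_pos j)))
        rw [this]; ring
    rw [Fin.sum_univ_succ, Fin.prod_univ_succ]
    have h3 : ∑ i : Fin m, (-1 : ℂ) ^ ((i.succ : Fin (m + 1)) : ℕ) * sg t (b i.succ) = -∑ i : Fin m, (-1 : ℂ) ^ (i : ℕ) * sg t (b i.succ) := by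
      rw [← sum_neg_distrib]
      refine sum_congr rfl fun i _ => ?_
      rw [Fin.val_succ, pow_succ]; ring
    rw [h3, h1, Fin.val_zero, pow_zero, one_mul]
    by_cases he : Even m
    · rw [if_pos he, if_neg (by simpa [Nat.even_add_one] using he)]
      linear_combination h2
    · rw [if_neg he, if_pos (by simpa [Nat.even_add_one] using he)]
      linear_combination h2

theorem ep_expand (t : α) {m : ℕ} (hm : Even m) (b : Fin (m + 1) → α) :
    (∏ j, sg t (b j)) * ep b = ∑ j : Fin (m + 1), (-1) ^ (j : ℕ) * sg t (b j) * ep (fun i => b (j.succAbove i)) := by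
  refine alt_ext (fun b => (∏ j, sg t (b j)) * ep b)
    (fun b => ∑ j : Fin (m + 1), (-1) ^ (j : ℕ) * sg t (b j) * ep (fun i => b (j.succAbove i))) ?_ ?_ ?_ b
  · intro b σ
    beta_reduce
    rw [ep_perm, Equiv.prod_comp σ (fun i => sg t (b i))]; ring
  · have hfac : (Nat.factorial m : ℂ) ≠ 0 := by exact_mod_cast Nat.factorial_ne_zero m
    have key : ∀ b : Fin (m + 1) → α, (Nat.factorial m : ℂ) * (∑ j : Fin (m + 1), (-1) ^ (j : ℕ) * sg t (b j) * ep (fun i => b (j.succAbove i)))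
        = ∑ σ : Equiv.Perm (Fin (m + 1)), ((Equiv.Perm.sign σ : ℤ) : ℂ) * (sg t (b (σ 0)) * ep (fun j : Fin m => b (σ j.succ))) := by
      intro b
      have := alt_rec (K := ℂ) (fun x : Fin (m + 1) → α => sg t (x 0) * ep (fun j : Fin m => x j.succ)) (fun c _ => sg t c) (fun x => ep x)
        (fun x => rfl) (fun _ _ _ => rfl) b
      refine Eq.trans ?_ this.symm
      rw [mul_sum]
      refine sum_congr rfl fun j _ => ?_
      have h2 : ∀ τ : Equiv.Perm (Fin m), ((Equiv.Perm.sign τ : ℤ) : ℂ) * ep (fun i => b (j.succAbove (τ i))) = ep (fun i => b (j.succAbove i)) := by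
        intro τ
        rw [ep_perm (fun i => b (j.succAbove i)) τ, ← mul_assoc, sgn_sq, one_mul]
      rw [sum_congr rfl fun τ _ => h2 τ, sum_const, card_univ, Fintype.card_perm, Fintype.card_fin, nsmul_eq_mul]
      ring
    intro b τ
    beta_reduce
    refine mul_left_cancel₀ hfac ?_
    rw [key (fun i => b (τ i)), mul_left_comm, key b, mul_sum]
    refine Eq.symm ((Equiv.sum_comp (Equiv.mulLeft τ) _).symm.trans ?_)
    refine sum_congr rfl fun σ _ => ?_
    simp only [Equiv.coe_mulLeft, Equiv.Perm.mul_apply, Equiv.Perm.sign_mul]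
    push_cast
    linear_combination (((Equiv.Perm.sign σ : ℤ) : ℂ) * (sg t (b (τ (σ 0))) * ep fun j => b (τ (σ j.succ)))) * sgn_sq τ
  · intro b hb
    beta_reduce
    rw [ep_mono b hb, mul_one]
    have h := sg_sum t (m + 1) b hb
    rw [if_neg (by simpa [Nat.even_add_one] using hm), sub_zero] at h
    rw [← h]
    refine sum_congr rfl fun j _ => ?_
    rw [ep_mono, mul_one]
    exact fun x y hxy => hb ((Fin.strictMono_succAbove j) hxy)

variable [Fintype α]

noncomputable def SS {m : ℕ} (F : Fin m → α → ℂ) : ℂ := ∑ a : Fin m → α, ep a * ∏ i, F i (a i)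
noncomputable def om (f g : α → ℂ) : ℂ := ∑ s, ∑ t, sg s t * f s * g t

theorem om_anti (f g : α → ℂ) : om f g = - om g f := by
  unfold om
  rw [sum_comm, ← sum_neg_distrib]
  refine sum_congr rfl fun s _ => ?_
  rw [← sum_neg_distrib]
  refine sum_congr rfl fun t _ => ?_
  rw [sg_anti]; ring

theorem SS_perm {m : ℕ} (F : Fin m → α → ℂ) (σ : Equiv.Perm (Fin m)) : SS (fun i => F (σ i)) = ((Equiv.Perm.sign σ : ℤ) : ℂ) * SS F := by
  unfold SS
  rw [mul_sum, ← Equiv.sum_comp (Equiv.arrowCongr σ.symm (Equiv.refl α))]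
  refine sum_congr rfl fun a _ => ?_
  have h : (Equiv.arrowCongr σ.symm (Equiv.refl α)) a = fun i => a (σ i) := by
    funext i; simp [Equiv.arrowCongr]
  rw [h, ep_perm, Equiv.prod_comp σ (fun i => F i (a i))]; ring

theorem SS_cons {m : ℕ} (x : α → ℂ) (L : Fin m → α → ℂ) :
    SS (Fin.cons x L : Fin (m + 1) → α → ℂ) = ∑ t, ∑ b : Fin m → α, x t * ((∏ j, sg t (b j)) * ep b) * ∏ i, L i (b i) := by
  unfold SS
  rw [← (Fin.consEquiv (fun _ : Fin (m + 1) => α)).sum_comp, Fintype.sum_prod_type]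
  refine sum_congr rfl fun t _ => sum_congr rfl fun b _ => ?_
  have h : ep ((Fin.consEquiv (fun _ : Fin (m + 1) => α)) (t, b)) = (∏ j, sg t (b j)) * ep b := by
    unfold ep
    rw [pairs_split _ 0]
    simp [Fin.consEquiv]
  rw [h, Fin.prod_univ_succ]
  simp only [Fin.consEquiv, Equiv.coe_fn_mk, Fin.cons_zero, Fin.cons_succ]
  ring

theorem SS_expand {m : ℕ} (hm : Even m) (x : α → ℂ) (L : Fin (m + 1) → α → ℂ) :
    SS (Fin.cons x L : Fin (m + 2) → α → ℂ) = ∑ j : Fin (m + 1), (-1) ^ (j : ℕ) * om x (L j) * SS (fun i => L (j.succAbove i)) := by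
  rw [SS_cons]
  simp only [ep_expand _ hm, mul_sum, sum_mul]
  have : ∀ t : α, ∑ b : Fin (m + 1) → α, ∑ i : Fin (m + 1), x t * ((-1) ^ (i : ℕ) * sg t (b i) * ep fun l => b (i.succAbove l)) * ∏ j, L j (b j)
      = ∑ i : Fin (m + 1), ∑ s : α, ∑ c : Fin m → α, x t * ((-1) ^ (i : ℕ) * sg t s * ep c) * (L i s * ∏ j, L (i.succAbove j) (c j)) := by
    intro t
    rw [sum_comm]
    refine sum_congr rfl fun i _ => ?_
    rw [← (Fin.insertNthEquiv (fun _ : Fin (m + 1) => α) i).sum_comp, Fintype.sum_prod_type]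
    refine sum_congr rfl fun s _ => sum_congr rfl fun c _ => ?_
    rw [Fin.prod_univ_succAbove _ i]
    simp [Fin.insertNthEquiv]
  rw [sum_congr rfl fun t _ => this t, sum_comm]
  refine sum_congr rfl fun i _ => ?_
  unfold om SS
  simp only [mul_sum, sum_mul]
  rw [sum_comm' (s := univ) (t := fun _ => univ) (t' := univ) (s' := fun _ => univ) (by simp)]
  refine Eq.trans (sum_congr rfl fun s _ => sum_comm) ?_
  rw [sum_comm]
  refine sum_congr rfl fun c _ => ?_
  rw [sum_comm]
  refine sum_congr rfl fun t _ => sum_congr rfl fun s _ => ?_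
  ring

end pf
end ACP

namespace ACP
open Finset Filter Topology

section pf
variable {α : Type*}

theorem cons_cyc {β : Type*} {m : ℕ} (U : Fin (m + 1) → β) (j : Fin (m + 1)) :
    (Fin.cons (U j) (fun i => U (j.succAbove i)) : Fin (m + 1) → β) = fun i => U (j.cycleRange.symm i) := by
  funext i
  refine Fin.cases ?_ (fun i => ?_) i
  · rw [Fin.cons_zero, Fin.cycleRange_symm_zero]
  · rw [Fin.cons_succ, Fin.cycleRange_symm_succ]

theorem cons_sA {β : Type*} {m : ℕ} (g : β) (U : Fin (m + 1) → β) (j : Fin (m + 1)) :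
    (fun i => (Fin.cons g U : Fin (m + 2) → β) (j.succ.succAbove i)) = (Fin.cons g (fun i => U (j.succAbove i)) : Fin (m + 1) → β) := by
  funext i
  refine Fin.cases ?_ (fun i => ?_) i
  · simp
  · rw [Fin.succ_succAbove_succ, Fin.cons_succ, Fin.cons_succ]

theorem sgn_cyc {m : ℕ} (j : Fin (m + 1)) : ((Equiv.Perm.sign j.cycleRange.symm : ℤ) : ℂ) = (-1) ^ (j : ℕ) := by
  rw [Equiv.Perm.sign_symm, Fin.sign_cycleRange]; push_cast; rfl

variable [LinearOrder α] [Fintype α]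

theorem SS_front {m : ℕ} (U : Fin (m + 1) → α → ℂ) (j : Fin (m + 1)) :
    SS (Fin.cons (U j) (fun i => U (j.succAbove i)) : Fin (m + 1) → α → ℂ) = (-1) ^ (j : ℕ) * SS U := by
  rw [cons_cyc, SS_perm, sgn_cyc]

noncomputable def OM {m : ℕ} (R C : Fin m → α → ℂ) : Matrix (Fin m) (Fin m) ℂ := Matrix.of fun i j => om (R i) (C j)

theorem OM_front {m : ℕ} (U C : Fin (m + 1) → α → ℂ) (j : Fin (m + 1)) :
    (OM U C).det = (-1) ^ (j : ℕ) * (OM (Fin.cons (U j) (fun i => U (j.succAbove i))) C).det := by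
  have h : OM (Fin.cons (U j) (fun i => U (j.succAbove i))) C = (OM U C).submatrix j.cycleRange.symm id := by
    rw [cons_cyc]; rfl
  rw [h, Matrix.det_permute, sgn_cyc, ← mul_assoc, ← pow_add, ← two_mul, pow_mul]
  simp

theorem SS_tie {m : ℕ} (e : α → ℂ) (L : Fin m → α → ℂ) : SS (Fin.cons e (Fin.cons e L : Fin (m + 1) → α → ℂ) : Fin (m + 2) → α → ℂ) = 0 := by
  have h := SS_front (Fin.cons e (Fin.cons e L : Fin (m + 1) → α → ℂ) : Fin (m + 2) → α → ℂ) (Fin.succ 0)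
  rw [cons_sA] at h
  simp only [Fin.cons_succ, Fin.cons_zero, Fin.succAbove_zero, Fin.val_succ, Fin.val_zero] at h
  linear_combination h / 2

theorem cayley : ∀ (m : ℕ) (e g : α → ℂ) (U : Fin m → α → ℂ),
    (OM (Fin.cons e U : Fin (m + 1) → α → ℂ) (Fin.cons g U)).det =
      if Even m then SS U * SS (Fin.cons e (Fin.cons g U : Fin (m + 1) → α → ℂ) : Fin (m + 2) → α → ℂ)
      else SS (Fin.cons e U : Fin (m + 1) → α → ℂ) * SS (Fin.cons g U : Fin (m + 1) → α → ℂ) := by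
  intro m
  induction m with
  | zero =>
    intro e g U
    rw [if_pos Even.zero, SS_expand Even.zero]
    have h : ∀ V : Fin 0 → α → ℂ, SS V = 1 := by
      intro V
      simp [SS, ep]
    simp [h, OM]
  | succ m ih =>
    intro e g U
    have hminor : ∀ j : Fin (m + 1), ((OM (Fin.cons e U : Fin (m + 2) → α → ℂ) (Fin.cons g U)).submatrix Fin.succ j.succ.succAbove).det
        = (-1) ^ (j : ℕ) * (OM (Fin.cons (U j) (fun i => U (j.succAbove i))) (Fin.cons g (fun i => U (j.succAbove i)))).det := by
      intro j
      rw [← OM_front, ← cons_sA]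
      rfl
    have h0 : ((OM (Fin.cons e U : Fin (m + 2) → α → ℂ) (Fin.cons g U)).submatrix Fin.succ (Fin.succAbove 0)).det
        = (OM (Fin.cons (U 0) (fun i => U i.succ)) (Fin.cons (U 0) (fun i => U i.succ))).det := by
      have hU : (Fin.cons (U 0) (fun i => U i.succ) : Fin (m + 1) → α → ℂ) = U := Fin.cons_self_tail U
      rw [hU]; rfl
    rw [Matrix.det_succ_row_zero, Fin.sum_univ_succ, h0]
    simp only [hminor, ih]
    have hU : (Fin.cons (U 0) (fun i => U i.succ) : Fin (m + 1) → α → ℂ) = U := Fin.cons_self_tail U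
    by_cases he : Even m
    · rw [if_neg (fun h => (Nat.even_add_one.1 h) he), if_pos he, SS_tie, SS_expand he e U, sum_mul]
      rw [mul_zero, mul_zero, zero_add]
      refine sum_congr rfl fun j _ => ?_
      rw [if_pos he]
      have h1 := SS_front (Fin.cons g U : Fin (m + 2) → α → ℂ) j.succ
      rw [cons_sA, Fin.cons_succ] at h1
      rw [h1]
      have h2 : ((-1 : ℂ) ^ (j : ℕ)) * (-1) ^ (j : ℕ) = 1 := by rw [← mul_pow]; simp
      have h3 : (OM (Fin.cons e U : Fin (m + 2) → α → ℂ) (Fin.cons g U)) 0 j.succ = om e (U j) := rfl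
      rw [h3, Fin.val_succ, pow_succ]
      linear_combination ((-1 : ℂ) ^ (j : ℕ) * om e (U j) * SS (fun i => U (j.succAbove i)) * SS (Fin.cons g U : Fin (m + 2) → α → ℂ)) * h2
    · have he' : Even (m + 1) := by simpa [Nat.even_add_one] using he
      rw [if_pos he', if_neg he, SS_expand he' e (Fin.cons g U), mul_sum, hU]
      refine Eq.trans ?_ (Fin.sum_univ_succ _).symm
      have h3 : (OM (Fin.cons e U : Fin (m + 2) → α → ℂ) (Fin.cons g U)) 0 0 = om e g := rfl
      rw [h3]
      refine congrArg₂ (fun x y : ℂ => x + y) ?_ ?_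
      · simp only [Fin.val_zero, pow_zero, Fin.cons_zero, Fin.succAbove_zero, Fin.cons_succ]; ring
      · refine sum_congr rfl fun j _ => ?_
        rw [if_neg he, SS_front U j, cons_sA]
        have h2 : ((-1 : ℂ) ^ (j : ℕ)) * (-1) ^ (j : ℕ) = 1 := by rw [← mul_pow]; simp
        have h3 : (OM (Fin.cons e U : Fin (m + 2) → α → ℂ) (Fin.cons g U)) 0 j.succ = om e (U j) := rfl
        rw [h3, Fin.cons_succ]
        linear_combination ((-1 : ℂ) ^ (j.succ : ℕ) * om e (U j) * SS U * SS (Fin.cons g (fun i => U (j.succAbove i)) : Fin (m + 1) → α → ℂ)) * h2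

end pf
end ACP

namespace ACP
open Finset Filter Topology

theorem ep_alt {α : Type*} [LinearOrder α] {m : ℕ} (a : Fin m → α) :
    (∑ σ : Equiv.Perm (Fin m), ((Equiv.Perm.sign σ : ℤ) : ℂ) * (if StrictMono (fun i => a (σ i)) then 1 else 0)) = ep a := by
  refine alt_ext (fun a : Fin m → α => ∑ σ : Equiv.Perm (Fin m), ((Equiv.Perm.sign σ : ℤ) : ℂ) * (if StrictMono (fun i => a (σ i)) then 1 else 0)) ep ?_ ep_perm ?_ a
  · intro b τ
    beta_reduce
    rw [mul_sum]
    refine Eq.symm ((Equiv.sum_comp (Equiv.mulLeft τ) _).symm.trans ?_)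
    refine sum_congr rfl fun σ _ => ?_
    simp only [Equiv.coe_mulLeft, Equiv.Perm.mul_apply, Equiv.Perm.sign_mul]
    push_cast
    rw [mul_assoc, ← mul_assoc, ← mul_assoc, sgn_sq, one_mul]
    congr
  · intro b hb
    beta_reduce
    rw [ep_mono b hb, sum_eq_single 1]
    · simp [hb]
    · intro σ _ hσ
      rw [if_neg, mul_zero]
      intro h
      apply hσ
      have h1 := Tuple.unique_monotone (f := b) (σ := σ) (τ := 1) h.monotone hb.monotone
      ext i
      exact congrArg Fin.val (hb.injective (congrFun h1 i))
    · simp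

noncomputable def cf (N : ℕ) (p : Polynomial ℂ) : Fin N → ℂ := fun a => p.coeff a
noncomputable def hp (k j : ℕ) : Polynomial ℂ := Polynomial.X ^ (k + 1 + j) * (1 + Polynomial.X) ^ (k + j)

theorem hp_deg (k j : ℕ) : (hp k j).natDegree ≤ 2 * k + 2 * j + 1 := by
  unfold hp
  refine (Polynomial.natDegree_mul_le).trans ?_
  have h1 : (Polynomial.X ^ (k + 1 + j) : Polynomial ℂ).natDegree ≤ k + 1 + j := Polynomial.natDegree_X_pow_le _
  have h2 : ((1 + Polynomial.X) ^ (k + j) : Polynomial ℂ).natDegree ≤ (k + j) * 1 := by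
    refine Polynomial.natDegree_pow_le_of_le _ ?_
    refine (Polynomial.natDegree_add_le _ _).trans ?_
    simp
  omega

theorem PV_sum (m k : ℕ) : PV m k = ∑ σ : Equiv.Perm (Fin m), ((Equiv.Perm.sign σ : ℤ) : MvPolynomial (Fin m) ℂ) *
    ∏ i, Polynomial.aeval (X (σ i) : MvPolynomial (Fin m) ℂ) (hp k i) := by
  have h1 : (∏ a : Fin m, ∏ b : Fin m, if a < b then ((X b : MvPolynomial (Fin m) ℂ) - X a) * (1 + X a + X b) else 1) =
      (Matrix.vandermonde fun l : Fin m => (X l * (1 + X l) : MvPolynomial (Fin m) ℂ)).det := by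
    rw [Matrix.det_vandermonde, ← pp_Ioi (fun i j : Fin m => (X j * (1 + X j) : MvPolynomial (Fin m) ℂ) - X i * (1 + X i))]
    refine prod_congr rfl fun a _ => prod_congr rfl fun b _ => ?_
    split_ifs
    · ring
    · rfl
  unfold PV
  rw [h1, Matrix.det_apply', mul_sum]
  refine sum_congr rfl fun σ _ => ?_
  rw [mul_left_comm, ← Equiv.prod_comp σ (fun l => (X l ^ (k + 1) * (1 + X l) ^ k : MvPolynomial (Fin m) ℂ)), ← prod_mul_distrib]
  congr 1
  refine prod_congr rfl fun i _ => ?_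
  simp only [hp, Matrix.vandermonde_apply, map_mul, map_pow, map_add, map_one, Polynomial.aeval_X, mul_pow]
  ring

theorem aeval_cf {m N : ℕ} (p : Polynomial ℂ) (hN : p.natDegree < N) (l : Fin m) :
    Polynomial.aeval (X l : MvPolynomial (Fin m) ℂ) p = ∑ a : Fin N, C (cf N p a) * X l ^ (a : ℕ) := by
  conv_lhs => rw [p.as_sum_range' N hN]
  rw [map_sum, ← Fin.sum_univ_eq_sum_range (fun i => (Polynomial.aeval (X l : MvPolynomial (Fin m) ℂ)) (Polynomial.monomial i (p.coeff i))) N]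
  refine sum_congr rfl fun a _ => ?_
  rw [Polynomial.aeval_monomial]; rfl

theorem DV_SS (m k N : ℕ) (hN : 2 * k + 2 * m < N) : prs (EE 1 m) 0 (PV m k) = SS (fun j : Fin m => cf N (hp k j)) := by
  have h1 : ∀ σ : Equiv.Perm (Fin m), (∏ i, Polynomial.aeval (X (σ i) : MvPolynomial (Fin m) ℂ) (hp k i)) =
      ∑ a : Fin m → Fin N, monomial (fs fun l => (a (σ⁻¹ l) : ℕ)) (∏ i : Fin m, cf N (hp k i) (a i)) := by
    intro σ
    rw [prod_congr rfl fun (i : Fin m) _ => aeval_cf (N := N) (hp k i) (by have := hp_deg k i; have := i.2; omega) (σ i)]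
    rw [prod_univ_sum, Fintype.piFinset_univ]
    refine sum_congr rfl fun a _ => ?_
    rw [prod_mul_distrib, ← map_prod, monomial_eq, Finsupp.prod_fintype _ _ (by simp),
      ← Equiv.prod_comp σ (fun l => (X l : MvPolynomial (Fin m) ℂ) ^ ((fs fun l => (a (σ⁻¹ l) : ℕ)) l))]
    simp
  rw [PV_sum, map_sum]
  have h2 : ∀ σ : Equiv.Perm (Fin m), prs (EE 1 m) 0 (((Equiv.Perm.sign σ : ℤ) : MvPolynomial (Fin m) ℂ) *
      ∏ i, Polynomial.aeval (X (σ i) : MvPolynomial (Fin m) ℂ) (hp k i)) =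
      ∑ a : Fin m → Fin N, ((Equiv.Perm.sign σ : ℤ) : ℂ) * ((∏ i : Fin m, cf N (hp k i) (a i)) * (if StrictMono (fun i => a (σ⁻¹ i)) then 1 else 0)) := by
    intro σ
    rw [h1]
    have h3 : ((Equiv.Perm.sign σ : ℤ) : MvPolynomial (Fin m) ℂ) = C ((Equiv.Perm.sign σ : ℤ) : ℂ) := by simp
    rw [h3, ← smul_eq_C_mul, map_smul, map_sum, smul_eq_mul, mul_sum]
    refine sum_congr rfl fun a _ => ?_
    rw [prs_mon, add_zero, coeff_EE]
    congr 2
    refine if_congr ?_ rfl rfl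
    simp only [Nat.div_one, fs_apply]
    exact Iff.rfl
  rw [sum_congr rfl fun σ _ => h2 σ, sum_comm]
  unfold SS
  refine sum_congr rfl fun a _ => ?_
  rw [← ep_alt a, sum_mul, ← Equiv.sum_comp (Equiv.inv (Equiv.Perm (Fin m)))]
  refine sum_congr rfl fun σ _ => ?_
  simp only [Equiv.inv_apply, inv_inv, Equiv.Perm.sign_inv]
  ring

end ACP

namespace ACP
open Finset Filter Topology

theorem sg_range (g : ℕ → ℂ) (s N : ℕ) : (∑ t ∈ range N, sg s t * g t) =
    if N ≤ s then -∑ t ∈ range N, g t else (∑ t ∈ range N, g t) - (∑ t ∈ range (s + 1), g t) - ∑ t ∈ range s, g t := by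
  induction N with
  | zero => simp
  | succ N ih =>
    rw [sum_range_succ, ih, sum_range_succ g N]
    rcases lt_trichotomy N s with h | h | h
    · rw [if_pos h.le, if_pos (by omega)]
      simp [sg, h, not_lt_of_gt h]; ring
    · subst h
      rw [if_pos le_rfl, if_neg (by omega)]
      simp [sg, sum_range_succ]
    · rw [if_neg (by omega), if_neg (by omega)]
      simp [sg, h]; ring

theorem om_tel {N : ℕ} (f : Fin N → ℂ) (G : Polynomial ℂ) (hG : G.natDegree + 1 < N) :
    om f (cf N ((Polynomial.X - 1) * G)) = ∑ s : Fin N, f s * ((1 + Polynomial.X) * G).coeff s := by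
  have hP : ∀ n, ∑ t ∈ range (n + 1), ((Polynomial.X - 1) * G).coeff t = - G.coeff n := by
    intro n
    induction n with
    | zero => simp [sub_mul, Polynomial.coeff_sub]
    | succ n ih =>
      rw [sum_range_succ, ih, sub_mul, one_mul, Polynomial.coeff_sub, Polynomial.coeff_X_mul]; ring
  unfold om
  refine sum_congr rfl fun s _ => ?_
  have h1 : ∑ t : Fin N, sg s t * f s * cf N ((Polynomial.X - 1) * G) t = f s * ∑ t ∈ range N, sg (s : ℕ) t * ((Polynomial.X - 1) * G).coeff t := by
    rw [← Fin.sum_univ_eq_sum_range (fun t : ℕ => (sg (s : ℕ) t * ((Polynomial.X - 1) * G : Polynomial ℂ).coeff t : ℂ)) N, mul_sum]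
    refine sum_congr rfl fun t _ => ?_
    have : sg s t = sg (s : ℕ) (t : ℕ) := by simp [sg]
    rw [this, cf]; ring
  rw [h1, sg_range, if_neg (by have := s.2; omega)]
  congr 1
  have hN : N = (N - 1) + 1 := by omega
  have h2 : ∑ t ∈ range N, ((Polynomial.X - 1) * G).coeff t = 0 := by
    rw [hN, hP, Polynomial.coeff_eq_zero_of_natDegree_lt (by omega), neg_zero]
  rw [h2, hP]
  rcases hs : (s : ℕ) with _ | s'
  · simp [add_mul]
  · rw [hP, add_mul, one_mul, Polynomial.coeff_add, Polynomial.coeff_X_mul]; ring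

theorem hp_coeff (k i s : ℕ) : (hp k i).coeff s = if s ≤ 2 * k + 1 + 2 * i then ((k + i).choose (2 * k + 1 + 2 * i - s) : ℂ) else 0 := by
  unfold hp
  rw [Polynomial.coeff_X_pow_mul', Polynomial.coeff_one_add_X_pow]
  split_ifs with h1 h2 h2
  · rw [← Nat.choose_symm_of_eq_add]; omega
  · rw [Nat.choose_eq_zero_of_lt (by omega)]; simp
  · rw [Nat.choose_eq_zero_of_lt (by omega)]; simp
  · rfl

theorem hp_conv {N : ℕ} (k i : ℕ) (Q : Polynomial ℂ) (hN : 2 * k + 2 * i + 2 ≤ N) :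
    ∑ s : Fin N, cf N (hp k i) s * Q.coeff s = (Q * (1 + Polynomial.X) ^ (k + i)).coeff (2 * k + 1 + 2 * i) := by
  rw [Polynomial.coeff_mul, Nat.sum_antidiagonal_eq_sum_range_succ (fun a b => Q.coeff a * ((1 + Polynomial.X : Polynomial ℂ) ^ (k + i)).coeff b)]
  simp only [cf]
  rw [Fin.sum_univ_eq_sum_range (fun s => (hp k i).coeff s * Q.coeff s) N]
  symm
  rw [← sum_subset (range_mono (show (2 * k + 1 + 2 * i).succ ≤ N by omega))]
  · refine sum_congr rfl fun s hs => ?_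
    rw [mem_range] at hs
    rw [hp_coeff, if_pos (by omega), Polynomial.coeff_one_add_X_pow]; ring
  · intro s _ hs
    rw [mem_range] at hs
    rw [hp_coeff, if_neg (by omega), zero_mul]

noncomputable def invf (z : ℤ) : ℂ := if z < 0 then 0 else 1 / (z.toNat.factorial : ℂ)

theorem invf_nat (z : ℤ) (a : ℕ) (h : z = a) : invf z = 1 / (a.factorial : ℂ) := by
  subst h; unfold invf; rw [if_neg (by omega)]; simp

theorem invf_neg (z : ℤ) (h : z < 0) : invf z = 0 := if_pos h

theorem choose_lem (N r : ℕ) : ((Polynomial.X + 2) * (1 + Polynomial.X) ^ N : Polynomial ℂ).coeff r =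
    (N.factorial : ℂ) * (2 * N + 2 - r) * invf r * invf (N + 1 - r) := by
  have h2 : ((Polynomial.X + 2) * (1 + Polynomial.X) ^ N : Polynomial ℂ) = Polynomial.X * (1 + Polynomial.X) ^ N + Polynomial.C 2 * (1 + Polynomial.X) ^ N := by
    rw [add_mul]; rfl
  rw [h2, Polynomial.coeff_add, Polynomial.coeff_C_mul, Polynomial.coeff_one_add_X_pow, invf_nat r r rfl]
  have hf : ∀ a : ℕ, (a.factorial : ℂ) ≠ 0 := fun a => by exact_mod_cast a.factorial_ne_zero
  have hch : ∀ a b : ℕ, ((a + b).choose a : ℂ) = ((a + b).factorial : ℂ) / (a.factorial * b.factorial) := by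
    intro a b
    rw [eq_div_iff (mul_ne_zero (hf a) (hf b)), ← mul_assoc]
    rw [Nat.choose_symm_add]
    exact_mod_cast Nat.add_choose_mul_factorial_mul_factorial a b
  rcases lt_trichotomy r (N + 1) with h | h | h
  · obtain ⟨c, rfl⟩ : ∃ c, N = r + c := ⟨N - r, by omega⟩
    rw [invf_nat _ (c + 1) (by push_cast; ring), hch]
    rcases r with _ | r
    · simp only [Nat.cast_zero, Polynomial.coeff_X_mul_zero]
      have := hf c
      rw [Nat.factorial_succ]
      have h3 : (c : ℂ) + 1 ≠ 0 := by exact_mod_cast c.succ_ne_zero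
      push_cast
      field_simp
      ring
    · rw [Polynomial.coeff_X_mul, Polynomial.coeff_one_add_X_pow, show r + 1 + c = r + (c + 1) by ring, hch]
      have h1 := hf c
      have h4 := hf r
      rw [Nat.factorial_succ c, Nat.factorial_succ r]
      have h3 : (c : ℂ) + 1 ≠ 0 := by exact_mod_cast c.succ_ne_zero
      have h5 : (r : ℂ) + 1 ≠ 0 := by exact_mod_cast r.succ_ne_zero
      push_cast
      field_simp
      ring
  · subst h
    rw [Polynomial.coeff_X_mul, Polynomial.coeff_one_add_X_pow, invf_nat _ 0 (by push_cast; ring), Nat.choose_eq_zero_of_lt (Nat.lt_succ_self N), Nat.choose_self]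
    have h1 := hf N
    have h3 : (N : ℂ) + 1 ≠ 0 := by exact_mod_cast N.succ_ne_zero
    rw [Nat.factorial_succ]
    push_cast
    field_simp
    simp; ring
  · rw [invf_neg _ (by omega)]
    obtain ⟨c, rfl⟩ : ∃ c, r = c + 1 := ⟨r - 1, by omega⟩
    rw [Polynomial.coeff_X_mul, Polynomial.coeff_one_add_X_pow, Nat.choose_eq_zero_of_lt (by omega), Nat.choose_eq_zero_of_lt (by omega)]
    simp

theorem B_entry {N : ℕ} (k i j : ℕ) (hi : 2 * k + 2 * i + 2 ≤ N) (hj : 2 * k + 2 * j + 5 ≤ N) :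
    om (cf N (hp k i)) (cf N (hp k (j + 1))) - 2 * om (cf N (hp k i)) (cf N (hp k j)) =
    (3 * k + 4 + 3 * j) * (((2 * k + 1 + i + j).factorial : ℂ) * invf (k + 2 * i - j) * invf (k + 2 + 2 * j - i)) := by
  have h1 : om (cf N (hp k i)) (cf N (hp k (j + 1))) - 2 * om (cf N (hp k i)) (cf N (hp k j)) =
      om (cf N (hp k i)) (cf N ((Polynomial.X - 1) * ((Polynomial.X + 2) * hp k j))) := by
    have h2 : (Polynomial.X - 1) * ((Polynomial.X + 2) * hp k j) = hp k (j + 1) - Polynomial.C 2 * hp k j := by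
      unfold hp
      have : (Polynomial.C 2 : Polynomial ℂ) = 2 := rfl
      rw [this]; ring
    rw [h2]
    unfold om
    rw [mul_sum, ← sum_sub_distrib]
    refine sum_congr rfl fun s _ => ?_
    rw [mul_sum, ← sum_sub_distrib]
    refine sum_congr rfl fun t _ => ?_
    simp only [cf, Polynomial.coeff_sub, Polynomial.coeff_C_mul]
    ring
  rw [h1, om_tel, hp_conv _ _ _ hi]
  · have h3 : (1 + Polynomial.X) * ((Polynomial.X + 2) * hp k j) * (1 + Polynomial.X) ^ (k + i) =
        Polynomial.X ^ (k + 1 + j) * ((Polynomial.X + 2) * (1 + Polynomial.X) ^ (2 * k + 1 + i + j)) := by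
      unfold hp; ring
    rw [h3, Polynomial.coeff_X_pow_mul']
    split_ifs with h
    · rw [choose_lem]
      have h4 : ((2 * k + 1 + 2 * i - (k + 1 + j) : ℕ) : ℤ) = k + 2 * i - j := by omega
      have h5 : ((2 * k + 1 + 2 * i - (k + 1 + j) : ℕ) : ℂ) = k + 2 * i - j := by
        rw [← Int.cast_natCast, h4]; push_cast; ring
      rw [h4, h5]
      have h6 : ((2 * k + 1 + i + j : ℕ) : ℤ) + 1 - (k + 2 * i - j) = k + 2 + 2 * j - i := by push_cast; ring
      rw [h6]; push_cast; ring
    · rw [invf_neg (k + 2 * i - j) (by omega)]; simp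
  · have h4 := hp_deg k j
    have h5 : ((Polynomial.X + 2) * hp k j).natDegree ≤ 1 + (2 * k + 2 * j + 1) := by
      refine Polynomial.natDegree_mul_le_of_le ?_ h4
      refine (Polynomial.natDegree_add_le _ _).trans ?_
      have : (2 : Polynomial ℂ) = Polynomial.C 2 := rfl
      rw [this]; simp
    omega

end ACP

namespace ACP
open Finset Filter Topology

noncomputable def DV (m k : ℕ) : ℂ := prs (EE 1 m) 0 (PV m k)

noncomputable def MM (x y : ℤ) (n : ℕ) : Matrix (Fin n) (Fin n) ℂ :=
  Matrix.of fun i j => ((x + y + i + j - 1).toNat.factorial : ℂ) * invf (x + 2 * i - j) * invf (y + 2 * j - i)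

theorem SS_e {m N : ℕ} (L : Fin m → Fin (N + 1) → ℂ) (hL : ∀ i, L i 0 = 0) :
    SS (Fin.cons (cf (N + 1) 1) L : Fin (m + 1) → Fin (N + 1) → ℂ) = SS L := by
  rw [SS_cons, sum_eq_single 0]
  · unfold SS
    refine sum_congr rfl fun b _ => ?_
    have h1 : cf (N + 1) 1 0 = 1 := by simp [cf]
    rw [h1]
    by_cases hb : ∃ i, b i = 0
    · obtain ⟨i, hi⟩ := hb
      have : ∏ i, L i (b i) = 0 := prod_eq_zero (mem_univ i) (by rw [hi, hL])
      rw [this]; ring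
    · push Not at hb
      have : ∏ j, sg 0 (b j) = 1 := prod_eq_one fun j _ => if_pos (Fin.pos_iff_ne_zero.2 (hb j))
      rw [this]; ring
  · intro t _ ht
    have h1 : cf (N + 1) 1 t = 0 := by
      have : ¬ (t : ℕ) = 0 := fun h => ht (Fin.ext h)
      simp [cf, Polynomial.coeff_one, this]
    refine sum_eq_zero fun b _ => ?_
    rw [h1]; ring
  · simp

theorem om_e {N : ℕ} (p : Polynomial ℂ) (h0 : p.coeff 0 = 0) (hN : p.natDegree < N + 1) : om (cf (N + 1) 1) (cf (N + 1) p) = p.eval 1 := by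
  unfold om
  rw [sum_eq_single 0]
  · rw [p.eval_eq_sum_range' hN, ← Fin.sum_univ_eq_sum_range (fun i => p.coeff i * 1 ^ i) (N + 1)]
    refine sum_congr rfl fun t _ => ?_
    have h1 : cf (N + 1) 1 0 = 1 := by simp [cf]
    rw [h1]
    by_cases ht : t = 0
    · subst ht; simp [sg, h0]
    · rw [sg, if_pos (Fin.pos_iff_ne_zero.2 ht)]; simp [cf]
  · intro t _ ht
    have h1 : cf (N + 1) 1 t = 0 := by
      have : ¬ (t : ℕ) = 0 := fun h => ht (Fin.ext h)
      simp [cf, Polynomial.coeff_one, this]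
    refine sum_eq_zero fun b _ => ?_
    rw [h1]; ring
  · simp

theorem DV_mul (m k : ℕ) : DV m k * DV (m + 1) k = 2 ^ k * (∏ j : Fin m, (3 * k + 4 + 3 * (j : ℕ) : ℂ)) * (MM k (k + 2) m).det := by
  obtain ⟨N, hN⟩ : ∃ N, N + 1 = 2 * k + 2 * m + 10 := ⟨2 * k + 2 * m + 9, rfl⟩
  unfold DV
  rw [DV_SS m k (N + 1) (by omega), DV_SS (m + 1) k (N + 1) (by omega)]
  set V : Fin (m + 1) → Fin (N + 1) → ℂ := fun j => cf (N + 1) (hp k j) with hV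
  set U : Fin m → Fin (N + 1) → ℂ := fun j => cf (N + 1) (hp k j) with hU
  set e : Fin (N + 1) → ℂ := cf (N + 1) 1 with he
  have hc0 : ∀ j, (hp k j).coeff 0 = 0 := by
    intro j
    unfold hp
    rw [Polynomial.coeff_X_pow_mul', if_neg (by omega)]
  have hU0 : ∀ i, U i 0 = 0 := fun i => hc0 i
  have hVU : (fun i => V ((Fin.last m).succAbove i)) = U := by
    funext i; simp [hV, hU]
  have hfront := SS_front V (Fin.last m)
  rw [hVU] at hfront
  have h1 : (OM (Fin.cons e U : Fin (m + 1) → _) (Fin.cons (V (Fin.last m)) U)).det = SS U * SS (Fin.cons (V (Fin.last m)) U : Fin (m + 1) → _) := by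
    rw [cayley]
    split_ifs
    · rw [SS_e]
      intro i
      refine Fin.cases ?_ (fun i => ?_) i
      · exact hc0 _
      · exact hU0 i
    · rw [SS_e _ hU0]
  have h2 : OM (Fin.cons e U : Fin (m + 1) → _) (Fin.cons (V (Fin.last m)) U) = (OM (Fin.cons e U) V).submatrix id (Fin.last m).cycleRange.symm := by
    rw [← hVU, cons_cyc]; rfl
  rw [h2, Matrix.det_permute', sgn_cyc, hfront, mul_left_comm] at h1
  have h3 := mul_left_cancel₀ (pow_ne_zero _ (by norm_num)) h1
  rw [← h3]
  have h4 : (OM (Fin.cons e U) V).det = (Matrix.of fun (i j : Fin (m + 1)) =>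
      (Fin.cases (OM (Fin.cons e U) V i 0) (fun j => OM (Fin.cons e U) V i j.succ - 2 * OM (Fin.cons e U) V i j.castSucc) j : ℂ)).det := by
    refine Matrix.det_eq_of_forall_col_eq_smul_add_pred (fun _ => 2) (fun i => rfl) (fun i j => ?_)
    simp only [Matrix.of_apply, Fin.cases_succ]; ring
  have h5 : ∀ j : Fin (m + 1), OM (Fin.cons e U) V 0 j = 2 ^ (k + (j : ℕ)) := by
    intro j
    have : OM (Fin.cons e U) V 0 j = om e (V j) := rfl
    rw [this, hV, he, om_e _ (hc0 j)]
    · simp [hp]; norm_num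
    · have := hp_deg k j; have := j.2; omega
  rw [h4, Matrix.det_succ_row_zero, sum_eq_single 0]
  · have h6 : ((Matrix.of fun (i j : Fin (m + 1)) =>
      (Fin.cases (OM (Fin.cons e U) V i 0) (fun j => OM (Fin.cons e U) V i j.succ - 2 * OM (Fin.cons e U) V i j.castSucc) j : ℂ)).submatrix Fin.succ (Fin.succAbove 0))
      = Matrix.of fun i j : Fin m => (3 * k + 4 + 3 * (j : ℕ) : ℂ) * MM k (k + 2) m i j := by
      ext i j
      simp only [Matrix.submatrix_apply, Matrix.of_apply, Fin.succAbove_zero, Fin.cases_succ]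
      have := B_entry (N := N + 1) k i j (by have := i.2; omega) (by have := j.2; omega)
      refine Eq.trans this ?_
      simp only [MM, Matrix.of_apply]
      have h7 : ((k : ℤ) + (k + 2) + (i : ℕ) + (j : ℕ) - 1).toNat = 2 * k + 1 + i + j := by omega
      rw [h7]
    rw [h6, Matrix.det_mul_row]
    simp only [Matrix.of_apply, Fin.cases_zero, h5]
    simp; ring
  · intro j _ hj
    obtain ⟨j, rfl⟩ := Fin.exists_succ_eq.2 hj
    simp only [Matrix.of_apply, Fin.cases_succ, h5]
    simp only [Fin.val_succ, Fin.val_castSucc]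
    ring
  · simp

end ACP

namespace ACP
open Finset Filter Topology

theorem schur {ι κ : Type*} {n : ℕ} (f : ι → κ → ℂ) (r : Fin n → ι) (c : Fin n → κ)
    (hA : (Matrix.of fun i j => f (r i) (c j)).det ≠ 0) :
    ∃ φ : ι → κ → ℂ, ∀ (p : ℕ) (R : Fin p → ι) (C : Fin p → κ),
      (Matrix.of fun i j => f (Fin.append r R i) (Fin.append c C j)).det =
        (Matrix.of fun i j => f (r i) (c j)).det * (Matrix.of fun i j => φ (R i) (C j)).det := by
  set A : Matrix (Fin n) (Fin n) ℂ := Matrix.of fun i j => f (r i) (c j) with hAdef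
  haveI : Invertible A := Matrix.invertibleOfIsUnitDet A (isUnit_iff_ne_zero.2 hA)
  refine ⟨fun i j => f i j - ∑ b, (∑ a, f i (c a) * (⅟A) a b) * f (r b) j, fun p R C => ?_⟩
  rw [← Matrix.det_submatrix_equiv_self finSumFinEquiv]
  have h : (Matrix.of fun i j => f (Fin.append r R i) (Fin.append c C j)).submatrix (finSumFinEquiv : Fin n ⊕ Fin p ≃ _) finSumFinEquiv =
      Matrix.fromBlocks A (Matrix.of fun i j => f (r i) (C j)) (Matrix.of fun i j => f (R i) (c j)) (Matrix.of fun i j => f (R i) (C j)) := by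
    ext i j
    rcases i with i | i <;> rcases j with j | j <;> simp [hAdef]
  rw [h, Matrix.det_fromBlocks₁₁]
  congr 2

theorem dodgson {n : ℕ} (M : Matrix (Fin (n + 2)) (Fin (n + 2)) ℂ)
    (hA : (M.submatrix (fun i : Fin n => i.castSucc.succ) (fun i : Fin n => i.castSucc.succ)).det ≠ 0) :
    M.det * (M.submatrix (fun i : Fin n => i.castSucc.succ) (fun i : Fin n => i.castSucc.succ)).det =
      (M.submatrix Fin.succ Fin.succ).det * (M.submatrix Fin.castSucc Fin.castSucc).det -
      (M.submatrix Fin.succ Fin.castSucc).det * (M.submatrix Fin.castSucc Fin.succ).det := by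
  set inn : Fin n → Fin (n + 2) := fun i : Fin n => i.castSucc.succ with hinn
  obtain ⟨φ, hφ⟩ := schur (fun i j => M i j) inn inn hA
  have hA' : (Matrix.of fun i j => (fun i j => M i j) (inn i) (inn j)).det = (M.submatrix inn inn).det := rfl
  rw [hA'] at hφ
  set D := (M.submatrix inn inn).det
  have hl : Fin.append inn (fun _ : Fin 1 => Fin.last (n + 1)) = Fin.succ := by
    funext i
    refine Fin.addCases (fun i => ?_) (fun i => ?_) i
    · rw [Fin.append_left]; rfl
    · rw [Fin.append_right]
      ext; simp [Subsingleton.elim i 0]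
  have hf : Fin.append inn (fun _ : Fin 1 => (0 : Fin (n + 2))) = fun i => (finRotate (n + 1) i).castSucc := by
    funext i
    refine Fin.addCases (fun i => ?_) (fun i => ?_) i
    · rw [Fin.append_left, finRotate_succ_apply]
      ext
      rw [Fin.val_castSucc, Fin.val_add_one_of_lt]
      · simp [hinn]
      · rw [Fin.lt_def]; simp
    · rw [Fin.append_right]
      have : Fin.natAdd n i = Fin.last n := by ext; simp [Subsingleton.elim i 0]
      rw [this, finRotate_last]; rfl
  have h11 := hφ 1 (fun _ => Fin.last (n + 1)) (fun _ => Fin.last (n + 1))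
  have h10 := hφ 1 (fun _ => Fin.last (n + 1)) (fun _ => 0)
  have h01 := hφ 1 (fun _ => 0) (fun _ => Fin.last (n + 1))
  have h00 := hφ 1 (fun _ => 0) (fun _ => 0)
  have h2 := hφ 2 ![0, Fin.last (n + 1)] ![0, Fin.last (n + 1)]
  rw [hl] at h11
  rw [hl, hf] at h10 h01
  rw [hf] at h00
  have e00 : (Matrix.of fun i j => M ((finRotate (n + 1) i).castSucc) ((finRotate (n + 1) j).castSucc)).det = (M.submatrix Fin.castSucc Fin.castSucc).det :=
    Matrix.det_submatrix_equiv_self (finRotate (n + 1)) (M.submatrix Fin.castSucc Fin.castSucc)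
  have e10 : (Matrix.of fun (i : Fin (n + 1)) j => M i.succ ((finRotate (n + 1) j).castSucc)).det = ((Equiv.Perm.sign (finRotate (n + 1)) : ℤ) : ℂ) * (M.submatrix Fin.succ Fin.castSucc).det :=
    Matrix.det_permute' (finRotate (n + 1)) (M.submatrix Fin.succ Fin.castSucc)
  have e01 : (Matrix.of fun i (j : Fin (n + 1)) => M ((finRotate (n + 1) i).castSucc) j.succ).det = ((Equiv.Perm.sign (finRotate (n + 1)) : ℤ) : ℂ) * (M.submatrix Fin.castSucc Fin.succ).det :=
    Matrix.det_permute (finRotate (n + 1)) (M.submatrix Fin.castSucc Fin.succ)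
  have e11 : (Matrix.of fun (i : Fin (n + 1)) (j : Fin (n + 1)) => M i.succ j.succ).det = (M.submatrix Fin.succ Fin.succ).det := rfl
  have hinj : Function.Injective (Fin.append inn ![0, Fin.last (n + 1)]) := by
    have hv : ∀ i, ((Fin.append inn ![0, Fin.last (n + 1)] i : Fin (n + 2)) : ℕ) = if (i : ℕ) < n then (i : ℕ) + 1 else if (i : ℕ) = n then 0 else n + 1 := by
      intro i
      refine Fin.addCases (fun i => ?_) (fun i => ?_) i
      · rw [Fin.append_left, Fin.val_castAdd, if_pos i.2]; rfl
      · rw [Fin.append_right]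
        fin_cases i <;> simp
    intro i j hij
    have := congrArg Fin.val hij
    rw [hv, hv] at this
    ext
    have := i.2
    have := j.2
    split_ifs at * <;> omega
  have e2 : (Matrix.of fun i j => M (Fin.append inn ![0, Fin.last (n + 1)] i) (Fin.append inn ![0, Fin.last (n + 1)] j)).det = M.det :=
    Matrix.det_submatrix_equiv_self (Equiv.ofBijective _ (Finite.injective_iff_bijective.1 hinj)) M
  rw [e00] at h00
  rw [e10] at h10
  rw [e01] at h01
  rw [e11] at h11
  rw [e2] at h2
  rw [Matrix.det_fin_two] at h2
  rw [Matrix.det_fin_one] at h00 h10 h01 h11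
  simp only [Matrix.of_apply, Matrix.cons_val_zero, Matrix.cons_val_one] at h00 h10 h01 h11 h2
  rw [h2, h00, h11]
  have hs := sgn_sq (finRotate (n + 1))
  generalize ((Equiv.Perm.sign (finRotate (n + 1)) : ℤ) : ℂ) = s at *
  linear_combination (s * (M.submatrix Fin.castSucc Fin.succ).det) * h10 + (D * φ (Fin.last (n + 1)) 0) * h01 - ((M.submatrix Fin.succ Fin.castSucc).det * (M.submatrix Fin.castSucc Fin.succ).det) * hs

end ACP

namespace ACP
open Finset Filter Topology

noncomputable def pw (x y i : ℕ) : ℂ :=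
  (i.factorial : ℂ) * (x + y + i - 1).factorial * ((2 * x + y + 2 * i).ascFactorial i) * ((x + 2 * y + 2 * i).ascFactorial i) /
    ((x + 2 * i).factorial * (y + 2 * i).factorial)

noncomputable def pwP (x y n : ℕ) : ℂ := ∏ i ∈ range n, pw x y i

noncomputable def pK (x y n : ℕ) : ℂ :=
  (n.factorial : ℂ) * (x + y + n).factorial * ((2 * x + y + 2 * n + 3).ascFactorial n) * ((x + 2 * y + 2 * n + 3).ascFactorial n) /
    ((x + 2 * n + 2).factorial * (y + 2 * n + 2).factorial)

theorem fac_ne (a : ℕ) : (a.factorial : ℂ) ≠ 0 := by exact_mod_cast a.factorial_ne_zero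

theorem asc_ne (a i : ℕ) (h : 1 ≤ a) : ((a.ascFactorial i : ℕ) : ℂ) ≠ 0 := by
  rcases i with _ | i
  · simp
  · have := Nat.ascFactorial_pos (a - 1) (i + 1)
    rw [Nat.sub_add_cancel h] at this
    exact_mod_cast this.ne'

theorem pw_ne (x y i : ℕ) (h : 1 ≤ x + y) : pw x y i ≠ 0 := by
  unfold pw
  refine div_ne_zero (mul_ne_zero (mul_ne_zero (mul_ne_zero (fac_ne _) (fac_ne _)) (asc_ne _ _ (by omega))) (asc_ne _ _ (by omega))) (mul_ne_zero (fac_ne _) (fac_ne _))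

theorem pwP_ne (x y n : ℕ) (h : 1 ≤ x + y) : pwP x y n ≠ 0 := prod_ne_zero_iff.2 fun i _ => pw_ne x y i h

theorem pT (x y n : ℕ) : pwP (x + 3) y (n + 1) * pwP x (y + 3) (n + 1) =
    pK (x + 1) (y + 1) n * ((x + 1) * (y + 1) * (x + y + 2)) * (pwP (x + 1) (y + 1) (n + 1) * pwP (x + 2) (y + 2) n) := by
  induction n with
  | zero =>
    simp only [pwP, prod_range_succ, prod_range_zero, one_mul, mul_one, pw, pK, Nat.ascFactorial_zero, Nat.mul_zero, Nat.add_zero]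
    rw [show x + 3 + y - 1 = x + y + 2 by omega, show x + (y + 3) - 1 = x + y + 2 by omega, show x + 1 + (y + 1) - 1 = x + y + 1 by omega,
      show x + 1 + (y + 1) = x + y + 2 by omega]
    rw [Nat.factorial_succ (x + y + 1), Nat.factorial_succ x, Nat.factorial_succ y]
    push_cast
    have h1 := fac_ne x
    have h2 := fac_ne y
    have h3 := fac_ne (x + 3)
    have h4 := fac_ne (y + 3)
    have h5 : (x : ℂ) + 1 ≠ 0 := by exact_mod_cast x.succ_ne_zero
    have h6 : (y : ℂ) + 1 ≠ 0 := by exact_mod_cast y.succ_ne_zero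
    field_simp
    ring
  | succ n ih =>
    have hs : ∀ x y n, pwP x y (n + 1) = pwP x y n * pw x y n := fun x y n => prod_range_succ _ _
    rw [hs _ _ (n + 1), hs _ _ (n + 1), hs (x + 1) (y + 1) (n + 1), hs (x + 2) (y + 2) n]
    have key : pw (x + 3) y (n + 1) * pw x (y + 3) (n + 1) * pK (x + 1) (y + 1) n =
        pK (x + 1) (y + 1) (n + 1) * pw (x + 1) (y + 1) (n + 1) * pw (x + 2) (y + 2) n := by
      simp only [pw, pK]
      rw [show x+3+y+(n+1)-1 = x+y+n+3 by omega, show x+(y+3)+(n+1)-1 = x+y+n+3 by omega, show x+1+(y+1)+(n+1)-1 = x+y+n+2 by omega, show x+2+(y+2)+n-1 = x+y+n+3 by omega]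
      ring_nf
    have hK : pK (x + 1) (y + 1) n ≠ 0 := by
      unfold pK
      refine div_ne_zero (mul_ne_zero (mul_ne_zero (mul_ne_zero (fac_ne _) (fac_ne _)) (asc_ne _ _ (by omega))) (asc_ne _ _ (by omega))) (mul_ne_zero (fac_ne _) (fac_ne _))
    refine mul_left_cancel₀ hK ?_
    linear_combination (pw (x + 3) y (n + 1) * pw x (y + 3) (n + 1) * pK (x + 1) (y + 1) n) * ih + (pK (x + 1) (y + 1) n * ((x + 1) * (y + 1) * (x + y + 2)) * (pwP (x + 1) (y + 1) (n + 1) * pwP (x + 2) (y + 2) n)) * key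

theorem asc_first (c n : ℕ) : c.ascFactorial (n + 1) = c * (c + 1).ascFactorial n := by
  rw [Nat.succ_ascFactorial, Nat.ascFactorial_succ]

theorem pdiff (x y n : ℕ) (h : 1 ≤ x + y) : pw x y (n + 1) = pw (x + 1) (y + 1) n - pK x y n * (x * y * (x + y)) := by
  simp only [pw, pK]
  rw [show x + y + (n + 1) - 1 = x + y + n by omega, show x + 1 + (y + 1) + n - 1 = x + y + n + 1 by omega,
    show 2 * x + y + 2 * (n + 1) = (2 * x + y + 2 * n + 2) by ring, show x + 2 * y + 2 * (n + 1) = x + 2 * y + 2 * n + 2 by ring,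
    show 2 * (x + 1) + (y + 1) + 2 * n = 2 * x + y + 2 * n + 3 by ring, show x + 1 + 2 * (y + 1) + 2 * n = x + 2 * y + 2 * n + 3 by ring,
    show x + 2 * (n + 1) = x + 2 * n + 1 + 1 by ring, show y + 2 * (n + 1) = y + 2 * n + 1 + 1 by ring,
    show x + 1 + 2 * n = x + 2 * n + 1 by ring, show y + 1 + 2 * n = y + 2 * n + 1 by ring]
  rw [asc_first, asc_first, Nat.factorial_succ (x + 2 * n + 1), Nat.factorial_succ (y + 2 * n + 1), Nat.factorial_succ (x + y + n), Nat.factorial_succ n]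
  push_cast
  have h1 := fac_ne (x + 2 * n + 1)
  have h2 := fac_ne (y + 2 * n + 1)
  have h3 : (x : ℂ) + 2 * n + 1 + 1 ≠ 0 := by exact_mod_cast (x + 2 * n + 1).succ_ne_zero
  have h4 : (y : ℂ) + 2 * n + 1 + 1 ≠ 0 := by exact_mod_cast (y + 2 * n + 1).succ_ne_zero
  have h5 : (x : ℂ) + 2 * n + 2 ≠ 0 := by exact_mod_cast (x + 2 * n + 1).succ_ne_zero
  have h6 : (y : ℂ) + 2 * n + 2 ≠ 0 := by exact_mod_cast (y + 2 * n + 1).succ_ne_zero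
  rw [add_assoc _ (1 : ℂ) 1, add_assoc _ (1 : ℂ) 1, one_add_one_eq_two]
  clear h3 h4
  generalize hX : (x : ℂ) + 2 * n + 2 = X at *
  generalize hY : (y : ℂ) + 2 * n + 2 = Y at *
  field_simp
  rw [← hX, ← hY]
  ring

theorem MM_sub (x y x' y' : ℤ) {n p : ℕ} (r c : Fin p → Fin n) (a b : ℤ) (hr : ∀ i, ((r i : ℕ) : ℤ) = i + a) (hc : ∀ i, ((c i : ℕ) : ℤ) = i + b)
    (hx : x' = x + 2 * a - b) (hy : y' = y + 2 * b - a) : (MM x y n).submatrix r c = MM x' y' p := by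
  subst hx hy
  ext i j
  simp only [MM, Matrix.submatrix_apply, Matrix.of_apply, hr, hc]
  rw [show x + y + ((i : ℕ) + a) + ((j : ℕ) + b) - 1 = x + 2 * a - b + (y + 2 * b - a) + (i : ℕ) + (j : ℕ) - 1 by ring,
    show x + 2 * ((i : ℕ) + a) - ((j : ℕ) + b) = x + 2 * a - b + 2 * (i : ℕ) - (j : ℕ) by ring,
    show y + 2 * ((j : ℕ) + b) - ((i : ℕ) + a) = y + 2 * b - a + 2 * (j : ℕ) - (i : ℕ) by ring]

theorem MM_det_aux (n : ℕ) : (∀ x y : ℕ, 1 ≤ x + y → (MM x y n).det = pwP x y n) ∧ (∀ x y : ℕ, 1 ≤ x + y → (MM x y (n + 1)).det = pwP x y (n + 1)) := by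
  induction n with
  | zero =>
    refine ⟨fun x y h => by simp [pwP], fun x y h => ?_⟩
    show (MM x y 1).det = pwP x y 1
    rw [Matrix.det_unique]
    simp only [MM, Matrix.of_apply, pwP, prod_range_one, pw]
    rw [invf_nat _ x (by simp), invf_nat _ y (by simp), show ((x : ℤ) + y + ((default : Fin 1) : ℕ) + ((default : Fin 1) : ℕ) - 1).toNat = x + y - 1 by simp; omega]
    simp only [Nat.factorial_zero, Nat.ascFactorial_zero, Nat.mul_zero, Nat.add_zero]
    push_cast
    have h1 := fac_ne x
    have h2 := fac_ne y
    field_simp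
  | succ n ih =>
    refine ⟨ih.2, fun x y h => ?_⟩
    have e1 : (MM x y (n + 2)).submatrix (fun i : Fin n => i.castSucc.succ) (fun i : Fin n => i.castSucc.succ) = MM ((x + 1 : ℕ)) ((y + 1 : ℕ)) n :=
      MM_sub _ _ _ _ _ _ 1 1 (by simp) (by simp) (by push_cast; ring) (by push_cast; ring)
    have e2 : (MM x y (n + 2)).submatrix Fin.succ Fin.succ = MM ((x + 1 : ℕ)) ((y + 1 : ℕ)) (n + 1) :=
      MM_sub _ _ _ _ _ _ 1 1 (by simp) (by simp) (by push_cast; ring) (by push_cast; ring)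
    have e3 : (MM x y (n + 2)).submatrix Fin.castSucc Fin.castSucc = MM x y (n + 1) :=
      MM_sub _ _ _ _ _ _ 0 0 (by simp) (by simp) (by push_cast; ring) (by push_cast; ring)
    have e4 : (MM x y (n + 2)).submatrix Fin.succ Fin.castSucc = MM (x + 2) (y - 1) (n + 1) :=
      MM_sub _ _ _ _ _ _ 1 0 (by simp) (by simp) (by push_cast; ring) (by push_cast; ring)
    have e5 : (MM x y (n + 2)).submatrix Fin.castSucc Fin.succ = MM (x - 1) (y + 2) (n + 1) :=
      MM_sub _ _ _ _ _ _ 0 1 (by simp) (by simp) (by push_cast; ring) (by push_cast; ring)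
    have hne := pwP_ne (x + 1) (y + 1) n (by omega)
    have hd := dodgson (MM x y (n + 2)) (by rw [e1, ih.1 _ _ (by omega)]; exact hne)
    rw [e1, e2, e3, e4, e5, ih.1 _ _ (by omega), ih.2 _ _ (by omega), ih.2 _ _ h] at hd
    have hs : ∀ x y n, pwP x y (n + 1) = pwP x y n * pw x y n := fun x y n => prod_range_succ _ _
    have hp : (MM (x + 2) (y - 1) (n + 1)).det * (MM (x - 1) (y + 2) (n + 1)).det = pK x y n * (x * y * (x + y)) * (pwP x y (n + 1) * pwP (x + 1) (y + 1) n) := by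
      rcases x with _ | x
      · rw [Matrix.det_eq_zero_of_row_eq_zero (A := MM (((0 : ℕ) : ℤ) - 1) (y + 2) (n + 1)) 0]
        · simp
        · intro j
          simp only [MM, Matrix.of_apply]
          rw [invf_neg (((0 : ℕ) : ℤ) - 1 + _ - _) (by simp; omega)]; simp
      rcases y with _ | y
      · rw [Matrix.det_eq_zero_of_column_eq_zero (A := MM (((x + 1 : ℕ) : ℤ) + 2) (((0 : ℕ) : ℤ) - 1) (n + 1)) 0]
        · simp
        · intro j
          simp only [MM, Matrix.of_apply]
          rw [invf_neg (((0 : ℕ) : ℤ) - 1 + _ - _) (by simp; omega)]; simp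
      have := pT x y n
      rw [show ((x + 1 : ℕ) : ℤ) + 2 = ((x + 3 : ℕ) : ℤ) by push_cast; ring, show ((y + 1 : ℕ) : ℤ) - 1 = (y : ℤ) by push_cast; ring,
        show ((x + 1 : ℕ) : ℤ) - 1 = (x : ℤ) by push_cast; ring, show ((y + 1 : ℕ) : ℤ) + 2 = ((y + 3 : ℕ) : ℤ) by push_cast; ring,
        ih.2 _ _ (by omega), ih.2 _ _ (by omega), this]
      push_cast
      ring
    rw [hp, hs (x + 1) (y + 1) n] at hd
    refine mul_right_cancel₀ hne (hd.trans ?_)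
    rw [hs x y (n + 1), pdiff x y n h]
    ring

theorem MM_det (x y n : ℕ) (h : 1 ≤ x + y) : (MM x y n).det = pwP x y n := (MM_det_aux n).1 x y h

end ACP

namespace ACP
open Finset Filter Topology

noncomputable def ff (K : ℕ) (M : ℂ) : ℂ := ∏ i ∈ range K, (M ^ 2 - (i + 1) ^ 2)

theorem ff_fac (K d : ℕ) : ff K (K + 1 + d) * (K + 1 + d) * d.factorial = (2 * K + 1 + d).factorial := by
  induction K generalizing d with
  | zero =>
    rw [show 2 * 0 + 1 + d = d + 1 by ring, Nat.factorial_succ]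
    simp only [ff, range_zero, prod_empty]; push_cast; ring
  | succ K ih =>
    have h := ih (d + 1)
    rw [Nat.factorial_succ d] at h
    rw [ff, prod_range_succ, ← ff, show 2 * (K + 1) + 1 + d = 2 * K + 1 + (d + 1) + 1 by ring, Nat.factorial_succ]
    push_cast at h ⊢
    rw [← h, show (K : ℂ) + 1 + (d + 1) = K + 1 + 1 + d by ring]
    ring

noncomputable def Vk (k : ℕ) (m : ℂ) : ℂ :=
  (∏ i ∈ Icc ((k + 1) / 2 + 1) (k + 1), (m ^ 2 - (i : ℂ) ^ 2)) / ∏ j ∈ range (k / 2 + 1), (4 * m ^ 2 - ((2 * j + 1 : ℕ) : ℂ) ^ 2)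

theorem den_range (p : ℕ) (g : ℕ → ℂ) : ∏ j ∈ Icc 0 (p - 1), g j ^ (p - j) = ∏ j ∈ range p, g j ^ (p - j) := by
  rcases p with _ | p
  · simp
  · refine prod_congr ?_ fun _ _ => rfl
    ext j; simp

theorem den_succ (p : ℕ) (g : ℕ → ℂ) : ∏ j ∈ range (p + 1), g j ^ (p + 1 - j) = (∏ j ∈ range p, g j ^ (p - j)) * ∏ j ∈ range (p + 1), g j := by
  rw [prod_range_succ, prod_range_succ _ p, ← mul_assoc, ← prod_mul_distrib]
  refine congrArg₂ (fun x y : ℂ => x * y) (prod_congr rfl fun j hj => ?_) (by simp)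
  have := mem_range.1 hj
  rw [← pow_succ]; congr 1; omega

theorem Rfun_even (p m : ℕ) : Rfun (2 * p) m = (∏ j ∈ Icc 1 p, ∏ i ∈ Icc j (2 * j - 1), ((m : ℂ) ^ 2 - (i : ℂ) ^ 2)) /
    ∏ j ∈ range p, (4 * (m : ℂ) ^ 2 - ((2 * j + 1 : ℕ) : ℂ) ^ 2) ^ (p - j) := by
  unfold Rfun
  rw [if_neg (by omega), show 2 * p / 2 = p by omega, den_range p fun j => (4 * (m : ℂ) ^ 2 - ((2 * j + 1 : ℕ) : ℂ) ^ 2)]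

theorem Rfun_odd (p m : ℕ) : Rfun (2 * p + 1) m = (∏ j ∈ Icc 1 (p + 1), ∏ i ∈ Icc j (2 * j - 2), ((m : ℂ) ^ 2 - (i : ℂ) ^ 2)) /
    ∏ j ∈ range p, (4 * (m : ℂ) ^ 2 - ((2 * j + 1 : ℕ) : ℂ) ^ 2) ^ (p - j) := by
  unfold Rfun
  rw [if_pos (by omega), show (2 * p + 1 + 1) / 2 = p + 1 by omega, show (2 * p + 1 - 3) / 2 = p - 1 by omega, show (2 * p + 1 - 1) / 2 = p by omega,
    den_range p fun j => (4 * (m : ℂ) ^ 2 - ((2 * j + 1 : ℕ) : ℂ) ^ 2)]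

theorem Rfun_step (k m : ℕ) : Rfun (k + 2) m = Rfun k m * Vk k m := by
  unfold Vk
  rcases Nat.even_or_odd' k with ⟨p, rfl | rfl⟩
  · rw [show 2 * p + 2 = 2 * (p + 1) by ring, Rfun_even, Rfun_even, prod_Icc_succ_top (by omega), den_succ p fun j => (4 * (m : ℂ) ^ 2 - ((2 * j + 1 : ℕ) : ℂ) ^ 2),
      show (2 * p + 1) / 2 = p by omega, show 2 * p / 2 = p by omega, show 2 * (p + 1) - 1 = 2 * p + 1 by omega, mul_div_mul_comm]
  · rw [show 2 * p + 1 + 2 = 2 * (p + 1) + 1 by ring, Rfun_odd, Rfun_odd, prod_Icc_succ_top (by omega), den_succ p fun j => (4 * (m : ℂ) ^ 2 - ((2 * j + 1 : ℕ) : ℂ) ^ 2),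
      show (2 * p + 1 + 1) / 2 = p + 1 by omega, show (2 * p + 1) / 2 = p by omega, show 2 * (p + 1 + 1) - 2 = 2 * p + 1 + 1 by omega, mul_div_mul_comm]

theorem ff_split (k : ℕ) (m : ℂ) : ff (k + 1) (2 * m) = (∏ j ∈ range (k / 2 + 1), (4 * m ^ 2 - ((2 * j + 1 : ℕ) : ℂ) ^ 2)) * (4 ^ ((k + 1) / 2) * ff ((k + 1) / 2) m) := by
  induction k with
  | zero => simp [ff]; ring
  | succ k ih =>
    rw [ff, prod_range_succ, ← ff, ih]
    rcases Nat.even_or_odd' k with ⟨p, rfl | rfl⟩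
    · rw [show (2 * p + 1) / 2 = p by omega, show 2 * p / 2 = p by omega, show (2 * p + 1 + 1) / 2 = p + 1 by omega]
      rw [ff, ff, prod_range_succ _ p, prod_range_succ (fun i : ℕ => (m ^ 2 - ((i : ℂ) + 1) ^ 2)) p]
      push_cast; ring
    · rw [show (2 * p + 1 + 1) / 2 = p + 1 by omega, show (2 * p + 1) / 2 = p by omega, show (2 * p + 1 + 1 + 1) / 2 = p + 1 by omega]
      rw [prod_range_succ _ (p + 1)]
      push_cast; ring

theorem ff_Icc (a b : ℕ) (h : a ≤ b) (m : ℂ) : ff b m = ff a m * ∏ i ∈ Icc (a + 1) b, (m ^ 2 - (i : ℂ) ^ 2) := by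
  induction b, h using Nat.le_induction with
  | base => simp
  | succ b hb ih =>
    rw [ff, prod_range_succ, ← ff, ih, prod_Icc_succ_top (by omega)]
    push_cast; ring

theorem Vk_closed (k d : ℕ) : Vk k ((k + 2 + d : ℕ) : ℂ) = 4 ^ ((k + 1) / 2) * 2 * (2 * k + 3 + d).factorial * (k + 2 + 2 * d).factorial / (d.factorial * (3 * k + 5 + 2 * d).factorial) := by
  have h1 := ff_fac (k + 1) d
  have h2 := ff_fac (k + 1) (k + 2 + 2 * d)
  set m : ℂ := ((k + 2 + d : ℕ) : ℂ) with hm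
  have hm' : m = k + 2 + d := by rw [hm]; push_cast; ring
  rw [show ((k + 1 : ℕ) : ℂ) + 1 + d = m by rw [hm]; push_cast; ring, show 2 * (k + 1) + 1 + d = 2 * k + 3 + d by ring] at h1
  rw [show ((k + 1 : ℕ) : ℂ) + 1 + ((k + 2 + 2 * d : ℕ) : ℂ) = 2 * m by rw [hm]; push_cast; ring, show 2 * (k + 1) + 1 + (k + 2 + 2 * d) = 3 * k + 5 + 2 * d by ring] at h2
  have hne : m ≠ 0 := by rw [hm]; exact_mod_cast (by omega)
  have h3 := fac_ne d
  have h4 := fac_ne (k + 2 + 2 * d)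
  have h5 := fac_ne (3 * k + 5 + 2 * d)
  have hf2 : ff (k + 1) (2 * m) ≠ 0 := fun h => h5 (by rw [← h2, h]; ring)
  have hs := ff_split k m
  have hi := ff_Icc ((k + 1) / 2) (k + 1) (by omega) m
  rw [hs] at hf2
  have hd := left_ne_zero_of_mul hf2
  have hq := right_ne_zero_of_mul (right_ne_zero_of_mul hf2)
  have h6 : ((4 : ℂ) ^ ((k + 1) / 2)) ≠ 0 := pow_ne_zero _ (by norm_num)
  unfold Vk
  rw [← h1, ← h2, hs, hi]
  field_simp

theorem Rfun_ne : ∀ k d : ℕ, Rfun k (k + d) ≠ 0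
  | 0, d => by rw [show (0 : ℕ) = 2 * 0 by rfl, Rfun_even]; simp
  | 1, d => by rw [show (1 : ℕ) = 2 * 0 + 1 by rfl, Rfun_odd]; simp
  | k + 2, d => by
    rw [Rfun_step, Vk_closed]
    refine mul_ne_zero (by rw [show k + 2 + d = k + (d + 2) by ring]; exact Rfun_ne k (d + 2)) ?_
    refine div_ne_zero (mul_ne_zero (mul_ne_zero (mul_ne_zero (pow_ne_zero _ (by norm_num)) (by norm_num)) (fac_ne _)) (fac_ne _)) (mul_ne_zero (fac_ne _) (fac_ne _))

theorem Rfun_zero (m : ℕ) : Rfun 0 m = 1 := by rw [show (0 : ℕ) = 2 * 0 by rfl, Rfun_even]; simp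
theorem Rfun_one (m : ℕ) : Rfun 1 m = 1 := by rw [show (1 : ℕ) = 2 * 0 + 1 by rfl, Rfun_odd]; simp

noncomputable def Gc (k d : ℕ) : ℂ :=
  d.factorial * (2 * k + d + 1).factorial * ((2 * k + 2 * d).factorial * (2 * k + 2 * d + 1).factorial * (2 * k + 2 * d + 2).factorial * (2 * k + 2 * d + 3).factorial) /
    ((3 * k + 2 * d + 1).factorial * (3 * k + 2 * d + 3).factorial * (k + 2 * d).factorial * (k + 2 * d + 2).factorial * ((k + d).factorial * (k + d + 1).factorial))

theorem Rfun_G : ∀ k d : ℕ, Rfun k (k + d + 2) = Rfun k (k + d) * Gc k d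
  | 0, d => by
    rw [Rfun_zero, Rfun_zero, Gc]
    simp only [Nat.mul_zero, Nat.zero_add]
    have h1 := fac_ne d
    have h2 := fac_ne (d + 1)
    have h3 := fac_ne (2 * d)
    have h4 := fac_ne (2 * d + 1)
    have h5 := fac_ne (2 * d + 2)
    have h6 := fac_ne (2 * d + 3)
    field_simp
  | 1, d => by
    rw [Rfun_one, Rfun_one, Gc]
    rw [show 2 * 1 + d + 1 = d + 2 + 1 by ring, show 2 * 1 + 2 * d = 2 * d + 1 + 1 by ring, show 3 * 1 + 2 * d + 1 = 2 * d + 4 by ring, show 3 * 1 + 2 * d + 3 = 2 * d + 5 + 1 by ring,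
      show 1 + 2 * d = 2 * d + 1 by ring, show 1 + d + 1 = d + 2 by ring, show 1 + d = d + 1 by ring, Nat.factorial_succ (d + 2), Nat.factorial_succ (2 * d + 1), Nat.factorial_succ (2 * d + 5), Nat.factorial_succ d]
    have h1 := fac_ne d
    have h2 := fac_ne (d + 2)
    have h3 := fac_ne (2 * d + 1)
    have h4 := fac_ne (2 * d + 3)
    have h5 := fac_ne (2 * d + 4)
    have h6 := fac_ne (2 * d + 5)
    have h7 : (d : ℂ) + 1 ≠ 0 := by exact_mod_cast d.succ_ne_zero
    have h8 : (d : ℂ) + 3 ≠ 0 := by exact_mod_cast (d + 2).succ_ne_zero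
    push_cast
    rw [show (d : ℂ) + 2 + 1 = d + 3 by ring, show 2 * (d : ℂ) + 1 + 1 = 2 * (d + 1) by ring, show 2 * (d : ℂ) + 5 + 1 = 2 * (d + 3) by ring]
    rw [show 2 * d + 1 + 1 + 1 = 2 * d + 3 by ring, show 2 * d + 1 + 1 + 2 = 2 * d + 4 by ring, show 2 * d + 1 + 1 + 3 = 2 * d + 5 by ring, show 2 * d + 1 + 2 = 2 * d + 3 by ring]
    field_simp
  | k + 2, d => by
    have h := Rfun_G k (d + 2)
    have key : Gc k (d + 2) * Vk k ((k + 2 + (d + 2) : ℕ) : ℂ) = Vk k ((k + 2 + d : ℕ) : ℂ) * Gc (k + 2) d := by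
      rw [Vk_closed, Vk_closed, Gc, Gc, div_mul_div_comm, div_mul_div_comm, div_eq_div_iff (by simp [Nat.factorial_ne_zero]) (by simp [Nat.factorial_ne_zero])]
      ring_nf
    rw [Rfun_step, Rfun_step, show k + 2 + d + 2 = k + 2 + (d + 2) by ring]
    rw [show k + (d + 2) + 2 = k + 2 + (d + 2) by ring, show k + (d + 2) = k + 2 + d by ring] at h
    rw [h]
    linear_combination Rfun k (k + 2 + d) * key

noncomputable def wc (k : ℕ) : ℂ := 2 ^ k * (2 * k).factorial * (2 * k + 1).factorial / ((3 * k + 1).factorial * k.factorial)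

theorem Rfun_w : ∀ k : ℕ, Rfun k (k + 1) = Rfun k k * wc k
  | 0 => by simp [Rfun_zero, wc]
  | 1 => by simp [Rfun_one, wc, Nat.factorial]; norm_num
  | k + 2 => by
    have h := Rfun_w k
    have g0 := Rfun_G k 0
    have g1 := Rfun_G k 1
    have key : wc k * Gc k 1 * Vk k ((k + 2 + 1 : ℕ) : ℂ) = Gc k 0 * Vk k ((k + 2 + 0 : ℕ) : ℂ) * wc (k + 2) := by
      rw [Vk_closed, Vk_closed, Gc, Gc, wc, wc, div_mul_div_comm, div_mul_div_comm, div_mul_div_comm, div_mul_div_comm, div_eq_div_iff (by simp [Nat.factorial_ne_zero]) (by simp [Nat.factorial_ne_zero])]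
      simp only [Nat.mul_one, Nat.mul_zero, Nat.add_zero, Nat.mul_add, Nat.add_assoc, Nat.reduceAdd, Nat.reduceMul, show ∀ x, 2 + x = x + 2 from fun x => Nat.add_comm _ _]
      simp only [Nat.factorial, pow_add]
      push_cast
      ring
    rw [Rfun_step, Rfun_step]
    rw [Nat.add_zero] at g0 key
    rw [show k + 1 + 2 = k + 2 + 1 by ring] at g1
    rw [g1, h, g0]
    linear_combination Rfun k k * key

theorem ASM_succ (n : ℕ) : ASM (n + 1) = ASM n * ((3 * n + 1).factorial * n.factorial / ((2 * n).factorial * (2 * n + 1).factorial)) := by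
  unfold ASM
  rw [prod_div_distrib, prod_div_distrib]
  have hne : ∀ a b : ℕ, (∏ j ∈ range a, ((b + j).factorial : ℂ)) ≠ 0 := fun a b => prod_ne_zero_iff.2 fun _ _ => fac_ne _
  have h : (n.factorial : ℂ) * ∏ j ∈ range (n + 1), ((n + 1 + j).factorial : ℂ) = (∏ j ∈ range n, ((n + j).factorial : ℂ)) * (2 * n).factorial * (2 * n + 1).factorial := by
    have h1 := prod_range_succ' (fun j => ((n + j).factorial : ℂ)) (n + 1)
    rw [prod_range_succ, prod_range_succ] at h1
    rw [mul_comm]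
    rw [prod_congr rfl fun j _ => show ((n + 1 + j).factorial : ℂ) = (n + (j + 1)).factorial by rw [show n + 1 + j = n + (j + 1) by ring]]
    refine h1.symm.trans ?_
    rw [show n + (n + 1) = n + 1 + n by ring, show n + n = 2 * n by ring, show n + 1 + n = 2 * n + 1 by ring]
  rw [prod_range_succ]
  have h1 := hne (n + 1) (n + 1)
  have h2 := hne n n
  have h3 := fac_ne (2 * n)
  have h4 := fac_ne (2 * n + 1)
  rw [div_mul_div_comm, div_eq_div_iff h1 (mul_ne_zero h2 (mul_ne_zero h3 h4))]
  linear_combination (-(∏ j ∈ range n, ((3 * j + 1).factorial : ℂ)) * (3 * n + 1).factorial) * h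

theorem ASM_ne (n : ℕ) : ASM n ≠ 0 := prod_ne_zero_iff.2 fun _ _ => div_ne_zero (fac_ne _) (fac_ne _)

noncomputable def Aa (m k : ℕ) : ℂ := ASM (k + m) * Rfun k (k + m) / (ASM k * Rfun k k)

theorem Aa_ne (m k : ℕ) : Aa m k ≠ 0 :=
  div_ne_zero (mul_ne_zero (ASM_ne _) (Rfun_ne _ _)) (mul_ne_zero (ASM_ne _) (by simpa using Rfun_ne k 0))

theorem Aa_zero (k : ℕ) : Aa 0 k = 1 := div_self (mul_ne_zero (ASM_ne _) (Rfun_ne k 0))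

theorem Aa_one (k : ℕ) : Aa 1 k = 2 ^ k := by
  unfold Aa
  have h1 := ASM_ne k
  have h2 : Rfun k k ≠ 0 := by simpa using Rfun_ne k 0
  have h3 := fac_ne (2 * k)
  have h4 := fac_ne (2 * k + 1)
  have h5 := fac_ne (3 * k + 1)
  have h6 := fac_ne k
  rw [ASM_succ, Rfun_w, wc]
  field_simp

theorem Aa_step (m k : ℕ) : Aa (m + 2) k = Aa m k * ((3 * k + 4 + 3 * m) * pw k (k + 2) m) := by
  have key : ((3 * (k + m) + 1).factorial * (k + m).factorial / ((2 * (k + m)).factorial * (2 * (k + m) + 1).factorial)) *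
      ((3 * (k + m + 1) + 1).factorial * (k + m + 1).factorial / ((2 * (k + m + 1)).factorial * (2 * (k + m + 1) + 1).factorial)) * Gc k m =
      ((3 * k + 4 + 3 * m) * pw k (k + 2) m : ℂ) := by
    unfold Gc pw
    have e1 : ((3 * k + 2 * m + 1).factorial : ℂ) * (2 * k + (k + 2) + 2 * m).ascFactorial m = (3 * (k + m) + 1).factorial := by
      have := Nat.factorial_mul_ascFactorial (3 * k + 2 * m + 1) m
      rw [show 2 * k + (k + 2) + 2 * m = 3 * k + 2 * m + 1 + 1 by ring, show 3 * (k + m) + 1 = 3 * k + 2 * m + 1 + m by ring]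
      exact_mod_cast this
    have e2 : ((3 * k + 2 * m + 3).factorial : ℂ) * (k + 2 * (k + 2) + 2 * m).ascFactorial m = (3 * (k + m) + 3).factorial := by
      have := Nat.factorial_mul_ascFactorial (3 * k + 2 * m + 3) m
      rw [show k + 2 * (k + 2) + 2 * m = 3 * k + 2 * m + 3 + 1 by ring, show 3 * (k + m) + 3 = 3 * k + 2 * m + 3 + m by ring]
      exact_mod_cast this
    rw [show 3 * (k + m + 1) + 1 = 3 * (k + m) + 3 + 1 by ring, Nat.factorial_succ (3 * (k + m) + 3)]
    push_cast
    rw [← e1, ← e2, show 2 * k + 2 * m = 2 * (k + m) by ring, show 2 * (k + m + 1) = 2 * (k + m) + 2 by ring, show k + (k + 2) + m - 1 = 2 * k + m + 1 by omega,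
      show k + 2 + 2 * m = k + 2 * m + 2 by ring, show 2 * (k + m) + 2 + 1 = 2 * (k + m) + 3 by ring]
    have h1 := fac_ne (2 * (k + m))
    have h2 := fac_ne (2 * (k + m) + 1)
    have h3 := fac_ne (2 * (k + m) + 2)
    have h4 := fac_ne (2 * (k + m) + 3)
    have h5 := fac_ne (3 * k + 2 * m + 1)
    have h6 := fac_ne (3 * k + 2 * m + 3)
    have h7 := fac_ne (k + 2 * m)
    have h8 := fac_ne (k + 2 * m + 2)
    have h9 := fac_ne (k + m)
    have h10 := fac_ne (k + m + 1)
    field_simp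
    ring
  rw [← key]
  unfold Aa
  rw [show k + (m + 2) = k + m + 1 + 1 by ring, ASM_succ, ASM_succ, show k + m + 1 + 1 = k + m + 2 by ring, Rfun_G]
  ring

theorem Aa_mul (m k : ℕ) : Aa m k * Aa (m + 1) k = 2 ^ k * (∏ j ∈ range m, (3 * k + 4 + 3 * j : ℂ)) * pwP k (k + 2) m := by
  induction m with
  | zero => simp [Aa_zero, Aa_one, pwP]
  | succ m ih =>
    rw [Aa_step, pwP, prod_range_succ, prod_range_succ, ← pwP]
    linear_combination ((3 * k + 4 + 3 * m) * pw k (k + 2) m) * ih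

theorem DV_zero (k : ℕ) : DV 0 k = 1 := by
  have h : PV 0 k = monomial 0 1 := by simp [PV]
  rw [DV, h, prs_mon, coeff_EE, if_pos (fun l => l.elim0)]
  simp

theorem DV_eq (m k : ℕ) : DV m k = Aa m k := by
  induction m with
  | zero => rw [DV_zero, Aa_zero]
  | succ m ih =>
    have h := DV_mul m k
    rw [show ((k : ℤ) + 2) = ((k + 2 : ℕ) : ℤ) by push_cast; ring, MM_det _ _ _ (by omega), Fin.prod_univ_eq_prod_range (fun j => (3 * k + 4 + 3 * (j : ℕ) : ℂ)) m, ← Aa_mul, ih] at h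
    exact mul_left_cancel₀ (Aa_ne m k) h

theorem final (k n : ℕ) (hk : 1 ≤ k) (hkn : k ≤ n)
    (μ : NCM n → ℂ)
    (hsum : ∑ π : NCM n, μ π = 1) (hstat : Stationary μ)
    (huniq : ∀ v : NCM n → ℂ, (∑ π : NCM n, v π = 1) → Stationary v → v = μ) :
    (∑ π : NCM n,
        if ∀ i j : Fin (2 * n), i < j → (j : ℕ) < k → π.f i ≠ j
        then μ π else 0) =
      (1 / ASM k) * (Rfun k n / Rfun k k) := by
  obtain ⟨F, hF, hFP⟩ := F_exists n k
  obtain ⟨G, hG, hGP⟩ := F_exists n 1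
  have h := prob_ratio hk hkn μ hsum hstat huniq hG hGP hF hFP
  have hval : ∀ (j : ℕ) (_ : 1 ≤ j) (_ : j ≤ n) (F : (ℕ → ℂ) → ℂ) (_ : F ∈ W n) (_ : ∀ z, Gen (2 * n) z → F z = PS n j 0 z),
      F (fun _ => 1) = Kc n * (ASM n * Rfun j n / (ASM j * Rfun j j)) := by
    intro j h1 h2 F hF hFP
    obtain ⟨m, rfl⟩ := Nat.exists_eq_add_of_le' h2
    rw [F_one' (by omega) hF hFP, PP_PV]
    have := DV_eq m j
    rw [DV] at this
    rw [this, Aa, add_comm j m]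
  rw [hval k hk hkn F hF hFP, hval 1 le_rfl (by omega) G hG hGP, Rfun_one, Rfun_one] at h
  have hA1 : ASM 1 = 1 := by simp [ASM]
  rw [hA1, mul_assoc] at h
  have h' := mul_left_cancel₀ (Kc_ne n) h
  have hn := ASM_ne n
  have hk' := ASM_ne k
  have hR : Rfun k k ≠ 0 := by simpa using Rfun_ne k 0
  refine mul_left_cancel₀ hn ?_
  rw [mul_one, one_mul, div_one] at h'
  rw [← h']
  field_simp

end ACP

/-- Theorem 1.8, formula (1.12): the anti-cluster event probability
`P(AC_k^{(n)}) = (1/ASM(k)) · R_k(n)/R_k(k)`. -/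
theorem anti_cluster_probability (k n : ℕ) (hk : 1 ≤ k) (hkn : k ≤ n)
    (μ : NCM n → ℂ)
    (hsum : ∑ π : NCM n, μ π = 1) (hstat : Stationary μ)
    (huniq : ∀ v : NCM n → ℂ, (∑ π : NCM n, v π = 1) → Stationary v → v = μ) :
    (∑ π : NCM n,
        if ∀ i j : Fin (2 * n), i < j → (j : ℕ) < k → π.f i ≠ j
        then μ π else 0) =
      (1 / ASM k) * (Rfun k n / Rfun k k) :=
  ACP.final k n hk hkn μ hsum hstat huniq
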